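/- The following inclusions hold: 𝒢_{4,4} and 𝒢_{4,5} are empty (so 𝒮_{4,4} = 𝒮_{4,5} = ∅); 𝒮_{4,6} ⊆ {∅}; 𝒮_{4,7} ⊆ {{5}}; 𝒮_{4,8} ⊆ {{6}, {5,5}, ∅}; and 𝒮_{4,9} ⊆ {{7}, {6,5}, {5,5,5}, {5}}, where the inner sets are multisets of integers. -/

import Mathlib

open Set Topology

noncomputable section

/-- The circle `ℝ/ℤ`. -/
abbrev Circle1 : Type := AddCircle (1 : ℝ)

/-- The torus `(ℝ/ℤ) × (ℝ/ℤ)`. -/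
abbrev Torus : Type := Circle1 × Circle1

/-- A set is an arc if it is homeomorphic to the open unit interval. -/
def IsArc {S : Type} [TopologicalSpace S] (A : Set S) : Prop :=
  Nonempty ((Set.Ioo (0 : ℝ) 1) ≃ₜ A)

/-- A drawing, in the space `S`, of a multigraph whose edges `E` have endpoints
given by `ends`.  Vertices are drawn as distinct points, edges as arcs whose closure
adds exactly the endpoint vertices; arcs are pairwise disjoint and avoid all
vertex points. -/
structure MDrawing {V E : Type} (ends : E → Sym2 V) (S : Type) [TopologicalSpace S] where
  vmap : V → S
  vinj : Function.Injective vmap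
  emap : E → Set S
  arc : ∀ e, IsArc (emap e)
  closure_emap : ∀ (e : E) (u w : V), ends e = s(u, w) →
    closure (emap e) = emap e ∪ {vmap u, vmap w}
  vertex_notin : ∀ (e : E) (x : V), vmap x ∉ emap e
  edges_disj : ∀ e f : E, e ≠ f → emap e ∩ emap f = ∅

namespace MDrawing

variable {V E S : Type} [TopologicalSpace S] {ends : E → Sym2 V}

/-- The point set `|G|` of the drawing. -/
def image (d : MDrawing ends S) : Set S :=
  Set.range d.vmap ∪ ⋃ e, d.emap e

/-- A face: a connected component of the complement of the drawing. -/
def IsFace (d : MDrawing ends S) (f : Set S) : Prop :=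
  ∃ x ∈ (d.image)ᶜ, f = connectedComponentIn (d.image)ᶜ x

/-- The length of a face: each edge drawn in the frontier of `g` contributes `2`
if `g` is the unique face whose frontier contains the arc, and `1` otherwise. -/
def faceLen (d : MDrawing ends S) (g : Set S) : ℕ :=
  2 * {e : E | d.emap e ⊆ frontier g ∧
        (∀ g', d.IsFace g' → d.emap e ⊆ frontier g' → g' = g)}.ncard +
    {e : E | d.emap e ⊆ frontier g ∧
        ¬ (∀ g', d.IsFace g' → d.emap e ⊆ frontier g' → g' = g)}.ncard

end MDrawing

/-- A drawing of a simple graph `G`: a drawing of the multigraph whose edge set is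
the edge set of `G`. -/
abbrev Drawing {V : Type} (G : SimpleGraph V) (S : Type) [TopologicalSpace S] :=
  MDrawing (fun e : G.edgeSet => (e : Sym2 V)) S

/-- The point set of (the drawing of) a walk: the vertex points of its support
together with the arcs of its edges. -/
def walkImage {V S : Type} [TopologicalSpace S] {G : SimpleGraph V} (d : Drawing G S)
    {a b : V} (w : G.Walk a b) : Set S :=
  (⋃ v ∈ w.support, {d.vmap v}) ∪
    ⋃ (e : G.edgeSet) (_ : (e : Sym2 V) ∈ w.edges), d.emap e

/-- A closed curve is null-homotopic if it is homotopic to a constant map. -/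
def NullHomotopic {S : Type} [TopologicalSpace S] (γ : C(Circle1, S)) : Prop :=
  ∃ c : S, ContinuousMap.Homotopic γ (ContinuousMap.const Circle1 c)

/-- A set is a contractible simple closed curve if it is the range of an injective
closed curve which is null-homotopic. -/
def ContractibleSet {S : Type} [TopologicalSpace S] (A : Set S) : Prop :=
  ∃ γ : C(Circle1, S), Function.Injective γ ∧ Set.range γ = A ∧ NullHomotopic γ

/-- A cycle (given as a closed walk) is contractible if the closed curve tracing
its drawing is null-homotopic. -/
def ContractibleWalk {V S : Type} [TopologicalSpace S] {G : SimpleGraph V}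
    (d : Drawing G S) {a : V} (w : G.Walk a a) : Prop :=
  ContractibleSet (walkImage d w)

/-- A graph is 4-critical if its chromatic number is `4` and every proper subgraph
has chromatic number at most `3`. -/
def FourCritical {V : Type} (G : SimpleGraph V) : Prop :=
  G.chromaticNumber = 4 ∧
    ∀ H : G.Subgraph, H ≠ ⊤ → H.coe.chromaticNumber ≤ 3

/-- A graph is triangle-free if it contains no 3-cycle. -/
def TriangleFree {V : Type} (G : SimpleGraph V) : Prop :=
  ∀ (a : V) (w : G.Walk a a), w.IsCycle → w.length ≠ 3

/-- `f` is a `k`-face: a face bounded by a cycle of length `k`. -/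
def IsKFace {V S : Type} [TopologicalSpace S] {G : SimpleGraph V} (d : Drawing G S)
    (f : Set S) (k : ℕ) : Prop :=
  d.IsFace f ∧ ∃ (a : V) (w : G.Walk a a), w.IsCycle ∧ w.length = k ∧
    frontier f = walkImage d w

/-- `f` is a face bounded by the 4-cycle `v1 v2 v3 v4`. -/
def IsQuadFace {V S : Type} [TopologicalSpace S] {G : SimpleGraph V} (d : Drawing G S)
    (f : Set S) (v1 v2 v3 v4 : V) : Prop :=
  d.IsFace f ∧ ∃ w : G.Walk v1 v1, w.IsCycle ∧
    w.support = [v1, v2, v3, v4, v1] ∧ frontier f = walkImage d w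

/-- A set is an open disk if it is homeomorphic to an open disk in the plane. -/
def IsOpenDisk {S : Type} [TopologicalSpace S] (A : Set S) : Prop :=
  Nonempty (A ≃ₜ (Metric.ball (0 : ℝ × ℝ) 1))

/-- `φ` is a proper 3-coloring of the subgraph `A` (of the ambient graph `G`). -/
def ProperColOn {V : Type} {G : SimpleGraph V} (A : G.Subgraph) (φ : V → Fin 3) : Prop :=
  ∀ u v : V, A.Adj u v → φ u ≠ φ v

/-- `G1` is `C`-critical for 3-coloring, where `C` and `G1` are subgraphs of an
ambient graph `G`: `C` is a proper subgraph of `G1`, and for every proper subgraph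
`H` of `G1` containing `C` there is a proper 3-coloring of `C` that extends to a
proper 3-coloring of `H` but not to a proper 3-coloring of `G1`. -/
def CCritical {V : Type} {G : SimpleGraph V} (G1 C : G.Subgraph) : Prop :=
  C < G1 ∧
    ∀ H : G.Subgraph, C ≤ H → H < G1 →
      ∃ φ : V → Fin 3, ProperColOn C φ ∧
        (∃ ψ : V → Fin 3, ProperColOn H ψ ∧ ∀ v ∈ C.verts, ψ v = φ v) ∧
        ¬ ∃ ψ : V → Fin 3, ProperColOn G1 ψ ∧ ∀ v ∈ C.verts, ψ v = φ v

/-- The plane. -/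
abbrev Plane : Type := ℝ × ℝ

/-- The multiset of lengths of the internal (bounded) faces of length at least 5
of a plane drawing. -/
def PlaneS {V : Type} {G : SimpleGraph V} (d : Drawing G Plane) (Sm : Multiset ℕ) : Prop :=
  ∃ l : List (Set Plane), l.Nodup ∧
    (∀ f : Set Plane, f ∈ l ↔
      (d.IsFace f ∧ Bornology.IsBounded f ∧ 5 ≤ d.faceLen f)) ∧
    Sm = ↑(l.map d.faceLen)

/-- Membership in the class `𝒢_{4,k}`: `G` is a plane graph of girth at least 4
(i.e. triangle-free), its outer (unbounded) face is bounded by a cycle `C` of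
length `k`, and `G` is `C`-critical for 3-coloring. -/
def InGClass {V : Type} (G : SimpleGraph V) (d : Drawing G Plane) (k : ℕ) : Prop :=
  TriangleFree G ∧
    ∃ (a : V) (w : G.Walk a a), w.IsCycle ∧ w.length = k ∧
      (∃ fo : Set Plane, d.IsFace fo ∧ ¬ Bornology.IsBounded fo ∧
        frontier fo = walkImage d w) ∧
      CCritical (⊤ : G.Subgraph) w.toSubgraph

/-- The family `𝒮_{4,k}` of multisets of internal `(≥5)`-face lengths of graphs
in `𝒢_{4,k}`. -/
def Scal (k : ℕ) : Set (Multiset ℕ) :=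
  {Sm | ∃ (V : Type) (_ : Finite V) (G : SimpleGraph V) (d : Drawing G Plane),
    InGClass G d k ∧ PlaneS d Sm}


open Set Topology

noncomputable section
namespace CF
set_option linter.all false
open scoped Classical symmDiff

/-! ### Parity algebra of edge sets -/

structure Gr (V E : Type) where
  s : E → V
  t : E → V

section parity
variable {V E : Type}

def dl (a : V) : V → ZMod 2 := fun v => if v = a then 1 else 0

theorem z2 (x : V → ZMod 2) : x + x = 0 := by
  funext v; exact CharTwo.add_self_eq_zero _

theorem z2c {x y : V → ZMod 2} : x + y = 0 ↔ x = y := by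
  constructor
  · intro h
    calc x = x + (y + y) := by rw [z2]; simp
      _ = (x + y) + y := by rw [add_assoc]
      _ = y := by rw [h]; simp
  · rintro rfl; exact z2 _

theorem dl_inj {a b : V} (h : dl a = dl b) : a = b := by
  have := congrFun h a
  simp [dl] at this
  exact this

namespace Gr
variable (g : Gr V E)

def dg (Z : Finset E) : V → ZMod 2 := ∑ e ∈ Z, (dl (g.s e) + dl (g.t e))

theorem dg_symm (Z W : Finset E) : g.dg (Z ∆ W) = g.dg Z + g.dg W := by
  have h1 : g.dg Z = g.dg (Z \ W) + g.dg (Z ∩ W) := by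
    unfold dg; rw [← Finset.sum_union]
    · congr 1; ext x; simp; tauto
    · rw [Finset.disjoint_left]; intro a; simp; tauto
  have h2 : g.dg W = g.dg (W \ Z) + g.dg (Z ∩ W) := by
    unfold dg; rw [← Finset.sum_union]
    · congr 1; ext x; simp; tauto
    · rw [Finset.disjoint_left]; intro a; simp; tauto
  have h3 : g.dg (Z ∆ W) = g.dg (Z \ W) + g.dg (W \ Z) := by
    unfold dg; rw [← Finset.sum_union]
    · rfl
    · rw [Finset.disjoint_left]; intro a; simp; tauto
  rw [h3, h1, h2]
  have := z2 (g.dg (Z ∩ W))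
  linear_combination -this

theorem dg_empty : g.dg ∅ = 0 := by simp [dg]
theorem dg_single (e : E) : g.dg {e} = dl (g.s e) + dl (g.t e) := by simp [dg]

def Ev (Z : Finset E) : Prop := g.dg Z = 0
def Od (Z : Finset E) (a b : V) : Prop := g.dg Z = dl a + dl b

theorem ev_empty : g.Ev ∅ := g.dg_empty
variable {g}
theorem Ev.sd {Z W} (h : g.Ev Z) (h' : g.Ev W) : g.Ev (Z ∆ W) := by
  unfold Ev at *; rw [dg_symm, h, h']; simp
theorem od_self {Z a} : g.Od Z a a ↔ g.Ev Z := by unfold Od Ev; rw [z2]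
theorem Od.symm {Z a b} (h : g.Od Z a b) : g.Od Z b a := by unfold Od at *; rw [h, add_comm]
theorem Od.trans {Z W a b c} (h : g.Od Z a b) (h' : g.Od W b c) : g.Od (Z ∆ W) a c := by
  unfold Od at *; rw [dg_symm, h, h']; linear_combination z2 (dl b)
theorem Od.sd {Z W a b} (h : g.Od Z a b) (h' : g.Od W a b) : g.Ev (Z ∆ W) :=
  od_self.1 (h.trans h'.symm)
theorem Od.sdEv {Z W a b} (h : g.Od Z a b) (h' : g.Ev W) : g.Od (Z ∆ W) a b := by
  unfold Od Ev at *; rw [dg_symm, h, h']; simp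
theorem od_single (e : E) : g.Od {e} (g.s e) (g.t e) := g.dg_single e

variable (g)
/-- `e` joins `a` and `b`. -/
def jn (e : E) (a b : V) : Prop := (g.s e = a ∧ g.t e = b) ∨ (g.s e = b ∧ g.t e = a)
/-- `e` is incident with `v`. -/
def inc (e : E) (v : V) : Prop := g.s e = v ∨ g.t e = v
variable {g}
theorem jn.symm {e a b} (h : g.jn e a b) : g.jn e b a := Or.symm h
theorem jn.od {e a b} (h : g.jn e a b) : g.Od {e} a b := by
  rcases h with ⟨rfl, rfl⟩ | ⟨rfl, rfl⟩
  · exact od_single e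
  · exact (od_single e).symm
theorem jn.inc {e a b} (h : g.jn e a b) : g.inc e a := by
  rcases h with ⟨rfl, rfl⟩ | ⟨rfl, rfl⟩ <;> simp [Gr.inc]
theorem jn.inc' {e a b} (h : g.jn e a b) : g.inc e b := h.symm.inc
theorem inc.jn {e a} (h : g.inc e a) : ∃ b, g.jn e a b := by
  rcases h with rfl | rfl
  · exact ⟨_, Or.inl ⟨rfl, rfl⟩⟩
  · exact ⟨_, Or.inr ⟨rfl, rfl⟩⟩
theorem od_single_iff {e a b} (hab : a ≠ b) : g.Od {e} a b ↔ g.jn e a b := by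
  refine ⟨fun h => ?_, jn.od⟩
  unfold Od at h; rw [dg_single] at h
  have ha := congrFun h a
  have hb := congrFun h b
  by_cases h1 : a = g.s e <;> by_cases h2 : a = g.t e <;> by_cases h3 : b = g.s e <;>
   by_cases h4 : b = g.t e <;> simp [dl, h1, h2, h3, h4, hab] at ha hb ⊢ <;>
   simp_all [jn] 

variable (g)
def star (B : Finset E) (v : V) : Finset E := B.filter (fun e => g.inc e v)
variable {g}
theorem mem_star {B e v} : e ∈ g.star B v ↔ e ∈ B ∧ g.inc e v := by simp [star]
theorem star_sub {B v} : g.star B v ⊆ B := Finset.filter_subset _ _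

/-- no loops -/
def NL (g : Gr V E) (B : Finset E) : Prop := ∀ e ∈ B, g.s e ≠ g.t e

theorem dg_star {B} (h : g.NL B) (v : V) : g.dg B v = ((g.star B v).card : ZMod 2) := by
  unfold dg star
  rw [Finset.sum_apply, Finset.card_filter]
  push_cast
  apply Finset.sum_congr rfl
  intro e he
  have := h e he
  by_cases h1 : v = g.s e <;> by_cases h2 : v = g.t e
  · exact absurd (h1.symm.trans h2) this
  all_goals simp [dl, inc, h1, h2, this, Ne.symm this]
  all_goals simp [eq_comm, h1, h2]

theorem ev_star {B} (h : g.NL B) (hB : g.Ev B) (v : V) : Even (g.star B v).card := by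
  have := dg_star h v
  rw [hB] at this
  rw [← ZMod.natCast_eq_zero_iff_even]; exact this.symm

theorem od_star {B a b} (h : g.NL B) (hB : g.Od B a b) (v : V) (ha : v ≠ a) (hb : v ≠ b) :
    Even (g.star B v).card := by
  have := dg_star h v
  rw [hB] at this
  rw [← ZMod.natCast_eq_zero_iff_even, ← this]; simp [dl, ha, hb]

theorem od_star_odd {B a b} (h : g.NL B) (hB : g.Od B a b) (hb : a ≠ b) :
    Odd (g.star B a).card := by
  have := dg_star h a
  rw [hB] at this
  rw [← ZMod.natCast_eq_one_iff_odd, ← this]; simp [dl, hb]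

theorem ev_of_star {B} (h : g.NL B) (hB : ∀ v, Even (g.star B v).card) : g.Ev B := by
  funext v
  rw [dg_star h v]
  exact ZMod.natCast_eq_zero_iff_even.2 (hB v)

theorem dg_eq_zero_of_not_inc {Z : Finset E} {v} (h : ∀ e ∈ Z, ¬ g.inc e v) : g.dg Z v = 0 := by
  unfold dg
  rw [Finset.sum_apply]
  apply Finset.sum_eq_zero
  intro e he
  have := h e he
  simp [inc] at this
  simp [dl, Ne.symm this.1, Ne.symm this.2]

theorem Od.exists_inc {Z a b} (h : g.Od Z a b) (hab : a ≠ b) : ∃ e ∈ Z, g.inc e a := by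
  by_contra hc
  push Not at hc
  have := dg_eq_zero_of_not_inc hc
  rw [h] at this
  simp [dl, hab] at this

theorem sd_of_sub {A B : Finset E} (h : B ⊆ A) : A ∆ B = A \ B := by
  ext x; simp [Finset.mem_symmDiff]; have := @h x; tauto

theorem sd_union {A B : Finset E} (h : Disjoint A B) : A ∆ B = A ∪ B := by
  ext x; simp [Finset.mem_symmDiff]; have : x ∈ A → x ∉ B := fun hx => Finset.disjoint_left.1 h hx
  tauto

theorem card_sd_le (A B : Finset E) : (A ∆ B).card ≤ A.card + B.card := by
  calc (A ∆ B).card ≤ (A ∪ B).card := Finset.card_le_card (fun x hx => by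
        simp [Finset.mem_symmDiff] at hx ⊢; tauto)
    _ ≤ _ := Finset.card_union_le _ _

theorem card_sd (A B : Finset E) : (A ∆ B).card + 2 * (A ∩ B).card = A.card + B.card := by
  have h1 := Finset.card_sdiff_add_card_inter A B
  have h2 := Finset.card_sdiff_add_card_inter B A
  have h3 : (A ∆ B).card = (A \ B).card + (B \ A).card := by
    rw [← Finset.card_union_of_disjoint]
    · rfl
    · rw [Finset.disjoint_left]; intro a; simp; tauto
  rw [Finset.inter_comm B A] at h2
  omega

/-- peel off an edge of a path -/
theorem Od.peel {Z a b} (h : g.Od Z a b) (hab : a ≠ b) :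
    ∃ e ∈ Z, ∃ c, g.jn e a c ∧ g.Od (Z.erase e) c b := by
  obtain ⟨e, he, hi⟩ := h.exists_inc hab
  obtain ⟨c, hc⟩ := hi.jn
  refine ⟨e, he, c, hc, ?_⟩
  have := hc.symm.od.trans h
  rwa [symmDiff_comm, sd_of_sub (by simpa using he), Finset.sdiff_singleton_eq_erase] at this

variable (g)
def Cn (Q : Finset E) (a b : V) : Prop := ∃ P ⊆ Q, g.Od P a b
variable {g}
theorem Cn.refl (Q : Finset E) (a : V) : g.Cn Q a a := ⟨∅, by simp, od_self.2 g.ev_empty⟩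
theorem sd_sub {A B Q : Finset E} (h : A ⊆ Q) (h' : B ⊆ Q) : A ∆ B ⊆ Q := by
  intro x hx; rw [Finset.mem_symmDiff] at hx; rcases hx with hx | hx
  exacts [h hx.1, h' hx.1]
theorem Cn.trans {Q : Finset E} {a b c} (h : g.Cn Q a b) (h' : g.Cn Q b c) : g.Cn Q a c := by
  obtain ⟨P, hP, h1⟩ := h
  obtain ⟨P', hP', h1'⟩ := h'
  exact ⟨_, sd_sub hP hP', h1.trans h1'⟩
theorem Cn.symm {Q : Finset E} {a b} (h : g.Cn Q a b) : g.Cn Q b a := by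
  obtain ⟨P, hP, h1⟩ := h
  exact ⟨P, hP, h1.symm⟩
theorem Cn.mono {Q Q' : Finset E} (hQ : Q ⊆ Q') {a b} (h : g.Cn Q a b) : g.Cn Q' a b := by
  obtain ⟨P, hP, h1⟩ := h
  exact ⟨P, hP.trans hQ, h1⟩
theorem cn_edge {Q : Finset E} {e} (h : e ∈ Q) : g.Cn Q (g.s e) (g.t e) :=
  ⟨{e}, by simpa using h, od_single e⟩

/-- edges of `Z` inside a set of vertices closed under `Z`-edges form an even set -/
theorem ev_inside {Z : Finset E} (hZ : g.Ev Z) (X : Set V)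
    (hX : ∀ e ∈ Z, g.s e ∈ X ↔ g.t e ∈ X) : g.Ev (Z.filter (fun e => g.s e ∈ X)) := by
  funext v
  by_cases hv : v ∈ X
  · have h1 : g.dg (Z.filter (fun e => ¬ g.s e ∈ X)) v = 0 := by
      apply dg_eq_zero_of_not_inc
      intro e he hi
      simp at he
      rcases hi with rfl | rfl
      · exact he.2 hv
      · exact he.2 ((hX e he.1).2 hv)
    have h2 : g.dg Z v = g.dg (Z.filter (fun e => g.s e ∈ X)) v
        + g.dg (Z.filter (fun e => ¬ g.s e ∈ X)) v := by
      unfold dg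
      rw [← Pi.add_apply, Finset.sum_filter_add_sum_filter_not]
    rw [hZ, h1] at h2
    simpa using h2.symm
  · apply dg_eq_zero_of_not_inc
    intro e he hi
    simp at he
    rcases hi with rfl | rfl
    · exact hv he.2
    · exact hv ((hX e he.1).1 he.2)

variable (g)
def Vs (Z : Finset E) : Set V := {v | ∃ e ∈ Z, g.inc e v}
def Circuit (Z : Finset E) : Prop := g.Ev Z ∧ Z ≠ ∅ ∧ ∀ W ⊆ Z, g.Ev W → W ≠ ∅ → W = Z
/-- proper colouring of an edge set -/
def Pr (B : Finset E) (χ : V → Fin 3) : Prop := ∀ e ∈ B, χ (g.s e) ≠ χ (g.t e)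
variable {g}

theorem Circuit.cn {Z} (h : g.Circuit Z) {a b} (ha : a ∈ g.Vs Z) (hb : b ∈ g.Vs Z) :
    g.Cn Z a b := by
  obtain ⟨h1, h2, h3⟩ := h
  set X : Set V := {x | g.Cn Z a x}
  have hX : ∀ e ∈ Z, g.s e ∈ X ↔ g.t e ∈ X := fun e he =>
    ⟨fun h => Cn.trans h (cn_edge he), fun h => Cn.trans h (cn_edge he).symm⟩
  have h4 := ev_inside h1 X hX
  obtain ⟨e, he, hi⟩ := ha
  obtain ⟨e', he', hi'⟩ := hb
  have heX : g.s e ∈ X := by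
    rcases hi with rfl | rfl
    · exact Cn.refl _ _
    · exact (hX e he).2 (Cn.refl _ _)
  have h5 := h3 _ (Finset.filter_subset _ _) h4 (by
    rw [← Finset.nonempty_iff_ne_empty]; exact ⟨e, by simp [he, heX]⟩)
  rw [← h5] at he'
  simp at he'
  rcases hi' with rfl | rfl
  · exact he'.2
  · exact (hX e' he'.1).1 he'.2

theorem Pr.mono {B B' : Finset E} (h : B ⊆ B') {χ} (h' : g.Pr B' χ) : g.Pr B χ :=
  fun e he => h' e (h he)

theorem Pr.jn {B : Finset E} {χ} (h' : g.Pr B χ) {e a b} (he : e ∈ B) (h : g.jn e a b) : χ a ≠ χ b := by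
  rcases h with ⟨rfl, rfl⟩ | ⟨rfl, rfl⟩
  · exact h' e he
  · exact (h' e he).symm

/-- every nonempty even subset has at least 4 edges -/
def TF (g : Gr V E) (A : Finset E) : Prop := ∀ Z ⊆ A, g.Ev Z → Z ≠ ∅ → 4 ≤ Z.card

theorem TF.mono {A B : Finset E} (h : g.TF A) (h' : B ⊆ A) : g.TF B :=
  fun Z hZ => h Z (hZ.trans h')
theorem TF.nl {A : Finset E} (h : g.TF A) : g.NL A := by
  intro e he hst
  have h1 : g.Ev {e} := by
    unfold Ev; rw [dg_single, hst, z2]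
  have := h {e} (by simpa using he) h1 (by simp)
  simp at this
theorem TF.jn_ne {A : Finset E} (h : g.TF A) {e a b} (he : e ∈ A) (hj : g.jn e a b) : a ≠ b := by
  rintro rfl
  rcases hj with ⟨h1, h2⟩ | ⟨h1, h2⟩ <;> exact h.nl e he (h1.trans h2.symm)
theorem TF.zero {A : Finset E} (h : g.TF A) {Z} (hZ : Z ⊆ A) (hE : g.Ev Z) (hc : Z.card ≤ 3) :
    Z = ∅ := by
  by_contra hne
  have := h Z hZ hE hne
  omega
theorem TF.par {A : Finset E} (h : g.TF A) {e e' a b} (he : e ∈ A) (he' : e' ∈ A)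
    (hj : g.jn e a b) (hj' : g.jn e' a b) : e = e' := by
  have h1 := h.zero (Z := {e} ∆ {e'}) (sd_sub (by simpa using he) (by simpa using he'))
    (hj.od.sd hj'.od) ((card_sd_le _ _).trans (by simp))
  rw [Finset.bot_eq_empty.symm, symmDiff_eq_bot] at h1
  simpa using h1
theorem circuit_of_card {A : Finset E} (h : g.TF A) {Z} (hZ : Z ⊆ A) (hE : g.Ev Z) (hne : Z ≠ ∅)
    (hc : Z.card ≤ 7) : g.Circuit Z := by
  refine ⟨hE, hne, fun W hW hWE hWne => ?_⟩
  have h1 := h W (hW.trans hZ) hWE hWne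
  have h2 : g.Ev (Z ∆ W) := hE.sd hWE
  rw [sd_of_sub hW] at h2
  have h3 := h.zero (Z := Z \ W) (Finset.sdiff_subset.trans hZ) h2 (by
    rw [Finset.card_sdiff_of_subset hW]; omega)
  rw [Finset.sdiff_eq_empty_iff_subset] at h3
  exact hW.antisymm h3
end Gr
end parity
end CF

end

open Set Topology

noncomputable section
namespace CF
set_option linter.all false
open scoped Classical symmDiff

/-! ### Plane maps as abstract dual structures -/

structure PM (V E : Type) extends Gr V E where
  A : Finset E
  F : Type
  [fF : Fintype F]
  l : E → F
  r : E → F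
  even_bd : ∀ R : Set F, toGr.Ev (A.filter (fun e => ¬ (l e ∈ R ↔ r e ∈ R)))
  exists_bd : ∀ Z ⊆ A, toGr.Ev Z → ∃ R : Set F, A.filter (fun e => ¬ (l e ∈ R ↔ r e ∈ R)) = Z
  conn : ∀ R : Set F, A.filter (fun e => ¬ (l e ∈ R ↔ r e ∈ R)) = ∅ → R = ∅ ∨ R = Set.univ

attribute [instance] PM.fF

namespace PM
variable {V E : Type} (P : PM V E)

def bd (R : Set P.F) : Finset E := P.A.filter (fun e => ¬ (P.l e ∈ R ↔ P.r e ∈ R))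

variable {P}
theorem mem_bd {R : Set P.F} {e} : e ∈ P.bd R ↔ e ∈ P.A ∧ ¬ (P.l e ∈ R ↔ P.r e ∈ R) := by
  simp only [bd, Finset.mem_filter]
theorem bd_sub (R : Set P.F) : P.bd R ⊆ P.A := Finset.filter_subset _ _
theorem ev_bd (R : Set P.F) : P.Ev (P.bd R) := P.even_bd R
theorem ex_bd {Z} (h : Z ⊆ P.A) (h' : P.Ev Z) : ∃ R : Set P.F, P.bd R = Z := P.exists_bd Z h h'
theorem bd_conn {R : Set P.F} (h : P.bd R = ∅) : R = ∅ ∨ R = Set.univ := P.conn R h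
theorem bd_sd (R R' : Set P.F) : P.bd (R ∆ R') = P.bd R ∆ P.bd R' := by
  ext e; simp only [mem_bd, Finset.mem_symmDiff, Set.mem_symmDiff]; tauto
theorem bd_compl (R : Set P.F) : P.bd Rᶜ = P.bd R := by
  ext e; simp only [mem_bd, Set.mem_compl_iff]; tauto
theorem bd_empty : P.bd ∅ = ∅ := by ext e; simp [mem_bd]
theorem bd_univ : P.bd Set.univ = ∅ := by ext e; simp [mem_bd]
theorem bd_inj {R R' : Set P.F} (h : P.bd R = P.bd R') : R = R' ∨ R = R'ᶜ := by
  have h1 : P.bd (R ∆ R') = ∅ := by rw [bd_sd, h]; simp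
  rcases bd_conn h1 with h2 | h2
  · left; rwa [← Set.bot_eq_empty, symmDiff_eq_bot] at h2
  · right; ext x; have : x ∈ R ∆ R' := h2 ▸ Set.mem_univ x
    rw [Set.mem_symmDiff] at this; simp; tauto
theorem bd_inj_o {R R' : Set P.F} {o} (h : P.bd R = P.bd R') (ho : o ∉ R) (ho' : o ∉ R') : R = R' := by
  rcases bd_inj h with h1 | h1
  · exact h1
  · rw [h1] at ho; simp at ho; exact absurd ho ho'
theorem ex_bd_o {Z} (h : Z ⊆ P.A) (h' : P.Ev Z) (o : P.F) : ∃ R : Set P.F, o ∉ R ∧ P.bd R = Z := by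
  obtain ⟨R, hR⟩ := ex_bd h h'
  by_cases ho : o ∈ R
  · exact ⟨Rᶜ, by simpa using ho, by rw [bd_compl, hR]⟩
  · exact ⟨R, ho, hR⟩
theorem mem_bd1 {f : P.F} {e} : e ∈ P.bd {f} ↔ e ∈ P.A ∧ ¬ (P.l e = f ↔ P.r e = f) := by
  simp [mem_bd]
theorem bd_ne {R : Set P.F} (h : R ≠ ∅) (h' : R ≠ Set.univ) : P.bd R ≠ ∅ :=
  fun hh => (bd_conn hh).elim h h'
theorem bd1_ne {f f' : P.F} (h : f ≠ f') : P.bd {f} ≠ ∅ := by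
  apply bd_ne
  · simp
  · intro hh; have : f' ∈ ({f} : Set P.F) := hh ▸ Set.mem_univ _
    simp at this; exact h this.symm

variable (P)
/-- total excess of a region -/
def wt (R : Set P.F) : ℤ := ∑ f with f ∈ R, (((P.bd {f}).card : ℤ) - 4)
variable {P}
theorem wt_empty : P.wt ∅ = 0 := by simp [wt]
theorem wt_single (f : P.F) : P.wt {f} = ((P.bd {f}).card : ℤ) - 4 := by
  unfold wt
  apply Finset.sum_eq_single_of_mem f (by simp)
  intro b hb hne
  simp at hb
  exact absurd hb hne
theorem wt_union {R R' : Set P.F} (h : Disjoint R R') : P.wt (R ∪ R') = P.wt R + P.wt R' := by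
  unfold wt
  rw [← Finset.sum_union]
  · congr 1; ext f; simp
  · rw [Finset.disjoint_left]; intro a; simp; exact fun ha hb => Set.disjoint_left.1 h ha hb
theorem wt_insert {R : Set P.F} {q} (h : q ∉ R) : P.wt (insert q R) = (((P.bd {q}).card : ℤ) - 4) + P.wt R := by
  rw [Set.insert_eq, wt_union (by simpa using h), wt_single]
theorem wt_fiber {F2 : Type} [Fintype F2] (π : P.F → F2) (Q : Set F2) :
    P.wt (π ⁻¹' Q) = ∑ f with f ∈ Q, P.wt (π ⁻¹' {f}) := by
  unfold wt
  rw [← Finset.sum_fiberwise_of_maps_to (s := Finset.univ.filter (· ∈ π ⁻¹' Q)) (t := Finset.univ.filter (· ∈ Q)) (g := π)]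
  · apply Finset.sum_congr rfl
    intro f hf
    simp at hf
    congr 1
    ext x
    simp
    rintro rfl; exact hf
  · intro x; simp
theorem wt_nonneg (h : P.TF P.A) {f f' : P.F} (hne : f ≠ f') (R : Set P.F) : 0 ≤ P.wt R := by
  apply Finset.sum_nonneg
  intro x _
  have : P.bd {x} ≠ ∅ := by
    by_cases hx : x = f
    · rw [hx]; exact bd1_ne hne
    · exact bd1_ne hx
  have := h _ (bd_sub _) (ev_bd {x}) this
  omega
theorem wt_mono (h : P.TF P.A) {f f' : P.F} (hne : f ≠ f') {R R' : Set P.F} (hR : R ⊆ R') : P.wt R ≤ P.wt R' := by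
  have : P.wt R' = P.wt R + P.wt (R' \ R) := by
    rw [← wt_union Set.disjoint_sdiff_right, Set.union_diff_cancel hR]
  have := wt_nonneg h hne (R' \ R)
  omega

variable [Fintype V]

theorem dg_map (g : Gr V E) (ρ : V → V) (Z : Finset E) (v : V) :
    (Gr.mk (ρ ∘ g.s) (ρ ∘ g.t)).dg Z v = ∑ u, if ρ u = v then g.dg Z u else 0 := by
  unfold Gr.dg
  simp only [Finset.sum_apply]
  rw [← Finset.sum_filter, Finset.sum_comm]
  apply Finset.sum_congr rfl
  intro e _
  simp only [Pi.add_apply, Finset.sum_add_distrib, dl, Function.comp]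
  congr 1
  · simp [Finset.sum_filter, eq_comm]
  · simp [Finset.sum_filter, eq_comm]

theorem ev_map {g : Gr V E} (ρ : V → V) {Z : Finset E} (h : g.Ev Z) :
    (Gr.mk (ρ ∘ g.s) (ρ ∘ g.t)).Ev Z := by
  funext v
  rw [dg_map, h]; simp

theorem minor_key (g : Gr V E) (T : Finset E) (ρ : V → V) (hρ : ∀ x, g.Cn T x (ρ x)) (Z : Finset E) :
    ∃ T' ⊆ T, g.dg Z + g.dg T' = (Gr.mk (ρ ∘ g.s) (ρ ∘ g.t)).dg Z := by
  induction Z using Finset.induction_on with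
  | empty => exact ⟨∅, by simp, by simp [Gr.dg_empty]⟩
  | insert e Z he ih =>
    obtain ⟨T', hT', h⟩ := ih
    obtain ⟨P1, hP1, h1⟩ := hρ (g.s e)
    obtain ⟨P2, hP2, h2⟩ := hρ (g.t e)
    refine ⟨T' ∆ (P1 ∆ P2), Gr.sd_sub hT' (Gr.sd_sub hP1 hP2), ?_⟩
    have e1 : ∀ g : Gr V E, g.dg (insert e Z) = dl (g.s e) + dl (g.t e) + g.dg Z := fun g => by
      unfold Gr.dg; rw [Finset.sum_insert he]
    rw [e1, e1, ← h, Gr.dg_symm, Gr.dg_symm, h1, h2]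
    simp only [Function.comp]
    linear_combination z2 (dl (g.s e)) + z2 (dl (g.t e))

theorem minor (P : PM V E) (T A2 : Finset E) (ρ : V → V) (hT : T ⊆ P.A) (hA2 : A2 ⊆ P.A)
    (hdis : Disjoint T A2) (hρT : ∀ e ∈ T, ρ (P.s e) = ρ (P.t e)) (hρ : ∀ x, P.Cn T x (ρ x))
    (hac : ∀ Z ⊆ T, P.Ev Z → Z = ∅) :
    ∃ P2 : PM V E, P2.toGr = Gr.mk (ρ ∘ P.s) (ρ ∘ P.t) ∧ P2.A = A2 ∧
      ∃ π : P.F → P2.F, Function.Surjective π ∧ (∀ R, P2.bd R = P.bd (π ⁻¹' R) ∩ A2) ∧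
        (∀ R, P.bd (π ⁻¹' R) ⊆ A2 ∪ T) ∧ (∀ e, P2.l e = π (P.l e)) ∧ (∀ e, P2.r e = π (P.r e)) ∧
        (∀ Q : Set P.F, P.bd Q ⊆ A2 ∪ T → ∃ R, Q = π ⁻¹' R) := by
  let rel : P.F → P.F → Prop := fun a b => ∃ e ∈ P.A, e ∉ A2 ∪ T ∧ a = P.l e ∧ b = P.r e
  let F2 := Quot rel
  let π : P.F → F2 := Quot.mk rel
  have hπ : Function.Surjective π := Quot.mk_surjective
  haveI : Finite F2 := Finite.of_surjective π hπ
  letI : Fintype F2 := Fintype.ofFinite F2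
  have hD : ∀ R, P.bd (π ⁻¹' R) ⊆ A2 ∪ T := by
    intro R e he
    by_contra hc
    rw [mem_bd] at he
    apply he.2
    have : π (P.l e) = π (P.r e) := Quot.sound ⟨e, he.1, hc, rfl, rfl⟩
    simp [this]
  have hS : ∀ Q : Set P.F, P.bd Q ⊆ A2 ∪ T → ∃ R : Set F2, Q = π ⁻¹' R := by
    intro Q hQ
    refine ⟨{x | Quot.lift (· ∈ Q) (fun a b hab => ?_) x}, rfl⟩
    obtain ⟨e, he, he', rfl, rfl⟩ := hab
    by_contra hc
    apply he' (hQ _)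
    rw [mem_bd]; refine ⟨he, fun h => hc (propext h)⟩
  have hb : ∀ R : Set F2, A2.filter (fun e => ¬ (π (P.l e) ∈ R ↔ π (P.r e) ∈ R)) = P.bd (π ⁻¹' R) ∩ A2 := by
    intro R; ext e; simp only [Finset.mem_filter, Finset.mem_inter, mem_bd, Set.mem_preimage]
    have := @hA2 e; tauto
  have hTz : ∀ Z ⊆ T, (Gr.mk (ρ ∘ P.s) (ρ ∘ P.t)).Ev Z := by
    intro Z hZ
    apply Finset.sum_eq_zero
    intro e he
    simp only [Function.comp, hρT e (hZ he)]; exact z2 _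
  refine ⟨⟨Gr.mk (ρ ∘ P.s) (ρ ∘ P.t), A2, F2, π ∘ P.l, π ∘ P.r, ?_, ?_, ?_⟩, rfl, rfl, π, hπ, ?_, hD, fun _ => rfl, fun _ => rfl, hS⟩
  · intro R
    simp only [Function.comp] at *
    rw [hb]
    have h1 := ev_map ρ (ev_bd (π ⁻¹' R))
    have h2 := h1.sd (hTz (P.bd (π ⁻¹' R) ∩ T) (Finset.inter_subset_right))
    convert h2 using 1
    ext e
    have : e ∈ _ → e ∈ _ := fun h => hD R h
    have : e ∈ T → e ∉ A2 := fun h => Finset.disjoint_left.1 hdis h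
    simp only [Finset.mem_inter, Finset.mem_symmDiff, Finset.mem_union] at *; tauto
  · intro Z hZ hE
    simp only [Function.comp]
    obtain ⟨T', hT', h⟩ := minor_key P.toGr T ρ hρ Z
    rw [hE, ← Gr.dg_symm] at h
    obtain ⟨Q, hQ⟩ := ex_bd (P := P) (Gr.sd_sub (hZ.trans hA2) (hT'.trans hT)) h
    obtain ⟨R, rfl⟩ := hS Q (by rw [hQ]; exact Gr.sd_sub (hZ.trans Finset.subset_union_left) (hT'.trans Finset.subset_union_right))
    refine ⟨R, ?_⟩
    rw [hb, hQ]
    ext e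
    have := @hZ e
    have := @hT' e
    have : e ∈ T → e ∉ A2 := fun h => Finset.disjoint_left.1 hdis h
    simp only [Finset.mem_inter, Finset.mem_symmDiff] at *; tauto
  · intro R h
    simp only [Function.comp] at h
    rw [hb] at h
    have h1 := hac (P.bd (π ⁻¹' R)) (fun e he => by
      have h2 := hD R he
      rcases Finset.mem_union.1 h2 with h3 | h3
      · exact absurd (Finset.mem_inter.2 ⟨he, h3⟩) (by simp [h])
      · exact h3) (ev_bd _)
    rcases bd_conn h1 with h2 | h2
    · left; ext x; obtain ⟨y, rfl⟩ := hπ x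
      have : y ∈ π ⁻¹' R ↔ y ∈ (∅ : Set P.F) := by rw [h2]
      simpa using this
    · right; ext x; obtain ⟨y, rfl⟩ := hπ x
      have : y ∈ π ⁻¹' R ↔ y ∈ (Set.univ : Set P.F) := by rw [h2]
      simpa using this
  · intro R; exact hb R

/-- deletion -/
theorem del (P : PM V E) (A2 : Finset E) (hA2 : A2 ⊆ P.A) :
    ∃ P2 : PM V E, P2.toGr = P.toGr ∧ P2.A = A2 ∧
      ∃ π : P.F → P2.F, Function.Surjective π ∧ (∀ R, P2.bd R = P.bd (π ⁻¹' R)) ∧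
        (∀ e, P2.l e = π (P.l e)) ∧ (∀ e, P2.r e = π (P.r e)) ∧
        (∀ Q : Set P.F, P.bd Q ⊆ A2 → ∃ R, Q = π ⁻¹' R) := by
  obtain ⟨P2, h1, h2, π, h3, h4, h5, h6, h7, h8⟩ := minor P ∅ A2 id (by simp) hA2 (by simp) (by simp)
    (fun x => Gr.Cn.refl _ _) (fun Z hZ _ => by simpa using hZ)
  refine ⟨P2, h1, h2, π, h3, fun R => ?_, h6, h7, by simpa using h8⟩
  rw [h4]
  have := h5 R
  simp at this
  exact Finset.inter_eq_left.2 this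

end PM
end CF

end

open Set Topology

noncomputable section
namespace CF
set_option linter.all false
open scoped Classical symmDiff

namespace PM
variable {V E : Type} [Fintype V]

theorem split (P : PM V E) (q : P.F) (P1 : Finset E) (u w : V) (h1 : P1 ⊆ P.bd {q})
    (hod : P.Od P1 u w) (huw : u ≠ w) :
    ∃ P2 : PM V E, P2.toGr = Gr.mk ((fun x => if x = w then u else x) ∘ P.s)
        ((fun x => if x = w then u else x) ∘ P.t) ∧ P2.A = P.A ∧
      (∀ Z, P2.Ev Z → P.Ev Z ∨ P.Od Z u w) ∧
      ∃ (ι : P.F → P2.F) (n : P2.F), Function.Injective ι ∧ (∀ f, ι f ≠ n) ∧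
        (∀ x, x = n ∨ ∃ f, x = ι f) ∧
        (∀ R, P2.bd R = P.bd (ι ⁻¹' R) ∆ (if (n ∈ R ↔ ι q ∈ R) then ∅ else P1)) ∧
        (∀ e, P2.l e = if e ∈ P1 ∧ P.l e = q then n else ι (P.l e)) ∧
        (∀ e, P2.r e = if e ∈ P1 ∧ P.r e = q then n else ι (P.r e)) := by
  set ρ : V → V := fun x => if x = w then u else x with hρ
  let l' : E → Option P.F := fun e => if e ∈ P1 ∧ P.l e = q then none else some (P.l e)
  let r' : E → Option P.F := fun e => if e ∈ P1 ∧ P.r e = q then none else some (P.r e)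
  have hP1A : P1 ⊆ P.A := h1.trans (bd_sub _)
  have hb : ∀ R : Set (Option P.F), P.A.filter (fun e => ¬ (l' e ∈ R ↔ r' e ∈ R)) =
      P.bd (some ⁻¹' R) ∆ (if (none ∈ R ↔ some q ∈ R) then ∅ else P1) := by
    intro R
    ext e
    rw [Finset.mem_filter, Finset.mem_symmDiff, mem_bd]
    by_cases he : e ∈ P1
    · have h2 := mem_bd1.1 (h1 he)
      by_cases hl : P.l e = q
      · have hr : P.r e ≠ q := fun h => h2.2 ⟨fun _ => h, fun _ => hl⟩
        have e1 : l' e = none := by simp [l', he, hl]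
        have e2 : r' e = some (P.r e) := by simp [r', he, hr]
        rw [e1, e2]
        simp only [Set.mem_preimage, hl]
        by_cases hc : (none ∈ R ↔ some q ∈ R) <;> simp only [hc, if_true, if_false, he, h2.1] <;> simp <;> tauto
      · have hr : P.r e = q := by tauto
        have e1 : l' e = some (P.l e) := by simp [l', he, hl]
        have e2 : r' e = none := by simp [r', he, hr]
        rw [e1, e2]
        simp only [Set.mem_preimage, hr]
        by_cases hc : (none ∈ R ↔ some q ∈ R) <;> simp only [hc, if_true, if_false, he, h2.1] <;> simp <;> tauto
    · have e1 : l' e = some (P.l e) := by simp [l', he]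
      have e2 : r' e = some (P.r e) := by simp [r', he]
      rw [e1, e2]
      have : e ∉ (if (none ∈ R ↔ some q ∈ R) then ∅ else P1) := by split_ifs <;> simp [he]
      simp only [Set.mem_preimage]
      tauto
  have hdg : ∀ Z, (Gr.mk (ρ ∘ P.s) (ρ ∘ P.t)).Ev Z → P.Ev Z ∨ P.Od Z u w := by
    intro Z hZ
    have h3 : ∀ v, v ≠ u → v ≠ w → P.dg Z v = 0 := by
      intro v hv hv'
      have := congrFun hZ v
      rw [dg_map, Finset.sum_eq_single v] at this
      · simpa [hρ, hv'] using this
      · intro b _ hb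
        simp only [hρ]
        by_cases hbw : b = w
        · simp [hbw, Ne.symm hv]
        · simp [hbw, hb]
      · simp
    have h4 : P.dg Z u + P.dg Z w = 0 := by
      have := congrFun hZ u
      rw [dg_map, ← Finset.sum_filter] at this
      rw [show Finset.univ.filter (fun x => ρ x = u) = {u, w} by
        ext x; by_cases hx : x = w <;> simp [hρ, hx]] at this
      rw [Finset.sum_pair huw] at this
      exact this
    have h5 : P.dg Z u = P.dg Z w := CharTwo.add_eq_zero.1 h4
    have h6 : P.dg Z u = 0 ∨ P.dg Z u = 1 := by
      generalize P.dg Z u = x; revert x; decide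
    rcases h6 with h6 | h6
    · left; funext v
      by_cases hv : v = u
      · rw [hv, h6]; rfl
      · by_cases hv' : v = w
        · rw [hv', ← h5, h6]; rfl
        · exact h3 v hv hv'
    · right; funext v
      by_cases hv : v = u
      · rw [hv, h6]; simp [dl, huw]
      · by_cases hv' : v = w
        · rw [hv', ← h5, h6]; simp [dl, huw.symm]
        · rw [h3 v hv hv']; simp [dl, hv, hv']
  have hP1E : (Gr.mk (ρ ∘ P.s) (ρ ∘ P.t)).Ev P1 := by
    funext v
    rw [dg_map, hod]
    simp only [Pi.add_apply, dl]
    simp only [Pi.zero_apply]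
    have : ∀ x, (if ρ x = v then ((if x = u then 1 else 0) + (if x = w then 1 else 0) : ZMod 2) else 0)
      = (if x = u then (if u = v then 1 else 0) else 0) + (if x = w then (if u = v then 1 else 0) else 0) := by
      intro x
      by_cases hx : x = u
      · simp [hx, huw, hρ]
      · by_cases hx' : x = w
        · simp [hx', huw.symm, hρ]
        · simp [hx, hx']
    simp only [this, Finset.sum_add_distrib, Finset.sum_ite_eq', Finset.mem_univ, if_true]
    exact CharTwo.add_self_eq_zero _
  refine ⟨⟨Gr.mk (ρ ∘ P.s) (ρ ∘ P.t), P.A, Option P.F, l', r', ?_, ?_, ?_⟩, rfl, rfl, hdg, some, none,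
    Option.some_injective _, by simp, ?_, fun R => ?_, fun e => rfl, fun e => rfl⟩
  · intro R
    rw [hb]
    apply (ev_map ρ (ev_bd _)).sd
    split_ifs
    · exact Gr.ev_empty _
    · exact hP1E
  · intro Z hZ hE
    rcases hdg Z hE with h2 | h2
    · obtain ⟨R, hR⟩ := ex_bd hZ h2
      refine ⟨{x | (∃ f ∈ R, x = some f) ∨ (x = none ∧ q ∈ R)}, ?_⟩
      rw [hb, if_pos (by simp)]
      rw [show (some ⁻¹' {x | (∃ f ∈ R, x = some f) ∨ (x = none ∧ q ∈ R)}) = R by ext x; simp]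
      rw [hR]; simp
    · obtain ⟨R, hR⟩ := ex_bd (Gr.sd_sub hZ hP1A) (h2.sd hod)
      refine ⟨{x | (∃ f ∈ R, x = some f) ∨ (x = none ∧ q ∉ R)}, ?_⟩
      rw [hb, if_neg (by simp)]
      rw [show (some ⁻¹' {x | (∃ f ∈ R, x = some f) ∨ (x = none ∧ q ∉ R)}) = R by ext x; simp]
      rw [hR, symmDiff_assoc]; simp
  · intro R h
    rw [hb] at h
    have hh : ∀ X : Set P.F, some ⁻¹' R = X → (none ∈ R ↔ some q ∈ R) → R = {x | (∃ f ∈ X, x = some f) ∨ (x = none ∧ q ∈ X)} := by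
      rintro X rfl h2
      ext x; cases x <;> simp [h2]
    split_ifs at h with hc
    · simp at h
      rcases bd_conn h with h2 | h2
      · left; rw [hh _ h2 hc]; simp
      · right; rw [hh _ h2 hc]; ext x; cases x <;> simp
    · exfalso
      have h3 : P.bd (some ⁻¹' R) = P1 := by
        rwa [← Finset.bot_eq_empty, symmDiff_eq_bot] at h
      have h4 := ev_bd (P := P) (some ⁻¹' R)
      rw [h3] at h4
      have h5 : dl u + dl w = 0 := by
        rw [← show P.dg P1 = dl u + dl w from hod]; exact h4
      exact huw (dl_inj (z2c.1 h5))
  · intro x; cases x <;> simp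
  · exact hb R

/-- criticality relative to the outer face -/
def Crit (P : PM V E) (o : P.F) : Prop :=
  (∀ e ∈ P.A, ¬ (P.l e = o ∧ P.r e = o)) ∧ P.Circuit (P.bd {o}) ∧ P.bd {o} ≠ P.A ∧
  ∀ e ∈ P.A, e ∉ P.bd {o} → ∃ ψ, P.Pr (P.A.erase e) ψ ∧
    ¬ ∃ χ, P.Pr P.A χ ∧ ∀ v ∈ P.Vs (P.bd {o}), χ v = ψ v

theorem minCrit (P : PM V E) (o : P.F) (hoo : ∀ e ∈ P.A, ¬ (P.l e = o ∧ P.r e = o))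
    (hC : P.Circuit (P.bd {o})) (φ : V → Fin 3) (hφ : P.Pr (P.bd {o}) φ)
    (hne : ¬ ∃ χ, P.Pr P.A χ ∧ ∀ v ∈ P.Vs (P.bd {o}), χ v = φ v) :
    ∃ P2 : PM V E, P2.toGr = P.toGr ∧ P2.A ⊆ P.A ∧ 
      ∃ π : P.F → P2.F, Function.Surjective π ∧ (∀ R, P2.bd R = P.bd (π ⁻¹' R)) ∧
        (∀ e, P2.l e = π (P.l e)) ∧ (∀ e, P2.r e = π (P.r e)) ∧
        π ⁻¹' {π o} = {o} ∧ P2.bd {π o} = P.bd {o} ∧ P2.Crit (π o) := by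
  have hex : ∃ n, ∃ B : Finset E, P.bd {o} ⊆ B ∧ B ⊆ P.A ∧ B.card = n ∧
      ¬ ∃ χ, P.Pr B χ ∧ ∀ v ∈ P.Vs (P.bd {o}), χ v = φ v :=
    ⟨_, P.A, bd_sub _, subset_rfl, rfl, hne⟩
  obtain ⟨A2, hCA, hA2, hcard, hA2n⟩ := Nat.find_spec hex
  have hmin := fun m => Nat.find_min hex (m := m)
  rw [← hcard] at hmin
  obtain ⟨P2, h1, h2, π, h3, h4, h5, h6, h7⟩ := del P A2 hA2
  have hpre : π ⁻¹' {π o} = {o} := by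
    obtain ⟨R, hR⟩ := h7 {o} hCA
    ext x
    simp only [Set.mem_preimage, Set.mem_singleton_iff]
    constructor
    · intro hx
      have h8 : o ∈ π ⁻¹' R := hR ▸ rfl
      have h9 : x ∈ π ⁻¹' R := by simp [hx]; exact h8
      rw [← hR] at h9; exact h9
    · rintro rfl; rfl
  have hbd : P2.bd {π o} = P.bd {o} := by rw [h4, hpre]
  refine ⟨P2, h1, h2 ▸ hA2, π, h3, h4, h5, h6, hpre, hbd, ?_, ?_, ?_, ?_⟩
  · intro e he ⟨hl, hr⟩
    rw [h5] at hl; rw [h6] at hr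
    have hl' : P.l e ∈ π ⁻¹' {π o} := hl
    have hr' : P.r e ∈ π ⁻¹' {π o} := hr
    rw [hpre] at hl' hr'
    exact hoo e (hA2 (h2 ▸ he)) ⟨hl', hr'⟩
  · rw [h1, hbd]; exact hC
  · rw [hbd, h2]
    intro hh
    apply hA2n
    exact ⟨φ, hh ▸ hφ, fun _ _ => rfl⟩
  · intro e he heC
    rw [h1, h2, hbd] at *
    have h8 := hmin (A2.erase e).card (Finset.card_erase_lt_of_mem he)
    push Not at h8
    obtain ⟨χ, hχ, hχφ⟩ := h8 (A2.erase e) (fun x hx => Finset.mem_erase.2 ⟨fun h => heC (h ▸ hx), hCA hx⟩)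
      ((Finset.erase_subset _ _).trans hA2) rfl
    refine ⟨χ, hχ, ?_⟩
    rintro ⟨χ', h9, h10⟩
    exact hA2n ⟨χ', h9, fun v hv => (h10 v hv).trans (hχφ v hv)⟩

theorem Crit.par {P : PM V E} {o : P.F} (h : P.Crit o) {e e' a b} (he : e ∈ P.A) (he' : e' ∈ P.A)
    (hne : e ≠ e') (hC : e ∉ P.bd {o}) (hj : P.jn e a b) (hj' : P.jn e' a b) : False := by
  obtain ⟨ψ, h1, h2⟩ := h.2.2.2 e he hC
  apply h2
  refine ⟨ψ, fun x hx => ?_, fun _ _ => rfl⟩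
  by_cases hxe : x = e
  · subst hxe
    have := h1.jn (Finset.mem_erase.2 ⟨hne.symm, he'⟩) hj'
    rcases hj with ⟨rfl, rfl⟩ | ⟨rfl, rfl⟩
    · exact this
    · exact this.symm
  · exact h1 x (Finset.mem_erase.2 ⟨hxe, hx⟩)

variable (P : PM V E)
/-- nonisolated vertices -/
def Vp (g : Gr V E) (A : Finset E) : Finset V := A.image g.s ∪ A.image g.t

theorem mem_Vp {g : Gr V E} {A : Finset E} {v} : v ∈ Vp g A ↔ ∃ e ∈ A, g.inc e v := by
  simp only [Vp, Finset.mem_union, Finset.mem_image, Gr.inc]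
  constructor
  · rintro (⟨e, h, h'⟩ | ⟨e, h, h'⟩)
    exacts [⟨e, h, Or.inl h'⟩, ⟨e, h, Or.inr h'⟩]
  · rintro ⟨e, h, h' | h'⟩
    exacts [Or.inl ⟨e, h, h'⟩, Or.inr ⟨e, h, h'⟩]

theorem dg_sum (g : Gr V E) (Z : Finset E) : ∑ v, g.dg Z v = 0 := by
  unfold Gr.dg
  simp only [Finset.sum_apply]
  rw [Finset.sum_comm]
  apply Finset.sum_eq_zero
  intro e _
  simp only [Pi.add_apply, Finset.sum_add_distrib, dl, Finset.sum_ite_eq', Finset.mem_univ, if_true]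
  exact CharTwo.add_self_eq_zero _

theorem euler (hA : P.A.Nonempty) : P.A.card + 2 ≤ Fintype.card P.F + (Vp P.toGr P.A).card := by
  obtain ⟨e0, he0⟩ := hA
  set o := P.l e0
  set v0 := P.s e0
  have hv0 : v0 ∈ Vp P.toGr P.A := mem_Vp.2 ⟨e0, he0, Or.inl rfl⟩
  have hrep : ∀ d : V → ZMod 2, ∃ Z0, (∃ Z ⊆ P.A, P.dg Z = d) → Z0 ⊆ P.A ∧ P.dg Z0 = d := by
    intro d
    by_cases h : ∃ Z ⊆ P.A, P.dg Z = d
    · obtain ⟨Z, h⟩ := h; exact ⟨Z, fun _ => h⟩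
    · exact ⟨∅, fun h' => absurd h' h⟩
  choose rep hrep using hrep
  have hreg : ∀ Z : Finset E, ∃ R : Set P.F, Z ⊆ P.A → o ∉ R ∧ P.bd R = Z ∆ rep (P.dg Z) := by
    intro Z
    by_cases hZ : Z ⊆ P.A
    · obtain ⟨h1, h2⟩ := hrep (P.dg Z) ⟨Z, hZ, rfl⟩
      obtain ⟨R, hR⟩ := ex_bd_o (P := P) (Gr.sd_sub hZ h1) (by unfold Gr.Ev; rw [Gr.dg_symm, h2, z2]) o
      exact ⟨R, fun _ => hR⟩
    · exact ⟨∅, fun h => absurd h hZ⟩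
  choose reg hreg using hreg
  let Φ : Finset E → Finset V × Finset P.F := fun Z =>
    (((Vp P.toGr P.A).erase v0).filter (fun v => P.dg Z v = 1), Finset.univ.filter (· ∈ reg Z))
  have hmap : ∀ Z ∈ P.A.powerset, Φ Z ∈ ((Vp P.toGr P.A).erase v0).powerset ×ˢ ((Finset.univ : Finset P.F).erase o).powerset := by
    intro Z hZ
    rw [Finset.mem_powerset] at hZ
    rw [Finset.mem_product]
    refine ⟨Finset.mem_powerset.2 (Finset.filter_subset _ _), Finset.mem_powerset.2 ?_⟩
    intro x hx
    simp only [Finset.mem_filter, Φ] at hx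
    simp only [Finset.mem_erase, Finset.mem_univ, and_true]
    rintro rfl
    exact (hreg Z hZ).1 hx.2
  have hz1 : ∀ x : ZMod 2, x = 0 ∨ x = 1 := by decide
  have hinj : Set.InjOn Φ (P.A.powerset : Set (Finset E)) := by
    intro Z hZ W hW hZW
    simp only [Finset.coe_powerset, Set.mem_preimage, Set.mem_powerset_iff, Finset.coe_subset] at hZ hW
    simp only [Φ, Prod.mk.injEq] at hZW
    obtain ⟨h1, h2⟩ := hZW
    have h3 : ∀ v, v ≠ v0 → P.dg Z v = P.dg W v := by
      intro v hv
      by_cases hvV : v ∈ Vp P.toGr P.A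
      · have : v ∈ ((Vp P.toGr P.A).erase v0).filter (fun v => P.dg Z v = 1) ↔ v ∈ ((Vp P.toGr P.A).erase v0).filter (fun v => P.dg W v = 1) := by rw [h1]
        simp only [Finset.mem_filter, Finset.mem_erase, hv, hvV] at this
        rcases hz1 (P.dg Z v) with h4 | h4 <;> rcases hz1 (P.dg W v) with h5 | h5 <;> simp_all
      · rw [mem_Vp] at hvV
        push Not at hvV
        rw [Gr.dg_eq_zero_of_not_inc (fun e he => hvV e (hZ he)), Gr.dg_eq_zero_of_not_inc (fun e he => hvV e (hW he))]
    have h4 : P.dg Z = P.dg W := by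
      funext v
      by_cases hv : v = v0
      · have e1 := dg_sum P.toGr Z
        have e2 := dg_sum P.toGr W
        rw [← Finset.add_sum_erase _ _ (Finset.mem_univ v0)] at e1 e2
        rw [Finset.sum_congr rfl (fun x hx => h3 x (Finset.ne_of_mem_erase hx)), ← e2] at e1
        rw [hv]
        exact add_right_cancel e1
      · exact h3 v hv
    have h5 : reg Z = reg W := by
      ext x
      have : x ∈ Finset.univ.filter (· ∈ reg Z) ↔ x ∈ Finset.univ.filter (· ∈ reg W) := by rw [h2]
      simpa using this
    have h6 := (hreg Z hZ).2
    have h7 := (hreg W hW).2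
    rw [← h5, ← h4] at h7
    exact symmDiff_left_injective _ (h6.symm.trans h7)
  have := Finset.card_le_card_of_injOn Φ hmap hinj
  rw [Finset.card_product, Finset.card_powerset, Finset.card_powerset, Finset.card_powerset,
    Finset.card_erase_of_mem hv0, Finset.card_erase_of_mem (Finset.mem_univ _), ← pow_add] at this
  have h9 := (Nat.pow_le_pow_iff_right (by norm_num : 1 < 2)).1 this
  have h10 : 0 < (Vp P.toGr P.A).card := Finset.card_pos.2 ⟨_, hv0⟩
  have h11 : 0 < (Finset.univ : Finset P.F).card := Finset.card_pos.2 ⟨o, Finset.mem_univ _⟩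
  rw [← Finset.card_univ]
  omega

end PM
end CF

end

open Set Topology

noncomputable section
namespace CF
set_option linter.all false
open scoped Classical symmDiff

namespace PM
variable {V E : Type} [Fintype V]

def IHyp (V E : Type) [Fintype V] (n : ℕ) : Prop := ∀ (P : PM V E) (o : P.F), P.A.card < n →
  P.TF P.A → P.Crit o → (P.bd {o}).card ≤ 9 → P.wt {o}ᶜ ≤ ((P.bd {o}).card : ℤ) - 6

theorem deg_sum {g : Gr V E} {B : Finset E} (h : g.NL B) : ∑ v, (g.star B v).card = 2 * B.card := by
  simp only [Gr.star, Finset.card_filter]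
  rw [Finset.sum_comm, mul_comm, ← smul_eq_mul, ← Finset.sum_const]
  apply Finset.sum_congr rfl
  intro e he
  rw [← Finset.card_filter]
  rw [show Finset.univ.filter (fun v => g.inc e v) = {g.s e, g.t e} by ext v; simp [Gr.inc, eq_comm]]
  exact Finset.card_pair (h e he)

theorem deg_sum' {g : Gr V E} {B : Finset E} (h : g.NL B) : ∑ v ∈ Vp g B, (g.star B v).card = 2 * B.card := by
  rw [← deg_sum h]
  apply Finset.sum_subset (Finset.subset_univ _)
  intro v _ hv
  rw [mem_Vp] at hv
  push Not at hv
  rw [Finset.card_eq_zero, Finset.eq_empty_iff_forall_notMem]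
  intro e he
  rw [Gr.mem_star] at he
  exact hv e he.1 he.2

theorem recolor {g : Gr V E} {B : Finset E} (hNL : g.NL B) {v : V} {χ : V → Fin 3}
    (h : g.Pr (B \ g.star B v) χ) (hc : (g.star B v).card ≤ 2) :
    ∃ c, g.Pr B (Function.update χ v c) := by
  have : ∃ c, c ∉ (g.star B v).image (fun e => χ (if g.s e = v then g.t e else g.s e)) := by
    by_contra hcon
    push Not at hcon
    have h1 : Finset.univ ⊆ (g.star B v).image (fun e => χ (if g.s e = v then g.t e else g.s e)) :=
      fun c _ => hcon c
    have h2 := (Finset.card_le_card h1).trans Finset.card_image_le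
    simp at h2
    omega
  obtain ⟨c, hcc⟩ := this
  refine ⟨c, fun e he => ?_⟩
  have hst := hNL e he
  simp only [Finset.mem_image, not_exists, not_and, Gr.mem_star, Gr.inc] at hcc
  by_cases h1 : g.s e = v
  · have h2 : g.t e ≠ v := fun h => hst (h1.trans h.symm)
    have := hcc e ⟨he, Or.inl h1⟩
    simp [h1] at this
    rw [h1, Function.update_self, Function.update_of_ne h2]
    exact fun h => this h.symm
  · by_cases h2 : g.t e = v
    · have := hcc e ⟨he, Or.inr h2⟩
      simp [h1] at this
      rw [h2, Function.update_self, Function.update_of_ne h1]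
      exact this
    · rw [Function.update_of_ne h1, Function.update_of_ne h2]
      apply h e
      simp [Gr.mem_star, he, Gr.inc, h1, h2]

variable {n : ℕ} {P : PM V E}

/-- length of a face, counting both sides -/
def len (P : PM V E) (f : P.F) : ℕ :=
  (P.A.filter (fun e => P.l e = f)).card + (P.A.filter (fun e => P.r e = f)).card

theorem len_sum : ∑ f, P.len f = 2 * P.A.card := by
  unfold len
  rw [Finset.sum_add_distrib]
  simp only [Finset.card_filter]
  rw [Finset.sum_comm, Finset.sum_comm (s := Finset.univ)]
  simp
  ring

theorem bd_le_len (f : P.F) : (P.bd {f}).card ≤ P.len f := by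
  unfold len
  refine le_trans (Finset.card_le_card ?_) (Finset.card_union_le _ _)
  intro e he
  rw [mem_bd1] at he
  simp only [Finset.mem_union, Finset.mem_filter]
  tauto

theorem bd_lt_len {f : P.F} {e} (he : e ∈ P.A) (hl : P.l e = f) (hr : P.r e = f) : (P.bd {f}).card + 2 ≤ P.len f := by
  unfold len
  rw [← Finset.card_union_add_card_inter]
  have h1 : P.bd {f} ⊆ ((P.A.filter (fun e => P.l e = f)) ∪ (P.A.filter (fun e => P.r e = f))).erase e := by
    intro x hx
    rw [mem_bd1] at hx
    simp only [Finset.mem_erase, Finset.mem_union, Finset.mem_filter]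
    refine ⟨?_, by tauto⟩
    rintro rfl; exact hx.2 (by simp [hl, hr])
  have h2 : e ∈ (P.A.filter (fun e => P.l e = f)) ∪ (P.A.filter (fun e => P.r e = f)) := by simp [he, hl]
  have h3 : 0 < ((P.A.filter (fun e => P.l e = f)) ∩ (P.A.filter (fun e => P.r e = f))).card :=
    Finset.card_pos.2 ⟨e, by simp [he, hl, hr]⟩
  have h4 := Finset.card_le_card h1
  rw [Finset.card_erase_of_mem h2] at h4
  have h5 := Finset.card_pos.2 ⟨e, h2⟩
  omega

theorem grotzsch (ih : IHyp V E n) (hTF : P.TF P.A) {B : Finset E} (hB : B ⊆ P.A) (hn : B.card < n) :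
    ∃ χ, P.Pr B χ := by
  by_contra hno
  have hex : ∃ m, ∃ B' ⊆ B, B'.card = m ∧ ¬ ∃ χ, P.Pr B' χ := ⟨_, B, subset_rfl, rfl, hno⟩
  obtain ⟨B', hB', hm, hB'n⟩ := Nat.find_spec hex
  have hmin : ∀ D, D ⊂ B' → ∃ χ, P.Pr D χ := by
    intro D hD
    have := Nat.find_min hex (m := D.card) (by rw [← hm]; exact Finset.card_lt_card hD)
    push Not at this
    exact this D (hD.1.trans hB') rfl
  have hB'A := hB'.trans hB
  have hcard := Finset.card_le_card hB'
  clear hm hex hno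
  have hNL := (hTF.mono hB'A).nl
  have hTF' := hTF.mono hB'A
  have hdeg : ∀ v ∈ Vp P.toGr B', 3 ≤ (P.star B' v).card := by
    intro v hv
    by_contra hlt
    obtain ⟨e, he, hi⟩ := mem_Vp.1 hv
    obtain ⟨χ, hχ⟩ := hmin (B' \ P.star B' v) (Finset.ssubset_iff_subset_ne.2 ⟨Finset.sdiff_subset, fun h => by
      have : e ∈ B' \ P.star B' v := h.symm ▸ he
      simp [Gr.mem_star, he, hi] at this⟩)
    obtain ⟨c, hc⟩ := recolor hNL hχ (by omega)
    exact hB'n ⟨_, hc⟩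
  have hB'ne : B'.Nonempty := by
    rw [Finset.nonempty_iff_ne_empty]; rintro rfl
    exact hB'n ⟨fun _ => 0, by intro e he; simp at he⟩
  obtain ⟨P2, h1, h2, π, h3, h4, h5, h6, h7⟩ := del P B' hB'A
  have heul := euler P2 (h2 ▸ hB'ne)
  rw [h1, h2] at heul
  have hds := deg_sum' hNL
  have h8 : 3 * (Vp P.toGr B').card ≤ 2 * B'.card := by
    rw [← hds, mul_comm, ← smul_eq_mul, ← Finset.sum_const]
    exact Finset.sum_le_sum hdeg
  have hbp := Finset.card_pos.2 hB'ne
  have hF1 : ∀ f : P2.F, ∃ f', f ≠ f' := by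
    intro f
    by_contra hc
    push Not at hc
    have : Fintype.card P2.F ≤ 1 := Fintype.card_le_one_iff.2 (fun a b => (hc a).symm.trans (hc b))
    omega
  have hTF2 : P2.TF P2.A := by rw [h1, h2]; exact hTF'
  have hbd4 : ∀ f : P2.F, 4 ≤ (P2.bd {f}).card := by
    intro f
    obtain ⟨f', hf'⟩ := hF1 f
    exact hTF2 _ (bd_sub _) (ev_bd _) (bd1_ne hf')
  have hls := len_sum (P := P2)
  rw [h2] at hls
  have hf : ∃ f, P2.len f ≤ 5 := by
    by_contra hc
    push Not at hc
    have : 6 * Fintype.card P2.F ≤ ∑ f, P2.len f := by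
      rw [mul_comm, ← smul_eq_mul, ← Finset.card_univ, ← Finset.sum_const]
      exact Finset.sum_le_sum (fun f _ => hc f)
    omega
  obtain ⟨f, hf⟩ := hf
  have hbf := bd_le_len f
  have hloop : ∀ e ∈ P2.A, ¬ (P2.l e = f ∧ P2.r e = f) := by
    rintro e he ⟨hl, hr⟩
    have := bd_lt_len he hl hr
    have := hbd4 f
    omega
  have hcirc : P2.Circuit (P2.bd {f}) := by
    obtain ⟨f', hf'⟩ := hF1 f
    exact Gr.circuit_of_card hTF2 (bd_sub _) (ev_bd _) (bd1_ne hf') (by omega)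
  have hss : P2.bd {f} ⊂ B' := by
    rw [Finset.ssubset_iff_subset_ne]
    refine ⟨h2 ▸ bd_sub _, fun hh => ?_⟩
    have hc5 : B'.card ≤ 5 := by rw [← hh]; omega
    have : P2.len f + 4 * (Fintype.card P2.F - 1) ≤ ∑ f, P2.len f := by
      rw [← Finset.add_sum_erase _ _ (Finset.mem_univ f)]
      have : 4 * (Fintype.card P2.F - 1) = ∑ x ∈ Finset.univ.erase f, 4 := by
        rw [Finset.sum_const, Finset.card_erase_of_mem (Finset.mem_univ _), Finset.card_univ]; simp; ring
      rw [this]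
      apply add_le_add le_rfl
      exact Finset.sum_le_sum (fun x _ => (hbd4 x).trans (bd_le_len x))
    rw [hls] at this
    have h9 : B'.card ≤ P2.len f := by rw [← hh]; exact hbf
    have := hbd4 f
    rw [hh] at this
    omega
  obtain ⟨φ, hφ⟩ := hmin _ hss
  obtain ⟨P3, k1, k2, π3, k3, k4, k5, k6, k7, k8, k9⟩ := minCrit P2 f hloop hcirc φ (h1 ▸ hφ)
    (fun ⟨χ, hχ, _⟩ => hB'n ⟨χ, by rw [← h1, ← h2]; exact hχ⟩)
  have hTF3 : P3.TF P3.A := by rw [k1]; exact hTF2.mono k2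
  have h10 := ih P3 (π3 f) (lt_of_le_of_lt ((Finset.card_le_card k2).trans (h2 ▸ hcard)) hn) hTF3 k9 (by rw [k8]; omega)
  obtain ⟨f', hf'⟩ := hF1 f
  have hne : π3 f ≠ π3 f' := by
    intro h
    have : f' ∈ π3 ⁻¹' {π3 f} := h.symm
    rw [k7] at this
    exact hf' this.symm
  have h11 := wt_nonneg hTF3 hne {π3 f}ᶜ
  rw [k8] at h10
  omega

/-- standing hypotheses -/
structure Std (n : ℕ) (P : PM V E) (o : P.F) : Prop where
  ih : IHyp V E n
  tf : P.TF P.A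
  cr : P.Crit o
  cd : P.A.card = n
  k9 : (P.bd {o}).card ≤ 9

variable {o : P.F}

theorem deg3 (H : Std n P o) {v} (hv : v ∉ P.Vs (P.bd {o})) (hne : (P.star P.A v).Nonempty) :
    3 ≤ (P.star P.A v).card := by
  by_contra hlt
  obtain ⟨e, he⟩ := hne
  rw [Gr.mem_star] at he
  have heC : e ∉ P.bd {o} := fun h => hv ⟨e, h, he.2⟩
  obtain ⟨ψ, h1, h2⟩ := H.cr.2.2.2 e he.1 heC
  obtain ⟨c, hc⟩ := recolor (v := v) (χ := ψ) H.tf.nl (h1.mono (by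
    intro x hx
    rw [Finset.mem_sdiff] at hx
    rw [Finset.mem_erase]
    refine ⟨?_, hx.1⟩
    rintro rfl; exact hx.2 (Gr.mem_star.2 he))) (by omega)
  apply h2
  refine ⟨_, hc, fun x hx => ?_⟩
  rw [Function.update_of_ne]
  rintro rfl; exact hv hx

theorem other_face (H : Std n P o) : ∃ f, o ≠ f := by
  obtain ⟨h1, h2, h3⟩ := H.cr.2.1
  obtain ⟨e, he⟩ := Finset.nonempty_iff_ne_empty.2 h2
  rw [mem_bd1] at he
  by_contra hc
  push Not at hc
  apply he.2
  simp [← hc]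

/-- a partition of the edges with at most one common vertex is impossible -/
theorem sep (H : Std n P o) (A1 A2 : Finset E) (hU : A1 ∪ A2 = P.A) (hD : Disjoint A1 A2)
    (hn1 : A1.Nonempty) (hn2 : A2.Nonempty) (v : V)
    (hv : ∀ x e1 e2, e1 ∈ A1 → e2 ∈ A2 → P.inc e1 x → P.inc e2 x → x = v) : False := by
  have key : ∀ B1 B2 : Finset E, B1 ∪ B2 = P.A → Disjoint B1 B2 → B1.Nonempty → B2.Nonempty →
      (∀ x e1 e2, e1 ∈ B1 → e2 ∈ B2 → P.inc e1 x → P.inc e2 x → x = v) → P.bd {o} ⊆ B1 → False := by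
    intro B1 B2 hU hD hn1 hn2 hv hC
    have hB1 : B1 ⊆ P.A := hU ▸ Finset.subset_union_left
    have hB2 : B2 ⊆ P.A := hU ▸ Finset.subset_union_right
    obtain ⟨e, he⟩ := hn2
    have heB1 : e ∉ B1 := fun h => Finset.disjoint_left.1 hD h he
    obtain ⟨ψ, h1, h2⟩ := H.cr.2.2.2 e (hB2 he) (fun h => heB1 (hC h))
    have hlt : B2.card < n := by
      rw [← H.cd]
      apply Finset.card_lt_card
      rw [Finset.ssubset_iff_subset_ne]
      refine ⟨hB2, fun hh => ?_⟩
      obtain ⟨e', he'⟩ := hn1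
      exact Finset.disjoint_left.1 hD he' (hh ▸ hB1 he')
    obtain ⟨χ, hχ⟩ := grotzsch H.ih H.tf hB2 hlt
    let σ := Equiv.swap (χ v) (ψ v)
    apply h2
    refine ⟨fun x => if ∃ e1 ∈ B1, P.inc e1 x then ψ x else σ (χ x), ?_, ?_⟩
    · intro e' he'
      rw [← hU, Finset.mem_union] at he'
      rcases he' with he' | he'
      · simp only [show ∃ e1 ∈ B1, P.inc e1 (P.s e') from ⟨e', he', Or.inl rfl⟩,
          show ∃ e1 ∈ B1, P.inc e1 (P.t e') from ⟨e', he', Or.inr rfl⟩, if_true]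
        exact h1 e' (Finset.mem_erase.2 ⟨fun h => heB1 (h ▸ he'), hB1 he'⟩)
      · have hval : ∀ x, P.inc e' x → (if ∃ e1 ∈ B1, P.inc e1 x then ψ x else σ (χ x)) = σ (χ x) := by
          intro x hx
          split_ifs with h3
          · obtain ⟨e1, he1, hi⟩ := h3
            have := hv x e1 e' he1 he' hi hx
            subst this
            simp [σ]
          · rfl
        simp only [hval _ (Or.inl rfl : P.inc e' (P.s e')), hval _ (Or.inr rfl : P.inc e' (P.t e'))]
        exact fun h => hχ e' he' (σ.injective h)
    · intro x ⟨e1, he1, hi⟩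
      simp only [show ∃ e1 ∈ B1, P.inc e1 x from ⟨e1, hC he1, hi⟩, if_true]
  obtain ⟨c1, c2, c3⟩ := H.cr.2.1
  set C := P.bd {o}
  have hCA : C ⊆ P.A := bd_sub _
  -- the part of C in A1 is even
  have hev : P.Ev (C ∩ A1) := by
    have h0 : ∀ x, x ≠ v → P.dg (C ∩ A1) x = 0 := by
      intro x hx
      by_cases hx1 : ∃ e1 ∈ A1, P.inc e1 x
      · have h3 : P.dg (C \ A1) x = 0 := by
          apply Gr.dg_eq_zero_of_not_inc
          intro e he hi
          obtain ⟨e1, he1, hi1⟩ := hx1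
          rw [Finset.mem_sdiff] at he
          have : e ∈ A2 := by
            have := hCA he.1
            rw [← hU, Finset.mem_union] at this
            tauto
          exact hx (hv x e1 e he1 this hi1 hi)
        have h4 : P.dg C = P.dg (C \ A1) + P.dg (C ∩ A1) := by
          rw [← Gr.dg_symm]; congr 1; ext e; simp [Finset.mem_symmDiff]; tauto
        have h5 := congrFun h4 x
        rw [c1, Pi.add_apply, h3] at h5
        simpa using h5.symm
      · apply Gr.dg_eq_zero_of_not_inc
        intro e he hi
        exact hx1 ⟨e, (Finset.mem_inter.1 he).2, hi⟩
    funext x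
    by_cases hx : x = v
    · subst hx
      have := dg_sum P.toGr (C ∩ A1)
      rw [← Finset.add_sum_erase _ _ (Finset.mem_univ x), Finset.sum_eq_zero (fun y hy => h0 y (Finset.ne_of_mem_erase hy))] at this
      simpa using this
    · exact h0 x hx
  by_cases hem : C ∩ A1 = ∅
  · apply key A2 A1 (by rw [Finset.union_comm, hU]) hD.symm hn2 hn1 (fun x e1 e2 h1 h2 h3 h4 => hv x e2 e1 h2 h1 h4 h3)
    intro e he
    have := hCA he
    rw [← hU, Finset.mem_union] at this
    rcases this with h | h
    · exact absurd (Finset.mem_inter.2 ⟨he, h⟩) (by simp [hem])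
    · exact h
  · apply key A1 A2 hU hD hn1 hn2 hv
    have := c3 _ Finset.inter_subset_left hev hem
    exact Finset.inter_eq_left.1 this

end PM
end CF

end

open Set Topology

noncomputable section
namespace CF
set_option linter.all false
open scoped Classical symmDiff

namespace PM
variable {V E : Type} [Fintype V]
variable {n : ℕ} {P : PM V E} {o : P.F}

theorem cut (H : Std n P o) (v : V) (S1 : Finset E) (hS : S1 ⊆ P.star P.A v) (hne : S1.Nonempty)
    (hne' : S1 ≠ P.star P.A v) (hev : ∀ Z ⊆ P.A, P.Ev Z → Even (Z ∩ S1).card) : False := by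
  let g : Gr (Option V) E := ⟨fun e => if e ∈ S1 ∧ P.s e = v then none else some (P.s e),
    fun e => if e ∈ S1 ∧ P.t e = v then none else some (P.t e)⟩
  have hgs : ∀ e, g.s e = if e ∈ S1 ∧ P.s e = v then none else some (P.s e) := fun _ => rfl
  have hgt : ∀ e, g.t e = if e ∈ S1 ∧ P.t e = v then none else some (P.t e) := fun _ => rfl
  have h1 : ∀ Z x, x ≠ v → g.dg Z (some x) = P.dg Z x := by
    intro Z x hx
    unfold Gr.dg
    simp only [Finset.sum_apply]
    apply Finset.sum_congr rfl
    intro e _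
    simp only [Pi.add_apply, dl, hgs, hgt]
    congr 1
    · split_ifs <;> simp_all
    · split_ifs <;> simp_all
  have h2 : ∀ Z, g.dg Z (some v) + g.dg Z none = P.dg Z v := by
    intro Z
    unfold Gr.dg
    simp only [Finset.sum_apply]
    rw [← Finset.sum_add_distrib]
    apply Finset.sum_congr rfl
    intro e _
    simp only [Pi.add_apply, dl, hgs, hgt]
    by_cases he : e ∈ S1 <;> by_cases hs : P.s e = v <;> by_cases ht : P.t e = v <;>
      simp [he, hs, ht, eq_comm, ] <;> (try simp [eq_comm, hs, ht]) <;> (try ring)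
  have h3 : ∀ Z ⊆ P.A, g.dg Z none = ((Z ∩ S1).card : ZMod 2) := by
    intro Z hZ
    rw [← Finset.filter_mem_eq_inter, Finset.card_filter]
    unfold Gr.dg
    simp only [Finset.sum_apply]
    push_cast
    apply Finset.sum_congr rfl
    intro e he
    have := H.tf.nl e (hZ he)
    simp only [Pi.add_apply, dl, hgs, hgt]
    by_cases he1 : e ∈ S1
    · have h4 := (Gr.mem_star.1 (hS he1)).2
      rcases h4 with h4 | h4
      · have : P.t e ≠ v := fun h => this (h4.trans h.symm)
        simp [he1, h4, this]
      · have : P.s e ≠ v := fun h => this (h.trans h4.symm)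
        simp [he1, h4, this]
    · simp [he1]
  set X : Set (Option V) := {x | g.Cn P.A none x}
  have hcl : ∀ e ∈ P.A, g.s e ∈ X ↔ g.t e ∈ X := fun e he =>
    ⟨fun h => h.trans (Gr.cn_edge he), fun h => h.trans (Gr.cn_edge he).symm⟩
  have hvX : some v ∉ X := by
    rintro ⟨Q, hQ, hod⟩
    have h4 : g.dg Q none = 1 := by rw [hod]; simp [dl]
    have h5 : P.Ev Q := by
      funext x
      by_cases hx : x = v
      · rw [hx, ← h2, hod]; simp [dl]; decide
      · rw [← h1 Q x hx, hod]; simp [dl, hx]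
    have h6 := hev Q hQ h5
    rw [h3 Q hQ, ZMod.natCast_eq_one_iff_odd] at h4
    exact (Nat.not_odd_iff_even.2 h6) h4
  have hmem : ∀ e ∈ P.A, ∀ y, g.inc e y → (g.s e ∈ X ↔ y ∈ X) := by
    intro e he y hy
    rcases hy with rfl | rfl
    · rfl
    · exact hcl e he
  have hinc : ∀ e x, x ≠ v → P.inc e x → g.inc e (some x) := by
    intro e x hx hi
    rcases hi with hi | hi
    · left; rw [hgs, if_neg (fun h => hx (hi.symm.trans h.2)), hi]
    · right; rw [hgt, if_neg (fun h => hx (hi.symm.trans h.2)), hi]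
  apply sep H (P.A.filter (fun e => g.s e ∈ X)) (P.A.filter (fun e => ¬ g.s e ∈ X))
    (Finset.filter_union_filter_not_eq _ _) (Finset.disjoint_filter_filter_not _ _ _) ?_ ?_ v ?_
  · obtain ⟨e, he⟩ := hne
    have h4 := Gr.mem_star.1 (hS he)
    refine ⟨e, Finset.mem_filter.2 ⟨h4.1, ?_⟩⟩
    rw [hmem e h4.1 none]
    · exact Gr.Cn.refl _ _
    · rcases h4.2 with h | h
      · left; rw [hgs, if_pos ⟨he, h⟩]
      · right; rw [hgt, if_pos ⟨he, h⟩]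
  · obtain ⟨e, he, he'⟩ := Finset.exists_of_ssubset (Finset.ssubset_iff_subset_ne.2 ⟨hS, hne'⟩)
    have h4 := Gr.mem_star.1 he
    refine ⟨e, Finset.mem_filter.2 ⟨h4.1, ?_⟩⟩
    rw [hmem e h4.1 (some v)]
    · exact hvX
    · rcases h4.2 with h | h
      · left; rw [hgs, if_neg (fun h => he' h.1), h]
      · right; rw [hgt, if_neg (fun h => he' h.1), h]
  · intro x e1 e2 he1 he2 hi1 hi2
    by_contra hx
    rw [Finset.mem_filter] at he1 he2
    apply he2.2
    rw [hmem e2 he2.1 _ (hinc e2 x hx hi2), ← hmem e1 he1.1 _ (hinc e1 x hx hi1)]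
    exact he1.2

theorem exists_star_ne (H : Std n P o) {e v} (he : e ∈ P.A) (hv : P.inc e v) (hC : e ∉ P.bd {o}) :
    ∃ e' ∈ P.star P.A v, e' ≠ e := by
  by_cases h : v ∈ P.Vs (P.bd {o})
  · obtain ⟨e', he', hi⟩ := h
    exact ⟨e', Gr.mem_star.2 ⟨bd_sub _ he', hi⟩, fun h => hC (h ▸ he')⟩
  · have h3 := deg3 H h ⟨e, Gr.mem_star.2 ⟨he, hv⟩⟩
    by_contra hc
    push Not at hc
    have : P.star P.A v ⊆ {e} := fun x hx => by simpa using hc x hx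
    have := Finset.card_le_card this
    simp at this
    omega

theorem bridgeless (H : Std n P o) {e} (he : e ∈ P.A) : P.l e ≠ P.r e := by
  intro hlr
  have hnb : ∀ R, e ∉ P.bd R := by
    intro R h; rw [mem_bd] at h; apply h.2; rw [hlr]
  refine cut H (P.s e) {e} (by simpa [Gr.mem_star] using ⟨he, Or.inl rfl⟩) (by simp) ?_ ?_
  · obtain ⟨e', h1, h2⟩ := exists_star_ne H he (v := P.s e) (Or.inl rfl) (hnb _)
    intro h
    rw [← h] at h1
    exact h2 (by simpa using h1)
  · intro Z hZ hE
    obtain ⟨R, rfl⟩ := ex_bd hZ hE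
    rw [Finset.inter_singleton_of_notMem (hnb R)]; simp

/-- `e` has sides exactly `f` and `g` -/
def sd (P : PM V E) (e : E) (f g : P.F) : Prop := (P.l e = f ∧ P.r e = g) ∨ (P.l e = g ∧ P.r e = f)

theorem sd.symm {e} {f g : P.F} (h : P.sd e f g) : P.sd e g f := Or.symm h
theorem sd_iff {e} {f g : P.F} (h : P.sd e f g) (R : Set P.F) (he : e ∈ P.A) : e ∈ P.bd R ↔ ¬ (f ∈ R ↔ g ∈ R) := by
  rw [mem_bd]
  rcases h with ⟨h1, h2⟩ | ⟨h1, h2⟩ <;> rw [h1, h2] <;> tauto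

theorem twin (H : Std n P o) {e1 e2 v} {f g : P.F} (hne : e1 ≠ e2) (h1 : e1 ∈ P.A) (h2 : e2 ∈ P.A)
    (i1 : P.inc e1 v) (i2 : P.inc e2 v) (s1 : P.sd e1 f g) (s2 : P.sd e2 f g) :
    P.star P.A v = {e1, e2} := by
  by_contra hc
  refine cut H v {e1, e2} ?_ (by simp) (Ne.symm hc) ?_
  · intro x hx; simp at hx
    rcases hx with rfl | rfl
    · exact Gr.mem_star.2 ⟨h1, i1⟩
    · exact Gr.mem_star.2 ⟨h2, i2⟩
  · intro Z hZ hE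
    obtain ⟨R, rfl⟩ := ex_bd hZ hE
    have h3 := sd_iff s1 R h1
    have h4 := sd_iff s2 R h2
    by_cases h5 : e1 ∈ P.bd R
    · have h6 : e2 ∈ P.bd R := h4.2 (h3.1 h5)
      rw [Finset.inter_eq_right.2 (by intro x hx; simp at hx; rcases hx with rfl | rfl <;> assumption), Finset.card_pair hne]
      decide
    · have h6 : e2 ∉ P.bd R := fun h => h5 (h3.2 (h4.1 h))
      rw [show P.bd R ∩ {e1, e2} = ∅ by
        ext x; simp; intro hx; exact ⟨fun h => h5 (h ▸ hx), fun h => h6 (h ▸ hx)⟩]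
      simp

/-- edges with a side in R -/
def ER (P : PM V E) (R : Set P.F) : Finset E := P.A.filter (fun e => P.l e ∈ R ∨ P.r e ∈ R)

theorem bd_sub_ER (R : Set P.F) : P.bd R ⊆ P.ER R := by
  intro e he; rw [mem_bd] at he; rw [ER, Finset.mem_filter]; tauto

theorem region_vertex (H : Std n P o) {R : Set P.F} {x e1 e2} (h1 : e1 ∈ P.ER R) (h2 : e2 ∈ P.A)
    (h2' : e2 ∉ P.ER R) (i1 : P.inc e1 x) (i2 : P.inc e2 x) : x ∈ P.Vs (P.bd R) := by
  by_contra hc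
  have hx : ∀ e ∈ P.A, P.inc e x → (P.l e ∈ R ↔ P.r e ∈ R) := by
    intro e he hi
    by_contra hcon
    exact hc ⟨e, mem_bd.2 ⟨he, hcon⟩, hi⟩
  have e1A := (Finset.mem_filter.1 h1).1
  refine cut H x (P.star P.A x ∩ P.ER R) Finset.inter_subset_left ⟨e1, Finset.mem_inter.2 ⟨Gr.mem_star.2 ⟨e1A, i1⟩, h1⟩⟩ ?_ ?_
  · intro h
    have : e2 ∈ P.star P.A x := Gr.mem_star.2 ⟨h2, i2⟩
    rw [← h] at this
    exact h2' (Finset.mem_inter.1 this).2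
  · intro Z hZ hE
    obtain ⟨Q, rfl⟩ := ex_bd hZ hE
    have h3 := Gr.ev_star (B := P.bd (Q ∩ R)) (fun e he => H.tf.nl e (bd_sub _ he)) (ev_bd _) x
    convert h3 using 2
    ext e
    simp only [Finset.mem_inter, Gr.mem_star, mem_bd, ER, Finset.mem_filter, Set.mem_inter_iff]
    have := hx e
    tauto

theorem region_circuit (H : Std n P o) {R : Set P.F} (ho : o ∉ R) (hne : R ≠ ∅) (hne' : R ≠ {o}ᶜ)
    (h9 : (P.bd R).card ≤ 9) (hC : P.Circuit (P.bd R)) :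
    (∃ g, R = {g}) ∨ P.wt R ≤ ((P.bd R).card : ℤ) - 6 := by
  obtain ⟨c1, c2, c3⟩ := hC
  obtain ⟨ff, hff⟩ := other_face H
  by_cases hE : P.ER R = P.bd R
  · left
    obtain ⟨g, hg⟩ := Set.nonempty_iff_ne_empty.2 hne
    have hsub : P.bd {g} ⊆ P.bd R := by
      rw [← hE]; intro e he; rw [mem_bd1] at he; rw [ER, Finset.mem_filter]
      refine ⟨he.1, ?_⟩
      by_cases hl : P.l e = g
      · left; rw [hl]; exact hg
      · right; have : P.r e = g := by tauto
        rw [this]; exact hg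
    have hgo : g ≠ o := fun h => ho (h ▸ hg)
    have h1 := c3 _ hsub (ev_bd _) (bd1_ne hgo)
    refine ⟨g, (bd_inj_o h1 ?_ ho).symm⟩
    simpa using hgo.symm
  right
  have hRo : ∀ Q : Set P.F, o ∈ Q → Q ⊆ Rᶜ → P.bd Q ⊆ P.ER R → Q = Rᶜ := by
    intro Q hoQ hQ hb
    have hsub : P.bd Q ⊆ P.bd R := by
      intro e he
      have h1 := hb he
      rw [ER, Finset.mem_filter] at h1
      rw [mem_bd] at he ⊢
      refine ⟨he.1, ?_⟩
      have := @hQ (P.l e)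
      have := @hQ (P.r e)
      simp at *
      tauto
    have h2 := c3 _ hsub (ev_bd _) (bd_ne (fun h => by rw [h] at hoQ; simp at hoQ) (fun h => by
      obtain ⟨g, hg⟩ := Set.nonempty_iff_ne_empty.2 hne
      exact hQ (h ▸ Set.mem_univ g) hg))
    rw [← bd_compl R] at h2
    rcases bd_inj h2 with h3 | h3
    · exact h3
    · rw [h3] at hoQ; simp at hoQ; exact absurd hoQ ho
  have hss : P.ER R ⊂ P.A := by
    rw [Finset.ssubset_iff_subset_ne]
    refine ⟨Finset.filter_subset _ _, fun h => ?_⟩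
    apply hne'
    have := hRo {o} rfl (by simpa using ho) (h ▸ bd_sub _)
    rw [this]; simp
  obtain ⟨P2, h1, h2, π, h3, h4, h5, h6, h7⟩ := del P (P.ER R) hss.1
  obtain ⟨R2, hR2⟩ := h7 R (bd_sub_ER R)
  have hpo : π ⁻¹' {π o} = Rᶜ := by
    apply hRo (π ⁻¹' {π o}) rfl
    · intro x hx hxR
      rw [hR2] at hxR ho
      simp at hx hxR ho
      rw [hx] at hxR; exact ho hxR
    · rw [← h4, ← h2]; exact bd_sub _
  have hinj : ∀ a b, a ∈ R → π a = π b → a = b := by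
    intro a b ha hab
    obtain ⟨R3, hR3⟩ := h7 {a} (by
      intro e he; rw [mem_bd1] at he; rw [ER, Finset.mem_filter]
      refine ⟨he.1, ?_⟩
      by_cases hl : P.l e = a
      · left; rw [hl]; exact ha
      · right; have : P.r e = a := by tauto
        rw [this]; exact ha)
    have : b ∈ ({a} : Set P.F) := by
      rw [hR3]
      have : a ∈ π ⁻¹' R3 := by rw [← hR3]; rfl
      simpa [hab] using this
    exact (Set.mem_singleton_iff.1 this).symm
  have hbo : P2.bd {π o} = P.bd R := by rw [h4, hpo, bd_compl]
  have hTF2 : P2.TF P2.A := by rw [h1, h2]; exact H.tf.mono hss.1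
  have hcr : P2.Crit (π o) := by
    refine ⟨?_, ?_, ?_, ?_⟩
    · intro e he ⟨hl, hr⟩
      rw [h5] at hl; rw [h6] at hr
      rw [h2, ER, Finset.mem_filter] at he
      have hl' : P.l e ∈ π ⁻¹' {π o} := hl
      have hr' : P.r e ∈ π ⁻¹' {π o} := hr
      rw [hpo] at hl' hr'
      exact he.2.elim hl' hr'
    · rw [h1, hbo]; exact ⟨c1, c2, c3⟩
    · rw [h2, hbo]; exact Ne.symm hE
    · intro e he hne
      rw [h1, h2, hbo] at *
      have heA := hss.1 he
      have hin : P.l e ∈ R ∧ P.r e ∈ R := by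
        rw [mem_bd] at hne; rw [ER, Finset.mem_filter] at he; tauto
      have heC : e ∉ P.bd {o} := by
        rw [mem_bd1]
        have h8 : P.l e ≠ o := fun h => ho (h ▸ hin.1)
        have h9 : P.r e ≠ o := fun h => ho (h ▸ hin.2)
        tauto
      obtain ⟨ψ, hψ, hno⟩ := H.cr.2.2.2 e heA heC
      refine ⟨ψ, hψ.mono (Finset.erase_subset_erase _ hss.1), ?_⟩
      rintro ⟨χ, hχ, hag⟩
      apply hno
      refine ⟨fun x => if ∃ e ∈ P.ER R, P.inc e x then χ x else ψ x, ?_, ?_⟩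
      · intro e' he'
        by_cases hER : e' ∈ P.ER R
        · simp only [show ∃ e1 ∈ P.ER R, P.inc e1 (P.s e') from ⟨e', hER, Or.inl rfl⟩,
            show ∃ e1 ∈ P.ER R, P.inc e1 (P.t e') from ⟨e', hER, Or.inr rfl⟩, if_true]
          exact hχ e' hER
        · have hval : ∀ x, P.inc e' x → (if ∃ e1 ∈ P.ER R, P.inc e1 x then χ x else ψ x) = ψ x := by
            intro x hx
            split_ifs with h8
            · obtain ⟨e1, he1, hi⟩ := h8
              exact hag x (region_vertex H he1 he' hER hi hx)
            · rfl
          simp only [hval _ (Or.inl rfl : P.inc e' (P.s e')), hval _ (Or.inr rfl : P.inc e' (P.t e'))]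
          exact hψ e' (Finset.mem_erase.2 ⟨fun h => hER (h ▸ he), he'⟩)
      · intro x ⟨e', he', hi⟩
        show (if ∃ e ∈ P.ER R, P.inc e x then χ x else ψ x) = ψ x
        split_ifs with h8
        · obtain ⟨e1, he1, hi1⟩ := h8
          apply hag
          by_cases hER : e' ∈ P.ER R
          · refine ⟨e', ?_, hi⟩
            rw [mem_bd1] at he'
            rw [ER, Finset.mem_filter] at hER
            rw [mem_bd]
            refine ⟨he'.1, ?_⟩
            by_cases hl : P.l e' = o
            · rw [hl] at hER ⊢; tauto
            · have hr : P.r e' = o := by tauto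
              rw [hr] at hER ⊢; tauto
          · exact region_vertex H he1 (bd_sub _ he') hER hi1 hi
        · rfl
  have h8 := H.ih P2 (π o) (by rw [h2, ← H.cd]; exact Finset.card_lt_card hss) hTF2 hcr (by rw [hbo]; exact h9)
  rw [hbo] at h8
  refine le_trans (le_of_eq ?_) h8
  have hpre : R = π ⁻¹' ({π o}ᶜ) := by rw [Set.preimage_compl, hpo]; simp
  conv_lhs => rw [hpre]
  rw [wt_fiber]
  apply Finset.sum_congr rfl
  intro f hf
  obtain ⟨g, rfl⟩ := h3 f
  have hgR : g ∈ R := by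
    rw [hpre]; simpa using hf
  have hpg : π ⁻¹' {π g} = {g} := by
    ext x; simp; constructor
    · intro h; exact (hinj g x hgR h.symm).symm
    · rintro rfl; rfl
  rw [h4, hpg, wt_single]

theorem wt_nn (H : Std n P o) (R : Set P.F) : 0 ≤ P.wt R := by
  obtain ⟨f, hf⟩ := other_face H
  exact wt_nonneg H.tf hf R

theorem region_circuit' (H : Std n P o) {R : Set P.F} (ho : o ∉ R) (hne : R ≠ ∅) (hne' : R ≠ {o}ᶜ)
    (h9 : (P.bd R).card ≤ 7) :
    (∃ g, R = {g}) ∨ P.wt R ≤ ((P.bd R).card : ℤ) - 6 :=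
  region_circuit H ho hne hne' (by omega) (Gr.circuit_of_card H.tf (bd_sub _) (ev_bd _)
    (bd_ne hne (fun h => ho (h ▸ Set.mem_univ _))) h9)

theorem region (H : Std n P o) {R : Set P.F} (ho : o ∉ R) (hne : R ≠ ∅) (hne' : R ≠ {o}ᶜ)
    (h9 : (P.bd R).card ≤ (P.bd {o}).card) :
    (∃ g, R = {g}) ∨ P.wt R ≤ ((P.bd R).card : ℤ) - 6 := by
  by_cases hC : P.Circuit (P.bd R)
  · exact region_circuit H ho hne hne' (h9.trans H.k9) hC
  right
  have hbne : P.bd R ≠ ∅ := bd_ne hne (fun h => ho (h ▸ Set.mem_univ _))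
  have : ∃ Z ⊆ P.bd R, P.Ev Z ∧ Z ≠ ∅ ∧ Z ≠ P.bd R := by
    by_contra hc
    push Not at hc
    exact hC ⟨ev_bd _, hbne, fun W h1 h2 h3 => hc W h1 h2 (Finset.nonempty_iff_ne_empty.2 h3)⟩
  obtain ⟨Z, hZ, hZE, hZne, hZn⟩ := this
  have hZ' : P.Ev (P.bd R \ Z) := by
    rw [← Gr.sd_of_sub hZ]; exact (ev_bd _).sd hZE
  have hZ'ne : P.bd R \ Z ≠ ∅ := by
    intro h; rw [Finset.sdiff_eq_empty_iff_subset] at h; exact hZn (hZ.antisymm h)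
  have a1 := H.tf _ (hZ.trans (bd_sub _)) hZE hZne
  have a2 := H.tf _ (Finset.sdiff_subset.trans (bd_sub _)) hZ' hZ'ne
  have a3 := Finset.card_sdiff_add_card_eq_card hZ
  have k9 := H.k9
  obtain ⟨R1, o1, b1⟩ := ex_bd_o (hZ.trans (bd_sub _)) hZE o
  obtain ⟨R2, o2, b2⟩ := ex_bd_o (Finset.sdiff_subset.trans (bd_sub _)) hZ' o
  have sing : ∀ Q : Set P.F, o ∉ Q → (P.bd Q).card ≤ 5 → (P.bd Q).card < (P.bd {o}).card → P.bd Q ≠ ∅ → ∃ g, Q = {g} := by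
    intro Q hoQ hc hc' hb
    rcases region_circuit' H hoQ (fun h => hb (by rw [h, bd_empty])) (fun h => by rw [h, bd_compl] at hc'; omega) (by omega) with h | h
    · exact h
    · have := wt_nn H Q; omega
  obtain ⟨g1, rfl⟩ := sing R1 o1 (by rw [b1]; omega) (by rw [b1]; omega) (b1 ▸ hZne)
  obtain ⟨g2, rfl⟩ := sing R2 o2 (by rw [b2]; omega) (by rw [b2]; omega) (b2 ▸ hZ'ne)
  have hg : g1 ≠ g2 := by
    rintro rfl
    obtain ⟨e, he⟩ := Finset.nonempty_iff_ne_empty.2 hZne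
    have : e ∈ P.bd R \ Z := by rw [← b2, b1]; exact he
    exact (Finset.mem_sdiff.1 this).2 he
  have hR : R = {g1, g2} := by
    apply bd_inj_o (o := o) _ ho
    · simp at o1 o2 ⊢; tauto
    · have : ({g1, g2} : Set P.F) = {g1} ∆ {g2} := by
        ext x; simp [Set.mem_symmDiff]
        constructor
        · rintro (rfl | rfl) <;> simp [hg, hg.symm]
        · tauto
      rw [this, bd_sd, b1, b2]
      ext x; have := @hZ x; simp [Finset.mem_symmDiff]; tauto
  rw [hR, wt_insert (by simpa using hg), wt_single, b1, b2, ← hR]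
  omega

end PM
end CF

end

open Set Topology

noncomputable section
namespace CF
set_option linter.all false
open scoped Classical symmDiff

namespace PM
variable {V E : Type} [Fintype V]
variable {n : ℕ} {P : PM V E} {o : P.F}

theorem theta (H : Std n P o) {Z0 : Finset E} {a b : V} (hZ : Z0 ⊆ P.A) (hd : Disjoint Z0 (P.bd {o}))
    (hod : P.Od Z0 a b) (hne : Z0.Nonempty) (ha : a ∈ P.Vs (P.bd {o})) (hb : b ∈ P.Vs (P.bd {o})) :
    ∃ R R' : Set P.F, o ∉ R ∧ o ∉ R' ∧ Disjoint R R' ∧ R ∪ R' = {o}ᶜ ∧ R ≠ ∅ ∧ R' ≠ ∅ ∧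
      R ≠ {o}ᶜ ∧ R' ≠ {o}ᶜ ∧ Z0 ⊆ P.bd R ∧ Z0 ⊆ P.bd R' ∧
      (P.bd R).card + (P.bd R').card = (P.bd {o}).card + 2 * Z0.card := by
  obtain ⟨Z1, h1, h2⟩ := H.cr.2.1.cn ha hb
  have hdd : Disjoint Z1 Z0 := (hd.mono_right h1).symm
  have hev : P.Ev (Z1 ∆ Z0) := h2.sd hod
  obtain ⟨R, ho, hR⟩ := ex_bd_o (Z := Z1 ∆ Z0) (Gr.sd_sub (h1.trans (bd_sub _)) hZ) hev o
  have hR' : P.bd (({o}ᶜ : Set P.F) ∆ R) = (P.bd {o} \ Z1) ∪ Z0 := by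
    rw [bd_sd, bd_compl, hR, Gr.sd_union hdd]
    ext e
    have h3 := @h1 e
    have h4 : e ∈ Z0 → e ∉ P.bd {o} := fun h => Finset.disjoint_left.1 hd h
    simp only [Finset.mem_symmDiff, Finset.mem_union, Finset.mem_sdiff]
    tauto
  rw [Gr.sd_union hdd] at hR
  have hs : ({o}ᶜ : Set P.F) ∆ R = {o}ᶜ \ R := by
    ext x
    simp only [Set.mem_symmDiff, Set.mem_diff, Set.mem_compl_iff, Set.mem_singleton_iff]
    constructor
    · rintro (h | ⟨h, h'⟩)
      · exact h
      · push Not at h'; subst h'; exact absurd h ho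
    · tauto
  rw [hs] at hR'
  obtain ⟨e, he⟩ := hne
  have heC := Finset.disjoint_left.1 hd he
  have e1 : e ∈ P.bd R := by rw [hR]; exact Finset.mem_union_right _ he
  have e2 : e ∈ P.bd ({o}ᶜ \ R) := by rw [hR']; exact Finset.mem_union_right _ he
  refine ⟨R, {o}ᶜ \ R, ho, by simp, disjoint_sdiff_right, ?_, ?_, ?_, ?_, ?_, ?_, ?_, ?_⟩
  · apply Set.union_diff_cancel
    intro x hx; simp; rintro rfl; exact ho hx
  · intro h; rw [h, bd_empty] at e1; simp at e1
  · intro h; rw [h, bd_empty] at e2; simp at e2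
  · intro h; rw [h, bd_compl] at e1; exact heC e1
  · intro h; rw [h, bd_compl] at e2; exact heC e2
  · rw [hR]; exact Finset.subset_union_right
  · rw [hR']; exact Finset.subset_union_right
  · rw [hR, hR', Finset.card_union_of_disjoint hdd, Finset.card_union_of_disjoint
      (hd.symm.mono_left Finset.sdiff_subset), Finset.card_sdiff_of_subset h1]
    have := Finset.card_le_card h1
    omega

theorem bd4 (H : Std n P o) {R : Set P.F} (ho : o ∉ R) (hne : R ≠ ∅) : 4 ≤ (P.bd R).card :=
  H.tf _ (bd_sub _) (ev_bd _) (bd_ne hne (fun h => ho (h ▸ Set.mem_univ _)))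

theorem chord (H : Std n P o) {e a b} (he : e ∈ P.A) (hC : e ∉ P.bd {o}) (hj : P.jn e a b)
    (ha : a ∈ P.Vs (P.bd {o})) (hb : b ∈ P.Vs (P.bd {o})) : P.wt {o}ᶜ ≤ ((P.bd {o}).card : ℤ) - 6 := by
  obtain ⟨R, R', h1, h2, h3, h4, h5, h6, h7, h8, h9, h10, h11⟩ := theta H (Z0 := {e}) (by simpa using he)
    (by simpa using hC) hj.od (by simp) ha hb
  have b1 := bd4 H h1 h5
  have b2 := bd4 H h2 h6
  rw [Finset.card_singleton] at h11
  rw [← h4, wt_union h3]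
  rcases region H h1 h5 h7 (by omega) with ⟨g, hg⟩ | hg <;>
  rcases region H h2 h6 h8 (by omega) with ⟨g', hg'⟩ | hg' <;>
  (try rw [hg]) <;> (try rw [hg']) <;> (try rw [wt_single]) <;> (try rw [wt_single]) <;>
  (try rw [← hg]) <;> (try rw [← hg']) <;> omega

theorem sd_internal (H : Std n P o) {e} (he : e ∈ P.A) (hC : e ∉ P.bd {o}) : P.l e ≠ o ∧ P.r e ≠ o := by
  have := H.cr.1 e he
  rw [mem_bd1] at hC
  tauto

theorem chord2 (H : Std n P o) {e1 e2 v a b} (he1 : e1 ∈ P.A) (he2 : e2 ∈ P.A) (hne : e1 ≠ e2)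
    (hj1 : P.jn e1 v a) (hj2 : P.jn e2 v b) (hv : v ∉ P.Vs (P.bd {o}))
    (ha : a ∈ P.Vs (P.bd {o})) (hb : b ∈ P.Vs (P.bd {o})) : P.wt {o}ᶜ ≤ ((P.bd {o}).card : ℤ) - 6 := by
  have hab : a ≠ b := by
    rintro rfl
    exact hne (H.tf.par he1 he2 hj1 hj2)
  have hC1 : e1 ∉ P.bd {o} := fun h => hv ⟨e1, h, hj1.inc⟩
  have hC2 : e2 ∉ P.bd {o} := fun h => hv ⟨e2, h, hj2.inc⟩
  have hd12 : Disjoint ({e1} : Finset E) {e2} := by simpa using hne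
  have hod : P.Od ({e1, e2} : Finset E) a b := by
    have := hj1.symm.od.trans hj2.od
    rwa [Gr.sd_union hd12] at this
  obtain ⟨R, R', h1, h2, h3, h4, h5, h6, h7, h8, h9, h10, h11⟩ := theta H (Z0 := {e1, e2})
    (by intro x; simp; rintro (rfl | rfl) <;> assumption)
    (by simp [hC1, hC2]) hod (by simp) ha hb
  have b1 := bd4 H h1 h5
  have b2 := bd4 H h2 h6
  rw [Finset.card_pair hne] at h11
  rcases region H h1 h5 h7 (by omega) with ⟨g, hg⟩ | hg
  · rcases region H h2 h6 h8 (by omega) with ⟨g', hg'⟩ | hg'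
    · exfalso
      have hs : ∀ e ∈ P.A, e ∉ P.bd {o} → P.sd e g g' := by
        intro e he hC
        have h12 := sd_internal H he hC
        have h13 := bridgeless H he
        have hx : ∀ x, x ≠ o → x = g ∨ x = g' := by
          intro x hx
          have : x ∈ R ∪ R' := by rw [h4]; exact hx
          rw [hg, hg'] at this; simp at this; tauto
        have a1 := hx _ h12.1
        have a2 := hx _ h12.2
        unfold sd
        rcases a1 with a1 | a1 <;> rcases a2 with a2 | a2 <;> simp_all
      have := twin H hne he1 he2 hj1.inc hj2.inc (hs _ he1 hC1) (hs _ he2 hC2)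
      have h14 := deg3 H hv ⟨e1, Gr.mem_star.2 ⟨he1, hj1.inc⟩⟩
      rw [this, Finset.card_pair hne] at h14
      omega
    · rw [← h4, wt_union h3, hg, wt_single, ← hg]; omega
  · rcases region H h2 h6 h8 (by omega) with ⟨g', hg'⟩ | hg'
    · rw [← h4, wt_union h3, hg', wt_single, ← hg']; omega
    · rw [← h4, wt_union h3]; omega

/-- standing assumptions: a minimal counterexample -/
structure Cex (n : ℕ) (P : PM V E) (o : P.F) : Prop extends Std n P o where
  gt : ((P.bd {o}).card : ℤ) - 6 < P.wt {o}ᶜ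

theorem Cex.no1 (H : Cex n P o) {e a b} (he : e ∈ P.A) (hC : e ∉ P.bd {o}) (hj : P.jn e a b)
    (ha : a ∈ P.Vs (P.bd {o})) (hb : b ∈ P.Vs (P.bd {o})) : False :=
  absurd H.gt (not_lt.2 (chord H.toStd he hC hj ha hb))

theorem Cex.no2 (H : Cex n P o) {e1 e2 v a b} (he1 : e1 ∈ P.A) (he2 : e2 ∈ P.A)
    (hj1 : P.jn e1 v a) (hj2 : P.jn e2 v b) (hv : v ∉ P.Vs (P.bd {o}))
    (ha : a ∈ P.Vs (P.bd {o})) (hb : b ∈ P.Vs (P.bd {o})) : e1 = e2 := by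
  by_contra hne
  exact absurd H.gt (not_lt.2 (chord2 H.toStd he1 he2 hne hj1 hj2 hv ha hb))

end PM
end CF

end

open Set Topology

noncomputable section
namespace CF
set_option linter.all false
open scoped Classical symmDiff

namespace PM
variable {V E : Type} [Fintype V]
variable {n : ℕ} {P : PM V E} {o : P.F}

theorem foldIH (H : Std n P o) (P' : PM V E) (o' : P'.F) 
    (hoo : ∀ e ∈ P'.A, ¬ (P'.l e = o' ∧ P'.r e = o')) (hC : P'.bd {o'} = P.bd {o})
    (hst : ∀ e ∈ P.bd {o}, P'.s e = P.s e ∧ P'.t e = P.t e)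
    (hext : ∀ χ, P'.Pr P'.A χ → ∃ χ', P.Pr P.A χ' ∧ ∀ v ∈ P.Vs (P.bd {o}), χ' v = χ v)
    (hTF : ∀ Z ⊆ P'.A, P'.Ev Z → Z ≠ ∅ → Z.card ≤ 3 → ∃ e ∈ Z, ∃ e' ∈ Z, e ≠ e' ∧ e ∉ P.bd {o} ∧
      ∃ a b, P'.jn e a b ∧ P'.jn e' a b)
    (hA : P'.A ⊆ P.A)
    (hcard : P'.A.card < n ∨ ∃ e ∈ P'.A, ∃ e' ∈ P'.A, e ≠ e' ∧ e ∉ P.bd {o} ∧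
      ∃ a b, P'.jn e a b ∧ P'.jn e' a b) :
    ∃ P2 : PM V E, P2.toGr = P'.toGr ∧ P2.A ⊆ P'.A ∧ 
      ∃ π : P'.F → P2.F, Function.Surjective π ∧ (∀ R, P2.bd R = P'.bd (π ⁻¹' R)) ∧
        (∀ e, P2.l e = π (P'.l e)) ∧ (∀ e, P2.r e = π (P'.r e)) ∧
        π ⁻¹' {π o'} = {o'} ∧ P2.bd {π o'} = P.bd {o} ∧ P2.TF P2.A ∧ P2.Crit (π o') ∧
        P2.A.card < n ∧ P2.wt {π o'}ᶜ ≤ ((P.bd {o}).card : ℤ) - 6 := by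
  have hVs : P'.Vs (P.bd {o}) = P.Vs (P.bd {o}) := by
    ext v
    constructor
    · rintro ⟨e, he, hi⟩
      refine ⟨e, he, ?_⟩
      unfold Gr.inc at *
      rwa [(hst e he).1, (hst e he).2] at hi
    · rintro ⟨e, he, hi⟩
      refine ⟨e, he, ?_⟩
      unfold Gr.inc at *
      rwa [(hst e he).1, (hst e he).2]
  have hdg : ∀ W ⊆ P.bd {o}, P'.dg W = P.dg W := by
    intro W hW
    unfold Gr.dg
    apply Finset.sum_congr rfl
    intro e he
    rw [(hst e (hW he)).1, (hst e (hW he)).2]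
  have hcirc : P'.Circuit (P'.bd {o'}) := by
    rw [hC]
    obtain ⟨c1, c2, c3⟩ := H.cr.2.1
    refine ⟨?_, c2, ?_⟩
    · unfold Gr.Ev; rw [hdg _ subset_rfl]; exact c1
    · intro W hW hE hne
      refine c3 W hW ?_ hne
      unfold Gr.Ev at *; rwa [← hdg _ hW]
  obtain ⟨e, he, heC⟩ : ∃ e ∈ P.A, e ∉ P.bd {o} := by
    by_contra hc
    push Not at hc
    exact H.cr.2.2.1 (Finset.Subset.antisymm (bd_sub _) hc)
  obtain ⟨ψ, h1, h2⟩ := H.cr.2.2.2 e he heC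
  obtain ⟨P2, g1, g2, π, g3, g4, g5, g6, g7, g8, g9⟩ := minCrit P' o' hoo hcirc ψ (by
    rw [hC]
    intro x hx
    rw [(hst x hx).1, (hst x hx).2]
    exact h1 x (Finset.mem_erase.2 ⟨fun h => heC (h ▸ hx), bd_sub _ hx⟩)) (by
    rintro ⟨χ, h3, h4⟩
    obtain ⟨χ', h5, h6⟩ := hext χ h3
    apply h2
    refine ⟨χ', h5, fun v hv => ?_⟩
    rw [h6 v hv]
    apply h4
    rw [hC, hVs]; exact hv)
  have hno : ∀ e ∈ P2.A, ∀ e' ∈ P2.A, e ≠ e' → e ∉ P.bd {o} → ∀ a b, P'.jn e a b → P'.jn e' a b → False := by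
    intro e he e' he' hne heC a b hj hj'
    refine g9.par he he' hne ?_ (a := a) (b := b) ?_ ?_
    · rw [g8, hC]; exact heC
    · rw [g1]; exact hj
    · rw [g1]; exact hj'
  have hTF2 : P2.TF P2.A := by
    intro Z hZ hE hne
    by_contra hlt
    rw [g1] at hE
    obtain ⟨e, he, e', he', hne, heC, a, b, hj, hj'⟩ := hTF Z (hZ.trans g2) hE hne (by omega)
    exact hno e (hZ he) e' (hZ he') hne heC a b hj hj'
  have hlt : P2.A.card < n := by
    rcases hcard with h | ⟨e, he, e', he', hne, heC, a, b, hj, hj'⟩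
    · exact lt_of_le_of_lt (Finset.card_le_card g2) h
    · rw [← H.cd]
      have h3 : P2.A ⊂ P.A := by
        refine Finset.ssubset_iff_subset_ne.2 ⟨g2.trans hA, ?_⟩
        intro h
        exact hno e (h ▸ hA he) e' (h ▸ hA he') hne heC a b hj hj'
      exact Finset.card_lt_card h3
  refine ⟨P2, g1, g2, π, g3, g4, g5, g6, g7, g8.trans hC, hTF2, g9, hlt, ?_⟩
  have := H.ih P2 (π o') hlt hTF2 g9 (by rw [g8, hC]; exact H.k9)
  rwa [g8, hC] at this

theorem fold_face {P2 : PM V E} {o2 : P2.F} (hTF : P2.TF P2.A) {k : ℕ} (h : P2.wt {o2}ᶜ ≤ (k : ℤ) - 6) {f} (hf : f ≠ o2) :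
    4 ≤ (P2.bd {f}).card ∧ (P2.bd {f}).card + 2 ≤ k := by
  have h1 : 4 ≤ (P2.bd {f}).card := hTF _ (bd_sub _) (ev_bd _) (bd1_ne hf)
  have := wt_mono hTF hf (R := {f}) (R' := {o2}ᶜ) (by intro x hx; rw [Set.mem_singleton_iff.1 hx]; exact hf)
  rw [wt_single] at this
  exact ⟨h1, by omega⟩

theorem sd_of_two (H : Std n P o) {e} {g h : P.F} (he : e ∈ P.A) (h1 : e ∈ P.bd {g}) (h2 : e ∈ P.bd {h}) (hgh : g ≠ h) :
    P.sd e g h := by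
  rw [mem_bd1] at h1 h2
  unfold sd
  by_cases a1 : P.l e = g <;> by_cases a2 : P.l e = h <;> by_cases a3 : P.r e = g <;> by_cases a4 : P.r e = h <;> simp_all

theorem twin3 (H : Std n P o) {a b x} {f g : P.F} (hab : a ≠ b) (ia : P.inc a x) (ib : P.inc b x)
   (ha : a ∈ P.A) (hb : b ∈ P.A) (hfg : f ≠ g) (h1 : a ∈ P.bd {f}) (h2 : b ∈ P.bd {f}) (h3 : a ∈ P.bd {g}) (h4 : b ∈ P.bd {g})
   (hc : a ∉ P.bd {o}) : False := by
  have h5 := twin H hab ha hb ia ib (sd_of_two H ha h1 h3 hfg) (sd_of_two H hb h2 h4 hfg)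
  by_cases hx : x ∈ P.Vs (P.bd {o})
  · have h6 : P.star (P.bd {o}) x ⊆ {b} := by
      intro y hy
      rw [Gr.mem_star] at hy
      have : y ∈ P.star P.A x := Gr.mem_star.2 ⟨bd_sub _ hy.1, hy.2⟩
      rw [h5] at this
      simp at this
      rcases this with rfl | rfl
      · exact absurd hy.1 hc
      · simp
    have h7 := Gr.ev_star (fun e he => H.tf.nl e (bd_sub _ he)) (ev_bd {o}) x
    obtain ⟨y, hy, hi⟩ := hx
    have h8 : 0 < (P.star (P.bd {o}) x).card := Finset.card_pos.2 ⟨y, Gr.mem_star.2 ⟨hy, hi⟩⟩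
    have h9 := Finset.card_le_card h6
    simp at h9
    obtain ⟨m, hm⟩ := h7
    omega
  · have h6 := deg3 H hx ⟨a, Gr.mem_star.2 ⟨ha, ia⟩⟩
    rw [h5, Finset.card_pair hab] at h6
    omega

/-- a wedge: two edges of the face `h` sharing a vertex, the first not on the outer cycle -/
def Wd (P : PM V E) (o h : P.F) (Q : Finset E) : Prop :=
  ∃ a b x, a ≠ b ∧ Q = {a, b} ∧ P.inc a x ∧ P.inc b x ∧ a ∈ P.bd {h} ∧ b ∈ P.bd {h} ∧ a ∉ P.bd {o}

theorem acct (H : Std n P o) {h : P.F} (ho : h ≠ o) {R : Set P.F} (hoR : o ∉ R) (hhR : h ∉ R) (D : Finset E)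
    (h4 : 4 ≤ (P.bd R ∆ D).card) (hk : (P.bd R ∆ D).card + 2 ≤ (P.bd {o}).card)
    (hD : (D = ∅) ∨ Wd P o h D ∨ Wd P o h (P.bd {h} ∆ D) ∨ D = P.bd {h}) :
    P.wt R ≤ ((P.bd R ∆ D).card : ℤ) - 4 := by
  have hR1 : R ≠ {o}ᶜ := fun hh => hhR (hh ▸ ho)
  by_cases hRe : R = ∅
  · have : P.wt R = 0 := by rw [hRe, wt_empty]
    omega
  have hins : P.bd (insert h R) = P.bd R ∆ P.bd {h} := by
    rw [← bd_sd]; congr 1; ext x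
    simp only [Set.mem_insert_iff, Set.mem_symmDiff, Set.mem_singleton_iff]
    by_cases hx : x = h
    · subst hx; simp [hhR]
    · simp [hx]
  have hh4 : 4 ≤ (P.bd {h}).card := bd4 H (by simpa using ho.symm) (by simp)
  have hwi := wt_insert hhR
  have hns : ∀ g, insert h R ≠ {g} := by
    intro g hg
    have h1 : h = g := by have : h ∈ insert h R := by simp
                          rw [hg] at this; simpa using this
    obtain ⟨y, hy⟩ := Set.nonempty_iff_ne_empty.2 hRe
    have h2 : y = g := by have : y ∈ insert h R := by simp [hy]
                          rw [hg] at this; simpa using this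
    exact hhR (h1 ▸ h2 ▸ hy)
  have hoi : o ∉ insert h R := by simp [hoR, ho.symm]
  rcases hD with rfl | hD | hD | rfl
  · rw [show P.bd R ∆ (∅ : Finset E) = P.bd R by simp] at *
    rcases region H hoR hRe hR1 (by omega) with ⟨g, hg⟩ | hg
    · rw [hg, wt_single]
    · omega
  · obtain ⟨a, b, x, hab, rfl, ia, ib, ha, hb, hc⟩ := hD
    have h1 := Gr.card_sd (P.bd R) {a, b}
    have h2 : (P.bd R ∩ {a, b}).card ≤ 2 := (Finset.card_le_card Finset.inter_subset_right).trans (Finset.card_le_two)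
    rw [Finset.card_pair hab] at h1
    rcases region H hoR hRe hR1 (by omega) with ⟨g, hg⟩ | hg
    · have hgh : g ≠ h := by rintro rfl; exact hhR (by simp [hg])
      rw [hg] at h1 h2 ⊢
      rw [wt_single]
      by_cases h3 : (P.bd {g} ∩ {a, b}).card ≤ 1
      · omega
      have h5 : P.bd {g} ∩ {a, b} = {a, b} := Finset.eq_of_subset_of_card_le Finset.inter_subset_right
        (by rw [Finset.card_pair hab]; omega)
      have h6 : ({a, b} : Finset E) ⊆ P.bd {g} := by rw [← h5]; exact Finset.inter_subset_left
      exact (twin3 H hab ia ib (bd_sub _ ha) (bd_sub _ hb) hgh (h6 (by simp)) (h6 (by simp)) ha hb hc).elim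
    · omega
  · obtain ⟨a, b, x, hab, hQ, ia, ib, ha, hb, hc⟩ := hD
    have h3 : P.bd (insert h R) = (P.bd R ∆ D) ∆ {a, b} := by
      rw [hins, ← hQ]
      simp only [symmDiff_assoc]
      rw [symmDiff_left_comm D, symmDiff_self, symmDiff_comm _ (⊥ : Finset E), bot_symmDiff]
    have h1 := Gr.card_sd (P.bd R ∆ D) {a, b}
    rw [Finset.card_pair hab, ← h3] at h1
    have hne : insert h R ≠ {o}ᶜ := by
      intro hh
      rw [hh, bd_compl] at h3 h1
      have h5 : (P.bd R ∆ D ∩ {a, b}) = ∅ := by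
        rw [← Finset.card_eq_zero]; omega
      have h6 : a ∉ P.bd R ∆ D := by
        intro h; have : a ∈ (P.bd R ∆ D ∩ {a, b}) := by simp [h]
        rw [h5] at this; simp at this
      apply hc
      rw [h3, Finset.mem_symmDiff]; simp [h6]
    rcases region H hoi (Set.insert_nonempty _ _).ne_empty hne (by omega) with ⟨g, hg⟩ | hg
    · exact absurd hg (hns g)
    · omega
  · rw [← hins] at *
    have hne : insert h R ≠ {o}ᶜ := by
      intro hh
      rw [hh, bd_compl] at hk; omega
    rcases region H hoi (Set.insert_nonempty _ _).ne_empty hne (by omega) with ⟨g, hg⟩ | hg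
    · exact absurd hg (hns g)
    · omega

/-- pre-image bookkeeping: total weight compared through a fold -/
theorem wt_le_fold (H : Std n P o) {h : P.F} (hh : h ≠ o) {P2 : PM V E} {o2 : P2.F} (σ : P.F → P2.F)
    (hσ : σ ⁻¹' {o2} = {o}) (hf : ∀ f, f ≠ o2 → P.wt (σ ⁻¹' {f} \ {h}) ≤ ((P2.bd {f}).card : ℤ) - 4) :
    P.wt {o}ᶜ ≤ P2.wt {o2}ᶜ + ((P.bd {h}).card - 4) := by
  have h1 : P.wt {o}ᶜ = ∑ f with f ∈ ({o2}ᶜ : Set P2.F), P.wt (σ ⁻¹' {f}) := by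
    have := wt_fiber (P := P) σ {o2}ᶜ
    rw [Set.preimage_compl, hσ] at this
    rw [this]
    apply Finset.sum_congr _ (fun _ _ => rfl)
    ext; simp
  have h2 : ∀ f, P.wt (σ ⁻¹' {f}) = P.wt (σ ⁻¹' {f} \ {h}) + (if f = σ h then (((P.bd {h}).card : ℤ) - 4) else 0) := by
    intro f
    split_ifs with hc
    · have := wt_insert (P := P) (R := σ ⁻¹' {f} \ {h}) (q := h) (by simp)
      rw [add_comm, ← this]
      congr 1
      ext x; simp
      by_cases hx : x = h
      · subst hx; simp [hc]
      · simp [hx]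
    · congr 1
      rw [add_zero]
      congr 1
      ext x; simp
      rintro hx rfl
      exact hc hx.symm
  rw [h1, Finset.sum_congr rfl (fun f _ => h2 f), Finset.sum_add_distrib]
  have h3 : σ h ≠ o2 := by
    intro hc
    have : h ∈ σ ⁻¹' {o2} := hc
    rw [hσ] at this; exact hh this
  have h4 : (∑ f with f ∈ ({o2}ᶜ : Set P2.F), (if f = σ h then (((P.bd {h}).card : ℤ) - 4) else 0)) = ((P.bd {h}).card : ℤ) - 4 := by
    rw [Finset.sum_ite_eq']
    simp [h3]
  rw [h4]
  have h5 : (∑ f with f ∈ ({o2}ᶜ : Set P2.F), P.wt (σ ⁻¹' {f} \ {h})) ≤ P2.wt {o2}ᶜ := by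
    have h6 : P2.wt {o2}ᶜ = ∑ f with f ∈ ({o2}ᶜ : Set P2.F), (((P2.bd {f}).card : ℤ) - 4) := by
      unfold wt
      apply Finset.sum_congr _ (fun _ _ => rfl)
      ext; simp
    rw [h6]
    apply Finset.sum_le_sum
    intro f hf1
    exact hf f (by simpa using hf1)
  omega

end PM
end CF

end

open Set Topology

noncomputable section
namespace CF
set_option linter.all false
open scoped Classical symmDiff

namespace PM
variable {V E : Type} [Fintype V]
variable {n : ℕ} {P : PM V E} {o : P.F}

theorem jn_map {g g' : Gr V E} {ρ : V → V} (h : g' = Gr.mk (ρ ∘ g.s) (ρ ∘ g.t)) {e a b} (hj : g.jn e a b) :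
    g'.jn e (ρ a) (ρ b) := by
  subst h
  rcases hj with ⟨rfl, rfl⟩ | ⟨rfl, rfl⟩
  · exact Or.inl ⟨rfl, rfl⟩
  · exact Or.inr ⟨rfl, rfl⟩

theorem bd_diff {R : Set P.F} {h : P.F} (hR : h ∈ R) : P.bd R = P.bd (R \ {h}) ∆ P.bd {h} := by
  rw [← bd_sd]; congr 1; ext x
  simp only [Set.mem_diff, Set.mem_symmDiff, Set.mem_singleton_iff]
  by_cases hx : x = h
  · subst hx; simp [hR]
  · simp [hx]

theorem bd_ins {R : Set P.F} {h : P.F} (hR : h ∉ R) : P.bd (insert h R) = P.bd R ∆ P.bd {h} := by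
  rw [← bd_sd]; congr 1; ext x
  simp only [Set.mem_insert_iff, Set.mem_symmDiff, Set.mem_singleton_iff]
  by_cases hx : x = h
  · subst hx; simp [hR]
  · simp [hx]

theorem pair_sub {α} {a b : α} {S : Finset α} (ha : a ∈ S) (hb : b ∈ S) : ({a, b} : Finset α) ⊆ S := by
  intro x hx; simp at hx; rcases hx with rfl | rfl <;> assumption

/-- path of two edges -/
theorem od_pair {g : Gr V E} {e f a b c} (h : e ≠ f) (h1 : g.jn e a b) (h2 : g.jn f b c) : g.Od ({e, f} : Finset E) a c := by
  have := h1.od.trans h2.od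
  rwa [Gr.sd_union (by simpa using h)] at this

theorem sd_empty (A : Finset E) : A ∆ (∅ : Finset E) = A := by ext; simp [Finset.mem_symmDiff]

theorem pair_sd {a b c d : E} (h : [a, b, c, d].Nodup) : ({a, b} : Finset E) ∆ {c, d} = {a, b, c, d} := by
  rw [Gr.sd_union]
  · ext x; simp; tauto
  · rw [Finset.disjoint_left]; intro x; simp at *; rintro (rfl | rfl) <;> tauto

theorem ins_ne_single {α} {h x : α} {S : Set α} (hS : h ∉ S) (hne : S ≠ ∅) : insert h S ≠ {x} := by
  intro hg
  have h1 : h = x := by have : h ∈ insert h S := by simp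
                        rw [hg] at this; simpa using this
  obtain ⟨y, hy⟩ := Set.nonempty_iff_ne_empty.2 hne
  have h2 : y = x := by have : y ∈ insert h S := by simp [hy]
                        rw [hg] at this; simpa using this
  exact hS (h1 ▸ h2 ▸ hy)

/-- if the internal faces are `g, h` then each inner edge lies on both -/
theorem two_faces (H : Std n P o) {g h : P.F} (hU : insert h {g} = ({o}ᶜ : Set P.F)) {e} (he : e ∈ P.A) (hC : e ∉ P.bd {o}) :
    P.sd e g h := by
  have h12 := sd_internal H he hC
  have h13 := bridgeless H he
  have hx : ∀ x, x ≠ o → x = g ∨ x = h := by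
    intro x hx
    have : x ∈ insert h ({g} : Set P.F) := by rw [hU]; exact hx
    simp at this; tauto
  have a1 := hx _ h12.1
  have a2 := hx _ h12.2
  unfold sd
  rcases a1 with a1 | a1 <;> rcases a2 with a2 | a2 <;> simp_all

theorem two_faces' (H : Std n P o) {g h : P.F} (hU : insert h {g} = ({o}ᶜ : Set P.F)) {e e' v} (he : e ∈ P.A) (he' : e' ∈ P.A)
    (hne : e ≠ e') (hi : P.inc e v) (hi' : P.inc e' v) (hv : v ∉ P.Vs (P.bd {o})) : False := by
  have h5 := twin H hne he he' hi hi' (two_faces H hU he (fun h => hv ⟨e, h, hi⟩)) (two_faces H hU he' (fun h => hv ⟨e', h, hi'⟩))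
  have h6 := deg3 H hv ⟨e, Gr.mem_star.2 ⟨he, hi⟩⟩
  rw [h5, Finset.card_pair hne] at h6
  omega

theorem quadRed (H : Cex n P o) {q : P.F} (hq : q ≠ o) {e1 e2 e3 e4 v1 v2 v3 v4} (hnd : [e1, e2, e3, e4].Nodup)
    (hb : P.bd {q} = {e1, e2, e3, e4}) (j1 : P.jn e1 v1 v2) (j2 : P.jn e2 v2 v3) (j3 : P.jn e3 v3 v4)
    (j4 : P.jn e4 v4 v1) (h3 : v3 ∉ P.Vs (P.bd {o})) : False := by
  have HS := H.toStd
  have m1 : e1 ∈ P.bd {q} := by simp [hb]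
  have m2 : e2 ∈ P.bd {q} := by simp [hb]
  have m3 : e3 ∈ P.bd {q} := by simp [hb]
  have m4 : e4 ∈ P.bd {q} := by simp [hb]
  have a1 := bd_sub _ m1
  have a2 := bd_sub _ m2
  have a3 := bd_sub _ m3
  have a4 := bd_sub _ m4
  have n12 : e1 ≠ e2 := by simp at hnd; tauto
  have n23 : e2 ≠ e3 := by simp at hnd; tauto
  have n34 : e3 ≠ e4 := by simp at hnd; tauto
  have c2 : e2 ∉ P.bd {o} := fun h => h3 ⟨e2, h, j2.inc'⟩
  have c3 : e3 ∉ P.bd {o} := fun h => h3 ⟨e3, h, j3.inc⟩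
  have v13 : v1 ≠ v3 := by rintro rfl; exact n12 (H.tf.par a1 a2 j1 j2.symm)
  set Q1 : Finset E := {e1, e2}
  set Q2 : Finset E := {e3, e4}
  have hQ : P.bd {q} = Q1 ∆ Q2 := by rw [hb]; exact (pair_sd hnd).symm
  have hO1 : P.Od Q1 v1 v3 := od_pair n12 j1 j2
  have w1 : Wd P o q Q1 := ⟨e2, e1, v2, n12.symm, Finset.pair_comm _ _, j2.inc, j1.inc', m2, m1, c2⟩
  have w2 : Wd P o q Q2 := ⟨e3, e4, v4, n34, rfl, j3.inc', j4.inc, m3, m4, c3⟩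
  have hQ2 : P.bd {q} ∆ Q1 = Q2 := by rw [hQ, symmDiff_comm Q1, symmDiff_assoc, symmDiff_self]; simp
  have hQ1 : P.bd {q} ∆ Q2 = Q1 := by rw [hQ, symmDiff_assoc, symmDiff_self]; simp
  obtain ⟨P', s1, s2, s3, ι, nn, s4, s5, s6, s7, s8, s9⟩ := split P q Q1 v1 v3 (pair_sub m1 m2) hO1 v13
  set ρ : V → V := fun x => if x = v3 then v1 else x with hρ
  have hρ3 : ρ v3 = v1 := by simp [hρ]
  have hρo : ∀ x, x ≠ v3 → ρ x = x := fun x hx => by simp [hρ, hx]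
  have hs : ∀ e, P'.s e = ρ (P.s e) := fun e => congrFun (congrArg Gr.s s1) e
  have ht : ∀ e, P'.t e = ρ (P.t e) := fun e => congrFun (congrArg Gr.t s1) e
  have hpar1 : P'.jn e1 v1 (ρ v2) ∧ P'.jn e2 v1 (ρ v2) := by
    have b1 := jn_map s1 j1
    have b2 := jn_map s1 j2.symm
    rw [hρo _ v13] at b1; rw [hρ3] at b2; exact ⟨b1, b2⟩
  have hpar2 : P'.jn e3 v1 (ρ v4) ∧ P'.jn e4 v1 (ρ v4) := by
    have b1 := jn_map s1 j3
    have b2 := jn_map s1 j4.symm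
    rw [hρo _ v13] at b2; rw [hρ3] at b1; exact ⟨b1, b2⟩
  have hoq : ι o ≠ ι q := fun h => hq (s4 h).symm
  have hC' : P'.bd {ι o} = P.bd {o} := by
    rw [s7]
    have : ι ⁻¹' {ι o} = {o} := by ext x; simp [s4.eq_iff]
    rw [this, if_pos (by simp [hoq.symm, (s5 o).symm])]
    simp
  obtain ⟨P2, g1, g2, π, g3, g4, g5, g6, g7, g8, g9, g10, g11, g12⟩ := foldIH HS P' (ι o) (by
      intro e he ⟨hl, hr⟩
      rw [s2] at he
      rw [s8] at hl; rw [s9] at hr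
      split_ifs at hl with hl1
      · exact s5 o hl.symm
      split_ifs at hr with hr1
      · exact s5 o hr.symm
      exact H.cr.1 e he ⟨s4 hl, s4 hr⟩) hC' (by
      intro e he
      rw [hs, ht]
      exact ⟨hρo _ (fun h => h3 ⟨e, he, Or.inl h⟩), hρo _ (fun h => h3 ⟨e, he, Or.inr h⟩)⟩) (by
      intro χ hχ
      refine ⟨χ ∘ ρ, fun e he => ?_, fun v hv => ?_⟩
      · have := hχ e (s2 ▸ he)
        rwa [hs, ht] at this
      · simp only [Function.comp]; rw [hρo]; rintro rfl; exact h3 hv) (by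
      intro Z hZ hE hne hc
      rw [s2] at hZ
      rcases s3 Z hE with hE' | hO
      · exact absurd (H.tf.zero hZ hE' hc) hne
      -- the main case
      have key : ∀ Qi Qj : Finset E, Qi.card ≤ 2 → Qj.card ≤ 2 → P.bd {q} ∆ Qi = Qj → ∀ S : Set P.F, o ∉ S → q ∉ S →
          P.bd S = Z ∆ Qi → Z = Qi := by
        intro Qi Qj hci hcj hij S hoS hqS hS
        by_cases hSe : S = ∅
        · rw [hSe, bd_empty] at hS
          exact symmDiff_eq_bot.1 hS.symm
        exfalso
        have hc1 : (P.bd S).card ≤ 5 := by rw [hS]; exact (Gr.card_sd_le _ _).trans (by omega)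
        have hS2 : P.bd (insert q S) = Z ∆ Qj := by
          rw [bd_ins hqS, hS, symmDiff_assoc, symmDiff_comm Qi, hij]
        have hc2 : (P.bd (insert q S)).card ≤ 5 := by rw [hS2]; exact (Gr.card_sd_le _ _).trans (by omega)
        have hS1 : S ≠ {o}ᶜ := fun hh => hqS (hh ▸ hq)
        have nn1 := wt_nn HS (insert q S)
        have nn2 := wt_nn HS S
        by_cases hall : insert q S = {o}ᶜ
        · rcases region_circuit' HS hoS hSe hS1 (by omega) with ⟨g, hg⟩ | hg
          · rw [hg] at hall
            exact two_faces' HS hall a2 a3 n23 j2.inc' j3.inc h3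
          · omega
        · rcases region_circuit' HS (by simp [hoS, hq.symm]) (Set.insert_nonempty _ _).ne_empty hall (by omega) with ⟨g, hg⟩ | hg
          · exact ins_ne_single hqS hSe hg
          · omega
      have hQ1A : Q1 ⊆ P.A := pair_sub a1 a2
      obtain ⟨S, hoS, hS⟩ := ex_bd_o (Z := Z ∆ Q1) (Gr.sd_sub hZ hQ1A) (hO.sd hO1) o
      have cQ1 : Q1.card ≤ 2 := Finset.card_le_two
      have cQ2 : Q2.card ≤ 2 := Finset.card_le_two
      by_cases hqS : q ∈ S
      · have hS2 : P.bd (S \ {q}) = Z ∆ Q2 := by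
          have := bd_diff hqS
          rw [hS] at this
          rw [← hQ2, symmDiff_comm _ Q1, ← symmDiff_assoc, this, symmDiff_assoc, symmDiff_self, Finset.bot_eq_empty, sd_empty]
        have := key Q2 Q1 cQ2 cQ1 hQ1 _ (fun h => hoS h.1) (by simp) hS2
        rw [this]
        exact ⟨e3, by simp [Q2], e4, by simp [Q2], n34, c3, _, _, hpar2⟩
      · have := key Q1 Q2 cQ1 cQ2 hQ2 S hoS hqS hS
        rw [this]
        exact ⟨e2, by simp [Q1], e1, by simp [Q1], n12.symm, c2, _, _, hpar1.2, hpar1.1⟩) (s2 ▸ subset_rfl)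
      (Or.inr ⟨e2, s2 ▸ a2, e1, s2 ▸ a1, n12.symm, c2, _, _, hpar1.2, hpar1.1⟩)
  have hσ : (π ∘ ι) ⁻¹' {π (ι o)} = {o} := by
    rw [Set.preimage_comp, g7]; ext x; simp [s4.eq_iff]
  have := wt_le_fold HS hq (π ∘ ι) hσ (by
    intro f hf
    have hff := fold_face g9 g12 hf
    have hbf : P2.bd {f} = P.bd ((π ∘ ι) ⁻¹' {f}) ∆ (if (π nn = f ↔ π (ι q) = f) then ∅ else Q1) := by
      rw [g4, s7]; rfl
    set R := (π ∘ ι) ⁻¹' {f} with hR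
    have hoR : o ∉ R := fun h => hf (by simpa [hR] using h.symm)
    have hqR : q ∈ R ↔ π (ι q) = f := by simp [hR]
    by_cases hM : q ∈ R
    · rw [bd_diff hM] at hbf
      by_cases hN : π nn = f
      · rw [if_pos (by tauto)] at hbf
        rw [show P.bd (R \ {q}) ∆ P.bd {q} ∆ (∅ : Finset E) = P.bd (R \ {q}) ∆ P.bd {q} by simp] at hbf
        rw [hbf] at hff ⊢
        exact acct HS hq (fun h => hoR h.1) (by simp) _ hff.1 hff.2 (by simp)
      · rw [if_neg (by tauto), symmDiff_assoc, hQ2] at hbf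
        rw [hbf] at hff ⊢
        exact acct HS hq (fun h => hoR h.1) (by simp) _ hff.1 hff.2 (by simp [w2])
    · rw [show R \ {q} = R by simp [hM]]
      by_cases hN : π nn = f
      · rw [if_neg (by tauto)] at hbf
        rw [hbf] at hff ⊢
        exact acct HS hq hoR hM _ hff.1 hff.2 (by simp [w1])
      · rw [if_pos (by tauto)] at hbf
        rw [hbf] at hff ⊢
        exact acct HS hq hoR hM _ hff.1 hff.2 (by simp))
  have h4 : (P.bd {q}).card ≤ 4 := by rw [hb]; exact Finset.card_le_four
  have := H.gt
  omega

end PM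
end CF

end

open Set Topology

noncomputable section
namespace CF
set_option linter.all false
open scoped Classical symmDiff

namespace PM
variable {V E : Type} [Fintype V]
variable {n : ℕ} {P : PM V E} {o : P.F}

section paths
variable {g : Gr V E} {A : Finset E}

theorem path1 (hT : g.TF A) {Z a b} (hZ : Z ⊆ A) (ho : g.Od Z a b) (hc : Z.card = 1) : ∃ e, Z = {e} ∧ g.jn e a b := by
  obtain ⟨e, rfl⟩ := Finset.card_eq_one.1 hc
  refine ⟨e, rfl, ?_⟩
  have hab : a ≠ b := by
    rintro rfl
    exact absurd (hT.zero hZ (Gr.od_self.1 ho) (by simp)) (by simp)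
  exact (Gr.od_single_iff hab).1 ho

theorem ne_of_od (hT : g.TF A) {Z a b} (hZ : Z ⊆ A) (ho : g.Od Z a b) (hc : Z.card ≤ 3) (hne : Z ≠ ∅) : a ≠ b := by
  rintro rfl
  exact hne (hT.zero hZ (Gr.od_self.1 ho) hc)

theorem path2 (hT : g.TF A) {Z a b} (hZ : Z ⊆ A) (ho : g.Od Z a b) (hc : Z.card = 2) :
    ∃ e f c, e ≠ f ∧ Z = {e, f} ∧ g.jn e a c ∧ g.jn f c b := by
  have hne : Z ≠ ∅ := by rintro rfl; simp at hc
  obtain ⟨e, he, c, hj, ho'⟩ := ho.peel (ne_of_od hT hZ ho (by omega) hne)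
  obtain ⟨f, hf, hj'⟩ := path1 hT ((Finset.erase_subset _ _).trans hZ) ho' (by rw [Finset.card_erase_of_mem he]; omega)
  refine ⟨e, f, c, ?_, ?_, hj, hj'⟩
  · rintro rfl
    have : e ∈ Z.erase e := by rw [hf]; simp
    simp at this
  · rw [← Finset.insert_erase he, hf]

theorem path3 (hT : g.TF A) {Z a b} (hZ : Z ⊆ A) (ho : g.Od Z a b) (hc : Z.card = 3) :
    ∃ e f h c d, [e, f, h].Nodup ∧ Z = {e, f, h} ∧ g.jn e a c ∧ g.jn f c d ∧ g.jn h d b := by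
  have hne : Z ≠ ∅ := by rintro rfl; simp at hc
  obtain ⟨e, he, c, hj, ho'⟩ := ho.peel (ne_of_od hT hZ ho (by omega) hne)
  obtain ⟨f, h, d, hfh, hf, hj', hj''⟩ := path2 hT ((Finset.erase_subset _ _).trans hZ) ho' (by rw [Finset.card_erase_of_mem he]; omega)
  have : e ∉ Z.erase e := by simp
  rw [hf] at this
  refine ⟨e, f, h, c, d, ?_, ?_, hj, hj', hj''⟩
  · simp at *; tauto
  · rw [← Finset.insert_erase he, hf]

theorem path4 (hT : g.TF A) {Z a b} (hZ : Z ⊆ A) (ho : g.Od Z a b) (hc : Z.card = 4) (hab : a ≠ b) :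
    ∃ e f h i c d x, [e, f, h, i].Nodup ∧ Z = {e, f, h, i} ∧ g.jn e a c ∧ g.jn f c d ∧ g.jn h d x ∧ g.jn i x b := by
  obtain ⟨e, he, c, hj, ho'⟩ := ho.peel hab
  obtain ⟨f, h, i, d, x, hfh, hf, hj', hj'', hj3⟩ := path3 hT ((Finset.erase_subset _ _).trans hZ) ho' (by rw [Finset.card_erase_of_mem he]; omega)
  have : e ∉ Z.erase e := by simp
  rw [hf] at this
  refine ⟨e, f, h, i, c, d, x, ?_, ?_, hj, hj', hj'', hj3⟩
  · simp at *; tauto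
  · rw [← Finset.insert_erase he, hf]

theorem ev_erase {Z : Finset E} {e a b} (h : g.Ev Z) (he : e ∈ Z) (hj : g.jn e a b) : g.Od (Z.erase e) b a := by
  have := hj.od.sdEv h
  rw [symmDiff_comm, Gr.sd_of_sub (by simpa using he), ← Finset.erase_eq] at this
  exact this.symm

theorem cyc4 (hT : g.TF A) {Z} (hZ : Z ⊆ A) (ho : g.Ev Z) (hc : Z.card = 4) :
    ∃ e1 e2 e3 e4 v1 v2 v3 v4, [e1, e2, e3, e4].Nodup ∧ Z = {e1, e2, e3, e4} ∧ g.jn e1 v1 v2 ∧ g.jn e2 v2 v3 ∧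
      g.jn e3 v3 v4 ∧ g.jn e4 v4 v1 := by
  obtain ⟨e, he⟩ : Z.Nonempty := Finset.card_pos.1 (by omega)
  have hj : g.jn e (g.s e) (g.t e) := Or.inl ⟨rfl, rfl⟩
  obtain ⟨f, h, i, d, x, hfh, hf, hj', hj'', hj3⟩ := path3 hT ((Finset.erase_subset _ _).trans hZ) (ev_erase ho he hj) (by rw [Finset.card_erase_of_mem he]; omega)
  have : e ∉ Z.erase e := by simp
  rw [hf] at this
  refine ⟨e, f, h, i, _, _, d, x, ?_, ?_, hj, hj', hj'', hj3⟩
  · simp at *; tauto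
  · rw [← Finset.insert_erase he, hf]

theorem cyc5 (hT : g.TF A) {Z} (hZ : Z ⊆ A) (ho : g.Ev Z) (hc : Z.card = 5) {e a b} (he : e ∈ Z) (hj : g.jn e a b) :
    ∃ e2 e3 e4 e5 v3 v4 v5, [e, e2, e3, e4, e5].Nodup ∧ Z = {e, e2, e3, e4, e5} ∧ g.jn e2 b v3 ∧
      g.jn e3 v3 v4 ∧ g.jn e4 v4 v5 ∧ g.jn e5 v5 a := by
  obtain ⟨f, h, i, k, d, x, y, hfh, hf, hj', hj'', hj3, hj4⟩ := path4 hT ((Finset.erase_subset _ _).trans hZ) (ev_erase ho he hj) (by rw [Finset.card_erase_of_mem he]; omega)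
    (hT.jn_ne (hZ he) hj).symm
  have : e ∉ Z.erase e := by simp
  rw [hf] at this
  refine ⟨f, h, i, k, d, x, y, ?_, ?_, hj', hj'', hj3, hj4⟩
  · simp at *; tauto
  · rw [← Finset.insert_erase he, hf]
end paths

theorem not_sub (H : Std n P o) {q : P.F} (hq : q ≠ o) : ¬ P.bd {q} ⊆ P.bd {o} := by
  intro hsub
  have hne : P.bd {q} ≠ ∅ := bd1_ne hq
  have := H.cr.2.1.2.2 _ hsub (ev_bd _) hne
  rcases bd_inj this with h | h
  · exact hq (by simpa using h)
  · apply H.cr.2.2.1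
    refine Finset.Subset.antisymm (bd_sub _) ?_
    intro e he
    by_contra hc
    have h1 := sd_internal H he hc
    have h2 := bridgeless H he
    have h3 : P.l e ∈ ({q} : Set P.F) := by rw [h]; exact h1.1
    have h4 : P.r e ∈ ({q} : Set P.F) := by rw [h]; exact h1.2
    simp at h3 h4
    exact h2 (h3.trans h4.symm)

theorem Cex.f5 (H : Cex n P o) {q : P.F} (hq : q ≠ o) : 5 ≤ (P.bd {q}).card := by
  have h4 : 4 ≤ (P.bd {q}).card := bd4 H.toStd (by simpa using hq.symm) (by simp)
  by_contra hlt
  obtain ⟨e1, e2, e3, e4, v1, v2, v3, v4, hnd, hb, j1, j2, j3, j4⟩ := cyc4 H.tf (bd_sub {q}) (ev_bd _) (by omega)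
  by_cases h3 : v3 ∈ P.Vs (P.bd {o})
  swap
  · exact quadRed H hq hnd hb j1 j2 j3 j4 h3
  by_cases h4 : v4 ∈ P.Vs (P.bd {o})
  swap
  · exact quadRed H hq (e1 := e2) (e2 := e3) (e3 := e4) (e4 := e1) (by simp at *; tauto) (by rw [hb]; ext; simp; tauto) j2 j3 j4 j1 h4
  by_cases h1 : v1 ∈ P.Vs (P.bd {o})
  swap
  · exact quadRed H hq (e1 := e3) (e2 := e4) (e3 := e1) (e4 := e2) (by simp at *; tauto) (by rw [hb]; ext; simp; tauto) j3 j4 j1 j2 h1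
  by_cases h2 : v2 ∈ P.Vs (P.bd {o})
  swap
  · exact quadRed H hq (e1 := e4) (e2 := e1) (e3 := e2) (e4 := e3) (by simp at *; tauto) (by rw [hb]; ext; simp; tauto) j4 j1 j2 j3 h2
  apply not_sub H.toStd hq
  intro e he
  by_contra hc
  have hA := bd_sub _ he
  rw [hb] at he
  simp at he
  rcases he with rfl | rfl | rfl | rfl
  · exact H.no1 hA hc j1 h1 h2
  · exact H.no1 hA hc j2 h2 h3
  · exact H.no1 hA hc j3 h3 h4
  · exact H.no1 hA hc j4 h4 h1

end PM
end CF

end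

open Set Topology

noncomputable section
namespace CF
set_option linter.all false
open scoped Classical symmDiff

namespace PM
variable {V E : Type} [Fintype V]
variable {n : ℕ} {P : PM V E} {o : P.F}

theorem wt_card (H : Cex n P o) {R : Set P.F} (ho : o ∉ R) : ((Finset.univ.filter (· ∈ R)).card : ℤ) ≤ P.wt R := by
  unfold wt
  rw [Finset.card_eq_sum_ones]
  push_cast
  apply Finset.sum_le_sum
  intro f hf
  have : f ≠ o := by rintro rfl; simp at hf; exact ho hf
  have := H.f5 this
  omega

theorem wt_two (H : Cex n P o) {R : Set P.F} (ho : o ∉ R) (hne : R ≠ ∅) (hns : ¬ ∃ g, R = {g}) : 2 ≤ P.wt R := by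
  have h1 := wt_card H ho
  have h2 : 2 ≤ (Finset.univ.filter (· ∈ R)).card := by
    by_contra hlt
    obtain ⟨x, hx⟩ := Set.nonempty_iff_ne_empty.2 hne
    have h3 := Finset.card_le_one.1 (show (Finset.univ.filter (· ∈ R)).card ≤ 1 by omega)
    apply hns
    refine ⟨x, ?_⟩
    ext y
    constructor
    · intro hy; exact h3 y (by simpa using hy) x (by simpa using hx)
    · rintro rfl; exact hx
  omega

theorem short (H : Cex n P o) {R : Set P.F} (ho : o ∉ R) (hne : R ≠ ∅) (hne' : R ≠ {o}ᶜ) (h7 : (P.bd R).card ≤ 7) :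
    ∃ g, g ≠ o ∧ R = {g} ∧ 5 ≤ (P.bd R).card := by
  by_cases hs : ∃ g, R = {g}
  · obtain ⟨g, rfl⟩ := hs
    have hg : g ≠ o := fun h => ho (by simp [h])
    exact ⟨g, hg, rfl, H.f5 hg⟩
  have := wt_two H ho hne hs
  rcases region_circuit' H.toStd ho hne hne' h7 with h | h
  · exact absurd h hs
  · omega

theorem hexKey (H : Cex n P o) {h : P.F} (hh : h ≠ o) (h6 : (P.bd {h}).card = 6) {a b v} (ha : a ∈ P.A) (hb : b ∈ P.A)
    (hab : a ≠ b) (ia : P.inc a v) (ib : P.inc b v) (hv : v ∉ P.Vs (P.bd {o})) {Z Q : Finset E} (hZ : Z ⊆ P.A) (hZc : Z.card ≤ 3)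
    (hQ : Q ⊆ P.bd {h}) (hQ2 : Q.card = 2) (hE : P.Ev (Z ∆ Q)) : Z = Q := by
  have HS := H.toStd
  obtain ⟨S, hoS, hS⟩ := ex_bd_o (Gr.sd_sub hZ (hQ.trans (bd_sub _))) hE o
  have c1 : (P.bd S).card ≤ 5 := by rw [hS]; exact (Gr.card_sd_le _ _).trans (by omega)
  have c2 : (P.bd {h} ∆ Q).card ≤ 4 := by
    rw [Gr.sd_of_sub hQ, Finset.card_sdiff_of_subset hQ]; omega
  have c3 : (P.bd (S ∆ {h})).card ≤ 7 := by
    rw [bd_sd, hS, symmDiff_assoc, symmDiff_comm Q]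
    exact (Gr.card_sd_le _ _).trans (by omega)
  have aC : a ∉ P.bd {o} := fun h => hv ⟨a, h, ia⟩
  by_cases hSe : S = ∅
  · rw [hSe, bd_empty] at hS
    exact symmDiff_eq_bot.1 hS.symm
  exfalso
  by_cases hSo : S = {o}ᶜ
  · have e1 : S ∆ {h} = {o, h}ᶜ := by
      rw [hSo]; ext x
      simp only [Set.mem_symmDiff, Set.mem_compl_iff, Set.mem_singleton_iff, Set.mem_insert_iff]
      by_cases hx : x = h
      · subst hx; simp [hh]
      · simp [hx]
    rw [e1] at c3
    have hne : ({o, h}ᶜ : Set P.F) ≠ ∅ := by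
      intro hc
      have h1 := sd_internal HS ha aC
      have h2 := bridgeless HS ha
      have h3 : ∀ x : P.F, x = o ∨ x = h := by
        intro x
        have : x ∉ ({o, h}ᶜ : Set P.F) := by rw [hc]; simp
        simp at this; tauto
      have h4 := h3 (P.l a)
      have h5 := h3 (P.r a)
      rcases h4 with h4 | h4
      · exact h1.1 h4
      rcases h5 with h5 | h5
      · exact h1.2 h5
      exact h2 (h4.trans h5.symm)
    obtain ⟨g, hg, hgg, _⟩ := short H (R := {o, h}ᶜ) (by simp) hne
      (by intro hc; have : h ∈ ({o}ᶜ : Set P.F) := hh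
          rw [← hc] at this; simp at this) c3
    refine two_faces' HS (g := g) (h := h) ?_ ha hb hab ia ib hv
    rw [← hgg]; ext x; simp
    by_cases hx : x = h
    · subst hx; simp [hh]
    · simp [hx]
  obtain ⟨g, hg, rfl, _⟩ := short H hoS hSe hSo (by omega)
  have hgh : g ≠ h := by rintro rfl; omega
  have e1 : ({g} : Set P.F) ∆ {h} = insert h {g} := by
    ext x
    simp only [Set.mem_symmDiff, Set.mem_singleton_iff, Set.mem_insert_iff]
    by_cases hx : x = h
    · subst hx; simp [hgh.symm]
    · simp [hx]
  rw [e1] at c3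
  by_cases hall : insert h {g} = ({o}ᶜ : Set P.F)
  · exact two_faces' HS hall ha hb hab ia ib hv
  · obtain ⟨x, _, hx, _⟩ := short H (by simp [hg.symm, hh.symm]) (Set.insert_nonempty _ _).ne_empty hall c3
    exact ins_ne_single (by simpa using hgh.symm) (by simp) hx

theorem bd_sum (hb : ∀ e ∈ P.A, P.l e ≠ P.r e) : ∑ f, (P.bd {f}).card = 2 * P.A.card := by
  rw [← len_sum]
  apply Finset.sum_congr rfl
  intro f _
  unfold len
  rw [← Finset.card_union_of_disjoint]
  · congr 1
    ext e
    simp only [mem_bd1, Finset.mem_union, Finset.mem_filter]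
    have := hb e
    constructor
    · tauto
    · rintro (⟨h1, h2⟩ | ⟨h1, h2⟩)
      · refine ⟨h1, fun h => this h1 (by rw [h2, h.1 h2])⟩
      · refine ⟨h1, fun h => this h1 (by rw [h2, h.2 h2])⟩
  · rw [Finset.disjoint_left]
    intro e h1 h2
    simp at h1 h2
    exact hb e h1.1 (h1.2.trans h2.2.symm)

theorem wt_int : P.wt {o}ᶜ + 4 * ((Finset.univ.filter (fun f => f ≠ o)).card : ℤ) = (∑ f, ((P.bd {f}).card : ℤ)) - (P.bd {o}).card := by
  have h1 : P.wt {o}ᶜ = ∑ f ∈ Finset.univ.filter (fun f => f ≠ o), (((P.bd {f}).card : ℤ) - 4) := by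
    unfold wt
    apply Finset.sum_congr _ (fun _ _ => rfl)
    ext; simp
  rw [h1, Finset.sum_sub_distrib]
  simp only [Finset.sum_const, nsmul_eq_mul]
  have h2 := Finset.sum_erase_add Finset.univ (fun f => ((P.bd {f}).card : ℤ)) (Finset.mem_univ o)
  rw [← h2, show Finset.univ.filter (fun f => f ≠ o) = Finset.univ.erase o by ext; simp]
  ring

/-- number of inner edges -/
theorem inner (H : Std n P o) : 2 * ((P.A \ P.bd {o}).card : ℤ) + (P.bd {o}).card =
    P.wt {o}ᶜ + 4 * ((Finset.univ.filter (fun f => f ≠ o)).card : ℤ) := by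
  rw [wt_int]
  have h1 := bd_sum (fun e he => bridgeless H he)
  have h2 : (P.A \ P.bd {o}).card + (P.bd {o}).card = P.A.card := Finset.card_sdiff_add_card_eq_card (bd_sub _)
  have h3 : (∑ f, ((P.bd {f}).card : ℤ)) = 2 * P.A.card := by exact_mod_cast h1
  rw [h3]
  omega

end PM
end CF

end

open Set Topology

noncomputable section
namespace CF
set_option linter.all false
open scoped Classical symmDiff

namespace PM
variable {V E : Type} [Fintype V]
variable {n : ℕ} {P : PM V E} {o : P.F}

theorem nd6 {e1 e2 e3 e4 e5 e6 : E} (hnd : [e1, e2, e3, e4, e5, e6].Nodup) :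
    Disjoint ({e1, e2} : Finset E) {e3, e4} ∧ Disjoint (({e1, e2} : Finset E) ∪ {e3, e4}) {e5, e6} := by
  simp only [List.nodup_cons, List.mem_cons, List.not_mem_nil, or_false, not_or] at hnd
  obtain ⟨⟨h1, h2, h3, h4, h5⟩, ⟨g1, g2, g3, g4⟩, ⟨i1, i2, i3⟩, ⟨k1, k2⟩, l1, -⟩ := hnd
  simp only [Finset.disjoint_left, Finset.mem_union, Finset.mem_insert, Finset.mem_singleton]
  constructor
  · rintro x (rfl | rfl) (h | h) <;> contradiction
  · rintro x ((rfl | rfl) | (rfl | rfl)) (h | h) <;> contradiction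

set_option maxHeartbeats 2000000 in
theorem hexagram (H : Cex n P o) {h : P.F} (hh : h ≠ o) {e1 e2 e3 e4 e5 e6 w1 w2 w3 w4 w5 w6} 
    (hnd : [e1, e2, e3, e4, e5, e6].Nodup)
    (hb : P.bd {h} = {e1, e2, e3, e4, e5, e6}) (j1 : P.jn e1 w1 w2) (j2 : P.jn e2 w2 w3) (j3 : P.jn e3 w3 w4)
    (j4 : P.jn e4 w4 w5) (j5 : P.jn e5 w5 w6) (j6 : P.jn e6 w6 w1) 
    (h3 : w3 ∉ P.Vs (P.bd {o})) (h5 : w5 ∉ P.Vs (P.bd {o})) : False := by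
  have HS := H.toStd
  have m1 : e1 ∈ P.bd {h} := by simp [hb]
  have m2 : e2 ∈ P.bd {h} := by simp [hb]
  have m3 : e3 ∈ P.bd {h} := by simp [hb]
  have m4 : e4 ∈ P.bd {h} := by simp [hb]
  have m5 : e5 ∈ P.bd {h} := by simp [hb]
  have m6 : e6 ∈ P.bd {h} := by simp [hb]
  have a1 := bd_sub _ m1
  have a2 := bd_sub _ m2
  have a3 := bd_sub _ m3
  have a4 := bd_sub _ m4
  have a5 := bd_sub _ m5
  have a6 := bd_sub _ m6
  have h6c : (P.bd {h}).card = 6 := by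
    rw [hb]
    have := List.toFinset_card_of_nodup hnd
    simpa using this
  have n12 : e1 ≠ e2 := by clear * - hnd; simp at hnd; tauto
  have n23 : e2 ≠ e3 := by clear * - hnd; simp at hnd; tauto
  have n34 : e3 ≠ e4 := by clear * - hnd; simp at hnd; tauto
  have n56 : e5 ≠ e6 := by clear * - hnd; simp at hnd; tauto
  have c2 : e2 ∉ P.bd {o} := fun h => h3 ⟨e2, h, j2.inc'⟩
  have c3 : e3 ∉ P.bd {o} := fun h => h3 ⟨e3, h, j3.inc⟩
  have c4 : e4 ∉ P.bd {o} := fun h => h5 ⟨e4, h, j4.inc'⟩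
  have c5 : e5 ∉ P.bd {o} := fun h => h5 ⟨e5, h, j5.inc⟩
  have v13 : w1 ≠ w3 := by rintro rfl; exact n12 (H.tf.par a1 a2 j1 j2.symm)
  have v35 : w3 ≠ w5 := by rintro rfl; exact n34 (H.tf.par a3 a4 j3 j4.symm)
  have v15 : w1 ≠ w5 := by rintro rfl; exact n56 (H.tf.par a5 a6 j5 j6.symm)
  obtain ⟨Q1, hQ1d⟩ : ∃ Q1 : Finset E, Q1 = {e1, e2} := ⟨_, rfl⟩
  obtain ⟨Q2, hQ2d⟩ : ∃ Q2 : Finset E, Q2 = {e3, e4} := ⟨_, rfl⟩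
  obtain ⟨Q3, hQ3d⟩ : ∃ Q3 : Finset E, Q3 = {e5, e6} := ⟨_, rfl⟩
  have d12 : Disjoint Q1 Q2 := by
    rw [hQ1d, hQ2d]; exact (nd6 hnd).1
  have d123 : Disjoint (Q1 ∪ Q2) Q3 := by
    rw [hQ1d, hQ2d, hQ3d]; exact (nd6 hnd).2
  have hQ : P.bd {h} = Q1 ∆ Q2 ∆ Q3 := by
    rw [Gr.sd_union d12, Gr.sd_union d123, hb, hQ1d, hQ2d, hQ3d]; ext x; simp; clear * - P; tauto
  have hO1 : P.Od Q1 w1 w3 := hQ1d ▸ od_pair n12 j1 j2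
  have u1 : Wd P o h Q1 := ⟨e2, e1, w2, n12.symm, hQ1d.trans (Finset.pair_comm _ _), j2.inc, j1.inc', m2, m1, c2⟩
  have u2 : Wd P o h Q2 := ⟨e3, e4, w4, n34, hQ2d, j3.inc', j4.inc, m3, m4, c3⟩
  have u3 : Wd P o h Q3 := ⟨e5, e6, w6, n56, hQ3d, j5.inc', j6.inc, m5, m6, c5⟩
  have sb1 : Q1 ⊆ P.bd {h} := hQ1d ▸ pair_sub m1 m2
  have sb2 : Q2 ⊆ P.bd {h} := hQ2d ▸ pair_sub m3 m4
  have sb3 : Q3 ⊆ P.bd {h} := hQ3d ▸ pair_sub m5 m6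
  have k1 : Q1.card = 2 := hQ1d ▸ Finset.card_pair n12
  have k2 : Q2.card = 2 := hQ2d ▸ Finset.card_pair n34
  have k3 : Q3.card = 2 := hQ3d ▸ Finset.card_pair n56
  -- first split
  obtain ⟨P', s1, s2, s3, ι, nn, s4, s5, s6, s7, s8, s9⟩ := split P h Q1 w1 w3 sb1 hO1 v13
  obtain ⟨ρ1, hρ1⟩ : ∃ ρ1 : V → V, ρ1 = fun x => if x = w3 then w1 else x := ⟨_, rfl⟩
  rw [← hρ1] at s1
  have ρ13 : ρ1 w3 = w1 := by simp [hρ1]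
  have ρ1o : ∀ x, x ≠ w3 → ρ1 x = x := fun x hx => by simp [hρ1, hx]
  have hs1 : ∀ e, P'.s e = ρ1 (P.s e) := fun e => congrFun (congrArg Gr.s s1) e
  have ht1 : ∀ e, P'.t e = ρ1 (P.t e) := fun e => congrFun (congrArg Gr.t s1) e
  have hoq : ι o ≠ ι h := fun h => hh (s4 h).symm
  have hC' : P'.bd {ι o} = P.bd {o} := by
    rw [s7]
    have : ι ⁻¹' {ι o} = {o} := by ext x; simp [s4.eq_iff]
    rw [this, if_pos (by simp [hoq.symm, (s5 o).symm])]
    simp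
  have hh' : P'.bd {ι h} = P.bd {h} ∆ Q1 := by
    rw [s7]
    have : ι ⁻¹' {ι h} = {h} := by ext x; simp [s4.eq_iff]
    rw [this, if_neg (by simp [(s5 h).symm])]
  have sb3' : Q3 ⊆ P'.bd {ι h} := by
    rw [hh', Gr.sd_of_sub sb1]
    intro x hx
    rw [Finset.mem_sdiff]
    refine ⟨sb3 hx, fun h => Finset.disjoint_left.1 d123 (Finset.mem_union_left _ h) hx⟩
  have hO3 : P'.Od Q3 w1 w5 := by
    have b1 := jn_map s1 j5
    have b2 := jn_map s1 j6
    rw [ρ1o _ v35.symm] at b1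
    rw [ρ1o _ v13] at b2
    rw [hQ3d]
    exact (od_pair n56 b1 b2).symm
  obtain ⟨P3, t1, t2, t3, κ, mm, t4, t5, t6, t7, t8, t9⟩ := split P' (ι h) Q3 w1 w5 sb3' hO3 v15
  obtain ⟨ρ2, hρ2⟩ : ∃ ρ2 : V → V, ρ2 = fun x => if x = w5 then w1 else x := ⟨_, rfl⟩
  rw [← hρ2] at t1
  have ρ25 : ρ2 w5 = w1 := by simp [hρ2]
  have ρ2o : ∀ x, x ≠ w5 → ρ2 x = x := fun x hx => by simp [hρ2, hx]
  have hs : ∀ e, P3.s e = ρ2 (ρ1 (P.s e)) := fun e => by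
    rw [← hs1]; exact congrFun (congrArg Gr.s t1) e
  have ht : ∀ e, P3.t e = ρ2 (ρ1 (P.t e)) := fun e => by
    rw [← ht1]; exact congrFun (congrArg Gr.t t1) e
  have R1 : ρ2 (ρ1 w1) = w1 := by rw [ρ1o _ v13, ρ2o _ v15]
  have R3 : ρ2 (ρ1 w3) = w1 := by rw [ρ13, ρ2o _ v15]
  have R5 : ρ2 (ρ1 w5) = w1 := by rw [ρ1o _ v35.symm, ρ25]
  have Ro : ∀ x, x ∈ P.Vs (P.bd {o}) → ρ2 (ρ1 x) = x := by
    intro x hx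
    have x3 : x ≠ w3 := by rintro rfl; exact h3 hx
    have x5 : x ≠ w5 := by rintro rfl; exact h5 hx
    rw [ρ1o _ x3, ρ2o _ x5]
  have hjm : ∀ {e a b}, P.jn e a b → P3.jn e (ρ2 (ρ1 a)) (ρ2 (ρ1 b)) := fun hj => jn_map t1 (jn_map s1 hj)
  have A3 : P3.A = P.A := t2.trans s2
  have hC3 : P3.bd {κ (ι o)} = P.bd {o} := by
    rw [t7]
    have : κ ⁻¹' {κ (ι o)} = {ι o} := by ext x; simp [t4.eq_iff]
    rw [this, if_pos (by simp [(t5 (ι o)).symm, t4.eq_iff, hoq.symm]), hC']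
    simp
  have par1 : P3.jn e1 w1 (ρ2 (ρ1 w2)) ∧ P3.jn e2 w1 (ρ2 (ρ1 w2)) := by
    have b1 := hjm j1
    have b2 := hjm j2.symm
    rw [R1] at b1; rw [R3] at b2; exact ⟨b1, b2⟩
  have par2 : P3.jn e3 w1 (ρ2 (ρ1 w4)) ∧ P3.jn e4 w1 (ρ2 (ρ1 w4)) := by
    have b1 := hjm j3
    have b2 := hjm j4.symm
    rw [R3] at b1; rw [R5] at b2; exact ⟨b1, b2⟩
  have par3 : P3.jn e5 w1 (ρ2 (ρ1 w6)) ∧ P3.jn e6 w1 (ρ2 (ρ1 w6)) := by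
    have b1 := hjm j5
    have b2 := hjm j6.symm
    rw [R5] at b1; rw [R1] at b2; exact ⟨b1, b2⟩
  obtain ⟨P2, g1, g2, π, g3, g4, g5, g6, g7, g8, g9, g10, g11, g12⟩ := foldIH HS P3 (κ (ι o)) (by
      intro e he ⟨hl, hr⟩
      rw [A3] at he
      rw [t8] at hl; rw [t9] at hr
      split_ifs at hl with hl1
      · exact t5 _ hl.symm
      split_ifs at hr with hr1
      · exact t5 _ hr.symm
      have hl := t4 hl
      have hr := t4 hr
      rw [s8] at hl; rw [s9] at hr
      split_ifs at hl with hl1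
      · exact s5 o hl.symm
      split_ifs at hr with hr1
      · exact s5 o hr.symm
      exact H.cr.1 e he ⟨s4 hl, s4 hr⟩) hC3 (by
      intro e he
      rw [hs, ht]
      exact ⟨Ro _ ⟨e, he, Or.inl rfl⟩, Ro _ ⟨e, he, Or.inr rfl⟩⟩) (by
      intro χ hχ
      refine ⟨χ ∘ ρ2 ∘ ρ1, fun e he => ?_, fun v hv => ?_⟩
      · have := hχ e (A3 ▸ he)
        rwa [hs, ht] at this
      · simp only [Function.comp]; rw [Ro _ hv]) (by
      intro Z hZ hE hne hc
      rw [A3] at hZ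
      have hev : P.Ev Z ∨ P.Ev (Z ∆ Q1) ∨ P.Ev (Z ∆ Q2) ∨ P.Ev (Z ∆ Q3) := by
        rcases t3 Z hE with hE' | hO
        · rcases s3 Z hE' with hE'' | hO
          · exact Or.inl hE''
          · exact Or.inr (Or.inl (hO.sd hO1))
        · rcases s3 _ (hO.sd hO3) with hE'' | hO'
          · exact Or.inr (Or.inr (Or.inr hE''))
          · right; right; left
            have := (hO'.sd hO1).sd (ev_bd {h})
            rw [hQ] at this
            convert this using 1
            ext x; simp only [Finset.mem_symmDiff]; clear * - P; tauto
      have key : ∀ Q ⊆ P.bd {h}, Q.card = 2 → P.Ev (Z ∆ Q) → Z = Q := fun Q hQ hQ2 hE =>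
        hexKey H hh h6c a2 a3 n23 j2.inc' j3.inc h3 hZ hc hQ hQ2 hE
      rcases hev with h1 | h1 | h1 | h1
      · exact absurd (H.tf.zero hZ h1 hc) hne
      · have := key _ sb1 k1 h1
        rw [this, hQ1d]
        exact ⟨e2, by simp, e1, by simp, n12.symm, c2, _, _, par1.2, par1.1⟩
      · have := key _ sb2 k2 h1
        rw [this, hQ2d]
        exact ⟨e3, by simp, e4, by simp, n34, c3, _, _, par2⟩
      · have := key _ sb3 k3 h1
        rw [this, hQ3d]
        exact ⟨e5, by simp, e6, by simp, n56, c5, _, _, par3⟩) (A3 ▸ subset_rfl)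
      (Or.inr ⟨e2, A3 ▸ a2, e1, A3 ▸ a1, n12.symm, c2, _, _, par1.2, par1.1⟩)
  have hσ : (π ∘ κ ∘ ι) ⁻¹' {π (κ (ι o))} = {o} := by
    rw [Set.preimage_comp, g7]; ext x; simp [s4.eq_iff, t4.eq_iff]
  have hw := wt_le_fold HS hh (π ∘ κ ∘ ι) hσ (by
    intro f hf
    have hff := fold_face g9 g12 hf
    have hbf : P2.bd {f} = P.bd ((π ∘ κ ∘ ι) ⁻¹' {f}) ∆ (if (π (κ nn) = f ↔ π (κ (ι h)) = f) then ∅ else Q1) ∆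
        (if (π mm = f ↔ π (κ (ι h)) = f) then ∅ else Q3) := by
      rw [g4, t7, s7]; rfl
    obtain ⟨R, hR⟩ : ∃ R, R = (π ∘ κ ∘ ι) ⁻¹' {f} := ⟨_, rfl⟩
    rw [← hR] at hbf ⊢
    have hoR : o ∉ R := fun h => hf (by rw [hR] at h; exact h.symm)
    have hqR : h ∈ R ↔ π (κ (ι h)) = f := by simp [hR]
    have main : ∀ D : Finset E, P2.bd {f} = P.bd (R \ {h}) ∆ D → ((D = ∅) ∨ Wd P o h D ∨ Wd P o h (P.bd {h} ∆ D) ∨ D = P.bd {h}) →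
       P.wt (R \ {h}) ≤ ((P2.bd {f}).card : ℤ) - 4 := by
      intro D hD hD2
      rw [hD] at hff ⊢
      exact acct HS hh (fun h => hoR h.1) (by simp) _ hff.1 hff.2 hD2
    rw [← hqR] at hbf
    by_cases hM : h ∈ R
    · rw [bd_diff hM] at hbf
      by_cases hN : π (κ nn) = f <;> by_cases hN' : π mm = f
      · refine main (P.bd {h}) ?_ (by simp)
        rw [hbf]; simp only [hN, hN', hM]; ext x; simp [Finset.mem_symmDiff]
      · refine main (P.bd {h} ∆ Q3) ?_ (by right; right; left; rw [← symmDiff_assoc, symmDiff_self, bot_symmDiff]; exact u3)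
        rw [hbf]; simp only [hN, hN', hM]; ext x; simp [Finset.mem_symmDiff]; clear * - P; tauto
      · refine main (P.bd {h} ∆ Q1) ?_ (by right; right; left; rw [← symmDiff_assoc, symmDiff_self, bot_symmDiff]; exact u1)
        rw [hbf]; simp only [hN, hN', hM]; ext x; simp [Finset.mem_symmDiff]; clear * - P; tauto
      · refine main Q2 ?_ (by clear * - u1 u2 u3; tauto)
        rw [hbf, hQ]; simp only [hN, hN', hM]; ext x; simp [Finset.mem_symmDiff]; clear * - P; tauto
    · have : R \ {h} = R := by simp [hM]
      rw [← this] at hbf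
      rw [this] at hbf
      by_cases hN : π (κ nn) = f <;> by_cases hN' : π mm = f
      · refine main (Q1 ∆ Q3) ?_ (by
          right; right; left; convert u2 using 1; rw [hQ]
          ext x; simp only [Finset.mem_symmDiff]; clear * - P; tauto)
        rw [hbf, this]; simp only [hN, hN', hM]; ext x; simp [Finset.mem_symmDiff]; clear * - P; tauto
      · refine main Q1 ?_ (by clear * - u1 u2 u3; tauto)
        rw [hbf, this]; simp only [hN, hN', hM]; ext x; simp [Finset.mem_symmDiff]
      · refine main Q3 ?_ (by clear * - u1 u2 u3; tauto)
        rw [hbf, this]; simp only [hN, hN', hM]; ext x; simp [Finset.mem_symmDiff]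
      · refine main ∅ ?_ (by clear * - u1 u2 u3; tauto)
        rw [hbf, this]; simp only [hN, hN', hM]; ext x; simp [Finset.mem_symmDiff])
  -- counting
  have hwt : P.wt {o}ᶜ ≤ ((P.bd {o}).card : ℤ) - 4 := by omega
  have hF : ((Finset.univ.filter (fun f : P.F => f ≠ o)).card : ℤ) + 1 ≤ P.wt {o}ᶜ := by
    have e1 : ({o}ᶜ : Set P.F) = insert h ({o, h}ᶜ) := by
      ext x; simp
      by_cases hx : x = h
      · subst hx; simp [hh]
      · simp [hx]
    rw [e1, wt_insert (by simp), h6c]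
    have : ((Finset.univ.filter (· ∈ ({o, h}ᶜ : Set P.F))).card : ℤ) ≤ P.wt {o, h}ᶜ := by
      convert wt_card H (R := {o, h}ᶜ) (by simp)
    have e2 : (Finset.univ.filter (fun f : P.F => f ≠ o)) = insert h (Finset.univ.filter (· ∈ ({o, h}ᶜ : Set P.F))) := by
      ext x; simp
      by_cases hx : x = h
      · subst hx; simp [hh]
      · simp [hx]
    rw [e2, Finset.card_insert_of_notMem (by simp)]
    push_cast
    omega
  have hin := inner HS
  have hk9 := H.k9
  have hcnt : (P.A \ P.bd {o}).card ≤ 6 := by omega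
  have st : ∀ v, v ∉ P.Vs (P.bd {o}) → P.star P.A v ⊆ P.A \ P.bd {o} := by
    intro v hv e he
    rw [Gr.mem_star] at he
    rw [Finset.mem_sdiff]
    exact ⟨he.1, fun h => hv ⟨e, h, he.2⟩⟩
  have hdis : Disjoint (P.star P.A w3) (P.star P.A w5) := by
    rw [Finset.disjoint_left]
    intro e h1 h2
    rw [Gr.mem_star] at h1 h2
    obtain ⟨b, hj⟩ := h1.2.jn
    have : b = w5 := by
      have h3 := h2.2
      unfold Gr.inc at h3
      rcases hj with ⟨x, y⟩ | ⟨x, y⟩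
      · rcases h3 with h3 | h3
        · exact absurd (x.symm.trans h3) v35
        · exact y.symm.trans h3
      · rcases h3 with h3 | h3
        · exact x.symm.trans h3
        · exact absurd (y.symm.trans h3) v35
    subst this
    -- triangle e, e3, e4
    have hev : P.Ev (({e} : Finset E) ∆ {e3, e4}) := hj.od.sd (od_pair n34 j3 j4)
    have := H.tf.zero (Gr.sd_sub (by simpa using h1.1) (pair_sub a3 a4)) hev ((Gr.card_sd_le _ _).trans (by
      rw [Finset.card_pair n34]; simp))
    have : ({e} : Finset E) = {e3, e4} := symmDiff_eq_bot.1 this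
    have := congrArg Finset.card this
    rw [Finset.card_pair n34] at this; simp at this
  have d3 := deg3 HS h3 ⟨e2, Gr.mem_star.2 ⟨a2, j2.inc'⟩⟩
  have d5 := deg3 HS h5 ⟨e4, Gr.mem_star.2 ⟨a4, j4.inc'⟩⟩
  have hall : P.A \ P.bd {o} = P.star P.A w3 ∪ P.star P.A w5 := by
    symm
    apply Finset.eq_of_subset_of_card_le (Finset.union_subset (st _ h3) (st _ h5))
    rw [Finset.card_union_of_disjoint hdis]; omega
  -- every other vertex adjacent to w3 is on C
  have hC : ∀ x, x ≠ w3 → x ≠ w5 → (P.star P.A x).Nonempty → x ∈ P.Vs (P.bd {o}) := by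
    intro x x3 x5 hne
    by_contra hx
    have dx := deg3 HS hx hne
    have hsub := st x hx
    rw [hall] at hsub
    have hcl : ∀ v, x ≠ v → (P.star P.A x ∩ P.star P.A v).card ≤ 1 := by
      intro v hv
      rw [Finset.card_le_one]
      intro a ha b hb
      rw [Finset.mem_inter, Gr.mem_star, Gr.mem_star] at ha hb
      have jj : ∀ c, P.inc c x → P.inc c v → P.jn c x v := by
        intro c h1 h2
        unfold Gr.inc at h1 h2; unfold Gr.jn
        rcases h1 with h1 | h1 <;> rcases h2 with h2 | h2
        · exact absurd (h1.symm.trans h2) hv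
        · exact Or.inl ⟨h1, h2⟩
        · exact Or.inr ⟨h2, h1⟩
        · exact absurd (h1.symm.trans h2) hv
      exact H.tf.par ha.1.1 hb.1.1 (jj a ha.1.2 ha.2.2) (jj b hb.1.2 hb.2.2)
    have : P.star P.A x ⊆ (P.star P.A x ∩ P.star P.A w3) ∪ (P.star P.A x ∩ P.star P.A w5) := by
      intro e he
      have := hsub he
      simp only [Finset.mem_union, Finset.mem_inter] at *
      tauto
    have := (Finset.card_le_card this).trans (Finset.card_union_le _ _)
    have := hcl w3 x3
    have := hcl w5 x5
    omega
  have i2 : w2 ∈ P.Vs (P.bd {o}) := by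
    apply hC
    · exact H.tf.jn_ne a2 j2
    · rintro rfl
      exact Finset.disjoint_left.1 hdis (Gr.mem_star.2 ⟨a2, j2.inc'⟩) (Gr.mem_star.2 ⟨a2, j2.inc⟩)
    · exact ⟨e2, Gr.mem_star.2 ⟨a2, j2.inc⟩⟩
  have i4 : w4 ∈ P.Vs (P.bd {o}) := by
    apply hC
    · exact (H.tf.jn_ne a3 j3).symm
    · exact H.tf.jn_ne a4 j4
    · exact ⟨e3, Gr.mem_star.2 ⟨a3, j3.inc'⟩⟩
  exact n23 (H.no2 a2 a3 j2.symm j3 h3 i2 i4)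

end PM
end CF

end

open Set Topology

noncomputable section
namespace CF
set_option linter.all false
open scoped Classical symmDiff

namespace PM
variable {V E : Type} [Fintype V]
variable {n : ℕ} {P : PM V E} {o : P.F}

theorem ends {g : Gr V E} {e a b c d} (h : g.jn e a b) (h' : g.jn e c d) : (a = c ∧ b = d) ∨ (a = d ∧ b = c) := by
  unfold Gr.jn at *
  rcases h with ⟨rfl, rfl⟩ | ⟨rfl, rfl⟩ <;> rcases h' with ⟨rfl, rfl⟩ | ⟨rfl, rfl⟩ <;> simp

theorem inc_jn {g : Gr V E} {e a b c} (h : g.jn e a b) (h' : g.inc e c) : c = a ∨ c = b := by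
  unfold Gr.jn at *; unfold Gr.inc at *
  rcases h with ⟨rfl, rfl⟩ | ⟨rfl, rfl⟩ <;> rcases h' with rfl | rfl <;> simp

theorem short' (H : Cex n P o) {Z : Finset E} (hZ : Z ⊆ P.A) (hE : P.Ev Z) {e} (he : e ∈ Z) (hC : e ∉ P.bd {o})
    (h7 : Z.card ≤ 7) : ∃ g, g ≠ o ∧ P.bd {g} = Z ∧ 5 ≤ Z.card := by
  obtain ⟨R, ho, rfl⟩ := ex_bd_o hZ hE o
  obtain ⟨g, hg, rfl, h5⟩ := short H ho (by rintro rfl; simp [bd_empty] at he) (by rintro rfl; rw [bd_compl] at he; exact hC he) h7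
  exact ⟨g, hg, rfl, h5⟩

theorem tri {g : Gr V E} {A : Finset E} (hT : g.TF A) {e1 e2 e3 a b c} (h1 : e1 ∈ A) (h2 : e2 ∈ A) (h3 : e3 ∈ A)
    (j1 : g.jn e1 a b) (j2 : g.jn e2 b c) (j3 : g.jn e3 c a) : False := by
  have hE : g.Ev (({e1} : Finset E) ∆ {e2} ∆ {e3}) := (j1.od.trans j2.od).sd j3.symm.od
  have := hT.zero (Gr.sd_sub (Gr.sd_sub (by simpa) (by simpa)) (by simpa)) hE (by
    have := Gr.card_sd_le (({e1} : Finset E) ∆ {e2}) {e3}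
    have := Gr.card_sd_le ({e1} : Finset E) {e2}
    simp at *; omega)
  have h := congrArg Finset.card (symmDiff_eq_bot.1 this)
  have := Gr.card_sd ({e1} : Finset E) {e2}
  by_cases h12 : e1 = e2
  · subst h12; simp at h
  · have : ({e1} : Finset E) ∩ {e2} = ∅ := by ext x; simp; rintro rfl; exact h12
    simp_all

theorem quad (H : Cex n P o) {e1 e2 e3 e4 a b c d} (h1 : e1 ∈ P.A) (h2 : e2 ∈ P.A) (h3 : e3 ∈ P.A) (h4 : e4 ∈ P.A)
    (j1 : P.jn e1 a b) (j2 : P.jn e2 b c) (j3 : P.jn e3 c d) (j4 : P.jn e4 d a) (hac : a ≠ c) (hbd : b ≠ d)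
    (ha : a ∉ P.Vs (P.bd {o})) : False := by
  have hE : P.Ev (({e1} : Finset E) ∆ {e2} ∆ {e3} ∆ {e4}) := ((j1.od.trans j2.od).trans j3.od).sd j4.symm.od
  have c1 := Gr.card_sd_le (({e1} : Finset E) ∆ {e2} ∆ {e3}) {e4}
  have c2 := Gr.card_sd_le (({e1} : Finset E) ∆ {e2}) {e3}
  have c3 := Gr.card_sd_le ({e1} : Finset E) {e2}
  simp only [Finset.card_singleton] at c1 c2 c3
  have n12 : e1 ≠ e2 := by
    rintro rfl; rcases ends j1 j2 with h | h
    · exact H.tf.jn_ne h1 j1 h.1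
    · exact hac h.1
  have n13 : e1 ≠ e3 := by
    rintro rfl; rcases ends j1 j3 with h | h
    · exact hac h.1
    · exact H.tf.jn_ne h4 j4 h.1.symm
  have n14 : e1 ≠ e4 := by
    rintro rfl; rcases ends j1 j4 with h | h
    · exact H.tf.jn_ne h1 j4 h.1.symm
    · exact hbd h.2
  obtain ⟨g, hg, hg', h5⟩ := short' H (e := e1) (Gr.sd_sub (Gr.sd_sub (Gr.sd_sub (by simpa) (by simpa)) (by simpa)) (by simpa)) hE (by
    simp [Finset.mem_symmDiff, n12, n13, n14]) (fun h => ha ⟨e1, h, j1.inc⟩) (by omega)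
  omega

/-- two consecutive edges of a face `p` cannot lie together on another short cycle -/
theorem bad7 (H : Cex n P o) {p : P.F} {e f v} (hef : e ≠ f) (he : e ∈ P.bd {p}) (hf : f ∈ P.bd {p})
    (ie : P.inc e v) (jf : P.inc f v) (hv : v ∉ P.Vs (P.bd {o})) {Z : Finset E} (hZ : Z ⊆ P.A) (hE : P.Ev Z)
    (h7 : Z.card ≤ 7) (eZ : e ∈ Z) (fZ : f ∈ Z) {a} (aZ : a ∈ Z) (ap : a ∉ P.bd {p}) : False := by
  have eC : e ∉ P.bd {o} := fun h => hv ⟨e, h, ie⟩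
  obtain ⟨g, hg, rfl, h5⟩ := short' H hZ hE eZ eC h7
  have hgp : p ≠ g := by rintro rfl; exact ap aZ
  exact twin3 H.toStd hef ie jf (hZ eZ) (hZ fZ) hgp he hf eZ fZ eC

/-- splitting a 4-odd set -/
theorem odd4 {g : Gr V E} {Z : Finset E} {a b c d : V} (hab : a ≠ b) (hac : a ≠ c) (had : a ≠ d)
    (h : g.dg Z = dl a + dl b + dl c + dl d) : g.Cn Z a b ∨ g.Cn Z a c ∨ g.Cn Z a d := by
  by_contra hcon
  push Not at hcon
  obtain ⟨h1, h2, h3⟩ := hcon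
  let X : Set V := {v | g.Cn Z a v}
  have hX : ∀ e ∈ Z, g.s e ∈ X ↔ g.t e ∈ X := by
    intro e he
    have := Gr.cn_edge (g := g) he
    exact ⟨fun h => h.trans this, fun h => h.trans this.symm⟩
  have key : ∀ v, g.dg (Z.filter (fun e => g.s e ∈ X)) v = if v ∈ X then g.dg Z v else 0 := by
    intro v
    split_ifs with hv
    · have h1 : g.dg (Z.filter (fun e => ¬ g.s e ∈ X)) v = 0 := by
        apply Gr.dg_eq_zero_of_not_inc
        intro e he hi
        simp at he
        rcases hi with rfl | rfl
        · exact he.2 hv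
        · exact he.2 ((hX e he.1).2 hv)
      have h2 : g.dg Z v = g.dg (Z.filter (fun e => g.s e ∈ X)) v
          + g.dg (Z.filter (fun e => ¬ g.s e ∈ X)) v := by
        unfold Gr.dg
        rw [← Pi.add_apply, Finset.sum_filter_add_sum_filter_not]
      rw [h2, h1, add_zero]
    · apply Gr.dg_eq_zero_of_not_inc
      intro e he hi
      simp at he
      rcases hi with rfl | rfl
      · exact hv he.2
      · exact hv ((hX e he.1).1 he.2)
  have hs := dg_sum g (Z.filter (fun e => g.s e ∈ X))
  simp only [key, h] at hs
  have : ∀ v, (if v ∈ X then (dl a + dl b + dl c + dl d) v else 0) = (dl a v : ZMod 2) := by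
    intro v
    have a' : a ∈ X := Gr.Cn.refl _ _
    have b' : b ∉ X := h1
    have c' : c ∉ X := h2
    have d' : d ∉ X := h3
    simp only [Pi.add_apply, dl]
    by_cases hv : v ∈ X
    · have : v ≠ b := by rintro rfl; exact b' hv
      have : v ≠ c := by rintro rfl; exact c' hv
      have : v ≠ d := by rintro rfl; exact d' hv
      simp [*]
    · have : v ≠ a := by rintro rfl; exact hv a'
      simp [*]
  simp only [this, dl] at hs
  simp at hs

variable {p : P.F} {v1 v2 v3 v4 v5 x1 x2 x3 x4 : V} {e12 e23 e34 e45 e51 a1 a2 a3 a4 : E}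

/-- a pentagram configuration -/
structure Pent (P : PM V E) (o p : P.F) (v1 v2 v3 v4 v5 x1 x2 x3 x4 : V) (e12 e23 e34 e45 e51 a1 a2 a3 a4 : E) : Prop where
  hp : p ≠ o
  b : P.bd {p} = {e12, e23, e34, e45, e51}
  nd : [e12, e23, e34, e45, e51].Nodup
  j12 : P.jn e12 v1 v2
  j23 : P.jn e23 v2 v3
  j34 : P.jn e34 v3 v4
  j45 : P.jn e45 v4 v5
  j51 : P.jn e51 v5 v1
  k1 : P.jn a1 v1 x1
  k2 : P.jn a2 v2 x2
  k3 : P.jn a3 v3 x3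
  k4 : P.jn a4 v4 x4
  s1 : P.star P.A v1 = {e51, e12, a1}
  s2 : P.star P.A v2 = {e12, e23, a2}
  s3 : P.star P.A v3 = {e23, e34, a3}
  s4 : P.star P.A v4 = {e34, e45, a4}
  p1 : a1 ∉ P.bd {p}
  p2 : a2 ∉ P.bd {p}
  p3 : a3 ∉ P.bd {p}
  p4 : a4 ∉ P.bd {p}
  c1 : v1 ∉ P.Vs (P.bd {o})
  c2 : v2 ∉ P.Vs (P.bd {o})
  c3 : v3 ∉ P.Vs (P.bd {o})
  c4 : v4 ∉ P.Vs (P.bd {o})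
  c5 : v5 ∉ P.Vs (P.bd {o})
  d3 : x3 ∉ P.Vs (P.bd {o})
  d4 : x4 ∉ P.Vs (P.bd {o})

/-- derived facts -/
structure Pent2 (P : PM V E) (o p : P.F) (v1 v2 v3 v4 v5 x1 x2 x3 x4 : V) (e12 e23 e34 e45 e51 a1 a2 a3 a4 : E) : Prop extends
    Pent P o p v1 v2 v3 v4 v5 x1 x2 x3 x4 e12 e23 e34 e45 e51 a1 a2 a3 a4 where
  A12 : e12 ∈ P.A
  A23 : e23 ∈ P.A
  A34 : e34 ∈ P.A
  A45 : e45 ∈ P.A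
  A51 : e51 ∈ P.A
  B1 : a1 ∈ P.A
  B2 : a2 ∈ P.A
  B3 : a3 ∈ P.A
  B4 : a4 ∈ P.A
  ndv : [v1, v2, v3, v4, v5].Nodup
  ndx : [x2, x3, x4].Nodup
  y1 : x1 ∉ [v1, v2, v3, v4, v5]
  y2 : x2 ∉ [v1, v2, v3, v4, v5]
  y3 : x3 ∉ [v1, v2, v3, v4, v5]
  y4 : x4 ∉ [v1, v2, v3, v4, v5]
  nde : [e12, e23, e34, e45, e51, a1, a2, a3, a4].Nodup

theorem Pent.up (H : Cex n P o) (K : Pent P o p v1 v2 v3 v4 v5 x1 x2 x3 x4 e12 e23 e34 e45 e51 a1 a2 a3 a4) :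
    Pent2 P o p v1 v2 v3 v4 v5 x1 x2 x3 x4 e12 e23 e34 e45 e51 a1 a2 a3 a4 := by
  have A12 : e12 ∈ P.A := bd_sub {p} (by simp [K.b])
  have A23 : e23 ∈ P.A := bd_sub {p} (by simp [K.b])
  have A34 : e34 ∈ P.A := bd_sub {p} (by simp [K.b])
  have A45 : e45 ∈ P.A := bd_sub {p} (by simp [K.b])
  have A51 : e51 ∈ P.A := bd_sub {p} (by simp [K.b])
  have B1 : a1 ∈ P.A := (Gr.mem_star.1 (show _ ∈ P.star P.A v1 by rw [K.s1]; simp)).1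
  have B2 : a2 ∈ P.A := (Gr.mem_star.1 (show _ ∈ P.star P.A v2 by rw [K.s2]; simp)).1
  have B3 : a3 ∈ P.A := (Gr.mem_star.1 (show _ ∈ P.star P.A v3 by rw [K.s3]; simp)).1
  have B4 : a4 ∈ P.A := (Gr.mem_star.1 (show _ ∈ P.star P.A v4 by rw [K.s4]; simp)).1
  have hT := H.tf
  obtain ⟨hp, b, nd, j12, j23, j34, j45, j51, k1, k2, k3, k4, s1, s2, s3, s4, p1, p2, p3, p4, c1, c2, c3, c4, c5, d3, d4⟩ := id K
  have p1 := K.p1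
  have p2 := K.p2
  have p3 := K.p3
  have p4 := K.p4
  simp only [b, Finset.mem_insert, Finset.mem_singleton, not_or] at p1 p2 p3 p4
  have nd' := nd
  simp only [List.nodup_cons, List.mem_cons, List.not_mem_nil, or_false, not_or] at nd'
  obtain ⟨⟨m1, m2, m3, m4⟩, ⟨m5, m6, m7⟩, ⟨m8, m9⟩, m10, -⟩ := nd'
  have n12 := hT.jn_ne A12 j12
  have n23 := hT.jn_ne A23 j23
  have n34 := hT.jn_ne A34 j34
  have n45 := hT.jn_ne A45 j45
  have n51 := hT.jn_ne A51 j51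
  have n13 : v1 ≠ v3 := by rintro rfl; exact m1 (hT.par A12 A23 j12 j23.symm)
  have n24 : v2 ≠ v4 := by rintro rfl; exact m5 (hT.par A23 A34 j23 j34.symm)
  have n35 : v3 ≠ v5 := by rintro rfl; exact m8 (hT.par A34 A45 j34 j45.symm)
  have n14 : v1 ≠ v4 := by rintro rfl; exact m10 (hT.par A45 A51 j45 j51.symm)
  have n25 : v2 ≠ v5 := by rintro rfl; exact m4 (hT.par A12 A51 j12 j51.symm)
  have q1 := hT.jn_ne B1 k1
  have q2 := hT.jn_ne B2 k2
  have q3 := hT.jn_ne B3 k3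
  have q4 := hT.jn_ne B4 k4
  have y12 : x1 ≠ v2 := by rintro rfl; exact p1.1 (hT.par B1 A12 k1 j12)
  have y13 : x1 ≠ v3 := by rintro rfl; exact tri hT A12 A23 B1 j12 j23 k1.symm
  have y14 : x1 ≠ v4 := by rintro rfl; exact tri hT B1 A45 A51 k1 j45 j51
  have y15 : x1 ≠ v5 := by rintro rfl; exact p1.2.2.2.2 (hT.par B1 A51 k1 j51.symm)
  have y21 : x2 ≠ v1 := by rintro rfl; exact p2.1 (hT.par B2 A12 k2 j12.symm)
  have y23 : x2 ≠ v3 := by rintro rfl; exact p2.2.1 (hT.par B2 A23 k2 j23)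
  have y24 : x2 ≠ v4 := by rintro rfl; exact tri hT A23 A34 B2 j23 j34 k2.symm
  have y25 : x2 ≠ v5 := by rintro rfl; exact tri hT B2 A51 A12 k2 j51 j12
  have y31 : x3 ≠ v1 := by rintro rfl; exact tri hT A12 A23 B3 j12 j23 k3
  have y32 : x3 ≠ v2 := by rintro rfl; exact p3.2.1 (hT.par B3 A23 k3 j23.symm)
  have y34 : x3 ≠ v4 := by rintro rfl; exact p3.2.2.1 (hT.par B3 A34 k3 j34)
  have y35 : x3 ≠ v5 := by rintro rfl; exact tri hT A34 A45 B3 j34 j45 k3.symm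
  have y41 : x4 ≠ v1 := by rintro rfl; exact tri hT A45 A51 B4 j45 j51 k4.symm
  have y42 : x4 ≠ v2 := by rintro rfl; exact tri hT A23 A34 B4 j23 j34 k4
  have y43 : x4 ≠ v3 := by rintro rfl; exact p4.2.2.1 (hT.par B4 A34 k4 j34.symm)
  have y45 : x4 ≠ v5 := by rintro rfl; exact p4.2.2.2.1 (hT.par B4 A45 k4 j45)
  have x23 : x2 ≠ x3 := by rintro rfl; exact tri hT B2 B3 A23 k2 k3.symm j23.symm
  have x34 : x3 ≠ x4 := by rintro rfl; exact tri hT B3 B4 A34 k3 k4.symm j34.symm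
  have x24 : x2 ≠ x4 := by rintro rfl; exact quad H A23 A34 B4 B2 j23 j34 k4 k2.symm n24 y23.symm c2
  have f : ∀ {a b v w x y}, P.jn a v x → P.jn b w y → v ≠ w → x ≠ w → a ≠ b := by
    rintro a b v w x y h1 h2 h3 h4 rfl
    rcases ends h1 h2 with h | h
    · exact h3 h.1
    · exact h4 h.2
  have z12 := f k1 k2 n12 y12
  have z13 := f k1 k3 n13 y13
  have z14 := f k1 k4 n14 y14
  have z23 := f k2 k3 n23 y23
  have z24 := f k2 k4 n24 y24
  have z34 := f k3 k4 n34 y34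
  refine ⟨K, A12, A23, A34, A45, A51, B1, B2, B3, B4, ?_, ?_, ?_, ?_, ?_, ?_, ?_⟩
  · simp [*]; exact n51.symm
  · simp [*]
  · simp [*, q1.symm]
  · simp [*, q2.symm]
  · simp [*, q3.symm]
  · simp [*, q4.symm]
  · obtain ⟨r1, r2, r3, r4, r5⟩ := p1
    obtain ⟨t1, t2, t3, t4, t5⟩ := p2
    obtain ⟨u1, u2, u3, u4, u5⟩ := p3
    obtain ⟨w1, w2, w3, w4, w5⟩ := p4
    simp only [List.nodup_cons, List.mem_cons, List.not_mem_nil, or_false, not_or]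
    refine ⟨⟨m1, m2, m3, m4, Ne.symm r1, Ne.symm t1, Ne.symm u1, Ne.symm w1⟩, ⟨m5, m6, m7, Ne.symm r2, Ne.symm t2, Ne.symm u2, Ne.symm w2⟩,
      ⟨m8, m9, Ne.symm r3, Ne.symm t3, Ne.symm u3, Ne.symm w3⟩, ⟨m10, Ne.symm r4, Ne.symm t4, Ne.symm u4, Ne.symm w4⟩,
      ⟨Ne.symm r5, Ne.symm t5, Ne.symm u5, Ne.symm w5⟩, ⟨z12, z13, z14⟩, ⟨z23, z24⟩, z34, not_false, List.nodup_nil⟩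

end PM
end CF

end

open Set Topology

noncomputable section
namespace CF
set_option linter.all false
open scoped Classical symmDiff

namespace PM
variable {V E : Type} [Fintype V]
variable {n : ℕ} {P : PM V E} {o : P.F}

theorem star3 (hT : P.TF P.A) {v x y z} (hs : P.star P.A v = {x, y, z}) (hxy : x ≠ y) {Z : Finset E} (hZ : Z ⊆ P.A)
    (hE : P.Ev Z) (hz : z ∉ Z) : x ∈ Z ↔ y ∈ Z := by
  have h1 := Gr.ev_star (hT.mono hZ).nl hE v
  have h2 : P.star Z v = ({x, y} : Finset E).filter (· ∈ Z) := by
    ext e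
    have : e ∈ P.star P.A v ↔ e ∈ ({x, y, z} : Finset E) := by rw [hs]
    simp only [Gr.mem_star, Finset.mem_insert, Finset.mem_singleton, Finset.mem_filter] at *
    constructor
    · rintro ⟨h, h'⟩
      rcases this.1 ⟨hZ h, h'⟩ with rfl | rfl | rfl
      · simp [h]
      · simp [h]
      · exact absurd h hz
    · rintro ⟨rfl | rfl, h⟩
      · exact ⟨h, (this.2 (by simp)).2⟩
      · exact ⟨h, (this.2 (by simp)).2⟩
  rw [h2] at h1
  by_cases hx : x ∈ Z <;> by_cases hy : y ∈ Z <;> simp_all [Finset.filter_insert, Finset.filter_singleton]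

theorem od3 {g : Gr V E} {e f h a b c d} (hn : [e, f, h].Nodup) (j1 : g.jn e a b) (j2 : g.jn f b c) (j3 : g.jn h c d) :
    g.Od ({e, f, h} : Finset E) a d := by
  simp at hn
  have := (od_pair (g := g) hn.1.1 j1 j2).trans j3.od
  rw [Gr.sd_union (by simp; tauto)] at this
  convert this using 1
  ext x; simp

variable {p : P.F} {v1 v2 v3 v4 v5 x1 x2 x3 x4 : V} {e12 e23 e34 e45 e51 a1 a2 a3 a4 : E}

section
theorem Pent2.odT1 (H : Cex n P o) (K : Pent2 P o p v1 v2 v3 v4 v5 x1 x2 x3 x4 e12 e23 e34 e45 e51 a1 a2 a3 a4) : P.Od ({e51, e12, a2} : Finset E) v5 x2 := by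
  have hn := K.nde; simp at hn
  exact od3 (by clear * - hn; simp; tauto) K.j51 K.j12 K.k2

theorem Pent2.odT2 (H : Cex n P o) (K : Pent2 P o p v1 v2 v3 v4 v5 x1 x2 x3 x4 e12 e23 e34 e45 e51 a1 a2 a3 a4) : P.Od ({a3, e34, a4} : Finset E) x3 x4 := by
  have hn := K.nde; simp at hn
  exact od3 (by clear * - hn; simp; tauto) K.k3.symm K.j34 K.k4

theorem Pent2.pat (H : Cex n P o) (K : Pent2 P o p v1 v2 v3 v4 v5 x1 x2 x3 x4 e12 e23 e34 e45 e51 a1 a2 a3 a4) {Z : Finset E} (hZ : Z ⊆ P.A) (hE : P.Ev Z) (h1 : a1 ∉ Z) (h23 : e23 ∉ Z) (h45 : e45 ∉ Z) :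
    (e51 ∈ Z ↔ e12 ∈ Z) ∧ (e12 ∈ Z ↔ a2 ∈ Z) ∧ (a3 ∈ Z ↔ e34 ∈ Z) ∧ (e34 ∈ Z ↔ a4 ∈ Z) := by
  have hn := K.nde; simp at hn
  refine ⟨star3 H.tf K.s1 (by clear * - hn; tauto) hZ hE h1, star3 H.tf (z := e23) (K.s2.trans ?_) (by clear * - hn; tauto) hZ hE h23,
    star3 H.tf (z := e23) (K.s3.trans ?_) (by clear * - hn; tauto) hZ hE h23, star3 H.tf (z := e45) (K.s4.trans ?_) (by clear * - hn; tauto) hZ hE h45⟩ <;>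
  · ext x; simp; tauto

/-- no short cycle through `T1` -/
theorem Pent2.noT1 (H : Cex n P o) (K : Pent2 P o p v1 v2 v3 v4 v5 x1 x2 x3 x4 e12 e23 e34 e45 e51 a1 a2 a3 a4) {Z : Finset E} (hZ : Z ⊆ P.A) (hE : P.Ev Z) (h1 : e51 ∈ Z) (h2 : e12 ∈ Z) (h3 : a2 ∈ Z) : 8 ≤ Z.card := by
  by_contra hlt
  have hn := K.nde; simp at hn
  exact bad7 H (p := p) (e := e51) (f := e12) (v := v1) (by clear * - hn; tauto) (by simp [K.b]) (by simp [K.b]) K.j51.inc' K.j12.inc K.c1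
    hZ hE (by omega) h1 h2 h3 K.p2

theorem Pent2.lemY (H : Cex n P o) (K : Pent2 P o p v1 v2 v3 v4 v5 x1 x2 x3 x4 e12 e23 e34 e45 e51 a1 a2 a3 a4) {Z : Finset E} (hZ : Z ⊆ P.A) (hD : ∀ e ∈ Z, e ∉ ({e12, e23, e34, e45, e51, a1, a2, a3, a4} : Finset E))
    (hE : P.Ev (Z ∆ (({e51, e12, a2} : Finset E) ∆ {a3, e34, a4}))) : 5 ≤ Z.card := by
  have hn := K.nde; simp only [List.nodup_cons, List.mem_cons, List.not_mem_nil, or_false, not_or] at hn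
  have hx := K.ndx; simp at hx
  have y2 := K.y2; simp at y2
  have y3 := K.y3; simp at y3
  have y4 := K.y4; simp at y4
  have hdg : P.dg Z = dl v5 + dl x2 + dl x3 + dl x4 := by
    have h1 := Pent2.odT1 H K
    have h2 := Pent2.odT2 H K
    unfold Gr.Od at h1 h2
    unfold Gr.Ev at hE
    rw [Gr.dg_symm, Gr.dg_symm, h1, h2] at hE
    rw [z2c.1 hE, add_assoc, add_assoc, add_assoc]
  have hdis : ∀ W : Finset E, W ⊆ {e12, e23, e34, e45, e51, a1, a2, a3, a4} → ∀ Y ⊆ Z, Disjoint Y W := by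
    intro W hW Y hY
    rw [Finset.disjoint_left]
    intro x h1 h2
    exact hD x (hY h1) (hW h2)
  have key : ∀ (W : Finset E) (a b : V), W ⊆ {e12, e23, e34, e45, e51, a1, a2, a3, a4} → P.Od W a b → ∀ Y ⊆ Z, P.Od Y a b →
      W ∪ Y ⊆ P.A ∧ P.Ev (W ∪ Y) ∧ (W ∪ Y).card = W.card + Y.card := by
    intro W a b hW hO Y hY hO'
    have hd := (hdis W hW Y hY).symm
    refine ⟨Finset.union_subset (hW.trans ?_) (hY.trans hZ), ?_, Finset.card_union_of_disjoint hd⟩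
    · intro x; simp only [Finset.mem_insert, Finset.mem_singleton]
      rintro (rfl | rfl | rfl | rfl | rfl | rfl | rfl | rfl | rfl)
      exacts [K.A12, K.A23, K.A34, K.A45, K.A51, K.B1, K.B2, K.B3, K.B4]
    · rw [← Gr.sd_union hd]; exact hO.sd hO'
  have sub : ∀ {W : Finset E}, (∀ x ∈ W, x ∈ ({e12, e23, e34, e45, e51, a1, a2, a3, a4} : Finset E)) → 
     W ⊆ ({e12, e23, e34, e45, e51, a1, a2, a3, a4} : Finset E) := fun h => h
  rcases odd4 (Ne.symm y2.2.2.2.2) (Ne.symm y3.2.2.2.2) (Ne.symm y4.2.2.2.2) hdg with ⟨Y, hY, hO⟩ | ⟨Y, hY, hO⟩ | ⟨Y, hY, hO⟩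
  · obtain ⟨k1, k2, k3⟩ := key {e51, e12, a2} _ _ (by clear * - P; intro x; simp; tauto) (Pent2.odT1 H K) Y hY hO
    have := Pent2.noT1 H K k1 k2 (by simp) (by simp) (by simp)
    have : ({e51, e12, a2} : Finset E).card ≤ 3 := Finset.card_le_three
    have := Finset.card_le_card hY
    omega
  · have hod : P.Od ({e45, e34, a3} : Finset E) v5 x3 := od3 (by clear * - hn; simp; tauto) K.j45.symm K.j34.symm K.k3
    obtain ⟨k1, k2, k3⟩ := key _ _ _ (by clear * - P; intro x; simp; tauto) hod Y hY hO
    have : ({e45, e34, a3} : Finset E).card ≤ 3 := Finset.card_le_three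
    have := Finset.card_le_card hY
    by_contra hlt
    exact bad7 H (p := p) (e := e45) (f := e34) (v := v4) (a := a3) (by clear * - hn; tauto) (by simp [K.b]) (by simp [K.b]) K.j45.inc K.j34.inc' K.c4
      k1 k2 (by omega) (by simp) (by simp) (by simp) K.p3
  · have hod : P.Od ({e45, a4} : Finset E) v5 x4 := od_pair (by clear * - hn; tauto) K.j45.symm K.k4
    obtain ⟨k1, k2, k3⟩ := key _ _ _ (by clear * - P; intro x; simp; tauto) hod Y hY hO
    have hod2 : P.Od ({a2, e23, a3} : Finset E) x2 x3 := od3 (by clear * - hn; simp; tauto) K.k2.symm K.j23 K.k3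
    have hO2 : P.Od (Z \ Y) x2 x3 := by
      rw [← Gr.sd_of_sub hY]
      unfold Gr.Od at *
      rw [Gr.dg_symm, hdg, hO]
      have h1 := z2 (dl v5); have h2 := z2 (dl x4)
      calc dl v5 + dl x2 + dl x3 + dl x4 + (dl v5 + dl x4) = (dl v5 + dl v5) + (dl x4 + dl x4) + (dl x2 + dl x3) := by abel
        _ = _ := by rw [h1, h2]; simp
    obtain ⟨l1, l2, l3⟩ := key _ _ _ (by clear * - P; intro x; simp; tauto) hod2 (Z \ Y) Finset.sdiff_subset hO2
    have q1 : ({e45, a4} : Finset E).card ≤ 2 := Finset.card_le_two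
    have q2 : ({a2, e23, a3} : Finset E).card ≤ 3 := Finset.card_le_three
    have q3 := Finset.card_sdiff_add_card_eq_card hY
    by_contra hlt
    obtain ⟨-, -, -, r1⟩ := short' H k1 k2 (e := e45) (by simp) (fun h => K.c4 ⟨_, h, K.j45.inc⟩) (by omega)
    obtain ⟨-, -, -, r2⟩ := short' H l1 l2 (e := e23) (by simp) (fun h => K.c2 ⟨_, h, K.j23.inc⟩) (by omega)
    omega

end
end PM
end CF

end

open Set Topology

noncomputable section
namespace CF
set_option linter.all false
theorem PM.col1 : ∀ x c : Fin 3, ∃ p q : Fin 3, p ≠ x ∧ p ≠ c ∧ p ≠ q ∧ q ≠ c := by decide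
theorem PM.col2 : ∀ q c d : Fin 3, q ≠ c → ∃ r s : Fin 3, q ≠ r ∧ r ≠ d ∧ r ≠ s ∧ s ≠ d ∧ s ≠ c := by decide
theorem PM.col (x c d : Fin 3) : ∃ p q r s : Fin 3, p ≠ x ∧ p ≠ c ∧ p ≠ q ∧ q ≠ c ∧ q ≠ r ∧ r ≠ d ∧ r ≠ s ∧ s ≠ d ∧ s ≠ c := by
  obtain ⟨p, q, h1, h2, h3, h4⟩ := PM.col1 x c
  obtain ⟨r, s, h5⟩ := PM.col2 q c d h4
  exact ⟨p, q, r, s, h1, h2, h3, h4, h5⟩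

open scoped Classical symmDiff

namespace PM
variable {V E : Type} [Fintype V]
variable {n : ℕ} {P : PM V E} {o : P.F}

variable {p : P.F} {v1 v2 v3 v4 v5 x1 x2 x3 x4 : V} {e12 e23 e34 e45 e51 a1 a2 a3 a4 : E}

/-- vertex identification of the pentagon reduction -/
def pr (v1 v2 v3 v4 v5 x2 x3 x4 : V) (x : V) : V :=
  if x = v5 ∨ x = v1 ∨ x = v2 then x2 else if x = v3 ∨ x = v4 ∨ x = x4 then x3 else x

/-- deleted edges of the pentagon reduction -/
def D9 (e12 e23 e34 e45 e51 a1 a2 a3 a4 : E) : Finset E := {e12, e23, e34, e45, e51, a1, a2, a3, a4}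

/-- contracted edges -/
def T6 (e12 e34 e51 a2 a3 a4 : E) : Finset E := {e51, e12, a2} ∪ {a3, e34, a4}

theorem Pent2.pr_eq (H : Cex n P o) (K : Pent2 P o p v1 v2 v3 v4 v5 x1 x2 x3 x4 e12 e23 e34 e45 e51 a1 a2 a3 a4) :
    pr v1 v2 v3 v4 v5 x2 x3 x4 v5 = x2 ∧ pr v1 v2 v3 v4 v5 x2 x3 x4 v1 = x2 ∧ pr v1 v2 v3 v4 v5 x2 x3 x4 v2 = x2 ∧
    pr v1 v2 v3 v4 v5 x2 x3 x4 v3 = x3 ∧ pr v1 v2 v3 v4 v5 x2 x3 x4 v4 = x3 ∧ pr v1 v2 v3 v4 v5 x2 x3 x4 x4 = x3 ∧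
    pr v1 v2 v3 v4 v5 x2 x3 x4 x2 = x2 ∧ pr v1 v2 v3 v4 v5 x2 x3 x4 x3 = x3 := by
  have h1 := K.ndv; have h2 := K.ndx; have h3 := K.y2; have h4 := K.y3; have h5 := K.y4
  clear K H
  simp only [List.nodup_cons, List.mem_cons, List.not_mem_nil, or_false, not_or] at h1 h2 h3 h4 h5
  unfold pr
  refine ⟨?_, ?_, ?_, ?_, ?_, ?_, ?_, ?_⟩
  · simp
  · simp
  · simp
  · rw [if_neg (by rintro (h | h | h) <;> simp_all), if_pos (by simp)]
  · rw [if_neg (by rintro (h | h | h) <;> simp_all), if_pos (by simp)]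
  · rw [if_neg (by rintro (h | h | h) <;> simp_all), if_pos (by simp)]
  · rw [if_neg (by rintro (h | h | h) <;> simp_all), if_neg (by rintro (h | h | h) <;> simp_all)]
  · rw [if_neg (by rintro (h | h | h) <;> simp_all), if_neg (by rintro (h | h | h) <;> simp_all)]

theorem pr_id {x : V} (h : x ∉ [v1, v2, v3, v4, v5, x4]) : pr v1 v2 v3 v4 v5 x2 x3 x4 x = x := by
  simp only [List.mem_cons, List.not_mem_nil, or_false, not_or] at h
  unfold pr
  rw [if_neg (by tauto), if_neg (by tauto)]

theorem Pent2.pr_C (H : Cex n P o) (K : Pent2 P o p v1 v2 v3 v4 v5 x1 x2 x3 x4 e12 e23 e34 e45 e51 a1 a2 a3 a4) {x}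
    (hx : x ∈ P.Vs (P.bd {o})) : pr v1 v2 v3 v4 v5 x2 x3 x4 x = x := by
  apply pr_id
  simp only [List.mem_cons, List.not_mem_nil, or_false, not_or]
  refine ⟨?_, ?_, ?_, ?_, ?_, ?_⟩ <;> rintro rfl
  exacts [K.c1 hx, K.c2 hx, K.c3 hx, K.c4 hx, K.c5 hx, K.d4 hx]

theorem Pent2.mem (H : Cex n P o) (K : Pent2 P o p v1 v2 v3 v4 v5 x1 x2 x3 x4 e12 e23 e34 e45 e51 a1 a2 a3 a4) {e}
    (he : e ∈ D9 e12 e23 e34 e45 e51 a1 a2 a3 a4) : e ∈ P.A ∧ e ∉ P.bd {o} := by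
  simp only [D9, Finset.mem_insert, Finset.mem_singleton] at he
  rcases he with rfl | rfl | rfl | rfl | rfl | rfl | rfl | rfl | rfl
  exacts [⟨K.A12, fun h => K.c1 ⟨_, h, K.j12.inc⟩⟩, ⟨K.A23, fun h => K.c2 ⟨_, h, K.j23.inc⟩⟩, 
    ⟨K.A34, fun h => K.c3 ⟨_, h, K.j34.inc⟩⟩, ⟨K.A45, fun h => K.c4 ⟨_, h, K.j45.inc⟩⟩, ⟨K.A51, fun h => K.c5 ⟨_, h, K.j51.inc⟩⟩,
    ⟨K.B1, fun h => K.c1 ⟨_, h, K.k1.inc⟩⟩, ⟨K.B2, fun h => K.c2 ⟨_, h, K.k2.inc⟩⟩, ⟨K.B3, fun h => K.c3 ⟨_, h, K.k3.inc⟩⟩,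
    ⟨K.B4, fun h => K.c4 ⟨_, h, K.k4.inc⟩⟩]

theorem T6_sub : T6 e12 e34 e51 a2 a3 a4 ⊆ D9 e12 e23 e34 e45 e51 a1 a2 a3 a4 := by
  intro x; simp only [T6, D9, Finset.mem_union, Finset.mem_insert, Finset.mem_singleton]; tauto

/-- edges at `v1..v4` are deleted -/
theorem Pent2.inD (H : Cex n P o) (K : Pent2 P o p v1 v2 v3 v4 v5 x1 x2 x3 x4 e12 e23 e34 e45 e51 a1 a2 a3 a4) {e}
    (he : e ∈ P.A) (h : P.inc e v1 ∨ P.inc e v2 ∨ P.inc e v3 ∨ P.inc e v4) : e ∈ D9 e12 e23 e34 e45 e51 a1 a2 a3 a4 := by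
  have s1 := K.s1; have s2 := K.s2; have s3 := K.s3; have s4 := K.s4
  simp only [D9, Finset.mem_insert, Finset.mem_singleton]
  rcases h with h | h | h | h
  · have : e ∈ P.star P.A v1 := Gr.mem_star.2 ⟨he, h⟩
    rw [s1] at this; simp only [Finset.mem_insert, Finset.mem_singleton] at this; clear * - this; tauto
  · have : e ∈ P.star P.A v2 := Gr.mem_star.2 ⟨he, h⟩
    rw [s2] at this; simp only [Finset.mem_insert, Finset.mem_singleton] at this; clear * - this; tauto
  · have : e ∈ P.star P.A v3 := Gr.mem_star.2 ⟨he, h⟩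
    rw [s3] at this; simp only [Finset.mem_insert, Finset.mem_singleton] at this; clear * - this; tauto
  · have : e ∈ P.star P.A v4 := Gr.mem_star.2 ⟨he, h⟩
    rw [s4] at this; simp only [Finset.mem_insert, Finset.mem_singleton] at this; clear * - this; tauto

theorem Pent2.cases (H : Cex n P o) (K : Pent2 P o p v1 v2 v3 v4 v5 x1 x2 x3 x4 e12 e23 e34 e45 e51 a1 a2 a3 a4)
    {Y : Finset E} (hY : Y ⊆ (P.A \ D9 e12 e23 e34 e45 e51 a1 a2 a3 a4) ∪ T6 e12 e34 e51 a2 a3 a4) (hE : P.Ev Y) :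
    (Y ∩ T6 e12 e34 e51 a2 a3 a4 = ∅) ∨ Y ∩ T6 e12 e34 e51 a2 a3 a4 = {e51, e12, a2} ∨
    Y ∩ T6 e12 e34 e51 a2 a3 a4 = {a3, e34, a4} ∨ Y ∩ T6 e12 e34 e51 a2 a3 a4 = T6 e12 e34 e51 a2 a3 a4 := by
  have hn := K.nde
  simp only [List.nodup_cons, List.mem_cons, List.not_mem_nil, or_false, not_or] at hn
  have hYA : Y ⊆ P.A := hY.trans (Finset.union_subset Finset.sdiff_subset (T6_sub.trans fun e he => (K.mem H he).1))
  have no : ∀ e ∈ D9 e12 e23 e34 e45 e51 a1 a2 a3 a4, e ∉ T6 e12 e34 e51 a2 a3 a4 → e ∉ Y := by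
    intro e h1 h2 h3
    have := hY h3
    simp only [Finset.mem_union, Finset.mem_sdiff] at this
    tauto
  have h := K.pat H hYA hE (no _ (by simp [D9]) (by simp only [T6, Finset.mem_union, Finset.mem_insert, Finset.mem_singleton]; clear * - hn; grind))
    (no _ (by simp [D9]) (by simp only [T6, Finset.mem_union, Finset.mem_insert, Finset.mem_singleton]; clear * - hn; grind))
    (no _ (by simp [D9]) (by simp only [T6, Finset.mem_union, Finset.mem_insert, Finset.mem_singleton]; clear * - hn; grind))
  clear * - h
  unfold T6
  by_cases h1 : e12 ∈ Y <;> by_cases h2 : e34 ∈ Y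
  · right; right; right
    ext x; simp only [Finset.mem_inter, Finset.mem_union, Finset.mem_insert, Finset.mem_singleton]; grind
  · right; left
    ext x; simp only [Finset.mem_inter, Finset.mem_union, Finset.mem_insert, Finset.mem_singleton]; grind
  · right; right; left
    ext x; simp only [Finset.mem_inter, Finset.mem_union, Finset.mem_insert, Finset.mem_singleton]; grind
  · left
    ext x; simp only [Finset.mem_inter, Finset.mem_union, Finset.mem_insert, Finset.mem_singleton]; grind

theorem Pent2.cnT (H : Cex n P o) (K : Pent2 P o p v1 v2 v3 v4 v5 x1 x2 x3 x4 e12 e23 e34 e45 e51 a1 a2 a3 a4) (x : V) :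
    P.Cn (T6 e12 e34 e51 a2 a3 a4) x (pr v1 v2 v3 v4 v5 x2 x3 x4 x) := by
  have ed : ∀ {e a b}, e ∈ T6 e12 e34 e51 a2 a3 a4 → P.jn e a b → P.Cn (T6 e12 e34 e51 a2 a3 a4) a b :=
    fun {e a b} h hj => ⟨{e}, by simpa using h, hj.od⟩
  have t1 := ed (e := a2) (by simp [T6]) K.k2
  have t2 := ed (e := e12) (by simp [T6]) K.j12
  have t3 := ed (e := e51) (by simp [T6]) K.j51
  have t4 := ed (e := a3) (by simp [T6]) K.k3
  have t5 := ed (e := e34) (by simp [T6]) K.j34.symm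
  have t6 := ed (e := a4) (by simp [T6]) K.k4.symm
  obtain ⟨r5, r1, r2, r3, r4, rx4, rx2, rx3⟩ := K.pr_eq H
  by_cases h : x ∈ [v1, v2, v3, v4, v5, x4]
  · simp only [List.mem_cons, List.not_mem_nil, or_false] at h
    rcases h with rfl | rfl | rfl | rfl | rfl | rfl
    · rw [r1]; exact t2.trans t1
    · rw [r2]; exact t1
    · rw [r3]; exact t4
    · rw [r4]; exact t5.trans t4
    · rw [r5]; exact t3.trans (t2.trans t1)
    · rw [rx4]; exact t6.trans (t5.trans t4)
  · rw [pr_id h]; exact Gr.Cn.refl _ _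

theorem Pent2.eqT (H : Cex n P o) (K : Pent2 P o p v1 v2 v3 v4 v5 x1 x2 x3 x4 e12 e23 e34 e45 e51 a1 a2 a3 a4) {e}
    (he : e ∈ T6 e12 e34 e51 a2 a3 a4) : pr v1 v2 v3 v4 v5 x2 x3 x4 (P.s e) = pr v1 v2 v3 v4 v5 x2 x3 x4 (P.t e) := by
  obtain ⟨r5, r1, r2, r3, r4, rx4, rx2, rx3⟩ := K.pr_eq H
  have ed : ∀ {e a b}, pr v1 v2 v3 v4 v5 x2 x3 x4 a = pr v1 v2 v3 v4 v5 x2 x3 x4 b → P.jn e a b → 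
    pr v1 v2 v3 v4 v5 x2 x3 x4 (P.s e) = pr v1 v2 v3 v4 v5 x2 x3 x4 (P.t e) := by
    rintro e a b h (⟨h1, h2⟩ | ⟨h1, h2⟩) <;> rw [h1, h2, h]
  simp only [T6, Finset.mem_union, Finset.mem_insert, Finset.mem_singleton] at he
  rcases he with (rfl | rfl | rfl) | rfl | rfl | rfl
  · exact ed (by rw [r5, r1]) K.j51
  · exact ed (by rw [r2, r1]) K.j12
  · exact ed (by rw [r2, rx2]) K.k2
  · exact ed (by rw [r3, rx3]) K.k3
  · exact ed (by rw [r3, r4]) K.j34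
  · exact ed (by rw [r4, rx4]) K.k4

theorem Pent2.dT (H : Cex n P o) (K : Pent2 P o p v1 v2 v3 v4 v5 x1 x2 x3 x4 e12 e23 e34 e45 e51 a1 a2 a3 a4) :
    Disjoint ({e51, e12, a2} : Finset E) {a3, e34, a4} ∧ ({e51, e12, a2} : Finset E).card = 3 ∧ 
    ({a3, e34, a4} : Finset E).card = 3 ∧ (T6 e12 e34 e51 a2 a3 a4).card = 6 := by
  have hn := K.nde
  simp only [List.nodup_cons, List.mem_cons, List.not_mem_nil, or_false, not_or] at hn
  have h1 : Disjoint ({e51, e12, a2} : Finset E) {a3, e34, a4} := by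
    rw [Finset.disjoint_left]; clear * - hn; intro x; simp only [Finset.mem_insert, Finset.mem_singleton]; grind
  have h2 : ({e51, e12, a2} : Finset E).card = 3 := Finset.card_eq_three.2 ⟨_, _, _, by grind, by grind, by grind, rfl⟩
  have h3 : ({a3, e34, a4} : Finset E).card = 3 := Finset.card_eq_three.2 ⟨_, _, _, by grind, by grind, by grind, rfl⟩
  refine ⟨h1, h2, h3, ?_⟩
  unfold T6
  rw [Finset.card_union_of_disjoint h1, h2, h3]

/-- short even sets after identification -/
theorem Pent2.tf (H : Cex n P o) (K : Pent2 P o p v1 v2 v3 v4 v5 x1 x2 x3 x4 e12 e23 e34 e45 e51 a1 a2 a3 a4) 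
    {g' : Gr V E} (hg : g' = Gr.mk (pr v1 v2 v3 v4 v5 x2 x3 x4 ∘ P.s) (pr v1 v2 v3 v4 v5 x2 x3 x4 ∘ P.t)) 
    (Z : Finset E) (hZ : Z ⊆ P.A \ D9 e12 e23 e34 e45 e51 a1 a2 a3 a4) (hE : g'.Ev Z) (hne : Z ≠ ∅) (hc : Z.card ≤ 3) :
    ∃ e ∈ Z, ∃ e' ∈ Z, e ≠ e' ∧ e ∉ P.bd {o} ∧ ∃ a b, g'.jn e a b ∧ g'.jn e' a b := by
  have hn := K.nde
  simp only [List.nodup_cons, List.mem_cons, List.not_mem_nil, or_false, not_or] at hn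
  obtain ⟨d1, d2, d3, d4⟩ := K.dT H
  obtain ⟨T', hT', hk⟩ := minor_key P.toGr _ _ (K.cnT H) Z
  rw [← hg, hE] at hk
  rw [← Gr.dg_symm] at hk
  have hZA : Z ⊆ P.A := hZ.trans Finset.sdiff_subset
  have hZD : Disjoint Z (D9 e12 e23 e34 e45 e51 a1 a2 a3 a4) := (Finset.sdiff_disjoint).mono_left hZ
  have hdj : Disjoint Z T' := hZD.mono_right (hT'.trans T6_sub)
  have hdT : Z ∩ T6 e12 e34 e51 a2 a3 a4 = ∅ := Finset.disjoint_iff_inter_eq_empty.1 (hZD.mono_right T6_sub)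
  rw [Gr.sd_union hdj] at hk
  have hin : (Z ∪ T') ∩ T6 e12 e34 e51 a2 a3 a4 = T' := by
    rw [Finset.union_inter_distrib_right, hdT, Finset.inter_eq_left.2 hT']; simp
  have hcs := K.cases H (Y := Z ∪ T') (Finset.union_subset_union hZ hT') hk
  rw [hin] at hcs
  have hYA : Z ∪ T' ⊆ P.A := Finset.union_subset hZA (hT'.trans (T6_sub.trans fun e he => (K.mem H he).1))
  have hYc := Finset.card_union_of_disjoint hdj
  rcases hcs with rfl | rfl | rfl | rfl
  · simp at hk
    exact absurd (H.tf.zero hZA hk hc) hne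
  · have := K.noT1 H hYA hk (by simp) (by simp) (by simp)
    omega
  · have hm : ∀ e ∈ Z, e ∉ D9 e12 e23 e34 e45 e51 a1 a2 a3 a4 := fun e h => (Finset.mem_sdiff.1 (hZ h)).2
    obtain ⟨g, hgo, hb, h5⟩ := short' H hYA hk (e := a3) (by simp) (K.mem H (by simp [D9])).2 (by omega)
    have hO : P.Od Z x3 x4 := by
      have h2 := K.odT2 H
      have : P.Od ((Z ∪ {a3, e34, a4}) ∆ {a3, e34, a4}) x3 x4 := by
        rw [symmDiff_comm]; exact h2.sdEv hk
      rwa [← Gr.sd_union hdj, symmDiff_symmDiff_cancel_right] at this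
    obtain ⟨r5, r1, r2, r3, r4, rx4, rx2, rx3⟩ := K.pr_eq H
    obtain h2 | h3 : Z.card = 2 ∨ Z.card = 3 := by omega
    · obtain ⟨e, f, c, hef, hZe, je, jf⟩ := path2 H.tf hZA hO h2
      refine ⟨e, by simp [hZe], f, by simp [hZe], hef, fun h => K.d3 ⟨_, h, je.inc⟩, _, _, jn_map hg je, ?_⟩
      have := jn_map hg jf.symm
      rw [rx3]; rwa [rx4] at this
    · exfalso
      obtain ⟨e, f, h, c, d, hef, hZe, je, jf, jh⟩ := path3 H.tf hZA hO h3
      have q1 := hm e (by simp [hZe]); have q2 := hm f (by simp [hZe]); have q3 := hm h (by simp [hZe])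
      simp only [D9, Finset.mem_insert, Finset.mem_singleton, not_or] at q1 q2 q3
      simp only [List.nodup_cons, List.mem_cons, List.not_mem_nil, or_false, not_or] at hef
      refine hexagram H hgo (e1 := e) (e2 := a3) (e3 := e34) (e4 := a4) (e5 := h) (e6 := f) ?_ ?_ je.symm K.k3.symm K.j34 K.k4 jh.symm jf.symm K.c3 K.d4
      · simp only [List.nodup_cons, List.mem_cons, List.not_mem_nil, or_false, not_or]
        clear * - hn q1 q2 q3 hef
        grind
      · rw [hb, hZe]; clear * - P; ext x; simp only [Finset.mem_union, Finset.mem_insert, Finset.mem_singleton]; tauto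
  · have := K.lemY H hZA (fun e h => (Finset.mem_sdiff.1 (hZ h)).2) (by
      rw [Gr.sd_union d1]; change P.Ev (Z ∆ T6 e12 e34 e51 a2 a3 a4); rw [Gr.sd_union hdj]; exact hk)
    omega

/-- the reduced map -/
structure Fold (n : ℕ) (P : PM V E) (o : P.F) (D T : Finset E) (ρ : V → V) (P2 : PM V E) (σ : P.F → P2.F) : Prop where
  gr : P2.toGr = Gr.mk (ρ ∘ P.s) (ρ ∘ P.t)
  A2 : P2.A ⊆ P.A \ D
  surj : Function.Surjective σ
  bd : ∀ R, P2.bd R = P.bd (σ ⁻¹' R) ∩ P2.A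
  bdT : ∀ R, P.bd (σ ⁻¹' R) ⊆ P2.A ∪ T
  l : ∀ e, P2.l e = σ (P.l e)
  r : ∀ e, P2.r e = σ (P.r e)
  o1 : σ ⁻¹' {σ o} = {o}
  C : P2.bd {σ o} = P.bd {o}
  st : Std P2.A.card P2 (σ o)
  wt : P2.wt {σ o}ᶜ ≤ ((P.bd {o}).card : ℤ) - 6

set_option maxHeartbeats 1000000 in
theorem Pent2.fold (H : Cex n P o) (K : Pent2 P o p v1 v2 v3 v4 v5 x1 x2 x3 x4 e12 e23 e34 e45 e51 a1 a2 a3 a4) :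
    ∃ P2 σ, Fold n P o (D9 e12 e23 e34 e45 e51 a1 a2 a3 a4) (T6 e12 e34 e51 a2 a3 a4) (pr v1 v2 v3 v4 v5 x2 x3 x4) P2 σ := by
  set D := D9 e12 e23 e34 e45 e51 a1 a2 a3 a4 with hD
  set T := T6 e12 e34 e51 a2 a3 a4 with hT
  set ρ := pr v1 v2 v3 v4 v5 x2 x3 x4 with hρ
  have hTD : T ⊆ D := T6_sub
  have hDA : D ⊆ P.A := fun e he => (K.mem H he).1
  obtain ⟨P', m1, m2, π1, m3, m4, m5, m6, m7, m8⟩ := minor P T (P.A \ D) ρ (hTD.trans hDA) Finset.sdiff_subset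
    ((Finset.sdiff_disjoint).symm.mono_left hTD) (fun e he => K.eqT H he) (K.cnT H) (by
      intro Z hZ hE
      by_contra hne
      have hc := (Finset.card_le_card hZ).trans (K.dT H).2.2.2.le
      obtain ⟨e, he⟩ := Finset.nonempty_iff_ne_empty.2 hne
      obtain ⟨g, h1, h2, h3⟩ := short' H (hZ.trans (hTD.trans hDA)) hE he (K.mem H (hTD (hZ he))).2 (by omega)
      have hcs := K.cases H (Y := Z) (hZ.trans Finset.subset_union_right) hE
      rw [Finset.inter_eq_left.2 hZ] at hcs
      obtain ⟨d1, d2, d3, d4⟩ := K.dT H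
      rcases hcs with rfl | rfl | rfl | rfl
      · exact hne rfl
      · omega
      · omega
      · have := K.noT1 H ((T6_sub.trans hDA)) hE (by simp [T6]) (by simp [T6]) (by simp [T6])
        omega)
  have hs : ∀ e, P'.s e = ρ (P.s e) := fun e => congrFun (congrArg Gr.s m1) e
  have ht : ∀ e, P'.t e = ρ (P.t e) := fun e => congrFun (congrArg Gr.t m1) e
  have hCD : P.bd {o} ⊆ P.A \ D := fun e he => Finset.mem_sdiff.2 ⟨bd_sub _ he, fun h => (K.mem H h).2 he⟩
  have ho1 : π1 ⁻¹' {π1 o} = {o} := by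
    obtain ⟨R, hR⟩ := m8 {o} (hCD.trans Finset.subset_union_left)
    ext x; constructor
    · intro hx
      have : x ∈ π1 ⁻¹' R := by
        have h1 : o ∈ π1 ⁻¹' R := hR ▸ rfl
        have h2 : π1 x = π1 o := hx
        simpa [h2] using h1
      rwa [← hR] at this
    · rintro rfl; rfl
  have hC' : P'.bd {π1 o} = P.bd {o} := by
    rw [m4, ho1]; exact Finset.inter_eq_left.2 hCD
  obtain ⟨r5, r1, r2, r3, r4, rx4, rx2, rx3⟩ := K.pr_eq H
  rw [← hρ] at r5 r1 r2 r3 r4 rx4 rx2 rx3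
  obtain ⟨P2, g1, g2, π, g3, g4, g5, g6, g7, g8, g9, g10, g11, g12⟩ := foldIH H.toStd P' (π1 o) (by
      intro e he ⟨hl, hr⟩
      rw [m2] at he
      rw [m6] at hl; rw [m7] at hr
      have hl' : P.l e ∈ π1 ⁻¹' {π1 o} := hl
      have hr' : P.r e ∈ π1 ⁻¹' {π1 o} := hr
      rw [ho1] at hl' hr'
      exact H.cr.1 e (Finset.mem_sdiff.1 he).1 ⟨hl', hr'⟩) hC' (by
      intro e he
      rw [hs, ht]
      exact ⟨K.pr_C H ⟨e, he, Or.inl rfl⟩, K.pr_C H ⟨e, he, Or.inr rfl⟩⟩) (by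
      intro χ hχ
      obtain ⟨p, q, r, s, q1, q2, q3, q4, q5, q6, q7, q8, q9⟩ := col (χ (ρ x1)) (χ x2) (χ x3)
      let χ' : V → Fin 3 := fun x => if x = v1 then p else if x = v2 then q else if x = v3 then r else if x = v4 then s else χ (ρ x)
      have hnd := K.ndv
      have y1 := K.y1; have y2 := K.y2; have y3 := K.y3; have y4 := K.y4
      simp only [List.nodup_cons, List.mem_cons, List.not_mem_nil, or_false, not_or] at hnd y1 y2 y3 y4
      have w : ∀ x, x ≠ v1 → x ≠ v2 → x ≠ v3 → x ≠ v4 → χ' x = χ (ρ x) := by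
        intro x h1 h2 h3 h4; simp [χ', h1, h2, h3, h4]
      have w1 : χ' v1 = p := by simp [χ']
      have w2 : χ' v2 = q := by show (if _ then _ else _) = _; rw [if_neg (fun h => hnd.1.1 h.symm), if_pos (by trivial)]
      have w3 : χ' v3 = r := by
        show (if _ then _ else _) = _; rw [if_neg (fun h => hnd.1.2.1 h.symm), if_neg (fun h => hnd.2.1.1 h.symm), if_pos (by trivial)]
      have w4 : χ' v4 = s := by
        show (if _ then _ else _) = _; rw [if_neg (fun h => hnd.1.2.2.1 h.symm), if_neg (fun h => hnd.2.1.2.1 h.symm), 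
          if_neg (fun h => hnd.2.2.1.1 h.symm), if_pos (by trivial)]
      have w5 : χ' v5 = χ x2 := by
        rw [w _ (Ne.symm hnd.1.2.2.2) (Ne.symm hnd.2.1.2.2) (Ne.symm hnd.2.2.1.2) (Ne.symm hnd.2.2.2.1), r5]
      have wx1 : χ' x1 = χ (ρ x1) := w _ y1.1 y1.2.1 y1.2.2.1 y1.2.2.2.1
      have wx2 : χ' x2 = χ x2 := by rw [w _ y2.1 y2.2.1 y2.2.2.1 y2.2.2.2.1, rx2]
      have wx3 : χ' x3 = χ x3 := by rw [w _ y3.1 y3.2.1 y3.2.2.1 y3.2.2.2.1, rx3]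
      have wx4 : χ' x4 = χ x3 := by rw [w _ y4.1 y4.2.1 y4.2.2.1 y4.2.2.2.1, rx4]
      have ed : ∀ {e a b}, χ' a ≠ χ' b → P.jn e a b → χ' (P.s e) ≠ χ' (P.t e) := by
        rintro e a b h (⟨h1, h2⟩ | ⟨h1, h2⟩) <;> rw [h1, h2]
        exacts [h, h.symm]
      refine ⟨χ', fun e he => ?_, fun v hv => ?_⟩
      · by_cases heD : e ∈ D
        · simp only [hD, D9, Finset.mem_insert, Finset.mem_singleton] at heD
          rcases heD with rfl | rfl | rfl | rfl | rfl | rfl | rfl | rfl | rfl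
          · exact ed (by rw [w1, w2]; exact q3) K.j12
          · exact ed (by rw [w2, w3]; exact q5) K.j23
          · exact ed (by rw [w3, w4]; exact q7) K.j34
          · exact ed (by rw [w4, w5]; exact q9) K.j45
          · exact ed (by rw [w5, w1]; exact q2.symm) K.j51
          · exact ed (by rw [w1, wx1]; exact q1) K.k1
          · exact ed (by rw [w2, wx2]; exact q4) K.k2
          · exact ed (by rw [w3, wx3]; exact q6) K.k3
          · exact ed (by rw [w4, wx4]; exact q8) K.k4
        · have hni : ∀ x, P.inc e x → x ≠ v1 ∧ x ≠ v2 ∧ x ≠ v3 ∧ x ≠ v4 := by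
            intro x hx
            refine ⟨?_, ?_, ?_, ?_⟩ <;> rintro rfl <;> exact heD (K.inD H he (by simp [hx]))
          have h1 := hni _ (Or.inl rfl)
          have h2 := hni _ (Or.inr rfl)
          rw [w _ h1.1 h1.2.1 h1.2.2.1 h1.2.2.2, w _ h2.1 h2.2.1 h2.2.2.1 h2.2.2.2, ← hs, ← ht]
          exact hχ e (m2 ▸ Finset.mem_sdiff.2 ⟨he, heD⟩)
      · rw [w, hρ, K.pr_C H hv]
        · rintro rfl; exact K.c1 hv
        · rintro rfl; exact K.c2 hv
        · rintro rfl; exact K.c3 hv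
        · rintro rfl; exact K.c4 hv) (by
      intro Z hZ hE hne hc
      exact K.tf H m1 Z (m2 ▸ hZ) hE hne hc) (m2 ▸ Finset.sdiff_subset)
      (Or.inl (by
        rw [m2, ← H.cd]
        exact Finset.card_lt_card (Finset.ssubset_iff_subset_ne.2 ⟨Finset.sdiff_subset, fun h => by
          have := (h.symm ▸ K.A12 : e12 ∈ P.A \ D); exact (Finset.mem_sdiff.1 this).2 (by simp [hD, D9])⟩)))
  have hb2 : ∀ R, P2.bd R = P.bd ((π ∘ π1) ⁻¹' R) ∩ (P.A \ D) := by
    intro R; rw [g4, m4]; rfl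
  have hA2 : P2.A ⊆ P.A \ D := m2 ▸ g2
  refine ⟨P2, π ∘ π1, ⟨g1.trans m1, hA2, g3.comp m3, fun R => ?_, fun R => ?_, fun e => ?_, fun e => ?_, ?_, g8, 
    ⟨?_, g9, g10, rfl, by rw [Function.comp, g8]; exact H.k9⟩, g12⟩⟩
  · ext e
    have h1 := hb2 R
    have h2 := bd_sub (P := P2) R
    rw [Finset.mem_inter]
    constructor
    · intro h
      refine ⟨?_, h2 h⟩
      rw [h1] at h
      exact (Finset.mem_inter.1 h).1
    · rintro ⟨ha, hb⟩
      rw [h1]; exact Finset.mem_inter.2 ⟨ha, hA2 hb⟩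
  · intro e he
    have h0 := m5 (π ⁻¹' R) he
    have h1 := hb2 R
    have h2 := bd_sub (P := P2) R
    rw [Finset.mem_union] at *
    rcases h0 with h | h
    · left; apply h2; rw [h1]; exact Finset.mem_inter.2 ⟨he, h⟩
    · exact Or.inr h
  · rw [g5, m6]; rfl
  · rw [g6, m7]; rfl
  · rw [Set.preimage_comp]; simp only [Function.comp]; rw [g7, ho1]
  · intro P o h1
    exact H.ih P o (h1.trans g11)

end PM
end CF

end

open Set Topology

noncomputable section
namespace CF
set_option linter.all false
open scoped Classical symmDiff

namespace PM
variable {V E : Type} [Fintype V]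
variable {n : ℕ} {P : PM V E} {o : P.F}

theorem bd_sumR (H : Std n P o) (R : Set P.F) : 
    ∑ f with f ∈ R, (P.bd {f}).card = 2 * (P.A.filter (fun e => P.l e ∈ R ∧ P.r e ∈ R)).card + (P.bd R).card := by
  have h1 : ∀ f, (P.bd {f}).card = ∑ e ∈ P.A, ((if P.l e = f then 1 else 0) + (if P.r e = f then 1 else 0)) := by
    intro f
    rw [bd, Finset.card_filter]
    refine Finset.sum_congr rfl fun e he => ?_
    have := bridgeless H he
    by_cases h1 : P.l e = f <;> by_cases h2 : P.r e = f <;> simp [h1, h2]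
    exact this (h1.trans h2.symm)
  simp_rw [h1]
  rw [Finset.sum_comm, bd, Finset.card_filter, Finset.card_filter, Finset.mul_sum, ← Finset.sum_add_distrib]
  refine Finset.sum_congr rfl fun e he => ?_
  rw [Finset.sum_add_distrib, Finset.sum_ite_eq, Finset.sum_ite_eq]
  simp only [Finset.mem_filter, Finset.mem_univ, true_and]
  by_cases h1 : P.l e ∈ R <;> by_cases h2 : P.r e ∈ R <;> simp [h1, h2]

theorem inside (H : Cex n P o) {R : Set P.F} (ho : o ∉ R) (hne' : R ≠ {o}ᶜ) (hk : (P.bd R).card ≤ (P.bd {o}).card)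
    {a b : P.F} (ha : a ∈ R) (hb : b ∈ R) (hab : a ≠ b) : (P.A.filter (fun e => P.l e ∈ R ∧ P.r e ∈ R)).card ≤ 3 := by
  have h1 := bd_sumR H.toStd R
  have h2 := wt_card H ho
  have h3 : P.wt R + 4 * ((Finset.univ.filter (· ∈ R)).card : ℤ) = ∑ f with f ∈ R, ((P.bd {f}).card : ℤ) := by
    unfold wt; rw [Finset.sum_sub_distrib]; simp; ring
  have h4 := H.k9
  rcases region H.toStd ho (fun h => by rw [h] at ha; exact ha) hne' hk with ⟨g, hg⟩ | h5
  · rw [hg] at ha hb; exact absurd (ha.trans hb.symm) hab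
  · have h1' : (∑ f with f ∈ R, ((P.bd {f}).card : ℤ)) = 2 * (P.A.filter (fun e => P.l e ∈ R ∧ P.r e ∈ R)).card + (P.bd R).card := by
      exact_mod_cast h1
    omega

theorem card4 {a b c d : E} (h : a ≠ b ∧ a ≠ c ∧ a ≠ d ∧ b ≠ c ∧ b ≠ d ∧ c ≠ d) : 4 ≤ ({a, b, c, d} : Finset E).card := by
  obtain ⟨h1, h2, h3, h4, h5, h6⟩ := h
  rw [Finset.card_insert_of_notMem, Finset.card_insert_of_notMem, Finset.card_pair h6]
  · simp [h4, h5]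
  · simp [h1, h2, h3]

variable {p : P.F} {v1 v2 v3 v4 v5 x1 x2 x3 x4 : V} {e12 e23 e34 e45 e51 a1 a2 a3 a4 : E} {P2 : PM V E} {σ : P.F → P2.F}

/-- all data of the pentagon reduction -/
structure PF (n : ℕ) (P : PM V E) (o p : P.F) (v1 v2 v3 v4 v5 x1 x2 x3 x4 : V) (e12 e23 e34 e45 e51 a1 a2 a3 a4 : E) 
    (P2 : PM V E) (σ : P.F → P2.F) : Prop where
  H : Cex n P o
  K : Pent2 P o p v1 v2 v3 v4 v5 x1 x2 x3 x4 e12 e23 e34 e45 e51 a1 a2 a3 a4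
  F : Fold n P o (D9 e12 e23 e34 e45 e51 a1 a2 a3 a4) (T6 e12 e34 e51 a2 a3 a4) (pr v1 v2 v3 v4 v5 x2 x3 x4) P2 σ

theorem PF.sz (X : PF n P o p v1 v2 v3 v4 v5 x1 x2 x3 x4 e12 e23 e34 e45 e51 a1 a2 a3 a4 P2 σ) {f} (hf : f ≠ σ o) : 4 ≤ (P2.bd {f}).card ∧ (P2.bd {f}).card + 2 ≤ (P.bd {o}).card :=
  fold_face X.F.st.tf X.F.wt hf

theorem PF.oR (X : PF n P o p v1 v2 v3 v4 v5 x1 x2 x3 x4 e12 e23 e34 e45 e51 a1 a2 a3 a4 P2 σ) {f} (hf : f ≠ σ o) : o ∉ σ ⁻¹' {f} := fun h => hf (Eq.symm h)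

theorem PF.dj (X : PF n P o p v1 v2 v3 v4 v5 x1 x2 x3 x4 e12 e23 e34 e45 e51 a1 a2 a3 a4 P2 σ) : Disjoint P2.A (T6 e12 e34 e51 a2 a3 a4) :=
  (Finset.sdiff_disjoint.mono_left X.F.A2).mono_right T6_sub

theorem PF.card (X : PF n P o p v1 v2 v3 v4 v5 x1 x2 x3 x4 e12 e23 e34 e45 e51 a1 a2 a3 a4 P2 σ) (R : Set P2.F) : (P.bd (σ ⁻¹' R)).card = (P2.bd R).card + (P.bd (σ ⁻¹' R) ∩ T6 e12 e34 e51 a2 a3 a4).card := by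
  rw [X.F.bd R, ← Finset.card_union_of_disjoint, ← Finset.inter_union_distrib_left, Finset.inter_eq_left.2 (X.F.bdT R)]
  exact X.dj.mono Finset.inter_subset_right Finset.inter_subset_right

theorem PF.cs (X : PF n P o p v1 v2 v3 v4 v5 x1 x2 x3 x4 e12 e23 e34 e45 e51 a1 a2 a3 a4 P2 σ) (R : Set P2.F) : 
    (P.bd (σ ⁻¹' R) ∩ T6 e12 e34 e51 a2 a3 a4 = ∅) ∨ P.bd (σ ⁻¹' R) ∩ T6 e12 e34 e51 a2 a3 a4 = {e51, e12, a2} ∨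
    P.bd (σ ⁻¹' R) ∩ T6 e12 e34 e51 a2 a3 a4 = {a3, e34, a4} ∨ P.bd (σ ⁻¹' R) ∩ T6 e12 e34 e51 a2 a3 a4 = T6 e12 e34 e51 a2 a3 a4 :=
  X.K.cases X.H ((X.F.bdT R).trans (Finset.union_subset_union X.F.A2 subset_rfl)) (ev_bd _)

theorem PF.notC (X : PF n P o p v1 v2 v3 v4 v5 x1 x2 x3 x4 e12 e23 e34 e45 e51 a1 a2 a3 a4 P2 σ) {f} (hf : f ≠ σ o) : σ ⁻¹' {f} ≠ {o}ᶜ := by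
  intro h
  have h1 := X.sz hf
  have h2 : P2.bd {f} = P.bd {o} := by
    rw [X.F.bd, h, bd_compl, ← X.F.C]; exact Finset.inter_eq_left.2 (bd_sub _)
  rw [h2] at h1; omega

/-- faces of length four -/
theorem PF.four (X : PF n P o p v1 v2 v3 v4 v5 x1 x2 x3 x4 e12 e23 e34 e45 e51 a1 a2 a3 a4 P2 σ) {f} (hf : f ≠ σ o) (h4 : (P2.bd {f}).card = 4) :
    P.bd (σ ⁻¹' {f}) ∩ T6 e12 e34 e51 a2 a3 a4 = {a3, e34, a4} := by
  have hc := X.card {f}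
  obtain ⟨d1, d2, d3, d4⟩ := X.K.dT X.H
  obtain ⟨g, hg⟩ := X.F.surj f
  rcases X.cs {f} with h | h | h | h
  · rw [h] at hc
    obtain ⟨g, -, -, h5⟩ := short X.H (X.oR hf) (Set.nonempty_iff_ne_empty.1 ⟨g, hg⟩) (X.notC hf) (by rw [hc, h4]; simp)
    rw [hc, h4] at h5; simp at h5
  · have hm : ∀ e ∈ ({e51, e12, a2} : Finset E), e ∈ P.bd (σ ⁻¹' {f}) := fun e he => (Finset.mem_inter.1 (h.symm ▸ he)).1
    have := X.K.noT1 X.H (bd_sub _) (ev_bd (P := P) (σ ⁻¹' {f})) (hm _ (by simp)) (hm _ (by simp)) (hm _ (by simp))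
    rw [h, d2] at hc; omega
  · exact h
  · have hT : T6 e12 e34 e51 a2 a3 a4 ⊆ P.bd (σ ⁻¹' {f}) := Finset.inter_eq_right.1 h
    have hU : P2.bd {f} ∪ T6 e12 e34 e51 a2 a3 a4 = P.bd (σ ⁻¹' {f}) := by
      rw [X.F.bd, ← h, ← Finset.inter_union_distrib_left, Finset.inter_eq_left]
      exact X.F.bdT _
    have := X.K.lemY X.H (Z := P2.bd {f}) ((bd_sub _).trans (X.F.A2.trans Finset.sdiff_subset))
      (fun e he => (Finset.mem_sdiff.1 (X.F.A2 (bd_sub _ he))).2) (by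
        rw [Gr.sd_union d1]
        change P.Ev (P2.bd {f} ∆ T6 e12 e34 e51 a2 a3 a4)
        rw [Gr.sd_union (X.dj.mono_left (bd_sub _)), hU]; exact ev_bd _)
    omega

theorem PF.p0 (X : PF n P o p v1 v2 v3 v4 v5 x1 x2 x3 x4 e12 e23 e34 e45 e51 a1 a2 a3 a4 P2 σ) : σ p ≠ σ o := by
  intro h
  have : p ∈ σ ⁻¹' {σ o} := h
  rw [X.F.o1] at this
  exact X.K.hp this

/-- an edge of the pentagon which is not on the boundary is inside -/
theorem PF.ins (X : PF n P o p v1 v2 v3 v4 v5 x1 x2 x3 x4 e12 e23 e34 e45 e51 a1 a2 a3 a4 P2 σ) {e} (he : e ∈ P.bd {p}) (h : e ∉ P.bd (σ ⁻¹' {σ p})) : P.l e ∈ σ ⁻¹' {σ p} ∧ P.r e ∈ σ ⁻¹' {σ p} := by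
  have hA := bd_sub _ he
  rw [mem_bd1] at he
  rw [mem_bd] at h
  have h1 : (P.l e ∈ σ ⁻¹' {σ p} ↔ P.r e ∈ σ ⁻¹' {σ p}) := by by_contra h'; exact h ⟨hA, h'⟩
  by_cases h2 : P.l e = p
  · have : P.l e ∈ σ ⁻¹' {σ p} := by rw [h2]; rfl
    exact ⟨this, h1.1 this⟩
  · have h3 : P.r e = p := by have := he.2; tauto
    have : P.r e ∈ σ ⁻¹' {σ p} := by rw [h3]; rfl
    exact ⟨h1.2 this, this⟩

theorem PF.notin (X : PF n P o p v1 v2 v3 v4 v5 x1 x2 x3 x4 e12 e23 e34 e45 e51 a1 a2 a3 a4 P2 σ) {e} (R : Set P2.F) (hD : e ∈ D9 e12 e23 e34 e45 e51 a1 a2 a3 a4) 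
    (hT : e ∉ P.bd (σ ⁻¹' R) ∩ T6 e12 e34 e51 a2 a3 a4) : e ∉ P.bd (σ ⁻¹' R) := by
  intro h
  rcases Finset.mem_union.1 (X.F.bdT R h) with h1 | h1
  · exact (Finset.mem_sdiff.1 (X.F.A2 h1)).2 hD
  · exact hT (Finset.mem_inter.2 ⟨h, h1⟩)

theorem PF.notT (X : PF n P o p v1 v2 v3 v4 v5 x1 x2 x3 x4 e12 e23 e34 e45 e51 a1 a2 a3 a4 P2 σ) : e23 ∉ T6 e12 e34 e51 a2 a3 a4 ∧ e45 ∉ T6 e12 e34 e51 a2 a3 a4 ∧ a1 ∉ T6 e12 e34 e51 a2 a3 a4 := by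
  have hn := X.K.nde
  simp only [List.nodup_cons, List.mem_cons, List.not_mem_nil, or_false, not_or] at hn
  clear X
  simp only [T6, Finset.mem_union, Finset.mem_insert, Finset.mem_singleton]
  grind

/-- the region of `p` contains two faces -/
theorem PF.two (X : PF n P o p v1 v2 v3 v4 v5 x1 x2 x3 x4 e12 e23 e34 e45 e51 a1 a2 a3 a4 P2 σ) : ∃ g, g ∈ σ ⁻¹' {σ p} ∧ p ≠ g := by
  have he : e23 ∈ P.bd {p} := by simp [X.K.b]
  have h := X.ins he (X.notin _ (by simp [D9]) (fun h => X.notT.1 (Finset.mem_inter.1 h).2))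
  have hb := bridgeless X.H.toStd (bd_sub _ he)
  by_cases h1 : P.l e23 = p
  · exact ⟨_, h.2, fun h => hb (h1.trans h)⟩
  · exact ⟨_, h.1, fun h => h1 h.symm⟩

/-- four inside edges force a large face -/
theorem PF.big (X : PF n P o p v1 v2 v3 v4 v5 x1 x2 x3 x4 e12 e23 e34 e45 e51 a1 a2 a3 a4 P2 σ) {S : Finset E} (h4 : 4 ≤ S.card) (hS : ∀ e ∈ S, e ∈ P.A ∧ P.l e ∈ σ ⁻¹' {σ p} ∧ P.r e ∈ σ ⁻¹' {σ p}) :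
    (P.bd {o}).card < (P.bd (σ ⁻¹' {σ p})).card := by
  by_contra hlt
  obtain ⟨g, hg, hpg⟩ := X.two
  have := inside X.H (X.oR X.p0) (X.notC X.p0) (by omega) (a := p) rfl hg hpg
  have h5 := Finset.card_le_card (show S ⊆ P.A.filter (fun e => P.l e ∈ σ ⁻¹' {σ p} ∧ P.r e ∈ σ ⁻¹' {σ p}) from fun e he =>
    Finset.mem_filter.2 (hS e he))
  omega

theorem PF.not_i (X : PF n P o p v1 v2 v3 v4 v5 x1 x2 x3 x4 e12 e23 e34 e45 e51 a1 a2 a3 a4 P2 σ) : P.bd (σ ⁻¹' {σ p}) ∩ T6 e12 e34 e51 a2 a3 a4 ≠ ∅ := by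
  intro h
  have hc := X.card {σ p}
  rw [h] at hc
  have := X.sz X.p0
  have h9 := X.H.k9
  obtain ⟨g, hg, hpg⟩ := X.two
  obtain ⟨g', h1, h2, h3⟩ := short X.H (X.oR X.p0) (Set.nonempty_iff_ne_empty.1 ⟨g, hg⟩) (X.notC X.p0) (by rw [hc]; simp; omega)
  rw [h2] at hg
  have hp : p ∈ σ ⁻¹' {σ p} := rfl
  rw [h2] at hp
  exact hpg (hp.trans hg.symm)

/-- an edge on the boundary of the region of `p` has another internal side -/
theorem PF.other (X : PF n P o p v1 v2 v3 v4 v5 x1 x2 x3 x4 e12 e23 e34 e45 e51 a1 a2 a3 a4 P2 σ) {e} (he : e ∈ P.bd (σ ⁻¹' {σ p})) (hT : e ∈ T6 e12 e34 e51 a2 a3 a4) : 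
    ∃ f, f ≠ σ o ∧ f ≠ σ p ∧ e ∈ P.bd (σ ⁻¹' {f}) := by
  have hC := (X.K.mem X.H (T6_sub hT)).2
  have hA := (X.K.mem X.H (T6_sub hT)).1
  have hi := sd_internal X.H.toStd hA hC
  rw [mem_bd] at he
  have hno : ∀ g, g ≠ o → σ g ≠ σ o := fun g hg h => hg (by
    have : g ∈ σ ⁻¹' {σ o} := h
    rw [X.F.o1] at this; exact this)
  by_cases h1 : P.l e ∈ σ ⁻¹' {σ p}
  · have h2 : P.r e ∉ σ ⁻¹' {σ p} := by have := he.2; tauto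
    refine ⟨σ (P.r e), hno _ hi.2, h2, ?_⟩
    rw [mem_bd]
    refine ⟨hA, fun h => h2 ?_⟩
    have h3 : σ (P.l e) = σ (P.r e) := h.2 rfl
    have h4 : σ (P.l e) = σ p := h1
    exact h3.symm.trans h4
  · have h2 : P.r e ∈ σ ⁻¹' {σ p} := by have := he.2; tauto
    refine ⟨σ (P.l e), hno _ hi.1, h1, ?_⟩
    rw [mem_bd]
    refine ⟨hA, fun h => h1 ?_⟩
    have h3 : σ (P.r e) = σ (P.l e) := h.1 rfl
    have h4 : σ (P.r e) = σ p := h2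
    exact h3.symm.trans h4

theorem PF.wt2 (X : PF n P o p v1 v2 v3 v4 v5 x1 x2 x3 x4 e12 e23 e34 e45 e51 a1 a2 a3 a4 P2 σ) {f g : P2.F} (hf : f ≠ σ o) (hg : g ≠ σ o) (hfg : f ≠ g) : 
    (P2.bd {f}).card + (P2.bd {g}).card ≤ (P.bd {o}).card + 2 := by
  have h1 := X.F.wt
  have h2 : P2.wt {f, g} ≤ P2.wt {σ o}ᶜ := wt_mono X.F.st.tf hf (by rintro x (rfl | rfl) <;> assumption)
  rw [wt_insert (by simpa using hfg), wt_single] at h2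
  omega

theorem PF.not_ii (X : PF n P o p v1 v2 v3 v4 v5 x1 x2 x3 x4 e12 e23 e34 e45 e51 a1 a2 a3 a4 P2 σ) : P.bd (σ ⁻¹' {σ p}) ∩ T6 e12 e34 e51 a2 a3 a4 ≠ {e51, e12, a2} := by
  intro h
  have hc := X.card {σ p}
  have hn := X.K.nde
  simp only [List.nodup_cons, List.mem_cons, List.not_mem_nil, or_false, not_or] at hn
  obtain ⟨d1, d2, d3, d4⟩ := X.K.dT X.H
  rw [h, d2] at hc
  have m12 : e12 ∈ P.bd (σ ⁻¹' {σ p}) ∩ T6 e12 e34 e51 a2 a3 a4 := by rw [h]; simp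
  obtain ⟨f, f1, f2, f3⟩ := X.other (Finset.mem_inter.1 m12).1 (Finset.mem_inter.1 m12).2
  have h5 : 5 ≤ (P2.bd {f}).card := by
    have := X.sz f1
    by_contra hlt
    have h6 := X.four f1 (by omega)
    have : e12 ∈ P.bd (σ ⁻¹' {f}) ∩ T6 e12 e34 e51 a2 a3 a4 := Finset.mem_inter.2 ⟨f3, (Finset.mem_inter.1 m12).2⟩
    rw [h6] at this
    simp only [Finset.mem_insert, Finset.mem_singleton] at this
    clear * - hn this; grind
  have h7 := X.wt2 f1 X.p0 f2
  have i1 := X.ins (e := e23) (by simp [X.K.b]) (X.notin _ (by simp [D9]) (fun h => X.notT.1 (Finset.mem_inter.1 h).2))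
  have i2 := X.ins (e := e45) (by simp [X.K.b]) (X.notin _ (by simp [D9]) (fun h => X.notT.2.1 (Finset.mem_inter.1 h).2))
  have i3 := X.ins (e := e34) (by simp [X.K.b]) (X.notin _ (by simp [D9]) (by 
    rw [h]; simp only [Finset.mem_insert, Finset.mem_singleton]; clear * - hn; grind))
  have i4 : P.l a4 ∈ σ ⁻¹' {σ p} ∧ P.r a4 ∈ σ ⁻¹' {σ p} := by
    have key : ∀ g, a4 ∈ P.bd {g} → g ∈ σ ⁻¹' {σ p} := by
      intro g hg
      have sub : ∀ e, e ∈ P.bd {g} → P.l e ∈ σ ⁻¹' {σ p} ∧ P.r e ∈ σ ⁻¹' {σ p} → g ∈ σ ⁻¹' {σ p} := by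
        intro e he hh
        rw [mem_bd1] at he
        by_cases h1 : P.l e = g
        · exact h1 ▸ hh.1
        · have : P.r e = g := by have := he.2; tauto
          exact this ▸ hh.2
      by_cases k1 : e34 ∈ P.bd {g}
      · exact sub _ k1 i3
      by_cases k2 : e45 ∈ P.bd {g}
      · exact sub _ k2 i2
      exfalso
      have := star3 X.H.tf (x := a4) (y := e34) (z := e45) (v := v4) (X.K.s4.trans (by clear * - P; ext x; simp; tauto)) 
        (by clear * - hn; grind) (bd_sub _) (ev_bd (P := P) {g}) k2
      exact k1 (this.1 hg)
    have hb := bridgeless X.H.toStd X.K.B4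
    exact ⟨key _ (mem_bd1.2 ⟨X.K.B4, fun h => hb (h.1 rfl).symm⟩), key _ (mem_bd1.2 ⟨X.K.B4, fun h => hb (h.2 rfl)⟩)⟩
  have := X.big (S := {e23, e45, e34, a4}) (card4 (by clear * - hn; grind)) (by
    intro e he
    simp only [Finset.mem_insert, Finset.mem_singleton] at he
    rcases he with rfl | rfl | rfl | rfl
    exacts [⟨X.K.A23, i1⟩, ⟨X.K.A45, i2⟩, ⟨X.K.A34, i3⟩, ⟨X.K.B4, i4⟩])
  omega

end PM
end CF

end

open Set Topology

noncomputable section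
namespace CF
set_option linter.all false
open scoped Classical symmDiff

namespace PM
variable {V E : Type} [Fintype V]
variable {n : ℕ} {P : PM V E} {o : P.F}

variable {p : P.F} {v1 v2 v3 v4 v5 x1 x2 x3 x4 : V} {e12 e23 e34 e45 e51 a1 a2 a3 a4 : E} {P2 : PM V E} {σ : P.F → P2.F}

theorem PF.edge (X : PF n P o p v1 v2 v3 v4 v5 x1 x2 x3 x4 e12 e23 e34 e45 e51 a1 a2 a3 a4 P2 σ) {a v} {R : Set P2.F} (ha : a ∈ P.bd (σ ⁻¹' R)) (hv : P.inc a v) 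
    (hT : ∀ e ∈ T6 e12 e34 e51 a2 a3 a4, P.inc e v → e = a) : ∃ e ∈ P2.A, P.inc e v := by
  have h1 := Gr.ev_star (X.H.tf.mono (bd_sub (P := P) (σ ⁻¹' R))).nl (ev_bd _) v
  have h2 : a ∈ P.star (P.bd (σ ⁻¹' R)) v := Gr.mem_star.2 ⟨ha, hv⟩
  have h3 : 0 < (P.star (P.bd (σ ⁻¹' R)) v).card := Finset.card_pos.2 ⟨a, h2⟩
  have h4 : 1 < (P.star (P.bd (σ ⁻¹' R)) v).card := by
    rcases h1 with ⟨r, hr⟩; omega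
  obtain ⟨e, he, hne⟩ := Finset.exists_mem_ne h4 a
  rw [Gr.mem_star] at he
  rcases Finset.mem_union.1 (X.F.bdT R he.1) with h | h
  · exact ⟨e, h, he.2⟩
  · exact absurd (hT e h he.2) hne

theorem PF.inc2 (X : PF n P o p v1 v2 v3 v4 v5 x1 x2 x3 x4 e12 e23 e34 e45 e51 a1 a2 a3 a4 P2 σ) {e x} (h : P.inc e x) : P2.inc e (pr v1 v2 v3 v4 v5 x2 x3 x4 x) := by
  have := X.F.gr
  have hs : P2.s e = pr v1 v2 v3 v4 v5 x2 x3 x4 (P.s e) := congrFun (congrArg Gr.s this) e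
  have ht : P2.t e = pr v1 v2 v3 v4 v5 x2 x3 x4 (P.t e) := congrFun (congrArg Gr.t this) e
  unfold Gr.inc at *
  rw [hs, ht]
  rcases h with h | h
  · left; rw [h]
  · right; rw [h]

theorem PF.vs (X : PF n P o p v1 v2 v3 v4 v5 x1 x2 x3 x4 e12 e23 e34 e45 e51 a1 a2 a3 a4 P2 σ) : P2.Vs (P2.bd {σ o}) = P.Vs (P.bd {o}) := by
  have := X.F.gr
  have hs : ∀ e, P2.s e = pr v1 v2 v3 v4 v5 x2 x3 x4 (P.s e) := congrFun (congrArg Gr.s this)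
  have ht : ∀ e, P2.t e = pr v1 v2 v3 v4 v5 x2 x3 x4 (P.t e) := congrFun (congrArg Gr.t this)
  rw [X.F.C]
  ext v
  have : ∀ e ∈ P.bd {o}, (P2.inc e v ↔ P.inc e v) := by
    intro e he
    unfold Gr.inc
    rw [hs, ht, X.K.pr_C X.H ⟨e, he, Or.inl rfl⟩, X.K.pr_C X.H ⟨e, he, Or.inr rfl⟩]
  constructor
  · rintro ⟨e, he, h⟩; exact ⟨e, he, (this e he).1 h⟩
  · rintro ⟨e, he, h⟩; exact ⟨e, he, (this e he).2 h⟩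

/-- degrees at internal vertices of the reduced map -/
theorem PF.deg (X : PF n P o p v1 v2 v3 v4 v5 x1 x2 x3 x4 e12 e23 e34 e45 e51 a1 a2 a3 a4 P2 σ) {e v} (he : e ∈ P2.A) (hv : P2.inc e v) (hC : v ∉ P.Vs (P.bd {o})) : 
    3 ≤ (P2.star P2.A v).card ∧ P2.star P2.A v ⊆ P2.A \ P2.bd {σ o} := by
  rw [← X.vs] at hC
  refine ⟨deg3 X.F.st hC ⟨e, Gr.mem_star.2 ⟨he, hv⟩⟩, fun e' he' => ?_⟩
  rw [Gr.mem_star] at he'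
  exact Finset.mem_sdiff.2 ⟨he'.1, fun h => hC ⟨e', h, he'.2⟩⟩

theorem PF.neX (X : PF n P o p v1 v2 v3 v4 v5 x1 x2 x3 x4 e12 e23 e34 e45 e51 a1 a2 a3 a4 P2 σ) : x3 ≠ v1 ∧ x3 ≠ v2 ∧ x3 ≠ v3 ∧ x3 ≠ v4 ∧ x3 ≠ v5 ∧ x3 ≠ x2 ∧ x3 ≠ x4 ∧ v5 ≠ v1 ∧ v5 ≠ v2 ∧ v5 ≠ v3 ∧ v5 ≠ v4 ∧ v5 ≠ x2 ∧ v5 ≠ x3 ∧ v5 ≠ x4 := by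
  have h1 := X.K.ndv; have h2 := X.K.ndx; have h3 := X.K.y2; have h4 := X.K.y3; have h5 := X.K.y4
  clear X
  simp only [List.nodup_cons, List.mem_cons, List.not_mem_nil, or_false, not_or] at h1 h2 h3 h4 h5
  grind

theorem PF.deg_x3 (X : PF n P o p v1 v2 v3 v4 v5 x1 x2 x3 x4 e12 e23 e34 e45 e51 a1 a2 a3 a4 P2 σ) (h : a3 ∈ P.bd (σ ⁻¹' {σ p})) : 3 ≤ (P2.star P2.A x3).card ∧ P2.star P2.A x3 ⊆ P2.A \ P2.bd {σ o} := by
  obtain ⟨q1, q2, q3, q4, q5, q6, q7, -⟩ := X.neX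
  obtain ⟨e, he, hi⟩ := X.edge h X.K.k3.inc' (by
    intro e he hi
    simp only [T6, Finset.mem_union, Finset.mem_insert, Finset.mem_singleton] at he
    rcases he with (rfl | rfl | rfl) | rfl | rfl | rfl
    · rcases inc_jn X.K.j51 hi with h | h <;> contradiction
    · rcases inc_jn X.K.j12 hi with h | h <;> contradiction
    · rcases inc_jn X.K.k2 hi with h | h <;> contradiction
    · rfl
    · rcases inc_jn X.K.j34 hi with h | h <;> contradiction
    · rcases inc_jn X.K.k4 hi with h | h <;> contradiction)
  have := X.inc2 hi
  rw [(X.K.pr_eq X.H).2.2.2.2.2.2.2] at this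
  exact X.deg he this X.K.d3

theorem PF.edge5 (X : PF n P o p v1 v2 v3 v4 v5 x1 x2 x3 x4 e12 e23 e34 e45 e51 a1 a2 a3 a4 P2 σ) (h : e51 ∈ P.bd (σ ⁻¹' {σ p})) : ∃ e ∈ P2.A, P.inc e v5 := by
  obtain ⟨-, -, -, -, q5, -, -, q1, q2, q3, q4, q6, q7, q8⟩ := X.neX
  exact X.edge h X.K.j51.inc (by
    intro e he hi
    simp only [T6, Finset.mem_union, Finset.mem_insert, Finset.mem_singleton] at he
    rcases he with (rfl | rfl | rfl) | rfl | rfl | rfl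
    · rfl
    · rcases inc_jn X.K.j12 hi with h | h <;> contradiction
    · rcases inc_jn X.K.k2 hi with h | h <;> contradiction
    · rcases inc_jn X.K.k3 hi with h | h <;> contradiction
    · rcases inc_jn X.K.j34 hi with h | h <;> contradiction
    · rcases inc_jn X.K.k4 hi with h | h <;> contradiction)

/-- an edge bounds at most two internal faces -/
theorem PF.twoF (X : PF n P o p v1 v2 v3 v4 v5 x1 x2 x3 x4 e12 e23 e34 e45 e51 a1 a2 a3 a4 P2 σ) {f g h : P2.F} {e} (hf : e ∈ P.bd (σ ⁻¹' {f})) (hg : e ∈ P.bd (σ ⁻¹' {g})) (hh : e ∈ P.bd (σ ⁻¹' {h})) 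
    (hfg : f ≠ g) (hfh : f ≠ h) : g = h := by
  rw [mem_bd] at hf hg hh
  simp only [Set.mem_preimage, Set.mem_singleton_iff] at hf hg hh
  grind

theorem PF.inner2 (X : PF n P o p v1 v2 v3 v4 v5 x1 x2 x3 x4 e12 e23 e34 e45 e51 a1 a2 a3 a4 P2 σ) : 2 * ((P2.A \ P2.bd {σ o}).card : ℤ) + 6 ≤ 4 * ((Finset.univ.filter (fun f => f ≠ σ o)).card : ℤ) := by
  have h1 := inner X.F.st
  have h2 := X.F.wt
  rw [X.F.C] at h1 ⊢
  omega

theorem PF.not_iii (X : PF n P o p v1 v2 v3 v4 v5 x1 x2 x3 x4 e12 e23 e34 e45 e51 a1 a2 a3 a4 P2 σ) : P.bd (σ ⁻¹' {σ p}) ∩ T6 e12 e34 e51 a2 a3 a4 ≠ {a3, e34, a4} := by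
  intro h
  have hc := X.card {σ p}
  have hn := X.K.nde
  simp only [List.nodup_cons, List.mem_cons, List.not_mem_nil, or_false, not_or] at hn
  obtain ⟨d1, d2, d3, d4⟩ := X.K.dT X.H
  rw [h, d3] at hc
  have i1 := X.ins (e := e23) (by simp [X.K.b]) (X.notin _ (by simp [D9]) (fun h => X.notT.1 (Finset.mem_inter.1 h).2))
  have i2 := X.ins (e := e45) (by simp [X.K.b]) (X.notin _ (by simp [D9]) (fun h => X.notT.2.1 (Finset.mem_inter.1 h).2))
  have i3 := X.ins (e := e51) (by simp [X.K.b]) (X.notin _ (by simp [D9]) (by 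
    rw [h]; simp only [Finset.mem_insert, Finset.mem_singleton]; clear * - hn; grind))
  have i4 := X.ins (e := e12) (by simp [X.K.b]) (X.notin _ (by simp [D9]) (by 
    rw [h]; simp only [Finset.mem_insert, Finset.mem_singleton]; clear * - hn; grind))
  have hbig := X.big (S := {e23, e45, e51, e12}) (card4 (by clear * - hn; grind)) (by
    intro e he
    simp only [Finset.mem_insert, Finset.mem_singleton] at he
    rcases he with rfl | rfl | rfl | rfl
    exacts [⟨X.K.A23, i1⟩, ⟨X.K.A45, i2⟩, ⟨X.K.A51, i3⟩, ⟨X.K.A12, i4⟩])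
  have m3 : a3 ∈ P.bd (σ ⁻¹' {σ p}) ∩ T6 e12 e34 e51 a2 a3 a4 := by rw [h]; simp
  have hx := X.deg_x3 (Finset.mem_inter.1 m3).1
  have hx2 := Finset.card_le_card hx.2
  have h4 : ∀ f, f ≠ σ o → f ≠ σ p → a3 ∈ P.bd (σ ⁻¹' {f}) := by
    intro f hf hfp
    have h1 := X.wt2 hf X.p0 hfp
    have h2 := X.sz hf
    have := X.four hf (by omega)
    have h5 : a3 ∈ P.bd (σ ⁻¹' {f}) ∩ T6 e12 e34 e51 a2 a3 a4 := by rw [this]; simp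
    exact (Finset.mem_inter.1 h5).1
  have hin := X.inner2
  have hF : (Finset.univ.filter (fun f => f ≠ σ o)).card ≤ 2 := by
    by_contra hlt
    obtain ⟨a, b, c, ha, hb, hc, hab, hac, hbc⟩ := (Finset.two_lt_card_iff (s := Finset.univ.filter (fun f => f ≠ σ o))).1 (by omega)
    simp only [Finset.mem_filter, Finset.mem_univ, true_and] at ha hb hc
    have w : ∀ f, f ≠ σ o → a3 ∈ P.bd (σ ⁻¹' {f}) := by
      intro f hf
      by_cases hfp : f = σ p
      · rw [hfp]; exact (Finset.mem_inter.1 m3).1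
      · exact h4 f hf hfp
    exact hbc (X.twoF (w a ha) (w b hb) (w c hc) hab hac)
  omega

/-- ends of an edge of the reduced map -/
theorem PF.ends2 (X : PF n P o p v1 v2 v3 v4 v5 x1 x2 x3 x4 e12 e23 e34 e45 e51 a1 a2 a3 a4 P2 σ) {e x y} (he : e ∈ P2.A) (h : P2.jn e x y) : ∃ a b, P.jn e a b ∧ pr v1 v2 v3 v4 v5 x2 x3 x4 a = x ∧ 
    pr v1 v2 v3 v4 v5 x2 x3 x4 b = y ∧ (a ≠ v1 ∧ a ≠ v2 ∧ a ≠ v3 ∧ a ≠ v4) ∧ (b ≠ v1 ∧ b ≠ v2 ∧ b ≠ v3 ∧ b ≠ v4) := by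
  have := X.F.gr
  have hs : P2.s e = pr v1 v2 v3 v4 v5 x2 x3 x4 (P.s e) := congrFun (congrArg Gr.s this) e
  have ht : P2.t e = pr v1 v2 v3 v4 v5 x2 x3 x4 (P.t e) := congrFun (congrArg Gr.t this) e
  have hA := Finset.mem_sdiff.1 (X.F.A2 he)
  have hni : ∀ x, P.inc e x → x ≠ v1 ∧ x ≠ v2 ∧ x ≠ v3 ∧ x ≠ v4 := by
    intro x hx
    refine ⟨?_, ?_, ?_, ?_⟩ <;> rintro rfl <;> exact hA.2 (X.K.inD X.H hA.1 (by simp [hx]))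
  have h1 := hni _ (Or.inl rfl)
  have h2 := hni _ (Or.inr rfl)
  rcases h with ⟨h3, h4⟩ | ⟨h3, h4⟩
  · exact ⟨_, _, Or.inl ⟨rfl, rfl⟩, hs.symm.trans h3, ht.symm.trans h4, h1, h2⟩
  · exact ⟨_, _, Or.inr ⟨rfl, rfl⟩, ht.symm.trans h4, hs.symm.trans h3, h2, h1⟩

theorem pr_x2 {a : V} (h : pr v1 v2 v3 v4 v5 x2 x3 x4 a = x2) (ha : a ≠ v1 ∧ a ≠ v2 ∧ a ≠ v3 ∧ a ≠ v4) (h3 : x3 ≠ x2) : a = v5 ∨ a = x2 := by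
  unfold pr at h
  split_ifs at h with h1 h2
  · left; tauto
  · exact absurd h h3
  · exact Or.inr h

theorem pr_x3 {a : V} (h : pr v1 v2 v3 v4 v5 x2 x3 x4 a = x3) (ha : a ≠ v1 ∧ a ≠ v2 ∧ a ≠ v3 ∧ a ≠ v4) (h3 : x3 ≠ x2) : a = x3 ∨ a = x4 := by
  unfold pr at h
  split_ifs at h with h1 h2
  · exact absurd h.symm h3
  · right; tauto
  · exact Or.inl h

/-- a short cycle through three vertices of the pentagon -/
theorem five (H : Cex n P o) {p : P.F} {f1 f2 f3 f4 f5 a b c d e} (j1 : P.jn f1 a b) (j2 : P.jn f2 b c) (j3 : P.jn f3 c d) (j4 : P.jn f4 d e)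
    (j5 : P.jn f5 e a) (A1 : f1 ∈ P.A) (A2 : f2 ∈ P.A) (A3 : f3 ∈ P.A) (A4 : f4 ∈ P.A) (A5 : f5 ∈ P.A) (hnd : [f1, f2, f3, f4, f5].Nodup)
    (b2 : f2 ∈ P.bd {p}) (b3 : f3 ∈ P.bd {p}) (b1 : f1 ∉ P.bd {p}) (hc : c ∉ P.Vs (P.bd {o})) : False := by
  simp only [List.nodup_cons, List.mem_cons, List.not_mem_nil, or_false, not_or] at hnd
  have o1 := od3 (g := P.toGr) (by simp only [List.nodup_cons, List.mem_cons, List.not_mem_nil, or_false, not_or]; clear * - hnd; tauto) j1 j2 j3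
  have o2 := od_pair (g := P.toGr) (by tauto) j4 j5
  have hE := o1.sd o2.symm
  rw [Gr.sd_union (by rw [Finset.disjoint_left]; clear * - hnd; intro x; simp only [Finset.mem_insert, Finset.mem_singleton]; grind)] at hE
  refine bad7 H (p := p) (e := f2) (f := f3) (v := c) (by tauto) b2 b3 j2.inc' j3.inc hc (a := f1) ?_ hE ?_ (by simp) (by simp) (by simp) b1
  · clear hE o1 o2
    intro x; simp only [Finset.mem_union, Finset.mem_insert, Finset.mem_singleton]
    rintro ((rfl | rfl | rfl) | rfl | rfl) <;> assumption
  · refine (Finset.card_union_le _ _).trans ?_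
    have := Finset.card_le_three (a := f1) (b := f2) (c := f3)
    have := Finset.card_le_two (a := f4) (b := f5)
    omega

theorem PF.nonadj (X : PF n P o p v1 v2 v3 v4 v5 x1 x2 x3 x4 e12 e23 e34 e45 e51 a1 a2 a3 a4 P2 σ) {e} (he : e ∈ P2.A) : ¬ P2.jn e x2 x3 := by
  intro h
  have hA := Finset.mem_sdiff.1 (X.F.A2 he)
  obtain ⟨q1, q2, q3, q4, q5, q6, q7, q8, q9, q10, q11, q12, q13, q14⟩ := X.neX
  have hn := X.K.nde
  have hndv := X.K.ndv; have hy2 := X.K.y2; have hy4 := X.K.y4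
  have hD := hA.2
  simp only [D9, Finset.mem_insert, Finset.mem_singleton] at hD
  simp only [List.nodup_cons, List.mem_cons, List.not_mem_nil, or_false, not_or] at hn hndv hy2 hy4
  obtain ⟨a, b, j, ha, hb, na, nb⟩ := X.ends2 he h
  rcases pr_x2 ha na q6 with rfl | rfl <;> rcases pr_x3 hb nb q6 with rfl | rfl
  · exact quad X.H X.K.A34 X.K.B3 hA.1 X.K.A45 X.K.j34.symm X.K.k3 j.symm X.K.j45.symm (Ne.symm q4) (Ne.symm q10) X.K.c4
  · exact tri X.H.tf X.K.A45 hA.1 X.K.B4 X.K.j45 j X.K.k4.symm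
  · exact quad X.H X.K.A23 X.K.B3 hA.1 X.K.B2 X.K.j23 X.K.k3 j.symm X.K.k2.symm (Ne.symm q2) (by clear * - hy2; grind) X.K.c2
  · exact five X.H (p := p) X.K.k2.symm X.K.j23 X.K.j34 X.K.k4 j.symm X.K.B2 X.K.A23 X.K.A34 X.K.B4 hA.1 (by
      simp only [List.nodup_cons, List.mem_cons, List.not_mem_nil, or_false, not_or]
      clear * - hn hD; grind) (by simp [X.K.b]) (by simp [X.K.b]) X.K.p2 X.K.c3

theorem PF.not_iv (X : PF n P o p v1 v2 v3 v4 v5 x1 x2 x3 x4 e12 e23 e34 e45 e51 a1 a2 a3 a4 P2 σ) : P.bd (σ ⁻¹' {σ p}) ∩ T6 e12 e34 e51 a2 a3 a4 ≠ T6 e12 e34 e51 a2 a3 a4 := by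
  intro h
  have hsub : T6 e12 e34 e51 a2 a3 a4 ⊆ P.bd (σ ⁻¹' {σ p}) := Finset.inter_eq_right.1 h
  have hx := X.deg_x3 (hsub (by simp [T6]))
  have hin := X.inner2
  have h9 := X.H.k9
  have hp5 : 5 ≤ (P2.bd {σ p}).card := by
    have := X.sz X.p0
    by_contra hlt
    have h1 := X.four X.p0 (by omega)
    have h2 := (X.K.dT X.H).2.2.2
    rw [← h, h1, (X.K.dT X.H).2.2.1] at h2; omega
  -- number of faces
  have hF : (Finset.univ.filter (fun f => f ≠ σ o)).card ≤ 4 := by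
    have hwt := X.F.wt
    have hw : P2.wt {σ o}ᶜ = ∑ f ∈ Finset.univ.filter (fun f => f ≠ σ o), (((P2.bd {f}).card : ℤ) - 4) := by
      unfold wt; apply Finset.sum_congr _ (fun _ _ => rfl); ext f; simp
    have hbound : ((Finset.univ.filter (fun f => f ≠ σ o)).card : ℤ) - 1 ≤ ∑ f ∈ Finset.univ.filter (fun f => f ≠ σ o), (((P2.bd {f}).card : ℤ) - 4) := by
      by_cases hex : ∃ f0, f0 ≠ σ o ∧ (P2.bd {f0}).card = 4
      · obtain ⟨f0, hf0, hf4⟩ := hex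
        have m0 : f0 ∈ Finset.univ.filter (fun f => f ≠ σ o) := by simp [hf0]
        rw [← Finset.add_sum_erase _ _ m0, hf4]
        have hw1 : ∀ f, f ≠ σ o → (P2.bd {f}).card = 4 → a3 ∈ P.bd (σ ⁻¹' {f}) := by
          intro f hf h4
          have h5 : a3 ∈ P.bd (σ ⁻¹' {f}) ∩ T6 e12 e34 e51 a2 a3 a4 := by rw [X.four hf h4]; simp
          exact (Finset.mem_inter.1 h5).1
        have : ∀ f ∈ (Finset.univ.filter (fun f => f ≠ σ o)).erase f0, (1 : ℤ) ≤ ((P2.bd {f}).card : ℤ) - 4 := by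
          intro f hf
          simp only [Finset.mem_erase, Finset.mem_filter, Finset.mem_univ, true_and] at hf
          have h4 := X.sz hf.2
          by_contra hlt
          have h5 : (P2.bd {f}).card = 4 := by omega
          have hpf : σ p ≠ f := by intro hh; rw [hh] at hp5; omega
          have hpf0 : σ p ≠ f0 := by intro hh; rw [hh] at hp5; omega
          exact hf.1 (X.twoF (hsub (by simp [T6])) (hw1 f hf.2 h5) (hw1 f0 hf0 hf4) hpf hpf0)
        have h6 := Finset.sum_le_sum this
        rw [Finset.sum_const, Finset.card_erase_of_mem m0] at h6
        have h7 : 0 < (Finset.univ.filter (fun f => f ≠ σ o)).card := Finset.card_pos.2 ⟨_, m0⟩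
        simp only [nsmul_eq_mul, mul_one] at h6
        push_cast [Nat.cast_sub h7] at h6
        push_cast
        linarith
      · push Not at hex
        have : ∀ f ∈ (Finset.univ.filter (fun f => f ≠ σ o)), (1 : ℤ) ≤ ((P2.bd {f}).card : ℤ) - 4 := by
          intro f hf
          simp only [Finset.mem_filter, Finset.mem_univ, true_and] at hf
          have h4 := X.sz hf
          have := hex f hf
          omega
        have h6 := Finset.sum_le_sum this
        rw [Finset.sum_const] at h6
        simp only [nsmul_eq_mul, mul_one] at h6
        linarith
    rw [← hw] at hbound
    omega
  have h5 : (P2.A \ P2.bd {σ o}).card ≤ 5 := by omega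
  obtain ⟨q1, q2, q3, q4, q5, q6, q7, q8, q9, q10, q11, q12, q13, q14⟩ := X.neX
  obtain ⟨r5, r1, r2, r3, r4, rx4, rx2, rx3⟩ := X.K.pr_eq X.H
  have hn := X.K.nde
  have hndv := X.K.ndv; have hy2 := X.K.y2; have hy4 := X.K.y4
  simp only [List.nodup_cons, List.mem_cons, List.not_mem_nil, or_false, not_or] at hn hndv hy2 hy4
  -- two stars sharing no edge
  have two : ∀ z, 3 ≤ (P2.star P2.A z).card → P2.star P2.A z ⊆ P2.A \ P2.bd {σ o} → z ≠ x3 → ∃ e ∈ P2.A, P2.jn e z x3 := by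
    intro z hz1 hz2 hzx
    by_contra hcon
    push Not at hcon
    have hd : Disjoint (P2.star P2.A z) (P2.star P2.A x3) := by
      rw [Finset.disjoint_left]
      intro e h1 h2
      rw [Gr.mem_star] at h1 h2
      obtain ⟨c, hc⟩ := h1.2.jn
      rcases inc_jn hc h2.2 with h | h
      · exact hzx h.symm
      · subst h; exact hcon e h1.1 hc
    have := Finset.card_le_card (Finset.union_subset hz2 hx.2)
    rw [Finset.card_union_of_disjoint hd] at this
    omega
  obtain ⟨e', he', hi'⟩ := X.edge5 (hsub (by simp [T6]))
  have hA' := Finset.mem_sdiff.1 (X.F.A2 he')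
  have hD' := hA'.2
  simp only [D9, Finset.mem_insert, Finset.mem_singleton, not_or] at hD'
  by_cases hx2 : x2 ∈ P.Vs (P.bd {o})
  swap
  · have := X.inc2 hi'
    rw [r5] at this
    have hd := X.deg he' this hx2
    obtain ⟨e, he, hj⟩ := two x2 hd.1 hd.2 (Ne.symm q6)
    exact X.nonadj he hj
  obtain ⟨y, hy⟩ := hi'.jn
  have ny : y ≠ v1 ∧ y ≠ v2 ∧ y ≠ v3 ∧ y ≠ v4 := by
    refine ⟨?_, ?_, ?_, ?_⟩ <;> rintro rfl <;> exact hA'.2 (X.K.inD X.H hA'.1 (by simp [hy.inc']))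
  have ny5 : y ≠ v5 := fun h => X.H.tf.jn_ne hA'.1 hy h.symm
  have j2' := jn_map X.F.gr hy
  have nyx3 : y ≠ x3 := by
    rintro rfl; rw [r5, rx3] at j2'; exact X.nonadj he' j2'
  have nyx4 : y ≠ x4 := by
    rintro rfl; rw [r5, rx4] at j2'; exact X.nonadj he' j2'
  have ry : pr v1 v2 v3 v4 v5 x2 x3 x4 y = y := pr_id (by simp [ny, ny5, nyx4])
  rw [r5, ry] at j2'
  by_cases hyC : y ∈ P.Vs (P.bd {o})
  swap
  · have hd := X.deg he' j2'.inc' hyC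
    obtain ⟨e, he, hj⟩ := two y hd.1 hd.2 nyx3
    have hA := Finset.mem_sdiff.1 (X.F.A2 he)
    have hD := hA.2
    simp only [D9, Finset.mem_insert, Finset.mem_singleton, not_or] at hD
    obtain ⟨a, b, j, ha, hb, na, nb⟩ := X.ends2 he hj
    have hay : a = y := by
      unfold pr at ha
      split_ifs at ha with h1 h2
      · exact absurd (ha ▸ hx2) hyC
      · exact absurd ha.symm nyx3
      · exact ha
    subst hay
    have hee : e ≠ e' := by
      rintro rfl
      rcases ends j2' hj with ⟨h1, h2⟩ | ⟨h1, h2⟩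
      · exact nyx3 h2
      · exact q6 h1.symm
    rcases pr_x3 hb nb q6 with rfl | rfl
    · exact five X.H (p := p) X.K.k3.symm X.K.j34 X.K.j45 hy j X.K.B3 X.K.A34 X.K.A45 hA'.1 hA.1 (by
        simp only [List.nodup_cons, List.mem_cons, List.not_mem_nil, or_false, not_or]
        clear * - hn hD hD' hee; grind) (by simp [X.K.b]) (by simp [X.K.b]) X.K.p3 X.K.c4
    · exact quad X.H X.K.A45 hA'.1 hA.1 X.K.B4 X.K.j45 hy j X.K.k4.symm (Ne.symm ny.2.2.2) q14 X.K.c4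
  -- now all edges at x3 go to C
  have toC : ∀ e ∈ P2.star P2.A x3, ∀ z, P2.jn e x3 z → z ∈ P.Vs (P.bd {o}) := by
    intro e he z hj
    by_contra hz
    rw [Gr.mem_star] at he
    have hd := X.deg he.1 hj.inc' hz
    have hne : z ≠ x3 := fun h => X.F.st.tf.jn_ne he.1 hj h.symm
    have hcap1 : (P2.star P2.A z ∩ P2.star P2.A x3).card ≤ 1 := by
      rw [Finset.card_le_one]
      intro f1 h1 f2 h2
      simp only [Finset.mem_inter, Gr.mem_star] at h1 h2
      have key : ∀ f, P2.inc f z → P2.inc f x3 → P2.jn f z x3 := by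
        intro f i1 i2
        obtain ⟨c, hc⟩ := i1.jn
        rcases inc_jn hc i2 with h | h
        · exact absurd h.symm hne
        · subst h; exact hc
      exact X.F.st.tf.par h1.1.1 h2.1.1 (key _ h1.1.2 h1.2.2) (key _ h2.1.2 h2.2.2)
    have hee : e' ∉ P2.star P2.A z ∪ P2.star P2.A x3 := by
      simp only [Finset.mem_union, Gr.mem_star, not_or, not_and]
      refine ⟨fun _ hh => ?_, fun _ hh => ?_⟩
      · rcases inc_jn j2' hh with rfl | rfl
        · exact hz hx2
        · exact hz hyC
      · rcases inc_jn j2' hh with h | h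
        · exact q6 h
        · exact nyx3 h.symm
    have heC : e' ∉ P2.bd {σ o} := by
      rw [X.F.C]; intro hh; exact X.K.c5 ⟨e', hh, hy.inc⟩
    have h6 := Finset.card_le_card (Finset.insert_subset (Finset.mem_sdiff.2 ⟨he', heC⟩) (Finset.union_subset hd.2 hx.2))
    rw [Finset.card_insert_of_notMem hee] at h6
    have := Finset.card_union_add_card_inter (P2.star P2.A z) (P2.star P2.A x3)
    omega
  -- each edge at x3 is an edge of P from x3 or x4 to C
  have cl : ∀ e ∈ P2.star P2.A x3, e ∈ P.A ∧ ∃ w ∈ P.Vs (P.bd {o}), P.jn e x3 w ∨ P.jn e x4 w := by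
    intro e he
    have he0 := he
    rw [Gr.mem_star] at he
    have hA := Finset.mem_sdiff.1 (X.F.A2 he.1)
    obtain ⟨z, hz⟩ := he.2.jn
    have hzC := toC e he0 z hz
    obtain ⟨a, b, j, ha, hb, na, nb⟩ := X.ends2 he.1 hz
    have hzx2 : z ≠ x2 := by rintro rfl; exact X.nonadj he.1 hz.symm
    have hbz : b = z := by
      unfold pr at hb
      split_ifs at hb with h1 h2
      · exact absurd hb.symm hzx2
      · exact absurd (hb ▸ hzC) X.K.d3
      · exact hb
    subst hbz
    refine ⟨hA.1, b, hzC, ?_⟩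
    rcases pr_x3 ha na q6 with rfl | rfl
    · exact Or.inl j
    · exact Or.inr j
  obtain ⟨f1, f2, f3, m1, m2, m3, n12, n13, n23⟩ := (Finset.two_lt_card_iff (s := P2.star P2.A x3)).1 (by omega)
  obtain ⟨b1, w1, c1, k1⟩ := cl _ m1
  obtain ⟨b2, w2, c2, k2⟩ := cl _ m2
  obtain ⟨b3, w3, c3, k3⟩ := cl _ m3
  have u3 : ∀ {f g w w'}, f ∈ P.A → g ∈ P.A → w ∈ P.Vs (P.bd {o}) → w' ∈ P.Vs (P.bd {o}) → P.jn f x3 w → P.jn g x3 w' → f = g :=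
    fun h1 h2 h3 h4 h5 h6 => X.H.no2 h1 h2 h5 h6 X.K.d3 h3 h4
  have u4 : ∀ {f g w w'}, f ∈ P.A → g ∈ P.A → w ∈ P.Vs (P.bd {o}) → w' ∈ P.Vs (P.bd {o}) → P.jn f x4 w → P.jn g x4 w' → f = g :=
    fun h1 h2 h3 h4 h5 h6 => X.H.no2 h1 h2 h5 h6 X.K.d4 h3 h4
  rcases k1 with k1 | k1 <;> rcases k2 with k2 | k2
  · exact n12 (u3 b1 b2 c1 c2 k1 k2)
  · rcases k3 with k3 | k3
    · exact n13 (u3 b1 b3 c1 c3 k1 k3)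
    · exact n23 (u4 b2 b3 c2 c3 k2 k3)
  · rcases k3 with k3 | k3
    · exact n23 (u3 b2 b3 c2 c3 k2 k3)
    · exact n13 (u4 b1 b3 c1 c3 k1 k3)
  · exact n12 (u4 b1 b2 c1 c2 k1 k2)

theorem pentagram (H : Cex n P o) (K : Pent P o p v1 v2 v3 v4 v5 x1 x2 x3 x4 e12 e23 e34 e45 e51 a1 a2 a3 a4) : False := by
  have K2 := K.up H
  obtain ⟨P2, σ, F⟩ := K2.fold H
  have X : PF n P o p v1 v2 v3 v4 v5 x1 x2 x3 x4 e12 e23 e34 e45 e51 a1 a2 a3 a4 P2 σ := ⟨H, K2, F⟩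
  rcases X.cs {σ p} with h | h | h | h
  exacts [X.not_i h, X.not_ii h, X.not_iii h, X.not_iv h]

end PM
end CF

end

open Set Topology

noncomputable section
namespace CF
set_option linter.all false
open scoped Classical symmDiff

namespace PM
variable {V E : Type} [Fintype V]
variable {n : ℕ} {P : PM V E} {o : P.F}

theorem faces_of (H : Std n P o) {e} (he : e ∈ P.A) : Finset.univ.filter (fun f => e ∈ P.bd {f}) = {P.l e, P.r e} := by
  have h := bridgeless H he
  ext f
  simp only [mem_bd1, Finset.mem_filter, Finset.mem_univ, true_and, Finset.mem_insert, Finset.mem_singleton, he]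
  constructor
  · intro h2; by_contra h3; apply h2; push Not at h3
    exact ⟨fun h4 => absurd h4.symm h3.1, fun h4 => absurd h4.symm h3.2⟩
  · rintro (rfl | rfl) h2
    · exact h (h2.1 rfl).symm
    · exact h (h2.2 rfl)

theorem sum_bd (H : Std n P o) {S : Finset E} (hS : S ⊆ P.A) : ∑ f, (S.filter (fun e => e ∈ P.bd {f})).card = 2 * S.card := by
  simp_rw [Finset.card_filter]
  rw [Finset.sum_comm]
  have : ∀ e ∈ S, (∑ f : P.F, if e ∈ P.bd {f} then 1 else 0) = 2 := by
    intro e he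
    rw [← Finset.card_filter, faces_of H (hS he), Finset.card_pair (bridgeless H (hS he))]
  rw [Finset.sum_congr rfl this]; simp [mul_comm]

/-- edges joining the outer cycle to the interior -/
def CI (P : PM V E) (o : P.F) : Finset E := P.A.filter (fun e => e ∉ P.bd {o} ∧ ∃ v ∈ P.Vs (P.bd {o}), P.inc e v)
/-- interior vertices -/
def In (P : PM V E) (o : P.F) : Finset V := (Vp P.toGr P.A).filter (fun v => v ∉ P.Vs (P.bd {o}))

theorem mem_In {v} : v ∈ P.In o ↔ (∃ e ∈ P.A, P.inc e v) ∧ v ∉ P.Vs (P.bd {o}) := by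
  simp [In, mem_Vp]
theorem mem_CI {e} : e ∈ P.CI o ↔ e ∈ P.A ∧ e ∉ P.bd {o} ∧ ∃ v ∈ P.Vs (P.bd {o}), P.inc e v := by
  simp [CI]

theorem ends_In (H : Cex n P o) {e} (he : e ∈ P.A) : ((P.In o).filter (fun v => P.inc e v)).card +
    2 * (if e ∈ P.bd {o} then 1 else 0) + (if e ∈ P.CI o then 1 else 0) = 2 := by
  have hne : P.s e ≠ P.t e := H.tf.nl e he
  have key : (P.In o).filter (fun v => P.inc e v) = ({P.s e, P.t e} : Finset V).filter (fun v => v ∉ P.Vs (P.bd {o})) := by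
    ext v
    simp only [Finset.mem_filter, mem_In, Finset.mem_insert, Finset.mem_singleton]
    constructor
    · rintro ⟨⟨_, h1⟩, h2⟩
      exact ⟨h2.imp Eq.symm Eq.symm, h1⟩
    · rintro ⟨h1, h2⟩
      have : P.inc e v := h1.imp Eq.symm Eq.symm
      exact ⟨⟨⟨e, he, this⟩, h2⟩, this⟩
  rw [key]
  have is : P.inc e (P.s e) := Or.inl rfl
  have it : P.inc e (P.t e) := Or.inr rfl
  by_cases hC : e ∈ P.bd {o}
  · have h1 : e ∉ P.CI o := fun h => (mem_CI.1 h).2.1 hC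
    have h2 : P.s e ∈ P.Vs (P.bd {o}) := ⟨e, hC, is⟩
    have h3 : P.t e ∈ P.Vs (P.bd {o}) := ⟨e, hC, it⟩
    simp [hC, h1, Finset.filter_insert, Finset.filter_singleton, h2, h3]
  · by_cases hs : P.s e ∈ P.Vs (P.bd {o})
    · have h3 : P.t e ∉ P.Vs (P.bd {o}) := fun h => H.no1 he hC (Or.inl ⟨rfl, rfl⟩) hs h
      have h1 : e ∈ P.CI o := mem_CI.2 ⟨he, hC, _, hs, is⟩
      simp [hC, h1, Finset.filter_insert, Finset.filter_singleton, hs, h3]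
    · by_cases ht : P.t e ∈ P.Vs (P.bd {o})
      · have h1 : e ∈ P.CI o := mem_CI.2 ⟨he, hC, _, ht, it⟩
        simp [hC, h1, Finset.filter_insert, Finset.filter_singleton, hs, ht]
      · have h1 : e ∉ P.CI o := by
          intro h
          obtain ⟨_, _, v, hv, hi⟩ := mem_CI.1 h
          rcases hi with rfl | rfl <;> contradiction
        simp [hC, h1, Finset.filter_insert, Finset.filter_singleton, hs, ht, Finset.card_pair hne]

theorem deg_In (H : Cex n P o) {B : Finset E} (hB : B ⊆ P.A) : ∑ v ∈ P.In o, (P.star B v).card +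
    2 * (B.filter (fun e => e ∈ P.bd {o})).card + (B.filter (fun e => e ∈ P.CI o)).card = 2 * B.card := by
  unfold Gr.star
  simp_rw [Finset.card_filter]
  rw [Finset.sum_comm, Finset.mul_sum, ← Finset.sum_add_distrib, ← Finset.sum_add_distrib]
  rw [Finset.sum_congr rfl (g := fun _ => 2)]
  · simp [mul_comm]
  · intro e he
    have := ends_In H (hB he)
    rw [Finset.card_filter] at this
    exact this

theorem Vp_le (H : Cex n P o) : (Vp P.toGr P.A).card ≤ (P.In o).card + (P.bd {o}).card := by
  have h1 : Vp P.toGr P.A = P.In o ∪ Vp P.toGr (P.bd {o}) := by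
    ext v
    simp only [Finset.mem_union, mem_In, mem_Vp, Gr.Vs, Set.mem_setOf_eq]
    constructor
    · intro h; by_cases h2 : ∃ e ∈ P.bd {o}, P.inc e v
      · exact Or.inr h2
      · exact Or.inl ⟨h, h2⟩
    · rintro (h | ⟨e, he, h⟩)
      · exact h.1
      · exact ⟨e, bd_sub _ he, h⟩
  rw [h1]
  refine (Finset.card_union_le _ _).trans ?_
  have hN := (H.tf.mono (bd_sub {o})).nl
  have h2 := deg_sum' hN
  have h3 : ∀ v ∈ Vp P.toGr (P.bd {o}), 2 ≤ (P.star (P.bd {o}) v).card := by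
    intro v hv
    obtain ⟨e, he, hi⟩ := mem_Vp.1 hv
    have h4 := Gr.ev_star hN (ev_bd _) v
    have h5 : 0 < (P.star (P.bd {o}) v).card := Finset.card_pos.2 ⟨e, Gr.mem_star.2 ⟨he, hi⟩⟩
    rcases h4 with ⟨r, hr⟩; omega
  have h4 := Finset.card_nsmul_le_sum _ _ _ h3
  rw [smul_eq_mul, h2] at h4
  omega

theorem star_bd_two {v} (H : Std n P o) {R : Set P.F} {e} (he : e ∈ P.bd R) (hi : P.inc e v) : 2 ≤ (P.star (P.bd R) v).card := by
  have h4 := Gr.ev_star ((H.tf.mono (bd_sub R)).nl) (ev_bd _) v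
  have h5 : 0 < (P.star (P.bd R) v).card := Finset.card_pos.2 ⟨e, Gr.mem_star.2 ⟨he, hi⟩⟩
  rcases h4 with ⟨r, hr⟩; omega

/-- face with no CI edge has no C edge -/
theorem t0_j0 (H : Cex n P o) {f : P.F} (hf : f ≠ o) (ht : ∀ e ∈ P.bd {f}, e ∉ P.CI o) : ∀ e ∈ P.bd {f}, e ∉ P.bd {o} := by
  intro e he heC
  have hb : P.bd {f} ∩ P.bd {o} = P.bd {o} := by
    apply H.cr.2.1.2.2 _ Finset.inter_subset_right
    · apply Gr.ev_of_star ((H.tf.mono (Finset.inter_subset_left.trans (bd_sub {f}))).nl)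
      intro v
      by_cases hv : v ∈ P.Vs (P.bd {o})
      · have : P.star (P.bd {f} ∩ P.bd {o}) v = P.star (P.bd {f}) v := by
          ext e
          simp only [Gr.mem_star, Finset.mem_inter]
          constructor
          · tauto
          · rintro ⟨h1, h2⟩
            refine ⟨⟨h1, ?_⟩, h2⟩
            by_contra h3
            exact ht e h1 (mem_CI.2 ⟨bd_sub _ h1, h3, v, hv, h2⟩)
        rw [this]
        exact Gr.ev_star ((H.tf.mono (bd_sub {f})).nl) (ev_bd _) v
      · have : P.star (P.bd {f} ∩ P.bd {o}) v = ∅ := by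
          ext e
          simp only [Gr.mem_star, Finset.mem_inter, Finset.notMem_empty, iff_false]
          rintro ⟨⟨_, h1⟩, h2⟩
          exact hv ⟨e, h1, h2⟩
        rw [this]; simp
    · intro h
      have : e ∈ P.bd {f} ∩ P.bd {o} := by simp [he, heC]
      rw [h] at this; simp at this
  have hsub : P.bd {o} ⊆ P.bd {f} := by rw [← hb]; exact Finset.inter_subset_left
  have hsd : ∀ e ∈ P.bd {o}, P.sd e f o := by
    intro e he
    have h1 := mem_bd1.1 he
    have h2 := mem_bd1.1 (hsub he)
    unfold sd
    have h3 := h1.2; have h4 := h2.2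
    by_cases a : P.l e = o
    · by_cases b : P.r e = f
      · exact Or.inr ⟨a, b⟩
      · exfalso; apply h4; rw [a]; exact ⟨fun h => absurd h.symm hf, fun h => absurd h b⟩
    · by_cases b : P.l e = f
      · left; refine ⟨b, ?_⟩
        by_contra c; exact h3 ⟨fun h => absurd h a, fun h => absurd h c⟩
      · exfalso
        have hr : P.r e = f := by by_contra c; exact h4 ⟨fun h => absurd h b, fun h => absurd h c⟩
        apply h3; rw [hr]; exact ⟨fun h => absurd h a, fun h => absurd h hf⟩
  obtain ⟨x0, -⟩ : ∃ x : V, True := ⟨P.s e, trivial⟩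
  apply sep H.toStd (P.bd {o}) (P.A \ P.bd {o}) (by rw [Finset.union_sdiff_of_subset (bd_sub _)]) Finset.disjoint_sdiff ⟨e, heC⟩
  · rw [Finset.nonempty_iff_ne_empty]; intro h
    rw [Finset.sdiff_eq_empty_iff_subset] at h
    exact H.cr.2.2.1 (Finset.Subset.antisymm (bd_sub _) h)
  · intro x e1 e2 h1 h2 i1 i2
    exfalso
    obtain ⟨e3, h3, hne⟩ := Finset.exists_mem_ne (show 1 < _ from star_bd_two H.toStd h1 i1) e1
    rw [Gr.mem_star] at h3
    have := twin H.toStd hne.symm (bd_sub _ h1) (bd_sub _ h3.1) i1 h3.2 (hsd _ h1) (hsd _ h3.1)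
    rw [Finset.mem_sdiff] at h2
    have h4 : e2 ∈ P.star P.A x := Gr.mem_star.2 ⟨h2.1, i2⟩
    rw [this] at h4
    simp at h4
    rcases h4 with rfl | rfl
    · exact h2.2 h1
    · exact h2.2 h3.1
  · exact x0

end PM
end CF

end

open Set Topology

noncomputable section
namespace CF
set_option linter.all false
open scoped Classical symmDiff

namespace PM
variable {V E : Type} [Fintype V]
variable {n : ℕ} {P : PM V E} {o : P.F}

/-- an internal pentagonal face with its labels -/
structure Pg (P : PM V E) (o p : P.F) (v1 v2 v3 v4 v5 : V) (e12 e23 e34 e45 e51 : E) : Prop where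
  hp : p ≠ o
  b : P.bd {p} = {e12, e23, e34, e45, e51}
  nd : [e12, e23, e34, e45, e51].Nodup
  j12 : P.jn e12 v1 v2
  j23 : P.jn e23 v2 v3
  j34 : P.jn e34 v3 v4
  j45 : P.jn e45 v4 v5
  j51 : P.jn e51 v5 v1
  fr : ∀ v ∈ P.Vs (P.bd {p}), v ∉ P.Vs (P.bd {o})

variable {p : P.F} {v1 v2 v3 v4 v5 : V} {e12 e23 e34 e45 e51 : E}

theorem Pg.rot (K : Pg P o p v1 v2 v3 v4 v5 e12 e23 e34 e45 e51) : Pg P o p v2 v3 v4 v5 v1 e23 e34 e45 e51 e12 where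
  hp := K.hp
  b := by rw [K.b]; ext; simp; tauto
  nd := by have := K.nd; clear K; simp at *; grind
  j12 := K.j23
  j23 := K.j34
  j34 := K.j45
  j45 := K.j51
  j51 := K.j12
  fr := K.fr

theorem Pg.mir (K : Pg P o p v1 v2 v3 v4 v5 e12 e23 e34 e45 e51) : Pg P o p v4 v3 v2 v1 v5 e34 e23 e12 e51 e45 where
  hp := K.hp
  b := by rw [K.b]; ext; simp; tauto
  nd := by have := K.nd; clear K; simp at *; grind
  j12 := K.j34.symm
  j23 := K.j23.symm
  j34 := K.j12.symm
  j45 := K.j51.symm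
  j51 := K.j45.symm
  fr := K.fr

theorem Pg.mem (K : Pg P o p v1 v2 v3 v4 v5 e12 e23 e34 e45 e51) : e12 ∈ P.bd {p} := by rw [K.b]; simp

theorem Pg.ne (H : Cex n P o) (K : Pg P o p v1 v2 v3 v4 v5 e12 e23 e34 e45 e51) : v1 ≠ v2 ∧ v1 ≠ v3 := by
  refine ⟨H.tf.jn_ne (bd_sub _ K.mem) K.j12, ?_⟩
  rintro rfl
  have := H.tf.par (bd_sub _ K.mem) (bd_sub _ K.rot.mem) K.j12 K.j23.symm
  have h := K.nd
  rw [this] at h; simp at h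

theorem Pg.ndv (H : Cex n P o) (K : Pg P o p v1 v2 v3 v4 v5 e12 e23 e34 e45 e51) : [v1, v2, v3, v4, v5].Nodup := by
  have h1 := K.ne H
  have h2 := K.rot.ne H
  have h3 := K.rot.rot.ne H
  have h4 := K.rot.rot.rot.ne H
  have h5 := K.rot.rot.rot.rot.ne H
  clear * - h1 h2 h3 h4 h5
  simp; grind

theorem Pg.star (H : Cex n P o) (K : Pg P o p v1 v2 v3 v4 v5 e12 e23 e34 e45 e51) : P.star (P.bd {p}) v1 = {e51, e12} := by
  have hn := K.ndv H
  have a1 := fun h => inc_jn (c := v1) K.j12 h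
  have a2 := fun h => inc_jn (c := v1) K.j23 h
  have a3 := fun h => inc_jn (c := v1) K.j34 h
  have a4 := fun h => inc_jn (c := v1) K.j45 h
  have i1 := K.j12.inc
  have i2 := K.j51.symm.inc
  ext e
  rw [Gr.mem_star, K.b]
  clear K
  simp only [Finset.mem_insert, Finset.mem_singleton]
  simp at hn
  constructor
  · rintro ⟨rfl | rfl | rfl | rfl | rfl, h⟩
    · simp
    · have := a2 h; grind
    · have := a3 h; grind
    · have := a4 h; grind
    · simp
  · rintro (rfl | rfl)
    · exact ⟨by simp, i2⟩
    · exact ⟨by simp, i1⟩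

theorem Pg.third (H : Cex n P o) (K : Pg P o p v1 v2 v3 v4 v5 e12 e23 e34 e45 e51) (h3 : (P.star P.A v1).card = 3) :
    ∃ a x, P.star P.A v1 = {e51, e12, a} ∧ P.jn a v1 x ∧ a ∉ P.bd {p} := by
  have hs := K.star H
  have hsub : ({e51, e12} : Finset E) ⊆ P.star P.A v1 := by
    rw [← hs]; intro e; simp only [Gr.mem_star]; exact fun h => ⟨bd_sub _ h.1, h.2⟩
  have hne : e51 ≠ e12 := by have := K.nd; clear * - this; simp at this; grind
  have hc : (P.star P.A v1 \ {e51, e12}).card = 1 := by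
    rw [Finset.card_sdiff_of_subset hsub, h3, Finset.card_pair hne]
  obtain ⟨a, ha⟩ := Finset.card_eq_one.1 hc
  have h4 : P.star P.A v1 = {e51, e12, a} := by
    rw [← Finset.union_sdiff_of_subset hsub, ha]; ext; simp
  have h5 : a ∈ P.star P.A v1 \ {e51, e12} := by rw [ha]; simp
  rw [Finset.mem_sdiff, Gr.mem_star] at h5
  obtain ⟨x, hx⟩ := h5.1.2.jn
  refine ⟨a, x, h4, hx, fun h => h5.2 ?_⟩
  rw [← hs, Gr.mem_star]; exact ⟨h, h5.1.2⟩

/-- a vertex with an edge to the outer cycle -/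
def hasCI (P : PM V E) (o : P.F) (v : V) : Prop := ∃ e ∈ P.CI o, P.inc e v

theorem Pg.c1 (K : Pg P o p v1 v2 v3 v4 v5 e12 e23 e34 e45 e51) : v1 ∉ P.Vs (P.bd {o}) := K.fr _ ⟨e12, K.mem, K.j12.inc⟩

theorem Pg.d (K : Pg P o p v1 v2 v3 v4 v5 e12 e23 e34 e45 e51) {a x e e'} (hs : P.star P.A v1 = {e, e', a})
    (hj : P.jn a v1 x) (h : ¬ P.hasCI o v1) : x ∉ P.Vs (P.bd {o}) := by
  intro hx
  have ha : a ∈ P.star P.A v1 := by rw [hs]; simp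
  rw [Gr.mem_star] at ha
  refine h ⟨a, mem_CI.2 ⟨ha.1, fun hC => K.c1 ⟨a, hC, ha.2⟩, x, hx, hj.symm.inc⟩, ha.2⟩

theorem Pg.kill (H : Cex n P o) (K : Pg P o p v1 v2 v3 v4 v5 e12 e23 e34 e45 e51) (d1 : (P.star P.A v1).card = 3)
    (d2 : (P.star P.A v2).card = 3) (d3 : (P.star P.A v3).card = 3) (d4 : (P.star P.A v4).card = 3)
    (h3 : ¬ P.hasCI o v3) (h4 : ¬ P.hasCI o v4) : False := by
  obtain ⟨a1, x1, s1, k1, q1⟩ := K.third H d1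
  obtain ⟨a2, x2, s2, k2, q2⟩ := K.rot.third H d2
  obtain ⟨a3, x3, s3, k3, q3⟩ := K.rot.rot.third H d3
  obtain ⟨a4, x4, s4, k4, q4⟩ := K.rot.rot.rot.third H d4
  have K2 : Pent P o p v1 v2 v3 v4 v5 x1 x2 x3 x4 e12 e23 e34 e45 e51 a1 a2 a3 a4 :=
    { hp := K.hp, b := K.b, nd := K.nd, j12 := K.j12, j23 := K.j23, j34 := K.j34, j45 := K.j45, j51 := K.j51,
      k1 := k1, k2 := k2, k3 := k3, k4 := k4, s1 := s1, s2 := s2, s3 := s3, s4 := s4, p1 := q1, p2 := q2, p3 := q3, p4 := q4,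
      c1 := K.c1, c2 := K.rot.c1, c3 := K.rot.rot.c1, c4 := K.rot.rot.rot.c1, c5 := K.rot.rot.rot.rot.c1,
      d3 := K.rot.rot.d s3 k3 h3, d4 := K.rot.rot.rot.d s4 k4 h4 }
  exact pentagram H K2

/-- charge from a vertex -/
def chv (P : PM V E) (v : V) : ℤ := if (P.star P.A v).card = 3 then -6 else 9
/-- bonus indicator -/
def bns (P : PM V E) (o : P.F) (v : V) (f : P.F) : Prop :=
  (P.star P.A v).card = 3 ∧ v ∈ P.Vs (P.bd {f}) ∧ ∃ e ∈ P.CI o, P.inc e v ∧ e ∉ P.bd {f}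
/-- contribution of a vertex -/
def vx (P : PM V E) (o : P.F) (v : V) (f : P.F) : ℤ := P.chv v * (P.star (P.bd {f}) v).card + 20 * (if P.bns o v f then 1 else 0)
/-- final charge of a face -/
def X (P : PM V E) (o f : P.F) : ℤ := 72 * (((P.bd {f}).card : ℤ) - 5) + ∑ v ∈ P.In o, P.vx o v f +
  44 * ((P.bd {f}).filter (fun e => e ∈ P.CI o)).card

/-- value of a pentagon vertex -/
def val (d b : Prop) : ℤ := if d then (if b then 8 else -12) else 18

theorem Pg.vx (H : Cex n P o) (K : Pg P o p v1 v2 v3 v4 v5 e12 e23 e34 e45 e51) (ht : ∀ e ∈ P.bd {p}, e ∉ P.CI o) :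
    P.vx o v1 p = val ((P.star P.A v1).card = 3) (P.hasCI o v1) := by
  have hne : e51 ≠ e12 := by have := K.nd; clear * - this; simp at this; grind
  have hb : P.bns o v1 p ↔ (P.star P.A v1).card = 3 ∧ P.hasCI o v1 := by
    unfold bns hasCI
    constructor
    · rintro ⟨h1, _, e, h2, h3, _⟩; exact ⟨h1, e, h2, h3⟩
    · rintro ⟨h1, e, h2, h3⟩; exact ⟨h1, ⟨e12, K.mem, K.j12.inc⟩, e, h2, h3, fun h => ht e h h2⟩
  unfold PM.vx val chv
  rw [K.star H, Finset.card_pair hne, if_congr hb rfl rfl]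
  by_cases h1 : (P.star P.A v1).card = 3 <;> by_cases h2 : P.hasCI o v1 <;> simp [h1, h2]

theorem val_nn {D1 D2 D3 D4 D5 b1 b2 b3 b4 b5 : Prop}
    (k0 : D1 → D2 → D3 → D4 → ¬ b3 → ¬ b4 → False) (k1 : D2 → D3 → D4 → D5 → ¬ b4 → ¬ b5 → False)
    (k2 : D3 → D4 → D5 → D1 → ¬ b5 → ¬ b1 → False) (k3 : D4 → D5 → D1 → D2 → ¬ b1 → ¬ b2 → False)
    (k4 : D5 → D1 → D2 → D3 → ¬ b2 → ¬ b3 → False)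
    (m0 : D4 → D3 → D2 → D1 → ¬ b2 → ¬ b1 → False) (m1 : D5 → D4 → D3 → D2 → ¬ b3 → ¬ b2 → False)
    (m2 : D1 → D5 → D4 → D3 → ¬ b4 → ¬ b3 → False) (m3 : D2 → D1 → D5 → D4 → ¬ b5 → ¬ b4 → False)
    (m4 : D3 → D2 → D1 → D5 → ¬ b1 → ¬ b5 → False) : 0 ≤ val D1 b1 + val D2 b2 + val D3 b3 + val D4 b4 + val D5 b5 := by
  unfold val
  by_cases D1 <;> by_cases D2 <;> by_cases D3 <;> by_cases D4 <;> by_cases D5 <;> 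
    simp only [*, if_true, if_false] <;> (try split_ifs) <;> first | omega | (exfalso; simp_all; done)

theorem Pg.nn (H : Cex n P o) (K : Pg P o p v1 v2 v3 v4 v5 e12 e23 e34 e45 e51) (ht : ∀ e ∈ P.bd {p}, e ∉ P.CI o) :
    0 ≤ P.vx o v1 p + P.vx o v2 p + P.vx o v3 p + P.vx o v4 p + P.vx o v5 p := by
  have R1 := K.rot; have R2 := R1.rot; have R3 := R2.rot; have R4 := R3.rot
  rw [K.vx H ht, R1.vx H ht, R2.vx H ht, R3.vx H ht, R4.vx H ht]
  have k0 := K.kill H; have k1 := R1.kill H; have k2 := R2.kill H; have k3 := R3.kill H; have k4 := R4.kill H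
  have m0 := K.mir.kill H; have m1 := R1.mir.kill H; have m2 := R2.mir.kill H; have m3 := R3.mir.kill H; have m4 := R4.mir.kill H
  exact val_nn k0 k1 k2 k3 k4 m0 m1 m2 m3 m4

theorem pent_nn (H : Cex n P o) (hp : p ≠ o) (h5 : (P.bd {p}).card = 5) (ht : ∀ e ∈ P.bd {p}, e ∉ P.CI o) : 0 ≤ ∑ v ∈ P.In o, P.vx o v p := by
  have hj := t0_j0 H hp ht
  obtain ⟨e, he⟩ : (P.bd {p}).Nonempty := Finset.card_pos.1 (by omega)
  obtain ⟨e2, e3, e4, e5, v3, v4, v5, hnd, hb, j2, j3, j4, j5⟩ := cyc5 H.tf (bd_sub {p}) (ev_bd _) h5 he (Or.inl ⟨rfl, rfl⟩)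
  have fr : ∀ v ∈ P.Vs (P.bd {p}), v ∉ P.Vs (P.bd {o}) := by
    rintro v ⟨e, he, hi⟩ hv
    exact ht e he (mem_CI.2 ⟨bd_sub _ he, hj e he, v, hv, hi⟩)
  have K : Pg P o p (P.s e) (P.t e) v3 v4 v5 e e2 e3 e4 e5 := 
    { hp := hp, b := hb, nd := hnd, j12 := Or.inl ⟨rfl, rfl⟩, j23 := j2, j34 := j3, j45 := j4, j51 := j5, fr := fr }
  have hv := K.ndv H
  have h0 := K.nn H ht
  have hI : ∀ {e v}, e ∈ P.bd {p} → P.inc e v → v ∈ P.In o := fun he hi => mem_In.2 ⟨⟨_, bd_sub _ he, hi⟩, fr _ ⟨_, he, hi⟩⟩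
  have h1 := hI K.mem K.j12.inc
  have h2 := hI K.rot.mem K.j23.inc
  have h3 := hI K.rot.rot.mem K.j34.inc
  have h4 := hI K.rot.rot.rot.mem K.j45.inc
  have h5 := hI K.rot.rot.rot.rot.mem K.j51.inc
  have hS : ({P.s e, P.t e, v3, v4, v5} : Finset V) ⊆ P.In o := by
    intro x hx; simp only [Finset.mem_insert, Finset.mem_singleton] at hx
    rcases hx with rfl | rfl | rfl | rfl | rfl <;> assumption
  rw [← Finset.sum_subset hS]
  · have : ∑ v ∈ ({P.s e, P.t e, v3, v4, v5} : Finset V), P.vx o v p = P.vx o (P.s e) p + P.vx o (P.t e) p + P.vx o v3 p + P.vx o v4 p + P.vx o v5 p := by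
      clear * - hv
      simp at hv
      rw [Finset.sum_insert (by simp; tauto), Finset.sum_insert (by simp; tauto), Finset.sum_insert (by simp; tauto), Finset.sum_insert (by simp; tauto), Finset.sum_singleton]
      ring
    rw [this]; exact h0
  · intro x _ hx
    have hx2 : x ∉ P.Vs (P.bd {p}) := by
      rintro ⟨e', he', hi⟩
      rw [hb] at he'
      simp only [Finset.mem_insert, Finset.mem_singleton] at he' hx
      clear * - he' hx hi j2 j3 j4 j5
      rcases he' with rfl | rfl | rfl | rfl | rfl
      · rcases hi with rfl | rfl <;> simp at hx
      · rcases inc_jn j2 hi with rfl | rfl <;> simp at hx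
      · rcases inc_jn j3 hi with rfl | rfl <;> simp at hx
      · rcases inc_jn j4 hi with rfl | rfl <;> simp at hx
      · rcases inc_jn j5 hi with rfl | rfl <;> simp at hx
    have h6 : P.star (P.bd {p}) x = ∅ := by
      ext e'; simp only [Gr.mem_star, Finset.notMem_empty, iff_false]
      exact fun h => hx2 ⟨e', h⟩
    unfold PM.vx
    rw [h6, if_neg (fun h : P.bns o x p => hx2 h.2.1)]; simp
end PM
end CF

end

open Set Topology

noncomputable section
namespace CF
set_option linter.all false
open scoped Classical symmDiff

namespace PM
variable {V E : Type} [Fintype V]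
variable {n : ℕ} {P : PM V E} {o : P.F}

theorem vx_ge (v : V) (f : P.F) : -6 * ((P.star (P.bd {f}) v).card : ℤ) ≤ P.vx o v f := by
  unfold vx chv
  split_ifs <;> nlinarith

/-- each internal face keeps enough charge -/
theorem X_ge (H : Cex n P o) {f : P.F} (hf : f ≠ o) :
    32 * (((P.bd {f}).filter (fun e => e ∈ P.bd {o})).card : ℤ) ≤ P.X o f ∧
    (P.X o f = 32 * (((P.bd {f}).filter (fun e => e ∈ P.bd {o})).card : ℤ) → Even ((P.bd {f}).filter (fun e => e ∈ P.bd {o})).card) := by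
  have h5 := H.f5 hf
  have hd := deg_In H (bd_sub {f})
  have hge : -6 * (∑ v ∈ P.In o, (P.star (P.bd {f}) v).card : ℤ) ≤ ∑ v ∈ P.In o, P.vx o v f := by
    rw [Finset.mul_sum]; exact Finset.sum_le_sum (fun v _ => vx_ge v f)
  by_cases ht : ∀ e ∈ P.bd {f}, e ∉ P.CI o
  · have hj := t0_j0 H hf ht
    have e1 : (P.bd {f}).filter (fun e => e ∈ P.bd {o}) = ∅ := Finset.filter_eq_empty_iff.2 (fun e he => hj e he)
    have e2 : (P.bd {f}).filter (fun e => e ∈ P.CI o) = ∅ := Finset.filter_eq_empty_iff.2 (fun e he => ht e he)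
    rw [e1]
    refine ⟨?_, fun _ => by simp⟩
    unfold X
    rw [e1, e2] at hd
    rw [e2]
    simp only [Finset.card_empty] at hd ⊢
    zify at hd h5
    by_cases h : (P.bd {f}).card = 5
    · have := pent_nn H hf h ht
      rw [h]; push_cast; linarith
    · have : (6:ℤ) ≤ (P.bd {f}).card := by omega
      push_cast
      linarith
  · have hev : Even (∑ v ∈ P.In o, (P.star (P.bd {f}) v).card) := by
      apply Finset.even_sum; intro v _
      exact Gr.ev_star ((H.tf.mono (bd_sub {f})).nl) (ev_bd _) v
    have htp : 0 < ((P.bd {f}).filter (fun e => e ∈ P.CI o)).card := by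
      push Not at ht
      obtain ⟨e, he, h⟩ := ht
      exact Finset.card_pos.2 ⟨e, by simp [he, h]⟩
    -- the count of interior half angles
    have h2 : 2 * ((P.bd {f}).filter (fun e => e ∈ P.CI o)).card ≤ ∑ v ∈ P.In o, (P.star (P.bd {f}) v).card := by
      have hch : ∀ e, ∃ v, e ∈ P.CI o → P.inc e v ∧ v ∉ P.Vs (P.bd {o}) := by
        intro e
        by_cases h : e ∈ P.CI o
        · obtain ⟨h1, h2, v, hv, hi⟩ := mem_CI.1 h
          obtain ⟨b, hb⟩ := hi.jn
          exact ⟨b, fun _ => ⟨hb.symm.inc, fun h' => H.no1 h1 h2 hb hv h'⟩⟩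
        · exact ⟨P.s e, fun h' => absurd h' h⟩
      choose φ hφ using hch
      have hinj : Set.InjOn φ ((P.bd {f}).filter (fun e => e ∈ P.CI o) : Finset E) := by
        intro e he e' he' hee
        simp only [Finset.coe_filter, Set.mem_setOf_eq] at he he'
        obtain ⟨h1, h2, v, hv, hi⟩ := mem_CI.1 he.2
        obtain ⟨h1', h2', v', hv', hi'⟩ := mem_CI.1 he'.2
        obtain ⟨a, ha⟩ := (hφ e he.2).1.jn
        obtain ⟨a', ha'⟩ := (hφ e' he'.2).1.jn
        have n1 := (hφ e he.2).2
        have n2 := (hφ e' he'.2).2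
        rw [← hee] at ha' n2
        have q1 : v = a := (inc_jn ha hi).resolve_left (fun h => n1 (h ▸ hv))
        have q2 : v' = a' := (inc_jn ha' hi').resolve_left (fun h => n1 (h ▸ hv'))
        exact H.no2 h1 h1' ha ha' n1 (q1 ▸ hv) (q2 ▸ hv')
      have hsub : ((P.bd {f}).filter (fun e => e ∈ P.CI o)).image φ ⊆ P.In o := by
        intro v hv
        simp only [Finset.mem_image, Finset.mem_filter] at hv
        obtain ⟨e, ⟨he, hc⟩, rfl⟩ := hv
        exact mem_In.2 ⟨⟨e, bd_sub _ he, (hφ e hc).1⟩, (hφ e hc).2⟩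
      rw [← Finset.card_image_of_injOn hinj, mul_comm, ← smul_eq_mul]
      refine (Finset.card_nsmul_le_sum _ (fun v => (P.star (P.bd {f}) v).card) 2 ?_).trans (Finset.sum_le_sum_of_subset hsub)
      intro v hv
      simp only [Finset.mem_image, Finset.mem_filter] at hv
      obtain ⟨e, ⟨he, hc⟩, rfl⟩ := hv
      exact star_bd_two H.toStd he (hφ e hc).1
    unfold X
    rcases hev with ⟨r, hr⟩
    have hr' : (∑ v ∈ P.In o, ((P.star (P.bd {f}) v).card : ℤ)) = r + r := by exact_mod_cast hr
    rw [hr'] at hge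
    rw [hr] at hd h2
    generalize ((P.bd {f}).filter (fun e => e ∈ P.CI o)).card = t at *
    generalize ((P.bd {f}).filter (fun e => e ∈ P.bd {o})).card = j at *
    generalize (P.bd {f}).card = l at *
    generalize ∑ v ∈ P.In o, P.vx o v f = S at *
    clear * - hge hd h2 htp h5
    constructor
    · omega
    · intro h
      have : j = 2 := by omega
      subst this; decide

theorem sum_X_le (H : Cex n P o) : ∑ f ∈ Finset.univ.erase o, P.X o f ≤ 72 * ((P.bd {o}).card : ℤ) - 360 := by
  have HS := H.toStd
  have hA : P.A.Nonempty := by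
    obtain ⟨e, he⟩ := Finset.nonempty_iff_ne_empty.2 H.cr.2.1.2.1
    exact ⟨e, bd_sub _ he⟩
  have eu := euler P hA
  have hV := Vp_le H
  have hD := deg_In H (Finset.Subset.refl P.A)
  have hAo : P.A.filter (fun e => e ∈ P.bd {o}) = P.bd {o} := by
    ext e; simp only [Finset.mem_filter]; exact ⟨fun h => h.2, fun h => ⟨bd_sub _ h, h⟩⟩
  have hAC : P.A.filter (fun e => e ∈ P.CI o) = P.CI o := by
    ext e; simp only [Finset.mem_filter]; exact ⟨fun h => h.2, fun h => ⟨(mem_CI.1 h).1, h⟩⟩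
  rw [hAo, hAC] at hD
  have hl := bd_sum (fun e he => bridgeless HS he)
  rw [← Finset.add_sum_erase _ _ (Finset.mem_univ o)] at hl
  have hFc : (Finset.univ.erase o).card + 1 = Fintype.card P.F := by
    rw [Finset.card_erase_of_mem (Finset.mem_univ o), Finset.card_univ]
    have : 0 < Fintype.card P.F := Fintype.card_pos_iff.2 ⟨o⟩
    omega
  -- CI sum
  have hCI : (P.CI o) ⊆ P.A := Finset.filter_subset _ _
  have ht := sum_bd HS hCI
  have ht2 : ∑ f ∈ Finset.univ.erase o, ((P.bd {f}).filter (fun e => e ∈ P.CI o)).card = 2 * (P.CI o).card := by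
    rw [← ht, ← Finset.add_sum_erase _ _ (Finset.mem_univ o)]
    have : (P.CI o).filter (fun e => e ∈ P.bd {o}) = ∅ := Finset.filter_eq_empty_iff.2 (fun e he => (mem_CI.1 he).2.1)
    rw [this, Finset.card_empty, zero_add]
    apply Finset.sum_congr rfl
    intro f _
    congr 1; ext e; simp [and_comm]
  -- vertices
  have hs : ∀ v ∈ P.In o, ∑ f ∈ Finset.univ.erase o, (P.star (P.bd {f}) v).card = 2 * (P.star P.A v).card := by
    intro v hv
    rw [← sum_bd HS (S := P.star P.A v) Gr.star_sub, ← Finset.add_sum_erase Finset.univ (fun f => ((P.star P.A v).filter (fun e => e ∈ P.bd {f})).card) (Finset.mem_univ o)]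
    have : (P.star P.A v).filter (fun e => e ∈ P.bd {o}) = ∅ := Finset.filter_eq_empty_iff.2 (fun e he h => (mem_In.1 hv).2 ⟨e, h, (Gr.mem_star.1 he).2⟩)
    rw [this, Finset.card_empty, zero_add]
    apply Finset.sum_congr rfl
    intro f _
    congr 1; ext e; simp only [Gr.mem_star, Finset.mem_filter]
    exact ⟨fun h => ⟨⟨bd_sub _ h.1, h.2⟩, h.1⟩, fun h => ⟨h.2, h.1.2⟩⟩
  have hb : ∀ v ∈ P.In o, ∑ f ∈ Finset.univ.erase o, (if P.bns o v f then 1 else 0) ≤ ((P.CI o).filter (fun e => P.inc e v)).card := by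
    intro v hv
    rw [← Finset.card_filter]
    rcases Finset.eq_empty_or_nonempty ((Finset.univ.erase o).filter (fun f => P.bns o v f)) with h | ⟨f, h⟩
    · rw [h]; simp
    have h1 : ((P.CI o).filter (fun e => P.inc e v)).Nonempty := by
      obtain ⟨-, -, -, e, he, hi, -⟩ := Finset.mem_filter.1 h
      exact ⟨e, by simp [he, hi]⟩
    refine le_trans ?_ (Finset.card_pos.2 h1)
    rw [Nat.succ_eq_add_one, zero_add, Finset.card_le_one]
    clear h f h1
    intro f hf g hg
    by_contra hfg
    rw [Finset.mem_filter] at hf hg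
    obtain ⟨-, h3, ⟨a, haf, hai⟩, e, he, hi, hef⟩ := hf
    obtain ⟨-, -, ⟨b, hbf, hbi⟩, e', he', hi', heg⟩ := hg
    have hvC := (mem_In.1 hv).2
    obtain ⟨h1, h2, w, hw, hwi⟩ := mem_CI.1 he
    obtain ⟨h1', h2', w', hw', hwi'⟩ := mem_CI.1 he'
    obtain ⟨y, hy⟩ := hi.jn
    obtain ⟨y', hy'⟩ := hi'.jn
    have q1 : w = y := (inc_jn hy hwi).resolve_left (fun h => hvC (h ▸ hw))
    have q2 : w' = y' := (inc_jn hy' hwi').resolve_left (fun h => hvC (h ▸ hw'))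
    have hee := H.no2 h1 h1' hy hy' hvC (q1 ▸ hw) (q2 ▸ hw')
    subst hee
    have hc : ((P.star P.A v).erase e).card = 2 := by
      rw [Finset.card_erase_of_mem (Gr.mem_star.2 ⟨h1, hi⟩), h3]
    have key : ∀ f : P.F, ∀ a ∈ P.bd {f}, P.inc a v → e ∉ P.bd {f} → P.star (P.bd {f}) v = (P.star P.A v).erase e := by
      intro f a haf hai hef
      apply Finset.eq_of_subset_of_card_le
      · intro x hx
        rw [Gr.mem_star] at hx
        rw [Finset.mem_erase, Gr.mem_star]
        exact ⟨fun h => hef (h ▸ hx.1), bd_sub _ hx.1, hx.2⟩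
      · rw [hc]; exact star_bd_two HS haf hai
    have kf := key f a haf hai hef
    have kg := key g b hbf hbi heg
    obtain ⟨c, d, hcd, hcd'⟩ := Finset.card_eq_two.1 hc
    have sdl : ∀ x ∈ (P.star P.A v).erase e, x ∈ P.A ∧ P.inc x v ∧ P.sd x f g := by
      intro x hx
      have xf := hx; have xg := hx
      rw [← kf, Gr.mem_star, mem_bd1] at xf
      rw [← kg, Gr.mem_star, mem_bd1] at xg
      refine ⟨xf.1.1, xf.2, ?_⟩
      have u1 := xf.1.2; have u2 := xg.1.2
      clear * - u1 u2 hfg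
      unfold sd; grind
    have hc1 := sdl c (by rw [hcd']; simp)
    have hd1 := sdl d (by rw [hcd']; simp)
    have := twin HS hcd hc1.1 hd1.1 hc1.2.1 hd1.2.1 hc1.2.2 hd1.2.2
    rw [this, Finset.card_pair hcd] at h3
    omega
  have hm : ∑ v ∈ P.In o, ((P.CI o).filter (fun e => P.inc e v)).card ≤ (P.CI o).card := by
    have := deg_In H hCI
    have e1 : (P.CI o).filter (fun e => e ∈ P.CI o) = P.CI o := Finset.filter_true_of_mem (fun _ h => h)
    rw [e1] at this
    unfold Gr.star at this
    omega
  have hvx : ∀ v ∈ P.In o, ∑ f ∈ Finset.univ.erase o, P.vx o v f ≤ 36 * (3 * ((P.star P.A v).card : ℤ) - 10) + 20 * ((P.CI o).filter (fun e => P.inc e v)).card := by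
    intro v hv
    have h1 := hs v hv
    have h2 := hb v hv
    unfold vx
    rw [Finset.sum_add_distrib, ← Finset.mul_sum, ← Finset.mul_sum]
    have h1' : ∑ f ∈ Finset.univ.erase o, ((P.star (P.bd {f}) v).card : ℤ) = 2 * (P.star P.A v).card := by exact_mod_cast h1
    have h2' : ∑ f ∈ Finset.univ.erase o, (if P.bns o v f then (1:ℤ) else 0) ≤ ((P.CI o).filter (fun e => P.inc e v)).card := by exact_mod_cast h2
    rw [h1']
    have h3 : 3 ≤ (P.star P.A v).card := by
      obtain ⟨⟨e, he, hi⟩, hC⟩ := mem_In.1 hv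
      exact deg3 HS hC ⟨e, Gr.mem_star.2 ⟨he, hi⟩⟩
    unfold chv
    split_ifs with h
    · rw [h]; push_cast; linarith
    · have : (4:ℤ) ≤ (P.star P.A v).card := by omega
      linarith
  unfold X
  rw [Finset.sum_add_distrib, Finset.sum_add_distrib, ← Finset.mul_sum, ← Finset.mul_sum, Finset.sum_comm, Finset.sum_sub_distrib]
  have hvx2 := Finset.sum_le_sum hvx
  rw [Finset.sum_add_distrib, ← Finset.mul_sum, ← Finset.mul_sum, Finset.sum_sub_distrib, ← Finset.mul_sum] at hvx2
  simp only [Finset.sum_const, nsmul_eq_mul] at hvx2 ⊢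
  zify at ht2 hm hD hl eu hV hFc
  rw [ht2]
  generalize (∑ f ∈ Finset.univ.erase o, ((P.bd {f}).card : ℤ)) = L at *
  generalize (∑ v ∈ P.In o, ((P.star P.A v).card : ℤ)) = D at *
  generalize (∑ v ∈ P.In o, (((P.CI o).filter (fun e => P.inc e v)).card : ℤ)) = M at *
  linarith

theorem Cex.false (H : Cex n P o) : False := by
  have h1 := sum_X_le H
  have hj : ∑ f ∈ Finset.univ.erase o, ((P.bd {f}).filter (fun e => e ∈ P.bd {o})).card = (P.bd {o}).card := by
    have := sum_bd H.toStd (bd_sub {o})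
    rw [← Finset.add_sum_erase _ _ (Finset.mem_univ o), Finset.filter_true_of_mem (fun _ h => h)] at this
    have h2 : ∑ f ∈ Finset.univ.erase o, ((P.bd {f}).filter (fun e => e ∈ P.bd {o})).card = ∑ f ∈ Finset.univ.erase o, ((P.bd {o}).filter (fun e => e ∈ P.bd {f})).card := by
      apply Finset.sum_congr rfl
      intro f _
      congr 1; ext e; simp [and_comm]
    omega
  have h2 : ∀ f ∈ Finset.univ.erase o, 32 * (((P.bd {f}).filter (fun e => e ∈ P.bd {o})).card : ℤ) ≤ P.X o f :=
    fun f hf => (X_ge H (Finset.ne_of_mem_erase hf)).1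
  have h3 := Finset.sum_le_sum h2
  rw [← Finset.mul_sum] at h3
  have hj' : ∑ f ∈ Finset.univ.erase o, (((P.bd {f}).filter (fun e => e ∈ P.bd {o})).card : ℤ) = (P.bd {o}).card := by exact_mod_cast hj
  rw [hj'] at h3
  have h9 := H.k9
  have hk : (P.bd {o}).card = 9 := by omega
  have heq : ∑ f ∈ Finset.univ.erase o, 32 * (((P.bd {f}).filter (fun e => e ∈ P.bd {o})).card : ℤ) = ∑ f ∈ Finset.univ.erase o, P.X o f := by
    apply le_antisymm (Finset.sum_le_sum h2)
    rw [← Finset.mul_sum, hj']; rw [hk] at h1 ⊢; push_cast at h1 ⊢; linarith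
  have h4 := (Finset.sum_eq_sum_iff_of_le h2).1 heq
  have h5 : Even (∑ f ∈ Finset.univ.erase o, ((P.bd {f}).filter (fun e => e ∈ P.bd {o})).card) := by
    apply Finset.even_sum
    intro f hf
    exact (X_ge H (Finset.ne_of_mem_erase hf)).2 (h4 f hf).symm
  rw [hj, hk] at h5
  rcases h5 with ⟨r, hr⟩; omega

theorem main_IHyp (n : ℕ) : IHyp V E n := by
  induction n with
  | zero => intro P o h; omega
  | succ n ih =>
    intro P o h tf cr k9
    by_contra hgt
    have h2 : P.A.card = n := by
      by_contra hne
      exact hgt (ih P o (by omega) tf cr k9)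
    exact Cex.false (n := n) (P := P) (o := o) ⟨⟨ih, tf, cr, h2, k9⟩, by omega⟩

theorem main (P : PM V E) (o : P.F) (tf : P.TF P.A) (cr : P.Crit o) (k9 : (P.bd {o}).card ≤ 9) :
    P.wt {o}ᶜ ≤ ((P.bd {o}).card : ℤ) - 6 := main_IHyp (P.A.card + 1) P o (by omega) tf cr k9

end PM
end CF

end

open Set Topology

noncomputable section
namespace CF
set_option linter.all false
open scoped Classical symmDiff unitInterval

/-! ### Logarithms on plane sets -/

theorem exp_const {X : Type} [TopologicalSpace X] {S : Set X} (hS : IsPreconnected S) {f : X → ℂ} (hf : ContinuousOn f S)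
    {c : ℂ} (h : ∀ x ∈ S, Complex.exp (f x) = c) {x y : X} (hx : x ∈ S) (hy : y ∈ S) : f x = f y := by
  apply Complex.isCoveringMap_exp.constOn_of_comp hS hf _ hx hy
  intro a ha b hb
  simp only [Subtype.mk.injEq]
  rw [h a ha, h b hb]

theorem plog (γ : C(I, ℂ)) (X : Set ℂ) (hd : ∀ t, γ t ∉ X) :
    ∃ L : ℂ → ℂ, ContinuousOn L X ∧ ∀ z ∈ X, Complex.exp (L z) = (z - γ 1) / (z - γ 0) := by
  have hne : ∀ (t : I) (z : X), (z : ℂ) - γ t ≠ 0 := by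
    intro t z h
    have := sub_eq_zero.1 h
    exact hd t (this ▸ z.2)
  let H : C(I × X, {z : ℂ // z ≠ 0}) :=
    ⟨fun q => ⟨((q.2 : ℂ) - γ q.1) / ((q.2 : ℂ) - γ 0), div_ne_zero (hne _ _) (hne _ _)⟩, by
      apply Continuous.subtype_mk
      exact Continuous.div (by fun_prop) (by fun_prop) (fun q => hne _ _)⟩
  let f : C(X, ℂ) := ⟨fun _ => 0, continuous_const⟩
  have H0 : ∀ a, H (0, a) = (fun z : ℂ ↦ (⟨_, z.exp_ne_zero⟩ : {z : ℂ // z ≠ 0})) (f a) := by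
    intro a
    apply Subtype.ext
    simp [H, f, div_self (hne 0 a)]
  let F := Complex.isCoveringMap_exp.liftHomotopy H f H0
  have hF := Complex.isCoveringMap_exp.liftHomotopy_lifts H f H0
  refine ⟨fun z => if hz : z ∈ X then F (1, ⟨z, hz⟩) else 0, ?_, ?_⟩
  · rw [continuousOn_iff_continuous_domRestrict]
    have : Continuous (fun z : X => F (1, z)) := by fun_prop
    convert this using 1
    ext z
    simp [Set.domRestrict]
  · intro z hz
    have := congrFun hF (1, ⟨z, hz⟩)
    have := congrArg Subtype.val this
    simp only [hz, dif_pos]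
    exact this

theorem lift1 (g : C(I, ℂ)) (hg : ∀ t, g t ≠ 0) {c : ℂ} (hc : Complex.exp c = g 0) :
    ∃ l : C(I, ℂ), (∀ t, Complex.exp (l t) = g t) ∧ l 0 = c := by
  let G : C(I, {z : ℂ // z ≠ 0}) := ⟨fun t => ⟨g t, hg t⟩, by fun_prop⟩
  have G0 : G 0 = (fun z : ℂ ↦ (⟨_, z.exp_ne_zero⟩ : {z : ℂ // z ≠ 0})) c := by
    apply Subtype.ext; simp [G, hc]
  refine ⟨Complex.isCoveringMap_exp.liftPath G c G0, ?_, Complex.isCoveringMap_exp.liftPath_zero ..⟩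
  intro t
  have := congrFun (Complex.isCoveringMap_exp.liftPath_lifts G c G0) t
  exact congrArg Subtype.val this

theorem convlog {U : Set ℂ} (hU : Convex ℝ U) (ho : IsOpen U) (hn : U.Nonempty) {g : ℂ → ℂ} (hg : ContinuousOn g U)
    (h0 : ∀ z ∈ U, g z ≠ 0) : ∃ f : ℂ → ℂ, ContinuousOn f U ∧ ∀ z ∈ U, Complex.exp (f z) = g z := by
  have hs : IsSimplyConnected U := by
    haveI := hU.contractibleSpace hn
    exact (inferInstance : SimplyConnectedSpace U)
  obtain ⟨f, h1, h2⟩ := Complex.exists_continuousOn_eqOn_exp_comp hs ho hg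
    (by rintro ⟨z, hz, e⟩; exact h0 z hz e)
  exact ⟨f, h1, fun z hz => h2 hz⟩

theorem hp_pre (c : ℝ) : IsPreconnected {w : ℂ | c < w.re} ∧ IsPreconnected {w : ℂ | w.re < c} :=
  ⟨(convex_halfSpace_re_gt c).isPreconnected, (convex_halfSpace_re_lt c).isPreconnected⟩

/-- winding lemma -/
theorem wind {W : Set ℂ} (hb : Bornology.IsBounded W) (ho : IsOpen W) {p : ℂ} (hp : p ∈ W) {n : ℤ} {g : ℂ → ℂ}
    (hg : ContinuousOn g (closure W)) (hg0 : ∀ z ∈ closure W, g z ≠ 0) {u : ℂ → ℂ}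
    (hu : ContinuousOn u (frontier W)) (h : ∀ z ∈ frontier W, Complex.exp (u z) = (z - p) ^ n * g z) : n = 0 := by
  obtain ⟨v, hv⟩ := ContinuousMap.exists_restrict_eq (isClosed_frontier (s := W))
    ⟨(frontier W).domRestrict u, continuousOn_iff_continuous_domRestrict.1 hu⟩
  have hv' : ∀ z ∈ frontier W, v z = u z := by
    intro z hz
    have := congrArg (fun f => f ⟨z, hz⟩) hv
    simpa using this
  set k : ℂ → ℂ := fun z => g z * Complex.exp (- v z) with hk
  have hkc : ContinuousOn k (closure W) := hg.mul (by fun_prop)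
  have hk0 : ∀ z ∈ closure W, k z ≠ 0 := fun z hz => mul_ne_zero (hg0 z hz) (Complex.exp_ne_zero _)
  set ψ : ℂ → ℂ := fun z => if z ∈ closure W then (z - p) ^ n * k z else 1 with hψ
  have hps : ∀ z : ℂ, z ∈ ({p}ᶜ : Set ℂ) → z - p ≠ 0 := fun z hz => sub_ne_zero.2 hz
  have hfp : ∀ z ∈ frontier (closure W), (z - p) ^ n * k z = 1 := by
    intro z hz
    have hz' : z ∈ frontier W := frontier_closure_subset hz
    simp only [hk]
    rw [← mul_assoc, ← h z hz', hv' z hz', ← Complex.exp_add]; simp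
  have hψc : ContinuousOn ψ {p}ᶜ := by
    apply ContinuousOn.if
    · intro z hz; exact hfp z hz.2
    · apply ContinuousOn.mul
      · apply ContinuousOn.zpow₀ (by fun_prop)
        intro z hz; exact Or.inl (hps z hz.1)
      · apply hkc.mono; intro z hz
        have := hz.2; simpa [closure_closure] using this
    · exact continuousOn_const
  have hψ0 : ∀ z ∈ ({p}ᶜ : Set ℂ), ψ z ≠ 0 := by
    intro z hz
    simp only [hψ]
    split_ifs with hc
    · exact mul_ne_zero (zpow_ne_zero _ (hps z hz)) (hk0 z hc)
    · exact one_ne_zero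
  have hep : ∀ w : ℂ, p + Complex.exp w ∈ ({p}ᶜ : Set ℂ) := by
    intro w; simp [Complex.exp_ne_zero]
  have hΨc : Continuous (fun w => ψ (p + Complex.exp w)) := by
    rw [← continuousOn_univ]
    exact hψc.comp (by fun_prop) (fun w _ => hep w)
  obtain ⟨L, hL, hL'⟩ := convlog convex_univ isOpen_univ univ_nonempty hΨc.continuousOn (fun w _ => hψ0 _ (hep w))
  have hLc : Continuous L := continuousOn_univ.1 hL
  have hper : ∀ w : ℂ, Complex.exp (w + 2 * Real.pi * Complex.I) = Complex.exp w := Complex.exp_periodic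
  have hD : ∀ x y : ℂ, L (x + 2 * Real.pi * Complex.I) - L x = L (y + 2 * Real.pi * Complex.I) - L y := by
    intro x y
    apply exp_const (f := fun w => L (w + 2 * Real.pi * Complex.I) - L w) (c := 1) isPreconnected_univ
    · fun_prop
    · intro w _
      rw [Complex.exp_sub, hL' _ trivial, hL' _ trivial, hper, div_self (hψ0 _ (hep w))]
    · trivial
    · trivial
  -- far away
  obtain ⟨R, hR⟩ := hb.closure.subset_ball (p)
  have hR0 : 0 < R := by
    have := hR (subset_closure hp); simpa using this
  have far : ∀ w ∈ {w : ℂ | Real.log R < w.re}, Complex.exp (L w) = 1 := by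
    intro w hw
    rw [hL' w trivial]
    simp only [hψ]
    rw [if_neg]
    intro hc
    have h1 := hR hc
    simp only [Metric.mem_ball, dist_self_add_left, Complex.norm_exp] at h1
    have h2 := (Real.lt_log_iff_exp_lt hR0).2 h1
    simp only [mem_setOf_eq] at hw
    linarith
  have d1 : L ((Real.log R + 1 : ℝ) + 2 * Real.pi * Complex.I) = L ((Real.log R + 1 : ℝ)) := by
    apply exp_const (hp_pre _).1 hLc.continuousOn far
    · simp
    · simp
  obtain ⟨ε, he, hε⟩ := Metric.isOpen_iff.1 ho p hp
  obtain ⟨l, hl, hl'⟩ := convlog (convex_ball p ε) Metric.isOpen_ball ⟨p, by simpa using he⟩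
    (hkc.mono (hε.trans subset_closure)) (fun z hz => hk0 z (subset_closure (hε hz)))
  have inb : ∀ w ∈ {w : ℂ | w.re < Real.log ε}, p + Complex.exp w ∈ Metric.ball p ε := by
    intro w hw
    simp only [Metric.mem_ball, dist_self_add_left, Complex.norm_exp]
    exact (Real.lt_log_iff_exp_lt he).1 hw
  set y : ℂ := ((Real.log ε - 1 : ℝ) : ℂ) with hy
  have d2 : (L (y + 2 * Real.pi * Complex.I) - n * (y + 2 * Real.pi * Complex.I) - l (p + Complex.exp (y + 2 * Real.pi * Complex.I)))
      = (L y - n * y - l (p + Complex.exp y)) := by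
    apply exp_const (f := fun w => L w - n * w - l (p + Complex.exp w)) (c := 1) (hp_pre (Real.log ε)).2
    · apply ContinuousOn.sub (by fun_prop)
      exact hl.comp (by fun_prop) inb
    · intro w hw
      rw [Complex.exp_sub, Complex.exp_sub, hL' w trivial, hl' _ (inb w hw), Complex.exp_int_mul]
      simp only [hψ]
      rw [if_pos (subset_closure (hε (inb w hw)))]
      have := hk0 _ (subset_closure (hε (inb w hw)))
      have h3 : (Complex.exp w) ^ n ≠ 0 := zpow_ne_zero _ (Complex.exp_ne_zero _)
      simp only [add_sub_cancel_left]
      field_simp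
    · simp [hy]
    · simp [hy]
  rw [hper] at d2
  have d3 := hD y ((Real.log R + 1 : ℝ))
  rw [d1] at d3
  have d4 : (n : ℂ) * (2 * Real.pi * Complex.I) = 0 := by linear_combination d3 - d2
  have : (2 * Real.pi * Complex.I : ℂ) ≠ 0 := Complex.two_pi_I_ne_zero
  have := (mul_eq_zero.1 d4).resolve_right this
  exact_mod_cast this

/-! ### components -/

def cc (K : Set ℂ) (p : ℂ) : Set ℂ := connectedComponentIn Kᶜ p

section comp
variable {K : Set ℂ}

theorem cc_open (hK : IsClosed K) (p : ℂ) : IsOpen (cc K p) := hK.isOpen_compl.connectedComponentIn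
theorem cc_mem {p : ℂ} (hp : p ∉ K) : p ∈ cc K p := mem_connectedComponentIn hp
theorem cc_sub (p : ℂ) : cc K p ⊆ Kᶜ := connectedComponentIn_subset _ _
theorem cc_pre (p : ℂ) : IsPreconnected (cc K p) := isPreconnected_connectedComponentIn
theorem cc_eq {p q : ℂ} (h : q ∈ cc K p) : cc K p = cc K q := connectedComponentIn_eq h
theorem cc_max {p : ℂ} {S : Set ℂ} (hS : IsPreconnected S) (hp : p ∈ S) (h : ∀ z ∈ S, z ∉ K) : S ⊆ cc K p :=
  hS.subset_connectedComponentIn hp h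
theorem cc_disj {p q z : ℂ} (h1 : z ∈ cc K p) (h2 : z ∈ cc K q) : cc K p = cc K q := by
  rw [cc_eq h1, cc_eq h2]
theorem cc_cl (hK : IsClosed K) {p z : ℂ} (h : z ∈ closure (cc K p)) (hz : z ∉ K) : z ∈ cc K p := by
  obtain ⟨w, h1, h2⟩ := mem_closure_iff.1 h _ (cc_open hK z) (cc_mem hz)
  rw [← cc_disj h1 h2]; exact cc_mem hz
theorem cc_fr (hK : IsClosed K) (p : ℂ) : frontier (cc K p) ⊆ K := by
  intro z hz
  by_contra hzK
  have := cc_cl hK hz.1 hzK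
  rw [(cc_open hK p).frontier_eq] at hz
  exact hz.2 this

theorem cc_joined (hK : IsClosed K) {p q : ℂ} (hp : p ∉ K) (h : q ∈ cc K p) :
    ∃ γ : C(I, ℂ), γ 0 = p ∧ γ 1 = q ∧ ∀ t, γ t ∈ cc K p := by
  have h1 : IsConnected (cc K p) := ⟨⟨p, cc_mem hp⟩, cc_pre p⟩
  have h2 := ((cc_open hK p).isConnected_iff_isPathConnected).1 h1
  obtain ⟨γ, hγ⟩ := h2.joinedIn p (cc_mem hp) q h
  exact ⟨γ.toContinuousMap, γ.source, γ.target, hγ⟩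

/-- C1 -/
theorem cc_log (hK : IsClosed K) {p q : ℂ} (hp : p ∉ K) (h : q ∈ cc K p) :
    ∃ u : ℂ → ℂ, ContinuousOn u K ∧ ∀ z ∈ K, Complex.exp (u z) = (z - p) / (z - q) := by
  obtain ⟨γ, h0, h1, hγ⟩ := cc_joined hK hp h
  obtain ⟨L, h2, h3⟩ := plog γ K (fun t ht => cc_sub p (hγ t) ht)
  refine ⟨fun z => - L z, h2.neg, fun z hz => ?_⟩
  rw [Complex.exp_neg, h3 z hz, h0, h1, inv_div]

theorem cc_unb (hK : Bornology.IsBounded K) {p q : ℂ}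
    (h1 : ¬ Bornology.IsBounded (cc K p)) (h2 : ¬ Bornology.IsBounded (cc K q)) : cc K p = cc K q := by
  obtain ⟨R, hR⟩ := hK.subset_ball (0 : ℂ)
  set R' := max R 1
  have hR' : K ⊆ Metric.ball 0 R' := hR.trans (Metric.ball_subset_ball (le_max_left _ _))
  have hpos : 0 < R' := lt_of_lt_of_le one_pos (le_max_right _ _)
  have hpre : IsPreconnected (Complex.exp '' {w : ℂ | Real.log R' < w.re}) :=
    (hp_pre _).1.image _ (by fun_prop)
  have hdis : ∀ z ∈ Complex.exp '' {w : ℂ | Real.log R' < w.re}, z ∉ K := by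
    rintro _ ⟨w, hw, rfl⟩ hK'
    have := hR' hK'
    simp only [Metric.mem_ball, dist_zero_right, Complex.norm_exp] at this
    have := (Real.lt_log_iff_exp_lt hpos).2 this
    simp only [mem_setOf_eq] at hw
    linarith
  have key : ∀ p, ¬ Bornology.IsBounded (cc K p) → ∃ z ∈ cc K p, z ∈ Complex.exp '' {w : ℂ | Real.log R' < w.re} := by
    intro p hp
    by_contra hc
    push Not at hc
    apply hp
    apply (Metric.isBounded_closedBall (x := (0 : ℂ)) (r := R')).subset
    intro z hz
    by_contra hz'
    simp only [Metric.mem_closedBall, dist_zero_right, not_le] at hz'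
    refine hc z hz ⟨Complex.log z, ?_, Complex.exp_log ?_⟩
    · simp only [mem_setOf_eq, Complex.log_re]
      exact Real.log_lt_log hpos hz'
    · intro h0; rw [h0] at hz'; simp at hz'; linarith
  obtain ⟨z, hz, hz'⟩ := key p h1
  obtain ⟨w, hw, hw'⟩ := key q h2
  have := cc_max hpre hz' hdis hw'
  rw [cc_eq hz, cc_eq this, cc_eq hw]

theorem cc_of_log1 (hK : IsClosed K) {p q : ℂ} (hp : p ∉ K) (hq : q ∉ K) (hb : Bornology.IsBounded (cc K p))
    {u : ℂ → ℂ} (hu : ContinuousOn u K) (h : ∀ z ∈ K, Complex.exp (u z) = (z - p) / (z - q)) : q ∈ cc K p := by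
  by_contra hc
  have hne : ∀ z ∈ closure (cc K p), z - q ≠ 0 := by
    intro z hz h0
    have : z = q := sub_eq_zero.1 h0
    subst this
    exact hc (cc_cl hK hz hq)
  have := wind (n := 1) (g := fun z => (z - q)⁻¹) hb (cc_open hK p) (cc_mem hp)
    (ContinuousOn.inv₀ (by fun_prop) hne) (fun z hz => inv_ne_zero (hne z hz))
    (hu.mono (cc_fr hK p)) (fun z hz => by rw [h z (cc_fr hK p hz)]; simp [div_eq_mul_inv])
  omega

/-- C2 -/
theorem cc_of_log (hK : IsClosed K) (hbK : Bornology.IsBounded K) {p q : ℂ} (hp : p ∉ K) (hq : q ∉ K)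
    {u : ℂ → ℂ} (hu : ContinuousOn u K) (h : ∀ z ∈ K, Complex.exp (u z) = (z - p) / (z - q)) : q ∈ cc K p := by
  by_cases h1 : Bornology.IsBounded (cc K p)
  · exact cc_of_log1 hK hp hq h1 hu h
  by_cases h2 : Bornology.IsBounded (cc K q)
  · have := cc_of_log1 hK hq hp h2 hu.neg (fun z hz => by rw [Pi.neg_apply, Complex.exp_neg, h z hz, inv_div])
    rw [← cc_eq this]; exact cc_mem hq
  · rw [cc_unb hbK h1 h2]; exact cc_mem hq

end comp
end CF

end

open Set Topology

noncomputable section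
namespace CF
set_option linter.all false
open scoped Classical symmDiff unitInterval

/-! ### attaching arcs -/

theorem glue {K0 : Set ℂ} (hK : IsClosed K0) (γ : C(I, ℂ)) (hi : Function.Injective γ) {u0 : ℂ → ℂ}
    (hu : ContinuousOn u0 K0) (l : C(I, ℂ)) (h : ∀ t, γ t ∈ K0 → l t = u0 (γ t)) :
    ∃ u : ℂ → ℂ, ContinuousOn u (K0 ∪ range γ) ∧ (∀ z ∈ K0, u z = u0 z) ∧ ∀ t, u (γ t) = l t := by
  have hemb : IsClosedEmbedding γ := γ.continuous.isClosedEmbedding hi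
  let u : ℂ → ℂ := fun z => if z ∈ K0 then u0 z else l (Function.invFun γ z)
  have h1 : ∀ z ∈ K0, u z = u0 z := fun z hz => if_pos hz
  have h2 : ∀ t, u (γ t) = l t := by
    intro t
    by_cases ht : γ t ∈ K0
    · rw [h1 _ ht, h t ht]
    · simp only [u, if_neg ht]; rw [Function.leftInverse_invFun hi t]
  refine ⟨u, ?_, h1, h2⟩
  apply ContinuousOn.union_of_isClosed
  · exact hu.congr h1
  · have : ContinuousOn u (γ '' univ) := by
      rw [hemb.isInducing.continuousOn_image_iff]
      have : u ∘ γ = l := funext h2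
      rw [this]; fun_prop
    rwa [image_univ] at this
  · exact hK
  · exact hemb.isClosed_range

/-- log data along an arc -/
theorem defect {K0 : Set ℂ} (γ : C(I, ℂ)) {f : ℂ → ℂ} (hf : ContinuousOn f (range γ)) (hf0 : ∀ z ∈ range γ, f z ≠ 0)
    {u0 : ℂ → ℂ} (h0 : Complex.exp (u0 (γ 0)) = f (γ 0)) :
    ∃ l : C(I, ℂ), (∀ t, Complex.exp (l t) = f (γ t)) ∧ l 0 = u0 (γ 0) ∧
      (Complex.exp (u0 (γ 1)) = f (γ 1) → ∃ n : ℤ, l 1 = u0 (γ 1) + n * (2 * Real.pi * Complex.I)) := by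
  obtain ⟨l, h1, h2⟩ := lift1 ⟨fun t => f (γ t), hf.comp_continuous γ.continuous (fun t => ⟨t, rfl⟩)⟩
    (fun t => hf0 _ ⟨t, rfl⟩) (c := u0 (γ 0)) h0
  refine ⟨l, h1, h2, fun h3 => ?_⟩
  have h4 : Complex.exp (l 1) = Complex.exp (u0 (γ 1)) := by rw [h3]; exact h1 1
  exact Complex.exp_eq_exp_iff_exists_int.1 h4

theorem fext {K0 : Set ℂ} (hK : IsClosed K0) (γ : C(I, ℂ)) (hi : Function.Injective γ)
    (h0 : γ 0 ∈ K0) (h1 : ∀ t, γ t ∈ K0 → t = 0) {f : ℂ → ℂ} (hf : ContinuousOn f (range γ))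
    (hf0 : ∀ z ∈ range γ, f z ≠ 0) {u0 : ℂ → ℂ} (hu : ContinuousOn u0 K0) (hu0 : ∀ z ∈ K0, Complex.exp (u0 z) = f z) :
    ∃ u : ℂ → ℂ, ContinuousOn u (K0 ∪ range γ) ∧ ∀ z ∈ K0 ∪ range γ, Complex.exp (u z) = f z := by
  obtain ⟨l, hl, hl0, -⟩ := defect (K0 := K0) γ hf hf0 (hu0 _ h0)
  obtain ⟨u, h2, h3, h4⟩ := glue hK γ hi hu l (fun t ht => by rw [h1 t ht, hl0])
  refine ⟨u, h2, ?_⟩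
  rintro z (hz | ⟨t, rfl⟩)
  · rw [h3 z hz, hu0 z hz]
  · rw [h4, hl]

theorem quot_ok {p q : ℂ} {S : Set ℂ} (hp : p ∉ S) (hq : q ∉ S) :
    ContinuousOn (fun z => (z - p) / (z - q)) S ∧ ∀ z ∈ S, (z - p) / (z - q) ≠ 0 := by
  have h1 : ∀ z ∈ S, z - p ≠ 0 := fun z hz h => hp (sub_eq_zero.1 h ▸ hz)
  have h2 : ∀ z ∈ S, z - q ≠ 0 := fun z hz h => hq (sub_eq_zero.1 h ▸ hz)
  exact ⟨ContinuousOn.div (by fun_prop) (by fun_prop) h2, fun z hz => div_ne_zero (h1 z hz) (h2 z hz)⟩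

section arc
variable {K0 : Set ℂ} {γ : C(I, ℂ)}

theorem range_comp_bdd (γ : C(I, ℂ)) : Bornology.IsBounded (range γ) := (isCompact_range γ.continuous).isBounded
theorem range_closed (γ : C(I, ℂ)) : IsClosed (range γ) := (isCompact_range γ.continuous).isClosed

theorem arc_conn (hin : ∀ t : I, t ≠ 0 → t ≠ 1 → γ t ∉ K0) {a b : I} (ha : a ∈ Ioo (0 : I) 1) (hb : b ∈ Ioo (0 : I) 1) :
    γ b ∈ cc K0 (γ a) := by
  have : IsPreconnected (γ '' Ioo (0 : I) 1) := isPreconnected_Ioo.image _ γ.continuous.continuousOn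
  refine cc_max this ⟨a, ha, rfl⟩ ?_ ⟨b, hb, rfl⟩
  rintro _ ⟨t, ht, rfl⟩
  exact hin t ht.1.ne' ht.2.ne

/-- a face whose closure touches the open arc lies in the component around the arc -/
theorem face_sub (hK : IsClosed K0) {p : ℂ} {a : I} (ha : γ a ∈ closure (cc (K0 ∪ range γ) p)) (ha0 : γ a ∉ K0) :
    cc (K0 ∪ range γ) p ⊆ cc K0 (γ a) := by
  obtain ⟨w, h1, h2⟩ := mem_closure_iff.1 ha _ (cc_open hK (γ a)) (cc_mem ha0)
  rw [cc_eq h1]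
  exact cc_max (cc_pre p) h2 (fun z hz hz' => cc_sub p hz (Or.inl hz'))

theorem face_touch (hK : IsClosed K0) {p : ℂ} {a : I} (ha0 : γ a ∉ K0)
    (hp : p ∈ cc K0 (γ a)) (hp' : p ∉ K0 ∪ range γ) :
    ∃ t : I, γ t ∈ closure (cc (K0 ∪ range γ) p) ∧ γ t ∉ K0 := by
  by_contra hc
  push Not at hc
  have : cc K0 (γ a) ⊆ cc (K0 ∪ range γ) p := by
    apply (cc_pre _).subset_of_closure_inter_subset (cc_open (hK.union (range_closed γ)) p)
    · exact ⟨p, hp, cc_mem hp'⟩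
    · rintro z ⟨h1, h2⟩
      apply cc_cl (hK.union (range_closed γ)) h1
      rintro (h3 | ⟨t, rfl⟩)
      · exact cc_sub _ h2 h3
      · exact cc_sub _ h2 (hc t h1)
  exact cc_sub p (this (cc_mem ha0)) (Or.inr ⟨a, rfl⟩)

theorem arcL1 (hK : IsClosed K0) (hb : Bornology.IsBounded K0) (hi : Function.Injective γ) (h0 : γ 0 ∈ K0) (h1 : γ 1 ∈ K0)
    (hin : ∀ t : I, t ≠ 0 → t ≠ 1 → γ t ∉ K0) {p : ℂ} (hp : p ∉ K0 ∪ range γ) {t0 t1 : I} (ht0 : t0 ∈ Ioo (0 : I) 1)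
    (ht1 : t1 ∈ Ioo (0 : I) 1) (h : γ t0 ∈ closure (cc (K0 ∪ range γ) p)) :
    γ t1 ∈ closure (cc (K0 ∪ range γ) p) := by
  by_contra hc
  set g := cc (K0 ∪ range γ) p with hg
  have hO : (γ ⁻¹' (closure g)ᶜ) ∈ 𝓝 t1 := (isClosed_closure.isOpen_compl.preimage γ.continuous).mem_nhds hc
  obtain ⟨l, u, ⟨hl, hu⟩, hlu⟩ := (mem_nhds_iff_exists_Ioo_subset' ⟨0, ht1.1⟩ ⟨1, ht1.2⟩).1 hO
  obtain ⟨a, ha, ha'⟩ := exists_between hl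
  obtain ⟨b, hb1, hb'⟩ := exists_between hu
  have a0 : 0 < (a : ℝ) := lt_of_le_of_lt l.2.1 ha
  have b1 : (b : ℝ) < 1 := lt_of_lt_of_le hb' u.2.2
  have at1 : (a : ℝ) < t1 := ha'
  have bt1 : (t1 : ℝ) < b := hb1
  have a1 : (a : ℝ) < 1 := lt_of_lt_of_le at1 t1.2.2
  let γ1 : C(I, ℂ) := ⟨fun s => γ (a * s), by fun_prop⟩
  let γ2 : C(I, ℂ) := ⟨fun s => γ (σ (σ b * s)), by fun_prop⟩
  have cf : ∀ s : I, ((σ (σ b * s) : I) : ℝ) = 1 - (1 - b) * s := by intro s; simp [unitInterval.coe_symm_eq]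
  have i1 : Function.Injective γ1 := by
    intro s s' hs
    have := congrArg Subtype.val (hi hs)
    simp only [Set.Icc.coe_mul] at this
    exact Subtype.ext (mul_left_cancel₀ a0.ne' this)
  have i2 : Function.Injective γ2 := by
    intro s s' hs
    have := congrArg Subtype.val (hi hs)
    rw [cf, cf] at this
    have h3 : (1 - (b : ℝ)) * s = (1 - b) * s' := by linarith
    exact Subtype.ext (mul_left_cancel₀ (by linarith : (1 - (b : ℝ)) ≠ 0) h3)
  have K01 : IsClosed (K0 ∪ range γ1) := hK.union (range_closed _)
  have hK' : IsClosed ((K0 ∪ range γ1) ∪ range γ2) := K01.union (range_closed _)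
  have hbK' : Bornology.IsBounded ((K0 ∪ range γ1) ∪ range γ2) := (hb.union (range_comp_bdd _)).union (range_comp_bdd _)
  have sub : (K0 ∪ range γ1) ∪ range γ2 ⊆ K0 ∪ range γ := by
    rintro z ((hz | ⟨s, rfl⟩) | ⟨s, rfl⟩)
    · exact Or.inl hz
    · exact Or.inr ⟨_, rfl⟩
    · exact Or.inr ⟨_, rfl⟩
  have hp' : p ∉ (K0 ∪ range γ1) ∪ range γ2 := fun hh => hp (sub hh)
  have hq' : γ t1 ∉ (K0 ∪ range γ1) ∪ range γ2 := by
    rintro ((hz | ⟨s, hs⟩) | ⟨s, hs⟩)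
    · exact hin t1 ht1.1.ne' ht1.2.ne hz
    · have := congrArg Subtype.val (hi hs)
      simp only [Set.Icc.coe_mul] at this
      nlinarith [s.2.1, s.2.2]
    · have := congrArg Subtype.val (hi hs)
      rw [cf] at this
      nlinarith [s.2.1, s.2.2]
  have hgU := face_sub hK h (hin t0 ht0.1.ne' ht0.2.ne)
  have hpU : p ∈ cc K0 (γ t0) := hgU (cc_mem hp)
  have hqU : γ t1 ∈ cc K0 (γ t0) := arc_conn hin ht0 ht1
  have hqp : γ t1 ∈ cc K0 p := by rw [← cc_eq hpU]; exact hqU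
  obtain ⟨v, hv, hv'⟩ := cc_log hK (fun hh => hp (Or.inl hh)) hqp
  obtain ⟨v1, hv1, hv1'⟩ := fext hK γ1 i1 (by simpa [γ1] using h0) (by
    intro s hs
    by_contra hs0
    apply hin (a * s) _ _ hs
    · intro h3
      have := congrArg Subtype.val h3
      simp only [Set.Icc.coe_mul, Set.Icc.coe_zero] at this
      rcases mul_eq_zero.1 this with h4 | h4
      · exact a0.ne' h4
      · exact hs0 (Subtype.ext h4)
    · intro h3
      have := congrArg Subtype.val h3
      simp only [Set.Icc.coe_mul, Set.Icc.coe_one] at this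
      nlinarith [s.2.1, s.2.2])
    (quot_ok (p := p) (q := γ t1) (fun hh => hp' (Or.inl (Or.inr hh))) (fun hh => hq' (Or.inl (Or.inr hh)))).1
    (quot_ok (p := p) (q := γ t1) (fun hh => hp' (Or.inl (Or.inr hh))) (fun hh => hq' (Or.inl (Or.inr hh)))).2 hv hv'
  obtain ⟨v2, hv2, hv2'⟩ := fext K01 γ2 i2 (by left; simpa [γ2] using h1) (by
    intro s hs
    by_contra hs0
    have s0 : 0 < (s : ℝ) := lt_of_le_of_ne s.2.1 (fun h => hs0 (Subtype.ext h.symm))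
    rcases hs with hs | ⟨s', hs⟩
    · apply hin (σ (σ b * s)) _ _ hs
      · intro h3
        have := congrArg Subtype.val h3
        rw [cf] at this
        simp only [Set.Icc.coe_zero] at this
        nlinarith [s.2.1, s.2.2]
      · intro h3
        have := congrArg Subtype.val h3
        rw [cf] at this
        simp only [Set.Icc.coe_one] at this
        nlinarith [s.2.1, s.2.2]
    · have := congrArg Subtype.val (hi hs)
      rw [cf] at this
      simp only [Set.Icc.coe_mul] at this
      nlinarith [s.2.1, s.2.2, s'.2.1, s'.2.2])
    (quot_ok (p := p) (q := γ t1) (fun hh => hp' (Or.inr hh)) (fun hh => hq' (Or.inr hh))).1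
    (quot_ok (p := p) (q := γ t1) (fun hh => hp' (Or.inr hh)) (fun hh => hq' (Or.inr hh))).2 hv1 hv1'
  have hfin := cc_of_log hK' hbK' hp' hq' hv2 hv2'
  have hsub : cc ((K0 ∪ range γ1) ∪ range γ2) p ⊆ g := by
    apply (cc_pre _).subset_of_closure_inter_subset (cc_open (hK.union (range_closed γ)) p)
    · exact ⟨p, cc_mem hp', cc_mem hp⟩
    · rintro z ⟨h2, h3⟩
      apply cc_cl (hK.union (range_closed γ)) h2
      have h4 := cc_sub _ h3
      rintro (h5 | ⟨t, rfl⟩)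
      · exact h4 (Or.inl (Or.inl h5))
      · have h6 : t ∉ Ioo l u := fun hh => hlu hh h2
        rcases le_or_gt (t : ℝ) a with h7 | h7
        · refine h4 (Or.inl (Or.inr ⟨⟨t / a, div_nonneg t.2.1 a0.le, (div_le_one a0).2 h7⟩, ?_⟩))
          change γ _ = γ t
          congr 1
          apply Subtype.ext
          simp only [Set.Icc.coe_mul]
          field_simp
        · have h8 : (b : ℝ) ≤ t := by
            by_contra h9
            push Not at h9
            exact h6 ⟨lt_trans ha h7, lt_trans (show t < b from h9) hb'⟩
          have h9 : 0 < 1 - (b : ℝ) := by linarith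
          refine h4 (Or.inr ⟨⟨(1 - t) / (1 - b), div_nonneg (by linarith [t.2.2]) h9.le, (div_le_one h9).2 (by linarith)⟩, ?_⟩)
          change γ _ = γ t
          congr 1
          apply Subtype.ext
          rw [cf]
          simp only
          field_simp
          ring
  exact hc (subset_closure (hsub hfin))

theorem arcL2 (hK : IsClosed K0) (hb : Bornology.IsBounded K0) (hi : Function.Injective γ) (h0 : γ 0 ∈ K0) (h1 : γ 1 ∈ K0)
    (hin : ∀ t : I, t ≠ 0 → t ≠ 1 → γ t ∉ K0) {p1 p2 p3 : ℂ} (hp1 : p1 ∉ K0 ∪ range γ) (hp2 : p2 ∉ K0 ∪ range γ)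
    (hp3 : p3 ∉ K0 ∪ range γ) (h2 : p2 ∈ cc K0 p1) (h3 : p3 ∈ cc K0 p1) :
    cc (K0 ∪ range γ) p1 = cc (K0 ∪ range γ) p2 ∨ cc (K0 ∪ range γ) p1 = cc (K0 ∪ range γ) p3 ∨
      cc (K0 ∪ range γ) p2 = cc (K0 ∪ range γ) p3 := by
  have hKc := hK.union (range_closed γ)
  have hKb := hb.union (range_comp_bdd γ)
  have n1 : ∀ {p}, p ∉ K0 ∪ range γ → p ∉ K0 := fun h hh => h (Or.inl hh)
  have n2 : ∀ {p}, p ∉ K0 ∪ range γ → p ∉ range γ := fun h hh => h (Or.inr hh)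
  have key : ∀ q, q ∉ K0 ∪ range γ → q ∈ cc K0 p1 → ∃ (u : ℂ → ℂ) (l : C(I, ℂ)) (n : ℤ), ContinuousOn u K0 ∧
      (∀ z ∈ K0, Complex.exp (u z) = (z - p1) / (z - q)) ∧ (∀ t, Complex.exp (l t) = (γ t - p1) / (γ t - q)) ∧
      l 0 = u (γ 0) ∧ l 1 = u (γ 1) + n * (2 * Real.pi * Complex.I) := by
    intro q hq hq'
    obtain ⟨u, hu, hu'⟩ := cc_log hK (n1 hp1) hq'
    obtain ⟨l, hl, hl0, hl1⟩ := defect (K0 := K0) γ (f := fun z => (z - p1) / (z - q)) (quot_ok (n2 hp1) (n2 hq)).1 (quot_ok (n2 hp1) (n2 hq)).2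
      (hu' _ h0)
    obtain ⟨n, hn⟩ := hl1 (hu' _ h1)
    exact ⟨u, l, n, hu, hu', hl, hl0, hn⟩
  have ends : ∀ t : I, γ t ∈ K0 → t = 0 ∨ t = 1 := by
    intro t ht; by_contra hc; push Not at hc; exact hin t hc.1 hc.2 ht
  have zero : ∀ q, q ∉ K0 ∪ range γ → ∀ (u : ℂ → ℂ) (l : C(I, ℂ)) (n : ℤ), ContinuousOn u K0 →
      (∀ z ∈ K0, Complex.exp (u z) = (z - p1) / (z - q)) → (∀ t, Complex.exp (l t) = (γ t - p1) / (γ t - q)) →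
      l 0 = u (γ 0) → l 1 = u (γ 1) + n * (2 * Real.pi * Complex.I) → n = 0 → cc (K0 ∪ range γ) p1 = cc (K0 ∪ range γ) q := by
    intro q hq u l n hu hu' hl hl0 hl1 hn
    subst hn
    obtain ⟨v, hv, hv', hv''⟩ := glue hK γ hi hu l (fun t ht => by
      rcases ends t ht with rfl | rfl
      · exact hl0
      · rw [hl1]; simp)
    apply cc_eq
    refine cc_of_log hKc hKb hp1 hq hv ?_
    rintro z (hz | ⟨t, rfl⟩)
    · rw [hv' z hz, hu' z hz]
    · rw [hv'', hl]
  obtain ⟨u, l, n, hu, hu', hl, hl0, hl1⟩ := key p2 hp2 h2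
  obtain ⟨v, m, k, hv, hv', hm, hm0, hm1⟩ := key p3 hp3 h3
  by_cases hn : n = 0
  · exact Or.inl (zero p2 hp2 u l n hu hu' hl hl0 hl1 hn)
  by_cases hk : k = 0
  · exact Or.inr (Or.inl (zero p3 hp3 v m k hv hv' hm hm0 hm1 hk))
  by_contra hcon
  push Not at hcon
  obtain ⟨c12, c13, c23⟩ := hcon
  obtain ⟨w, hw, hw', hw''⟩ := glue hK γ hi (u0 := fun z => k * u z - n * v z) (by fun_prop)
    ⟨fun t => k * l t - n * m t, by fun_prop⟩ (fun t ht => by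
      rcases ends t ht with rfl | rfl
      · simp [hl0, hm0]
      · simp only [ContinuousMap.coe_mk, hl1, hm1]; ring)
  have hwf : ∀ z ∈ K0 ∪ range γ, Complex.exp (w z) = ((z - p1) / (z - p2)) ^ k / ((z - p1) / (z - p3)) ^ n := by
    rintro z (hz | ⟨t, rfl⟩)
    · rw [hw' z hz, Complex.exp_sub, Complex.exp_int_mul, Complex.exp_int_mul, hu' z hz, hv' z hz]
    · rw [hw'']; simp only [ContinuousMap.coe_mk]; rw [Complex.exp_sub, Complex.exp_int_mul, Complex.exp_int_mul, hl, hm]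
  have nz : ∀ p z, p ∉ K0 ∪ range γ → z ∈ K0 ∪ range γ → z - p ≠ 0 := fun p z hp hz h => hp (sub_eq_zero.1 h ▸ hz)
  have clos : ∀ p q, q ∉ K0 ∪ range γ → cc (K0 ∪ range γ) p ≠ cc (K0 ∪ range γ) q → ∀ z ∈ closure (cc (K0 ∪ range γ) p), z - q ≠ 0 := by
    intro p q hq hne z hz h
    have : z = q := sub_eq_zero.1 h
    subst this
    exact hne (cc_eq (cc_cl hKc hz hq))
  have ctz : ∀ (q : ℂ) (j : ℤ) (S : Set ℂ), (∀ z ∈ S, z - q ≠ 0) → ContinuousOn (fun z => (z - q) ^ j) S := by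
    intro q j S h
    exact ContinuousOn.zpow₀ (by fun_prop) j (fun z hz => Or.inl (h z hz))
  by_cases hb2 : Bornology.IsBounded (cc (K0 ∪ range γ) p2)
  · have d1 := clos p2 p1 hp1 (Ne.symm c12)
    have d3 := clos p2 p3 hp3 c23
    have := wind (n := -k) (g := fun z => (z - p1) ^ (k - n) * (z - p3) ^ n) hb2 (cc_open hKc p2) (cc_mem hp2)
      ((ctz _ _ _ d1).mul (ctz _ _ _ d3)) (fun z hz => mul_ne_zero (zpow_ne_zero _ (d1 z hz)) (zpow_ne_zero _ (d3 z hz)))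
      (hw.mono (cc_fr hKc p2)) (fun z hz => by
        have hz' := cc_fr hKc p2 hz
        have e1 := nz p1 z hp1 hz'
        have e2 := nz p2 z hp2 hz'
        have e3 := nz p3 z hp3 hz'
        rw [hwf z hz', div_zpow, div_zpow, zpow_sub₀ e1, zpow_neg]
        field_simp)
    omega
  by_cases hb3 : Bornology.IsBounded (cc (K0 ∪ range γ) p3)
  · have d1 := clos p3 p1 hp1 (Ne.symm c13)
    have d3 := clos p3 p2 hp2 (Ne.symm c23)
    have := wind (n := n) (g := fun z => (z - p1) ^ (k - n) * (z - p2) ^ (-k)) hb3 (cc_open hKc p3) (cc_mem hp3)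
      ((ctz _ _ _ d1).mul (ctz _ _ _ d3)) (fun z hz => mul_ne_zero (zpow_ne_zero _ (d1 z hz)) (zpow_ne_zero _ (d3 z hz)))
      (hw.mono (cc_fr hKc p3)) (fun z hz => by
        have hz' := cc_fr hKc p3 hz
        have e1 := nz p1 z hp1 hz'
        have e2 := nz p2 z hp2 hz'
        have e3 := nz p3 z hp3 hz'
        rw [hwf z hz', div_zpow, div_zpow, zpow_sub₀ e1, zpow_neg]
        field_simp)
    omega
  exact c23 (cc_unb hKb hb2 hb3)

/-- arcs have empty interior -/
theorem arc_int (hi : Function.Injective γ) {U : Set ℂ} (hU : IsOpen U) (hn : U.Nonempty) : ∃ z ∈ U, z ∉ range γ := by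
  by_contra hc
  push Not at hc
  have hemb : IsClosedEmbedding γ := γ.continuous.isClosedEmbedding hi
  obtain ⟨x, hx⟩ := hn
  obtain ⟨ε, he, hε⟩ := Metric.isOpen_iff.1 hU x hx
  have hsub : Metric.ball x ε ⊆ range γ := fun z hz => hc z (hε hz)
  have pre : ∀ S ⊆ range γ, IsPreconnected S → IsPreconnected (γ ⁻¹' S) := by
    intro S hS h
    exact hemb.isInducing.isPreconnected_image.1 (by rwa [image_preimage_eq_of_subset hS])
  obtain ⟨a, ha⟩ := hsub (Metric.mem_ball_self he)
  have hzb : x + (ε / 2 : ℝ) ∈ Metric.ball x ε := by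
    simp [abs_of_pos he]; linarith
  obtain ⟨b, hbb⟩ := hsub hzb
  have hab : a ≠ b := by
    rintro rfl
    rw [ha] at hbb
    have : ((ε / 2 : ℝ) : ℂ) = 0 := by simpa using hbb
    have : ε / 2 = 0 := by exact_mod_cast this
    linarith
  have hball : IsPreconnected (γ ⁻¹' Metric.ball x ε) := pre _ hsub (convex_ball x ε).isPreconnected
  have main : ∀ a b : I, a < b → γ a ∈ Metric.ball x ε → γ b ∈ Metric.ball x ε → False := by
    intro a b hab ha hb
    obtain ⟨c, hac, hcb⟩ := exists_between hab
    have hcB : γ c ∈ Metric.ball x ε := by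
      have := hball.ordConnected.out ha hb ⟨hac.le, hcb.le⟩
      exact this
    obtain ⟨δ, hd, hδ⟩ := Metric.isOpen_iff.1 Metric.isOpen_ball _ hcB
    have hO : (γ ⁻¹' Metric.ball (γ c) δ) ∈ 𝓝 c :=
      (Metric.isOpen_ball.preimage γ.continuous).mem_nhds (Metric.mem_ball_self hd)
    obtain ⟨l, u, ⟨hl, hu⟩, hlu⟩ := (mem_nhds_iff_exists_Ioo_subset' ⟨a, hac⟩ ⟨b, hcb⟩).1 hO
    obtain ⟨a', ha1, ha2⟩ := exists_between hl
    obtain ⟨b', hb1, hb2⟩ := exists_between hu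
    set T := (fun w => γ c + Complex.exp w) '' {w : ℂ | w.re < Real.log δ} with hT
    have hTp : IsPreconnected T := (hp_pre _).2.image _ (by fun_prop)
    have hTm : ∀ z, z ∈ T ↔ z ∈ Metric.ball (γ c) δ ∧ z ≠ γ c := by
      intro z
      constructor
      · rintro ⟨w, hw, rfl⟩
        refine ⟨?_, by simp [Complex.exp_ne_zero]⟩
        simp only [Metric.mem_ball, dist_self_add_left, Complex.norm_exp]
        exact (Real.lt_log_iff_exp_lt hd).1 hw
      · rintro ⟨h1, h2⟩
        have h3 : z - γ c ≠ 0 := sub_ne_zero.2 h2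
        refine ⟨Complex.log (z - γ c), ?_, ?_⟩
        · simp only [mem_setOf_eq, Complex.log_re]
          apply Real.log_lt_log (norm_pos_iff.2 h3)
          rwa [← Complex.dist_eq]
        · simp only [Complex.exp_log h3]; ring
    have h2 := pre T (fun z hz => hsub (hδ ((hTm z).1 hz).1)) hTp
    have h3 := h2.ordConnected.out (x := a') (y := b') ((hTm _).2 ⟨hlu ⟨ha1, ha2.trans hu⟩, fun h => ha2.ne (hi h)⟩)
      ((hTm _).2 ⟨hlu ⟨hl.trans hb1, hb2⟩, fun h => hb1.ne' (hi h)⟩) ⟨ha2.le, hb1.le⟩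
    exact ((hTm _).1 h3).2 rfl
  rcases lt_or_gt_of_ne hab with h | h
  · exact main a b h (by rw [ha]; exact Metric.mem_ball_self he) (by rw [hbb]; exact hzb)
  · exact main b a h (by rw [hbb]; exact hzb) (by rw [ha]; exact Metric.mem_ball_self he)

end arc
end CF

end

open Set Topology

noncomputable section
namespace CF
set_option linter.all false
open scoped Classical symmDiff unitInterval

theorem nosqrt {a b : ℂ} (hab : a ≠ b) {M : ℂ → ℂ} (hM : ContinuousOn M {z | z ≠ a ∧ z ≠ b})
    (h : ∀ z, z ≠ a → z ≠ b → M z ^ 2 = (z - b) / (z - a)) : False := by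
  set ρ := dist a b with hρ
  have hρ0 : 0 < ρ := dist_pos.2 hab
  have hbn : ∀ z ∈ Metric.ball a ρ, z - b ≠ 0 := by
    intro z hz h0
    have : z = b := sub_eq_zero.1 h0
    subst this
    simp [hρ, dist_comm] at hz
  obtain ⟨l, hl, hl'⟩ := convlog (convex_ball a ρ) Metric.isOpen_ball ⟨a, by simpa using hρ0⟩
    (g := fun z => z - b) (by fun_prop) hbn
  set S : Set ℂ := {w : ℂ | w.re < Real.log ρ} with hS
  have inb : ∀ w ∈ S, a + Complex.exp w ∈ Metric.ball a ρ := by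
    intro w hw
    simp only [Metric.mem_ball, dist_self_add_left, Complex.norm_exp]
    exact (Real.lt_log_iff_exp_lt hρ0).1 hw
  have ok : ∀ w ∈ S, a + Complex.exp w ≠ a ∧ a + Complex.exp w ≠ b := by
    intro w hw
    refine ⟨by simp [Complex.exp_ne_zero], fun h => hbn _ (inb w hw) (sub_eq_zero.2 h)⟩
  set N : ℂ → ℂ := fun w => M (a + Complex.exp w) * Complex.exp (w / 2) * Complex.exp (- l (a + Complex.exp w) / 2) with hN
  have hNc : ContinuousOn N S := by
    have h1 : ContinuousOn (fun w => M (a + Complex.exp w)) S := hM.comp (by fun_prop) ok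
    have h2 : ContinuousOn (fun w => l (a + Complex.exp w)) S := hl.comp (by fun_prop) inb
    exact (h1.mul (by fun_prop)).mul (Complex.continuous_exp.comp_continuousOn (h2.neg.div_const 2))
  have hsq : EqOn (N ^ 2) ((fun _ => (1 : ℂ)) ^ 2) S := by
    intro w hw
    have e1 : Complex.exp (w / 2) ^ 2 = Complex.exp w := by rw [← Complex.exp_nat_mul]; congr 1; push_cast; ring
    have e2 : Complex.exp (- l (a + Complex.exp w) / 2) ^ 2 = (a + Complex.exp w - b)⁻¹ := by
      rw [← Complex.exp_nat_mul, ← hl' _ (inb w hw), ← Complex.exp_neg]; congr 1; push_cast; ring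
    have e3 := h _ (ok w hw).1 (ok w hw).2
    simp only [Pi.pow_apply, hN, mul_pow, e1, e2, e3, add_sub_cancel_left, one_pow]
    have := hbn _ (inb w hw)
    have := Complex.exp_ne_zero w
    field_simp
  have hper : ∀ w : ℂ, Complex.exp (w + 2 * Real.pi * Complex.I) = Complex.exp w := Complex.exp_periodic
  set y : ℂ := ((Real.log ρ - 1 : ℝ) : ℂ) with hy
  have y1 : y ∈ S := by simp [hS, hy]
  have y2 : y + 2 * Real.pi * Complex.I ∈ S := by simp [hS, hy]
  have hneg : N (y + 2 * Real.pi * Complex.I) = - N y := by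
    simp only [hN, hper]
    have : (y + 2 * Real.pi * Complex.I) / 2 = y / 2 + Real.pi * Complex.I := by ring
    rw [this, Complex.exp_add, Complex.exp_pi_mul_I]; ring
  rcases (hp_pre (Real.log ρ)).2.eq_or_eq_neg_of_sq_eq hNc continuousOn_const hsq (fun _ => one_ne_zero) with h1 | h1
  · have := h1 y1; have h2 := h1 y2
    rw [hneg, this] at h2; norm_num at h2
  · have := h1 y1; have h2 := h1 y2
    rw [hneg, this] at h2; norm_num at h2

structure Dr (V E : Type) extends Gr V E where
  pos : V → ℂ
  γ : E → C(I, ℂ)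
  pinj : Function.Injective pos
  ginj : ∀ e, Function.Injective (γ e)
  g0 : ∀ e, γ e 0 = pos (s e)
  g1 : ∀ e, γ e 1 = pos (t e)
  gv : ∀ e τ v, τ ∈ Ioo (0 : I) 1 → γ e τ ≠ pos v
  gd : ∀ e e' τ τ', e ≠ e' → τ ∈ Ioo (0 : I) 1 → τ' ∈ Ioo (0 : I) 1 → γ e τ ≠ γ e' τ'

namespace Dr
variable {V E : Type} [Fintype V] [Fintype E] (D : Dr V E)

def KZ (Z : Finset E) : Set ℂ := range D.pos ∪ ⋃ e ∈ Z, range (D.γ e)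

variable {D}

theorem st (e : E) : D.s e ≠ D.t e := by
  intro h
  have : D.γ e 0 = D.γ e 1 := by rw [D.g0, D.g1, h]
  exact zero_ne_one (D.ginj e this)

theorem NL (Z : Finset E) : D.toGr.NL Z := fun e _ => st e

theorem mem_KZ {Z : Finset E} {z : ℂ} : z ∈ D.KZ Z ↔ (∃ v, D.pos v = z) ∨ ∃ e ∈ Z, ∃ τ, D.γ e τ = z := by
  simp [KZ]

theorem io (τ : I) : τ = 0 ∨ τ = 1 ∨ τ ∈ Ioo (0 : I) 1 := by
  by_cases h0 : τ = 0
  · exact Or.inl h0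
  by_cases h1 : τ = 1
  · exact Or.inr (Or.inl h1)
  · exact Or.inr (Or.inr ⟨unitInterval.pos_iff_ne_zero.2 h0, unitInterval.lt_one_iff_ne_one.2 h1⟩)

theorem pos_mem {e : E} {v : V} {τ : I} (h : D.γ e τ = D.pos v) : v = D.s e ∨ v = D.t e := by
  rcases io τ with rfl | rfl | h'
  · left; rw [D.g0] at h; exact (D.pinj h).symm
  · right; rw [D.g1] at h; exact (D.pinj h).symm
  · exact absurd h (D.gv e τ v h')

theorem KZ_mono {Z Z' : Finset E} (h : Z ⊆ Z') : D.KZ Z ⊆ D.KZ Z' := by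
  intro z hz
  rw [mem_KZ] at *
  rcases hz with hz | ⟨e, he, h1⟩
  · exact Or.inl hz
  · exact Or.inr ⟨e, h he, h1⟩

theorem KZ_erase {Z : Finset E} {e : E} (he : e ∈ Z) : D.KZ Z = D.KZ (Z.erase e) ∪ range (D.γ e) := by
  ext z
  simp only [mem_union, mem_KZ, Finset.mem_erase, mem_range]
  constructor
  · rintro (h | ⟨e', he', h⟩)
    · exact Or.inl (Or.inl h)
    · by_cases hh : e' = e
      · subst hh; exact Or.inr h
      · exact Or.inl (Or.inr ⟨e', ⟨hh, he'⟩, h⟩)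
  · rintro ((h | ⟨e', he', h⟩) | h)
    · exact Or.inl h
    · exact Or.inr ⟨e', he'.2, h⟩
    · exact Or.inr ⟨e, he, h⟩

theorem KZ_comp (Z : Finset E) : IsCompact (D.KZ Z) :=
  (Set.finite_range _).isCompact.union (Z.finite_toSet.isCompact_biUnion (fun e _ => isCompact_range (D.γ e).continuous))
theorem KZ_closed (Z : Finset E) : IsClosed (D.KZ Z) := (KZ_comp Z).isClosed
theorem KZ_bdd (Z : Finset E) : Bornology.IsBounded (D.KZ Z) := (KZ_comp Z).isBounded

theorem arc_nin {Z : Finset E} {e : E} (he : e ∉ Z) {τ : I} (hτ : τ ∈ Ioo (0 : I) 1) : D.γ e τ ∉ D.KZ Z := by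
  rw [mem_KZ]
  rintro (⟨v, h⟩ | ⟨e', he', τ', h⟩)
  · exact D.gv e τ v hτ h.symm
  · have hne : e ≠ e' := fun hh => he (hh ▸ he')
    rcases io τ' with rfl | rfl | h'
    · rw [D.g0] at h; exact D.gv e τ _ hτ h.symm
    · rw [D.g1] at h; exact D.gv e τ _ hτ h.symm
    · exact D.gd e e' τ τ' hne hτ h' h.symm

theorem g0_mem (Z : Finset E) (e : E) : D.γ e 0 ∈ D.KZ Z := by rw [mem_KZ, D.g0]; exact Or.inl ⟨_, rfl⟩
theorem g1_mem (Z : Finset E) (e : E) : D.γ e 1 ∈ D.KZ Z := by rw [mem_KZ, D.g1]; exact Or.inl ⟨_, rfl⟩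
theorem arc_in {Z : Finset E} {e : E} (he : e ∉ Z) : ∀ t : I, t ≠ 0 → t ≠ 1 → D.γ e t ∉ D.KZ Z := by
  intro t h0 h1
  exact arc_nin he ⟨unitInterval.pos_iff_ne_zero.2 h0, unitInterval.lt_one_iff_ne_one.2 h1⟩

variable (D)
def K : Set ℂ := D.KZ Finset.univ
def FF : Type := {f : Set ℂ // ∃ x, x ∉ D.K ∧ f = cc D.K x}
variable {D}

def adj (f : D.FF) (e : E) : Prop := ∀ τ ∈ Ioo (0 : I) 1, D.γ e τ ∈ closure f.1

theorem K_erase (e : E) : D.K = D.KZ (Finset.univ.erase e) ∪ range (D.γ e) := KZ_erase (Finset.mem_univ e)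
theorem K_closed : IsClosed D.K := KZ_closed _

def mid : I := ⟨1 / 2, by norm_num, by norm_num⟩
theorem mid_mem : mid ∈ Ioo (0 : I) 1 := by
  constructor
  · change (0 : ℝ) < 1 / 2; norm_num
  · change (1 / 2 : ℝ) < 1; norm_num

theorem ff_eq {f f' : D.FF} {z : ℂ} (h : z ∈ f.1) (h' : z ∈ f'.1) : f = f' := by
  obtain ⟨f, x, hx, rfl⟩ := f
  obtain ⟨f', x', hx', rfl⟩ := f'
  apply Subtype.ext
  exact cc_disj h h'
theorem ff_sub (f : D.FF) : ∀ z ∈ f.1, z ∉ D.K := by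
  obtain ⟨f, x, hx, rfl⟩ := f
  exact fun z hz => cc_sub x hz
theorem ff_open (f : D.FF) : IsOpen f.1 := by
  obtain ⟨f, x, hx, rfl⟩ := f
  exact cc_open K_closed x
theorem ff_pre (f : D.FF) : IsPreconnected f.1 := by
  obtain ⟨f, x, hx, rfl⟩ := f
  exact cc_pre x
theorem ff_ne (f : D.FF) : f.1.Nonempty := by
  obtain ⟨f, x, hx, rfl⟩ := f
  exact ⟨x, cc_mem hx⟩
theorem ff_cc (f : D.FF) {z : ℂ} (h : z ∈ f.1) : f.1 = cc D.K z := by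
  obtain ⟨f, x, hx, rfl⟩ := f
  exact cc_eq h
theorem ff_at {z : ℂ} (h : z ∉ D.K) : ∃ f : D.FF, z ∈ f.1 := ⟨⟨cc D.K z, z, h, rfl⟩, cc_mem h⟩

theorem adj_of {f : D.FF} {e : E} {τ : I} (hτ : τ ∈ Ioo (0 : I) 1) (h : D.γ e τ ∈ closure f.1) : adj f e := by
  obtain ⟨f, x, hx, rfl⟩ := f
  intro τ' hτ'
  change _ ∈ closure (cc D.K x)
  change _ ∈ closure (cc D.K x) at h
  rw [K_erase e] at h hx ⊢
  exact arcL1 (KZ_closed _) (KZ_bdd _) (D.ginj e) (g0_mem _ e) (g1_mem _ e) (arc_in (by simp)) hx hτ hτ' h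

/-- the component around `e` when `e` is deleted -/
def Ue (D : Dr V E) (e : E) : Set ℂ := cc (D.KZ (Finset.univ.erase e)) (D.γ e mid)

theorem Ue_arc {e : E} {τ : I} (hτ : τ ∈ Ioo (0 : I) 1) : D.γ e τ ∈ D.Ue e :=
  arc_conn (arc_in (by simp)) mid_mem hτ

theorem Ue_of_adj {f : D.FF} {e : E} (h : adj f e) : f.1 ⊆ D.Ue e := by
  have h1 := h mid mid_mem
  obtain ⟨f, x, hx, rfl⟩ := f
  change cc D.K x ⊆ _
  change _ ∈ closure (cc D.K x) at h1
  rw [K_erase e] at *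
  exact face_sub (KZ_closed _) h1 (arc_nin (by simp) mid_mem)

theorem adj_of_Ue {f : D.FF} {e : E} {z : ℂ} (hz : z ∈ f.1) (hU : z ∈ D.Ue e) : adj f e := by
  have hzK := ff_sub f z hz
  have hf := ff_cc f hz
  rw [K_erase e] at hzK
  obtain ⟨t, h1, h2⟩ := face_touch (KZ_closed (Finset.univ.erase e)) (arc_nin (by simp) mid_mem) hU hzK
  rw [← K_erase e, ← hf] at h1
  rcases io t with rfl | rfl | h3
  · exact absurd (g0_mem _ e) h2
  · exact absurd (g1_mem _ e) h2
  · exact adj_of h3 h1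

theorem adj3 {f1 f2 f3 : D.FF} {e : E} (h1 : adj f1 e) (h2 : adj f2 e) (h3 : adj f3 e) : f1 = f2 ∨ f1 = f3 ∨ f2 = f3 := by
  obtain ⟨p1, q1⟩ := ff_ne f1
  obtain ⟨p2, q2⟩ := ff_ne f2
  obtain ⟨p3, q3⟩ := ff_ne f3
  have u1 := Ue_of_adj h1 q1
  have u2 := Ue_of_adj h2 q2
  have u3 := Ue_of_adj h3 q3
  unfold Ue at u1 u2 u3
  rw [cc_eq u1] at u2 u3
  have k1 := ff_sub f1 _ q1
  have k2 := ff_sub f2 _ q2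
  have k3 := ff_sub f3 _ q3
  rw [K_erase e] at k1 k2 k3
  have := arcL2 (KZ_closed _) (KZ_bdd _) (D.ginj e) (g0_mem _ e) (g1_mem _ e) (arc_in (by simp)) k1 k2 k3 u2 u3
  rw [← K_erase e, ← ff_cc f1 q1, ← ff_cc f2 q2, ← ff_cc f3 q3] at this
  rcases this with h | h | h
  · exact Or.inl (Subtype.ext h)
  · exact Or.inr (Or.inl (Subtype.ext h))
  · exact Or.inr (Or.inr (Subtype.ext h))

theorem adj_ex (e : E) : ∃ f : D.FF, adj f e := by
  have hm : D.γ e mid ∉ D.KZ (Finset.univ.erase e) := arc_nin (by simp) mid_mem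
  obtain ⟨z, hz, hz'⟩ := arc_int (D.ginj e) (cc_open (KZ_closed (Finset.univ.erase e)) (D.γ e mid)) ⟨_, cc_mem hm⟩
  have hK : z ∉ D.K := by
    rw [K_erase e]
    rintro (h | h)
    · exact cc_sub _ hz h
    · exact hz' h
  obtain ⟨f, hf⟩ := ff_at hK
  exact ⟨f, adj_of_Ue hf hz⟩

theorem exLR (e : E) : ∃ lr : D.FF × D.FF, ∀ f : D.FF, adj f e ↔ f = lr.1 ∨ f = lr.2 := by
  obtain ⟨l, hl⟩ := adj_ex (D := D) e
  by_cases h : ∃ r, adj r e ∧ r ≠ l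
  · obtain ⟨r, hr, hne⟩ := h
    refine ⟨(l, r), fun f => ⟨fun hf => ?_, ?_⟩⟩
    · rcases adj3 hl hr hf with h | h | h
      · exact absurd h.symm hne
      · exact Or.inl h.symm
      · exact Or.inr h.symm
    · rintro (rfl | rfl) <;> assumption
  · push Not at h
    refine ⟨(l, l), fun f => ⟨fun hf => Or.inl (h f hf), ?_⟩⟩
    rintro (rfl | rfl) <;> assumption

variable (D)
def fl (e : E) : D.FF := (exLR (D := D) e).choose.1
def fr (e : E) : D.FF := (exLR (D := D) e).choose.2
variable {D}
theorem adj_iff {f : D.FF} {e : E} : adj f e ↔ f = D.fl e ∨ f = D.fr e := (exLR e).choose_spec f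

theorem vc_conn : IsPreconnected (range D.pos)ᶜ := by
  refine ((Set.finite_range D.pos).countable.isConnected_compl_of_one_lt_rank ?_).isPreconnected
  rw [Complex.rank_real_complex]; norm_num

theorem face_adj (f : D.FF) : (∃ e, adj f e) ∨ f.1 = (range D.pos)ᶜ := by
  by_cases h : ∃ e, adj f e
  · exact Or.inl h
  right
  push Not at h
  have h1 : f.1 ⊆ (range D.pos)ᶜ := by
    intro z hz hz'
    exact ff_sub f z hz (Or.inl hz')
  apply h1.antisymm
  apply vc_conn.subset_of_closure_inter_subset (ff_open f)
  · obtain ⟨z, hz⟩ := ff_ne f; exact ⟨z, h1 hz, hz⟩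
  · rintro z ⟨hz, hz'⟩
    obtain ⟨x, hx⟩ := ff_ne f
    rw [ff_cc f hx] at hz ⊢
    apply cc_cl K_closed hz
    intro hzK
    rcases mem_KZ.1 hzK with hv | ⟨e, -, τ, rfl⟩
    · exact hz' hv
    · rcases io τ with rfl | rfl | h3
      · rw [D.g0] at hz'; exact hz' ⟨_, rfl⟩
      · rw [D.g1] at hz'; exact hz' ⟨_, rfl⟩
      · rw [← ff_cc f hx] at hz; exact h e (adj_of h3 hz)

theorem ff_finite : Finite D.FF := by
  rw [← Set.finite_univ_iff]
  have : (univ : Set D.FF) ⊆ (range D.fl ∪ range D.fr) ∪ {f | f.1 = (range D.pos)ᶜ} := by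
    intro f _
    rcases face_adj f with ⟨e, he⟩ | h
    · left
      rcases adj_iff.1 he with h | h
      · exact Or.inl ⟨e, h.symm⟩
      · exact Or.inr ⟨e, h.symm⟩
    · exact Or.inr h
  refine Set.Finite.subset (((Set.finite_range _).union (Set.finite_range _)).union ?_) this
  apply Set.Subsingleton.finite
  intro a ha b hb
  exact Subtype.ext (ha.trans hb.symm)

theorem side {R : Set D.FF} {Z : Finset E} (hZ : ∀ e, e ∉ Z → (D.fl e ∈ R ↔ D.fr e ∈ R)) {S : Set ℂ}
    (hS : IsPreconnected S) (hSZ : ∀ z ∈ S, z ∉ D.KZ Z) {f f' : D.FF} (hf : f ∈ R) (hf' : f' ∉ R)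
    (h : (S ∩ f.1).Nonempty) (h' : (S ∩ f'.1).Nonempty) : False := by
  haveI := ff_finite (D := D)
  have c1 : IsClosed (⋃ g ∈ R, closure g.1) := (Set.toFinite R).isClosed_biUnion (fun _ _ => isClosed_closure)
  have c2 : IsClosed (⋃ g ∈ Rᶜ, closure g.1) := (Set.toFinite Rᶜ).isClosed_biUnion (fun _ _ => isClosed_closure)
  have cases : ∀ z ∈ S, (∃ g : D.FF, z ∈ g.1) ∨ ∃ e ∉ Z, ∃ τ ∈ Ioo (0 : I) 1, D.γ e τ = z := by
    intro z hz
    by_cases hzK : z ∈ D.K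
    · right
      have hz2 := hSZ z hz
      rcases mem_KZ.1 hzK with hv | ⟨e, -, τ, rfl⟩
      · exact absurd (mem_KZ.2 (Or.inl hv)) hz2
      · refine ⟨e, fun he => hz2 (mem_KZ.2 (Or.inr ⟨e, he, τ, rfl⟩)), τ, ?_, rfl⟩
        rcases io τ with rfl | rfl | h3
        · exact absurd (g0_mem _ e) hz2
        · exact absurd (g1_mem _ e) hz2
        · exact h3
    · exact Or.inl (ff_at hzK)
  obtain ⟨z, hz, hz1, hz2⟩ := isPreconnected_closed_iff.1 hS _ _ c1 c2 (by
    intro z hz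
    have : ∃ g : D.FF, z ∈ closure g.1 := by
      rcases cases z hz with ⟨g, hg⟩ | ⟨e, he, τ, hτ, rfl⟩
      · exact ⟨g, subset_closure hg⟩
      · exact ⟨D.fl e, adj_iff.2 (Or.inl rfl) τ hτ⟩
    obtain ⟨g, hg⟩ := this
    by_cases hgR : g ∈ R
    · left; exact mem_iUnion₂.2 ⟨g, hgR, hg⟩
    · right; exact mem_iUnion₂.2 ⟨g, hgR, hg⟩)
    (by obtain ⟨z, h1, h2⟩ := h; exact ⟨z, h1, mem_iUnion₂.2 ⟨f, hf, subset_closure h2⟩⟩)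
    (by obtain ⟨z, h1, h2⟩ := h'; exact ⟨z, h1, mem_iUnion₂.2 ⟨f', hf', subset_closure h2⟩⟩)
  obtain ⟨g, hg, hg'⟩ := mem_iUnion₂.1 hz1
  obtain ⟨k, hk, hk'⟩ := mem_iUnion₂.1 hz2
  rcases cases z hz with ⟨j, hj⟩ | ⟨e, he, τ, hτ, rfl⟩
  · have m1 : ∀ g : D.FF, z ∈ closure g.1 → g = j := by
      intro g hg
      obtain ⟨w, hw, hw'⟩ := mem_closure_iff.1 hg _ (ff_open j) hj
      exact ff_eq hw' hw
    exact hk ((m1 k hk').trans (m1 g hg').symm ▸ hg)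
  · have a1 := adj_iff.1 (adj_of hτ hg')
    have a2 := adj_iff.1 (adj_of hτ hk')
    have := hZ e he
    change k ∉ R at hk
    rcases a1 with rfl | rfl <;> rcases a2 with rfl | rfl <;> tauto

variable (D)
def J (R : Set D.FF) : Finset E := Finset.univ.filter (fun e => ¬ (D.fl e ∈ R ↔ D.fr e ∈ R))
variable {D}
theorem mem_J {R : Set D.FF} {e : E} : e ∈ D.J R ↔ ¬ (D.fl e ∈ R ↔ D.fr e ∈ R) := by simp [J]
theorem nmem_J {R : Set D.FF} {e : E} (h : e ∉ D.J R) : (D.fl e ∈ R ↔ D.fr e ∈ R) := by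
  rw [mem_J] at h; tauto
theorem J_sd (R R' : Set D.FF) : D.J (R ∆ R') = D.J R ∆ D.J R' := by
  ext e; simp only [mem_J, Finset.mem_symmDiff, Set.mem_symmDiff]; tauto

theorem d_conn (R : Set D.FF) (h : D.J R = ∅) : R = ∅ ∨ R = univ := by
  by_contra hc
  push Not at hc
  obtain ⟨⟨f, hf⟩, h2⟩ := hc
  obtain ⟨f', hf'⟩ := (Set.ne_univ_iff_exists_notMem R).1 h2
  have ok : ∀ f : D.FF, ((range D.pos)ᶜ ∩ f.1).Nonempty := by
    intro f
    obtain ⟨z, hz⟩ := ff_ne f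
    exact ⟨z, fun hz' => ff_sub f z hz (Or.inl hz'), hz⟩
  refine side (R := R) (Z := ∅) (fun e _ => nmem_J (by rw [h]; simp)) vc_conn ?_ hf hf' (ok f) (ok f')
  intro z hz hz'
  rw [mem_KZ] at hz'
  rcases hz' with hv | ⟨e, he, -⟩
  · exact hz hv
  · simp at he

end Dr
end CF

end

open Set Topology

noncomputable section
namespace CF
set_option linter.all false
open scoped Classical symmDiff unitInterval

namespace Dr
variable {V E : Type} [Fintype V] [Fintype E] {D : Dr V E}

theorem exL (e : E) : ∃ L : ℂ → ℂ, ContinuousOn L (range (D.γ e))ᶜ ∧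
    ∀ z ∈ (range (D.γ e))ᶜ, Complex.exp (L z) = (z - D.pos (D.t e)) / (z - D.pos (D.s e)) := by
  obtain ⟨L, h1, h2⟩ := plog (D.γ e) (range (D.γ e))ᶜ (fun t h => h ⟨t, rfl⟩)
  rw [D.g0, D.g1] at h2
  exact ⟨L, h1, h2⟩

variable (D)
def Le (e : E) : ℂ → ℂ := (exL (D := D) e).choose
variable {D}
theorem Le_c (e : E) : ContinuousOn (D.Le e) (range (D.γ e))ᶜ := (exL e).choose_spec.1
theorem Le_e (e : E) {z : ℂ} (h : z ∉ range (D.γ e)) : Complex.exp (D.Le e z) = (z - D.pos (D.t e)) / (z - D.pos (D.s e)) :=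
  (exL e).choose_spec.2 z h

theorem sq_prod {Z : Finset E} (hZ : D.toGr.Ev Z) (z : ℂ) :
    (∏ v : V, (z - D.pos v) ^ ((D.toGr.star Z v).card / 2)) ^ 2 = ∏ e ∈ Z, ((z - D.pos (D.s e)) * (z - D.pos (D.t e))) := by
  rw [← Finset.prod_pow]
  have h1 : ∀ v : V, ((z - D.pos v) ^ ((D.toGr.star Z v).card / 2)) ^ 2 = ∏ e ∈ Z, if D.toGr.inc e v then z - D.pos v else 1 := by
    intro v
    rw [← pow_mul, Nat.div_mul_cancel (Gr.ev_star (NL Z) hZ v).two_dvd, ← Finset.prod_filter, Finset.prod_const]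
    rfl
  rw [Finset.prod_congr rfl (fun v _ => h1 v), Finset.prod_comm]
  apply Finset.prod_congr rfl
  intro e _
  rw [← Finset.prod_filter]
  have : (Finset.univ.filter (fun v => D.toGr.inc e v)) = {D.s e, D.t e} := by
    ext v; simp [Gr.inc, eq_comm]
  rw [this, Finset.prod_pair (st e)]

variable (D)
def gq (Z : Finset E) (z : ℂ) : ℂ := (∏ v : V, (z - D.pos v) ^ ((D.toGr.star Z v).card / 2)) / ∏ e ∈ Z, (z - D.pos (D.s e))
variable {D}

theorem pne {z : ℂ} (hz : z ∉ range D.pos) (v : V) : z - D.pos v ≠ 0 := fun h => hz ⟨v, (sub_eq_zero.1 h).symm⟩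

theorem gq_sq {Z : Finset E} (hZ : D.toGr.Ev Z) {z : ℂ} (hz : z ∉ range D.pos) :
    D.gq Z z ^ 2 = ∏ e ∈ Z, ((z - D.pos (D.t e)) / (z - D.pos (D.s e))) := by
  unfold gq
  rw [div_pow, sq_prod hZ, Finset.prod_mul_distrib, Finset.prod_div_distrib]
  have : ∏ e ∈ Z, (z - D.pos (D.s e)) ≠ 0 := Finset.prod_ne_zero_iff.2 (fun e _ => pne hz _)
  field_simp

theorem gq_ne (Z : Finset E) {z : ℂ} (hz : z ∉ range D.pos) : D.gq Z z ≠ 0 :=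
  div_ne_zero (Finset.prod_ne_zero_iff.2 (fun v _ => pow_ne_zero _ (pne hz _))) (Finset.prod_ne_zero_iff.2 (fun e _ => pne hz _))

theorem gq_c (Z : Finset E) : ContinuousOn (D.gq Z) (range D.pos)ᶜ := by
  apply ContinuousOn.div
  · fun_prop
  · fun_prop
  · intro z hz; exact Finset.prod_ne_zero_iff.2 (fun e _ => pne hz _)

theorem sumL_c (Z : Finset E) : ContinuousOn (fun z => ∑ e ∈ Z, D.Le e z) (D.KZ Z)ᶜ := by
  apply continuousOn_finset_sum
  intro e he
  apply (Le_c e).mono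
  intro z hz hz'
  obtain ⟨τ, rfl⟩ := hz'
  exact hz (mem_KZ.2 (Or.inr ⟨e, he, τ, rfl⟩))

theorem sumL_e (Z : Finset E) {z : ℂ} (hz : z ∉ D.KZ Z) :
    Complex.exp (∑ e ∈ Z, D.Le e z) = ∏ e ∈ Z, ((z - D.pos (D.t e)) / (z - D.pos (D.s e))) := by
  rw [Complex.exp_sum]
  apply Finset.prod_congr rfl
  intro e he
  apply Le_e
  rintro ⟨τ, rfl⟩
  exact hz (mem_KZ.2 (Or.inr ⟨e, he, τ, rfl⟩))

variable (D)
def sg (Z : Finset E) (z : ℂ) : ℂ := Complex.exp ((∑ e ∈ Z, D.Le e z) / 2) / D.gq Z z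
variable {D}

theorem nrp {Z : Finset E} {z : ℂ} (hz : z ∉ D.KZ Z) : z ∉ range D.pos := fun h => hz (Or.inl h)

theorem sg_c (Z : Finset E) : ContinuousOn (D.sg Z) (D.KZ Z)ᶜ := by
  apply ContinuousOn.div
  · exact Complex.continuous_exp.comp_continuousOn ((sumL_c Z).div_const 2)
  · exact (gq_c Z).mono (fun z hz => nrp hz)
  · intro z hz; exact gq_ne Z (nrp hz)

theorem half_sq (w : ℂ) : Complex.exp (w / 2) ^ 2 = Complex.exp w := by
  rw [← Complex.exp_nat_mul]; congr 1; push_cast; ring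

theorem sg_sq {Z : Finset E} (hZ : D.toGr.Ev Z) {z : ℂ} (hz : z ∉ D.KZ Z) : D.sg Z z ^ 2 = 1 := by
  unfold sg
  rw [div_pow, half_sq, sumL_e Z hz, gq_sq hZ (nrp hz), div_self]
  rw [← gq_sq hZ (nrp hz)]
  exact pow_ne_zero _ (gq_ne Z (nrp hz))

theorem sg_const {Z : Finset E} (hZ : D.toGr.Ev Z) {S : Set ℂ} (hS : IsPreconnected S) (h : ∀ z ∈ S, z ∉ D.KZ Z)
    {z w : ℂ} (hz : z ∈ S) (hw : w ∈ S) : D.sg Z z = D.sg Z w := by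
  rcases hS.eq_or_eq_neg_of_sq_eq ((sg_c Z).mono h) (g := fun _ => (1 : ℂ)) continuousOn_const
    (fun z hz => by simp [sg_sq hZ (h z hz)]) (fun _ => one_ne_zero) with h1 | h1
  · rw [h1 hz, h1 hw]
  · rw [h1 hz, h1 hw]; rfl

theorem K_of_KZ {Z : Finset E} {z : ℂ} (h : z ∉ D.K) : z ∉ D.KZ Z := fun hh => h (KZ_mono (Finset.subset_univ _) hh)

theorem sg_face {Z : Finset E} (hZ : D.toGr.Ev Z) (f : D.FF) {z w : ℂ} (hz : z ∈ f.1) (hw : w ∈ f.1) : D.sg Z z = D.sg Z w :=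
  sg_const hZ (ff_pre f) (fun z hz => K_of_KZ (ff_sub f z hz)) hz hw

theorem d_exists (Z : Finset E) (hZ : D.toGr.Ev Z) : ∃ R : Set D.FF, D.J R = Z := by
  set R : Set D.FF := {f | ∃ z ∈ f.1, D.sg Z z = 1} with hR
  have memR : ∀ (f : D.FF) z, z ∈ f.1 → (f ∈ R ↔ D.sg Z z = 1) := by
    intro f z hz
    constructor
    · rintro ⟨w, hw, h⟩; rw [sg_face hZ f hz hw, h]
    · intro h; exact ⟨z, hz, h⟩
  refine ⟨R, ?_⟩
  ext e
  rw [mem_J]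
  constructor
  · intro h
    by_contra he
    apply h
    have hm : D.γ e mid ∉ D.KZ Z := arc_nin he mid_mem
    have meet : ∀ f : D.FF, adj f e → ∃ z ∈ f.1, z ∈ cc (D.KZ Z) (D.γ e mid) := by
      intro f hf
      obtain ⟨w, h1, h2⟩ := mem_closure_iff.1 (hf mid mid_mem) _ (cc_open (KZ_closed Z) _) (cc_mem hm)
      exact ⟨w, h2, h1⟩
    obtain ⟨z, hz, hz'⟩ := meet _ (adj_iff.2 (Or.inl rfl))
    obtain ⟨w, hw, hw'⟩ := meet _ (adj_iff.2 (Or.inr rfl))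
    rw [memR _ z hz, memR _ w hw, sg_const hZ (cc_pre _) (fun z hz => cc_sub _ hz) hz' hw']
  · intro he hlr
    obtain ⟨z1, hz1⟩ := ff_ne (D.fl e)
    obtain ⟨z2, hz2⟩ := ff_ne (D.fr e)
    rw [memR _ _ hz1, memR _ _ hz2] at hlr
    set c := D.sg Z z1 with hc
    have c2 : c ^ 2 = 1 := sg_sq hZ (K_of_KZ (ff_sub _ _ hz1))
    have d2 : D.sg Z z2 ^ 2 = 1 := sg_sq hZ (K_of_KZ (ff_sub _ _ hz2))
    have heq : D.sg Z z2 = c := by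
      rcases mul_self_eq_one_iff.1 ((sq c).symm.trans c2) with h | h
      · rw [hlr.1 h, h]
      · rcases mul_self_eq_one_iff.1 ((sq _).symm.trans d2) with h' | h'
        · rw [hlr.2 h', h']
        · rw [h, h']
    have hU : ∀ z ∈ D.Ue e, z ∉ range (D.γ e) → D.sg Z z = c := by
      intro z hz hz'
      have hzK : z ∉ D.K := by
        rw [K_erase e]; rintro (h | h)
        · exact cc_sub _ hz h
        · exact hz' h
      obtain ⟨f, hf⟩ := ff_at hzK
      rcases adj_iff.1 (adj_of_Ue hf hz) with rfl | rfl
      · exact sg_face hZ _ hf hz1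
      · rw [← heq]; exact sg_face hZ _ hf hz2
    have hUo : IsOpen (D.Ue e) := cc_open (KZ_closed _) _
    have hUs : ∀ z ∈ D.Ue e, z ∉ D.KZ (Z.erase e) := fun z hz hh =>
      cc_sub _ hz (KZ_mono (Finset.erase_subset_erase _ (Finset.subset_univ _)) hh)
    set N : ℂ → ℂ := fun z => c * D.gq Z z * Complex.exp (-(∑ e' ∈ Z.erase e, D.Le e' z) / 2) with hN
    have hNc : ContinuousOn N (D.Ue e) := by
      apply ContinuousOn.mul
      · exact continuousOn_const.mul ((gq_c Z).mono (fun z hz => nrp (hUs z hz)))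
      · exact Complex.continuous_exp.comp_continuousOn ((((sumL_c (Z.erase e)).mono hUs).neg).div_const 2)
    have sp : ∀ z, ∑ e' ∈ Z, D.Le e' z = D.Le e z + ∑ e' ∈ Z.erase e, D.Le e' z := fun z =>
      (Finset.add_sum_erase _ _ he).symm
    have hNL : ∀ z ∈ D.Ue e, z ∉ range (D.γ e) → N z = Complex.exp (D.Le e z / 2) := by
      intro z hz hz'
      have h1 := hU z hz hz'
      unfold sg at h1
      rw [div_eq_iff (gq_ne Z (nrp (hUs z hz))), sp] at h1
      simp only [hN]
      rw [← h1, ← Complex.exp_add]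
      congr 1; ring
    have hN2 : ∀ z ∈ D.Ue e, N z ^ 2 = (z - D.pos (D.t e)) / (z - D.pos (D.s e)) := by
      intro z hz
      have h0 := nrp (hUs z hz)
      simp only [hN]
      rw [mul_pow, mul_pow, c2, half_sq, Complex.exp_neg, sumL_e _ (hUs z hz), gq_sq hZ h0, ← Finset.mul_prod_erase Z _ he]
      have : ∏ e ∈ Z.erase e, ((z - D.pos (D.t e)) / (z - D.pos (D.s e))) ≠ 0 :=
        Finset.prod_ne_zero_iff.2 (fun e _ => div_ne_zero (pne h0 _) (pne h0 _))
      rw [one_mul, mul_assoc, mul_inv_cancel₀ this, mul_one]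
    have arcU : ∀ z, z ≠ D.pos (D.s e) → z ≠ D.pos (D.t e) → z ∈ range (D.γ e) → z ∈ D.Ue e := by
      rintro _ h1 h2 ⟨τ, rfl⟩
      rcases io τ with rfl | rfl | h3
      · exact absurd (D.g0 e) h1
      · exact absurd (D.g1 e) h2
      · exact Ue_arc h3
    have hab : D.pos (D.s e) ≠ D.pos (D.t e) := fun h => st e (D.pinj h)
    refine nosqrt hab (M := fun z => if z ∈ D.Ue e then N z else Complex.exp (D.Le e z / 2)) ?_ ?_
    · rintro z ⟨h1, h2⟩
      apply ContinuousAt.continuousWithinAt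
      by_cases hz : z ∈ range (D.γ e)
      · have hzU := arcU z h1 h2 hz
        have hnh := hUo.mem_nhds hzU
        refine (hNc.continuousAt hnh).congr ?_
        filter_upwards [hnh] with w hw
        simp [hw]
      · have hnh : (range (D.γ e))ᶜ ∈ 𝓝 z := (range_closed _).isOpen_compl.mem_nhds hz
        have : ContinuousAt (fun z => Complex.exp (D.Le e z / 2)) z :=
          (Complex.continuous_exp.comp_continuousOn ((Le_c e).div_const 2)).continuousAt hnh
        refine this.congr ?_
        filter_upwards [hnh] with w hw
        split_ifs with h
        · exact (hNL w h hw).symm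
        · rfl
    · intro z h1 h2
      split_ifs with h
      · exact hN2 z h
      · rw [half_sq, Le_e e (fun hh => h (arcU z h1 h2 hh))]

theorem sep {Z : Finset E} {e : E} (he : e ∈ Z) (hcn : ¬ D.toGr.Cn (Z.erase e) (D.s e) (D.t e)) {p q : ℂ}
    (hp : p ∉ D.KZ Z) (hq : q ∉ D.KZ Z) (hpq : q ∈ cc (D.KZ (Z.erase e)) p) : q ∈ cc (D.KZ Z) p := by
  have hKe := KZ_erase (D := D) he
  have hp' : p ∉ D.KZ (Z.erase e) := fun h => hp (by rw [hKe]; exact Or.inl h)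
  obtain ⟨u, hu, hu'⟩ := cc_log (KZ_closed _) hp' hpq
  have rg : range (D.γ e) ⊆ D.KZ Z := by rw [hKe]; exact subset_union_right
  have hpr : p ∉ range (D.γ e) := fun h => hp (rg h)
  have hqr : q ∉ range (D.γ e) := fun h => hq (rg h)
  obtain ⟨l, hl, hl0, hl1⟩ := defect (K0 := D.KZ (Z.erase e)) (D.γ e) (f := fun z => (z - p) / (z - q))
    (quot_ok hpr hqr).1 (quot_ok hpr hqr).2 (hu' _ (g0_mem _ e))
  obtain ⟨n, hn⟩ := hl1 (hu' _ (g1_mem _ e))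
  set X : Set V := {v | D.toGr.Cn (Z.erase e) v (D.t e)} with hX
  have hXe : ∀ e' ∈ Z.erase e, (D.s e' ∈ X ↔ D.t e' ∈ X) := by
    intro e' he'
    have := Gr.cn_edge (g := D.toGr) he'
    exact ⟨fun h => this.symm.trans h, fun h => this.trans h⟩
  set Q : Set V → Set ℂ := fun Y => D.pos '' Y ∪ ⋃ e' ∈ {e' | e' ∈ Z.erase e ∧ D.s e' ∈ Y}, range (D.γ e') with hQ
  have Qc : ∀ Y, IsClosed (Q Y) := by
    intro Y
    apply IsClosed.union
    · exact (Set.toFinite _).isClosed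
    · exact (Set.toFinite _).isClosed_biUnion (fun e _ => range_closed _)
  have Qm : ∀ Y z, z ∈ Q Y ↔ (∃ v ∈ Y, D.pos v = z) ∨ ∃ e' ∈ Z.erase e, D.s e' ∈ Y ∧ ∃ τ, D.γ e' τ = z := by
    intro Y z; simp [hQ, and_assoc]
  have QU : D.KZ (Z.erase e) = Q X ∪ Q Xᶜ := by
    ext z
    rw [mem_union, Qm, Qm, mem_KZ]
    constructor
    · rintro (⟨v, h⟩ | ⟨e', he', h⟩)
      · by_cases hv : v ∈ X
        · exact Or.inl (Or.inl ⟨v, hv, h⟩)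
        · exact Or.inr (Or.inl ⟨v, hv, h⟩)
      · by_cases hv : D.s e' ∈ X
        · exact Or.inl (Or.inr ⟨e', he', hv, h⟩)
        · exact Or.inr (Or.inr ⟨e', he', hv, h⟩)
    · rintro ((⟨v, -, h⟩ | ⟨e', he', -, h⟩) | (⟨v, -, h⟩ | ⟨e', he', -, h⟩))
      · exact Or.inl ⟨v, h⟩
      · exact Or.inr ⟨e', he', h⟩
      · exact Or.inl ⟨v, h⟩
      · exact Or.inr ⟨e', he', h⟩
  -- a point of an edge is a vertex on its side or an interior point
  have Qn : ∀ Y : Set V, (∀ e' ∈ Z.erase e, (D.s e' ∈ Y ↔ D.t e' ∈ Y)) → ∀ z ∈ Q Y, (∃ v ∈ Y, D.pos v = z) ∨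
      ∃ e' ∈ Z.erase e, D.s e' ∈ Y ∧ ∃ τ ∈ Ioo (0 : I) 1, D.γ e' τ = z := by
    intro Y hY z hz
    rcases (Qm Y z).1 hz with h | ⟨e', he', hs, τ, h⟩
    · exact Or.inl h
    · rcases io τ with rfl | rfl | h3
      · rw [D.g0] at h; exact Or.inl ⟨_, hs, h⟩
      · rw [D.g1] at h; exact Or.inl ⟨_, (hY e' he').1 hs, h⟩
      · exact Or.inr ⟨e', he', hs, τ, h3, h⟩
  have Qd : ∀ z, z ∈ Q X → z ∈ Q Xᶜ → False := by
    intro z h1 h2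
    rcases Qn X hXe z h1 with ⟨v, hv, e1⟩ | ⟨a, ha, ha', τ, hτ, e1⟩ <;>
    rcases Qn Xᶜ (fun e' he' => not_congr (hXe e' he')) z h2 with ⟨w, hw, e2⟩ | ⟨b, hb, hb', τ', hτ', e2⟩
    · exact hw (D.pinj (e1.trans e2.symm) ▸ hv)
    · exact D.gv b τ' v hτ' (e2.trans e1.symm)
    · exact D.gv a τ w hτ (e1.trans e2.symm)
    · refine D.gd a b τ τ' ?_ hτ hτ' (e1.trans e2.symm)
      rintro rfl; exact hb' ha'
  set u1 : ℂ → ℂ := fun z => if z ∈ Q X then u z + n * (2 * Real.pi * Complex.I) else u z with hu1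
  have hu1c : ContinuousOn u1 (D.KZ (Z.erase e)) := by
    rw [QU]
    rw [QU] at hu
    apply ContinuousOn.union_of_isClosed _ _ (Qc _) (Qc _)
    · apply ((hu.mono subset_union_left).add_const (n * (2 * Real.pi * Complex.I))).congr
      intro z hz; simp [hu1, hz]
    · apply (hu.mono subset_union_right).congr
      intro z hz
      have : z ∉ Q X := fun h => Qd z h hz
      simp [hu1, this]
  have hu1e : ∀ z ∈ D.KZ (Z.erase e), Complex.exp (u1 z) = (z - p) / (z - q) := by
    intro z hz
    simp only [hu1]
    split_ifs
    · rw [Complex.exp_add, Complex.exp_int_mul_two_pi_mul_I, mul_one, hu' z hz]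
    · exact hu' z hz
  have hs : D.pos (D.s e) ∉ Q X := by
    intro h
    refine Qd _ h ((Qm _ _).2 (Or.inl ⟨D.s e, hcn, rfl⟩))
  have ht : D.pos (D.t e) ∈ Q X := (Qm _ _).2 (Or.inl ⟨D.t e, Gr.Cn.refl _ _, rfl⟩)
  obtain ⟨w, hw, hw1, hw2⟩ := glue (KZ_closed (Z.erase e)) (D.γ e) (D.ginj e) hu1c l (by
    intro τ hτ
    rcases io τ with rfl | rfl | h3
    · rw [hl0]; simp only [hu1, D.g0, if_neg hs]
    · rw [hn]; simp only [hu1, D.g1, if_pos ht]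
    · exact absurd hτ (arc_nin (by simp) h3))
  rw [hKe] at hp hq ⊢
  refine cc_of_log ((KZ_closed _).union (range_closed _)) ((KZ_bdd _).union (range_comp_bdd _)) hp hq hw ?_
  rintro z (hz | ⟨τ, rfl⟩)
  · rw [hw1 z hz, hu1e z hz]
  · rw [hw2, hl]

theorem d_forest (R : Set D.FF) (h : ∀ W ⊆ D.J R, D.toGr.Ev W → W = ∅) : D.J R = ∅ := by
  by_contra hne
  obtain ⟨e, he⟩ := Finset.nonempty_iff_ne_empty.2 hne
  have hcn : ¬ D.toGr.Cn ((D.J R).erase e) (D.s e) (D.t e) := by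
    rintro ⟨P, hP, hod⟩
    have h1 : D.toGr.Ev (P ∆ {e}) := by
      unfold Gr.Ev
      rw [Gr.dg_symm, Gr.dg_single, hod, z2]
    have h2 := h (P ∆ {e}) (by
      intro x hx
      rcases Finset.mem_symmDiff.1 hx with h | h
      · exact Finset.mem_of_mem_erase (hP h.1)
      · rw [Finset.mem_singleton.1 h.1]; exact he) h1
    have h3 : e ∈ P ∆ {e} := Finset.mem_symmDiff.2 (Or.inr ⟨by simp, fun hh => by simpa using hP hh⟩)
    rw [h2] at h3; simp at h3
  obtain ⟨p, hp⟩ := ff_ne (D.fl e)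
  obtain ⟨q, hq⟩ := ff_ne (D.fr e)
  have up : p ∈ D.Ue e := Ue_of_adj (adj_iff.2 (Or.inl rfl)) hp
  have uq : q ∈ D.Ue e := Ue_of_adj (adj_iff.2 (Or.inr rfl)) hq
  have hsub : D.KZ ((D.J R).erase e) ⊆ D.KZ (Finset.univ.erase e) :=
    KZ_mono (Finset.erase_subset_erase _ (Finset.subset_univ _))
  have hpq : q ∈ cc (D.KZ ((D.J R).erase e)) p := by
    unfold Ue at up uq
    rw [cc_eq up] at uq
    exact connectedComponentIn_mono _ (compl_subset_compl.2 hsub) uq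
  have hpK : p ∉ D.KZ (D.J R) := K_of_KZ (ff_sub _ _ hp)
  have := sep he hcn hpK (K_of_KZ (ff_sub _ _ hq)) hpq
  have hS := cc_pre (K := D.KZ (D.J R)) p
  rw [mem_J] at he
  by_cases hl : D.fl e ∈ R
  · have hr : D.fr e ∉ R := fun h => he ⟨fun _ => h, fun _ => hl⟩
    exact side (fun e h => nmem_J h) hS (fun z hz => cc_sub _ hz) hl hr ⟨p, cc_mem hpK, hp⟩ ⟨q, this, hq⟩
  · have hr : D.fr e ∈ R := by by_contra h; exact he ⟨fun h' => absurd h' hl, fun h' => absurd h' h⟩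
    exact side (fun e h => nmem_J h) hS (fun z hz => cc_sub _ hz) hr hl ⟨q, this, hq⟩ ⟨p, cc_mem hpK, hp⟩

theorem d_even (R : Set D.FF) : D.toGr.Ev (D.J R) := by
  obtain ⟨Y, hY, hmax⟩ := Finset.exists_max_image ((D.J R).powerset.filter (fun Y => D.toGr.Ev Y)) Finset.card
    ⟨∅, by simp [Gr.ev_empty]⟩
  simp only [Finset.mem_filter, Finset.mem_powerset] at hY hmax
  obtain ⟨R', hR'⟩ := d_exists (D := D) Y hY.2
  have hJ : D.J (R ∆ R') = D.J R \ Y := by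
    rw [J_sd, hR']
    ext x; simp only [Finset.mem_symmDiff, Finset.mem_sdiff]
    have hyx : x ∈ Y → x ∈ D.J R := fun h => hY.1 h
    clear * - hyx
    tauto
  have h0 := d_forest (R ∆ R') (by
    intro W hW hev
    rw [hJ] at hW
    have hd : Disjoint Y W := by
      rw [Finset.disjoint_left]; intro x hx hx'; exact (Finset.mem_sdiff.1 (hW hx')).2 hx
    have := hmax (Y ∆ W) ⟨by
      intro x hx
      rcases Finset.mem_symmDiff.1 hx with h | h
      · exact hY.1 h.1
      · exact (Finset.mem_sdiff.1 (hW h.1)).1, hY.2.sd hev⟩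
    have hdu : Y ∆ W = Y ∪ W := by
      ext x; simp only [Finset.mem_symmDiff, Finset.mem_union]
      have hyx : x ∈ Y → x ∉ W := fun h => Finset.disjoint_left.1 hd h
      clear * - hyx
      tauto
    rw [hdu, Finset.card_union_of_disjoint hd] at this
    exact Finset.card_eq_zero.1 (by omega))
  rw [hJ, Finset.sdiff_eq_empty_iff_subset] at h0
  rw [h0.antisymm hY.1]
  exact hY.2

variable (D)
def pm : PM V E where
  toGr := D.toGr
  A := Finset.univ
  F := D.FF
  fF := @Fintype.ofFinite _ ff_finite
  l := D.fl
  r := D.fr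
  even_bd := d_even
  exists_bd := fun Z _ h => d_exists Z h
  conn := d_conn

end Dr
end CF

end

open Set Topology

noncomputable section
namespace CF
set_option linter.all false
open scoped Classical symmDiff unitInterval

section ext
variable {X : Type} [MetricSpace X] [ProperSpace X]

def rv : Ioo (0:ℝ) 1 ≃ₜ Ioo (0:ℝ) 1 where
  toFun t := ⟨1 - t.1, by have := t.2.1; have := t.2.2; constructor <;> linarith⟩
  invFun t := ⟨1 - t.1, by have := t.2.1; have := t.2.2; constructor <;> linarith⟩
  left_inv t := by ext; simp
  right_inv t := by ext; simp
  continuous_toFun := by fun_prop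
  continuous_invFun := by fun_prop

def Clu {A : Set X} (h : Ioo (0:ℝ) 1 ≃ₜ A) (a : X) : Prop :=
  ∀ ε > 0, ∀ δ > 0, ∃ t : Ioo (0:ℝ) 1, t.1 < δ ∧ dist (h t).1 a < ε

def Lm {A : Set X} (h : Ioo (0:ℝ) 1 ≃ₜ A) (a : X) : Prop :=
  ∀ ε > 0, ∃ δ > 0, ∀ t : Ioo (0:ℝ) 1, t.1 < δ → dist (h t).1 a < ε

theorem clu_lm {A : Set X} {h : Ioo (0:ℝ) 1 ≃ₜ A} {a b : X} (hab : a ≠ b)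
    (hA : closure A = A ∪ {a, b}) (hc : Clu h a) : Lm h a := by
  intro ε' hε'
  set ε := min ε' (dist a b / 2) with hε
  have hd : 0 < dist a b := dist_pos.2 hab
  have h0 : 0 < ε := lt_min hε' (by linarith)
  have hQ : IsCompact (Metric.sphere a ε ∩ closure A) :=
    (isCompact_sphere a ε).inter_right isClosed_closure
  have hQA : Metric.sphere a ε ∩ closure A ⊆ A := by
    rintro x ⟨h1, h2⟩
    rw [hA] at h2
    rcases h2 with h2 | h2 | h2
    · exact h2
    · subst h2; rw [Metric.mem_sphere, dist_self] at h1; exact absurd h1 h0.ne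
    · rw [mem_singleton_iff] at h2; subst h2; rw [Metric.mem_sphere, dist_comm] at h1
      have := min_le_right ε' (dist a x / 2)
      rw [← hε] at this; linarith
  have hQ2 : IsCompact ((Subtype.val : A → X) ⁻¹' (Metric.sphere a ε ∩ closure A)) := by
    rw [Topology.IsInducing.subtypeVal.isCompact_preimage_iff (by simpa using hQA)]
    exact hQ
  have hQ3 := hQ2.image h.symm.continuous
  have hQ4 := hQ3.image continuous_subtype_val
  set Q := (Subtype.val '' (h.symm '' ((Subtype.val : A → X) ⁻¹' (Metric.sphere a ε ∩ closure A))) : Set ℝ) with hQd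
  have hn : (0:ℝ) ∉ Q := by
    rintro ⟨t, -, ht⟩
    exact t.2.1.ne ht.symm
  obtain ⟨δ, hδ, hδ'⟩ := Metric.isOpen_iff.1 hQ4.isClosed.isOpen_compl 0 hn
  have key : ∀ t : Ioo (0:ℝ) 1, t.1 < δ → dist (h t).1 a ≠ ε := by
    intro t ht hh
    have : t.1 ∈ Qᶜ := hδ' (by rw [Metric.mem_ball, Real.dist_eq, sub_zero, abs_of_pos t.2.1]; exact ht)
    exact this ⟨t, ⟨h t, ⟨hh, subset_closure (h t).2⟩, by simp⟩, rfl⟩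
  refine ⟨δ, hδ, fun t ht => lt_of_lt_of_le (b := ε) ?_ (min_le_left _ _)⟩
  by_contra hcon
  have hgt : ε < dist (h t).1 a := lt_of_le_of_ne (not_lt.1 hcon) (key t ht).symm
  obtain ⟨t', ht', hlt⟩ := hc ε h0 δ hδ
  have hpre : IsPreconnected {t : Ioo (0:ℝ) 1 | t.1 < δ} := by
    rw [← Topology.IsInducing.subtypeVal.isPreconnected_image]
    have : Subtype.val '' {t : Ioo (0:ℝ) 1 | t.1 < δ} = Ioo 0 (min 1 δ) := by
      ext x; constructor
      · rintro ⟨t, ht, rfl⟩; exact ⟨t.2.1, lt_min t.2.2 ht⟩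
      · intro hx
        exact ⟨⟨x, hx.1, hx.2.trans_le (min_le_left _ _)⟩, hx.2.trans_le (min_le_right _ _), rfl⟩
    rw [this]; exact isPreconnected_Ioo
  have hcont : ContinuousOn (fun t : Ioo (0:ℝ) 1 => dist (h t).1 a) {t : Ioo (0:ℝ) 1 | t.1 < δ} := by
    have : Continuous fun t : Ioo (0:ℝ) 1 => (h t).1 := continuous_subtype_val.comp h.continuous
    fun_prop
  obtain ⟨z, hz, hz'⟩ := hpre.intermediate_value ht' ht hcont ⟨hlt.le, hgt.le⟩
  exact key z hz hz'

theorem clu_or {A : Set X} (h : Ioo (0:ℝ) 1 ≃ₜ A) {a : X} (ha : a ∈ closure A) (ha' : a ∉ A) :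
    Clu h a ∨ Clu (rv.trans h) a := by
  by_contra hcon
  simp only [Clu] at hcon
  push Not at hcon
  obtain ⟨⟨ε1, h1, δ1, d1, k1⟩, ⟨ε2, h2, δ2, d2, k2⟩⟩ := hcon
  have hM : IsCompact {t : Ioo (0:ℝ) 1 | δ1 ≤ t.1 ∧ t.1 ≤ 1 - δ2} := by
    rw [Topology.IsEmbedding.subtypeVal.isCompact_iff]
    have : (Subtype.val '' {t : Ioo (0:ℝ) 1 | δ1 ≤ t.1 ∧ t.1 ≤ 1 - δ2}) = Icc δ1 (1 - δ2) := by
      ext x; constructor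
      · rintro ⟨t, ht, rfl⟩; exact ht
      · intro hx; exact ⟨⟨x, by linarith [hx.1], by linarith [hx.2]⟩, hx, rfl⟩
    rw [this]; exact isCompact_Icc
  have hc : Continuous fun t : Ioo (0:ℝ) 1 => (h t).1 := continuous_subtype_val.comp h.continuous
  have hM2 := (hM.image hc).isClosed
  have hsub : A ⊆ ({x | ε1 ≤ dist x a} ∪ {x | ε2 ≤ dist x a}) ∪
      ((fun t : Ioo (0:ℝ) 1 => (h t).1) '' {t : Ioo (0:ℝ) 1 | δ1 ≤ t.1 ∧ t.1 ≤ 1 - δ2}) := by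
    intro x hx
    obtain ⟨t, ht⟩ := h.surjective ⟨x, hx⟩
    have hx' : (h t).1 = x := by rw [ht]
    by_cases c1 : t.1 < δ1
    · left; left; rw [← hx']; exact k1 t c1
    by_cases c2 : 1 - δ2 < t.1
    · left; right
      have := k2 (rv t) (by show 1 - t.1 < δ2; linarith)
      have e : rv (rv t) = t := rv.left_inv t
      rw [← hx']; simpa [e] using this
    · right; exact ⟨t, ⟨not_lt.1 c1, not_lt.1 c2⟩, hx'⟩
  have hcl : IsClosed (({x | ε1 ≤ dist x a} ∪ {x | ε2 ≤ dist x a}) ∪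
      ((fun t : Ioo (0:ℝ) 1 => (h t).1) '' {t : Ioo (0:ℝ) 1 | δ1 ≤ t.1 ∧ t.1 ≤ 1 - δ2})) :=
    ((isClosed_le continuous_const (by fun_prop)).union (isClosed_le continuous_const (by fun_prop))).union hM2
  rcases closure_minimal hsub hcl ha with (h' | h') | ⟨t, _, h'⟩
  · simp at h'; linarith
  · simp at h'; linarith
  · exact ha' (h' ▸ (h t).2)

theorem lm_uniq {A : Set X} {h : Ioo (0:ℝ) 1 ≃ₜ A} {a b : X} (ha : Lm h a) (hb : Lm h b) : a = b := by
  by_contra hab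
  have hd : 0 < dist a b := dist_pos.2 hab
  obtain ⟨δ1, d1, k1⟩ := ha (dist a b / 2) (by linarith)
  obtain ⟨δ2, d2, k2⟩ := hb (dist a b / 2) (by linarith)
  set t : ℝ := min (min δ1 δ2) 1 / 2 with ht
  have hp : 0 < min (min δ1 δ2) 1 := lt_min (lt_min d1 d2) one_pos
  have l1 : min (min δ1 δ2) 1 ≤ δ1 := (min_le_left _ _).trans (min_le_left _ _)
  have l2 : min (min δ1 δ2) 1 ≤ δ2 := (min_le_left _ _).trans (min_le_right _ _)
  have l3 : min (min δ1 δ2) 1 ≤ 1 := min_le_right _ _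
  have e1 := k1 ⟨t, by linarith, by linarith⟩ (by show t < δ1; linarith)
  have e2 := k2 ⟨t, by linarith, by linarith⟩ (by show t < δ2; linarith)
  have := dist_triangle_left a b (h ⟨t, by linarith, by linarith⟩).1
  linarith

theorem mk_path {A : Set X} (h : Ioo (0:ℝ) 1 ≃ₜ A) {a b : X} (hab : a ≠ b) (ha : a ∉ A) (hb : b ∉ A)
    (l0 : Lm h a) (l1 : Lm (rv.trans h) b) :
    ∃ g : C(I, X), Function.Injective g ∧ g 0 = a ∧ g 1 = b ∧ g '' Ioo 0 1 = A := by
  set H : ℝ → X := fun t => if ht : t ∈ Ioo (0:ℝ) 1 then (h ⟨t, ht⟩).1 else a with hH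
  have hin : ∀ t (ht : t ∈ Ioo (0:ℝ) 1), H t = (h ⟨t, ht⟩).1 := fun t ht => dif_pos ht
  have hc : ContinuousOn H (Ioo 0 1) := by
    rw [continuousOn_iff_continuous_restrict]
    have : (Ioo (0:ℝ) 1).domRestrict H = fun t => (h t).1 := by
      funext t; exact hin t.1 t.2
    rw [this]; exact continuous_subtype_val.comp h.continuous
  have t0 : Filter.Tendsto H (𝓝[>] 0) (𝓝 a) := by
    rw [Metric.tendsto_nhds]
    intro ε hε
    obtain ⟨δ, hδ, k⟩ := l0 ε hε
    filter_upwards [Ioo_mem_nhdsGT (show (0:ℝ) < min δ 1 from lt_min hδ one_pos)] with t ht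
    have h1 : t ∈ Ioo (0:ℝ) 1 := ⟨ht.1, ht.2.trans_le (min_le_right _ _)⟩
    rw [hin t h1]; exact k _ (ht.2.trans_le (min_le_left _ _))
  have t1 : Filter.Tendsto H (𝓝[<] 1) (𝓝 b) := by
    rw [Metric.tendsto_nhds]
    intro ε hε
    obtain ⟨δ, hδ, k⟩ := l1 ε hε
    filter_upwards [Ioo_mem_nhdsLT (show 1 - min δ 1 < (1:ℝ) by have := lt_min hδ one_pos; linarith)] with t ht
    have m1 := min_le_left δ 1
    have m2 := min_le_right δ 1
    have h1 : t ∈ Ioo (0:ℝ) 1 := ⟨by linarith [ht.1], ht.2⟩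
    have e : rv (rv ⟨t, h1⟩) = ⟨t, h1⟩ := rv.left_inv _
    have := k (rv ⟨t, h1⟩) (by show 1 - t < δ; linarith [ht.1])
    rw [hin t h1]; simpa [e] using this
  have hC := continuousOn_Icc_extendFrom_Ioo hc t0 t1
  set g := extendFrom (Ioo 0 1) H with hg
  have g0 : g 0 = a := eq_lim_at_left_extendFrom_Ioo one_pos t0
  have g1 : g 1 = b := eq_lim_at_right_extendFrom_Ioo one_pos t1
  have gi : ∀ t (ht : t ∈ Ioo (0:ℝ) 1), g t = (h ⟨t, ht⟩).1 := by
    intro t ht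
    rw [← hin t ht]
    exact extendFrom_eq (subset_closure ht) (hc t ht)
  have hA : ∀ t (ht : t ∈ Ioo (0:ℝ) 1), g t ∈ A := fun t ht => by rw [gi t ht]; exact (h _).2
  have cases3 : ∀ t : I, t = 0 ∨ t = 1 ∨ t.1 ∈ Ioo (0:ℝ) 1 := by
    intro t
    rcases t.2.1.eq_or_lt with h | h
    · left; exact Subtype.ext h.symm
    rcases t.2.2.eq_or_lt with h' | h'
    · right; left; exact Subtype.ext h'
    · exact Or.inr (Or.inr ⟨h, h'⟩)
  refine ⟨⟨fun t => g t.1, continuousOn_iff_continuous_restrict.1 hC⟩, ?_, g0, g1, ?_⟩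
  · intro x y hxy
    have hxy : g x.1 = g y.1 := hxy
    rcases cases3 x with rfl | rfl | hx <;> rcases cases3 y with rfl | rfl | hy
    · rfl
    · exact absurd (g0.symm.trans (hxy.trans g1)) hab
    · exact absurd (by rw [← g0]; exact hxy ▸ hA _ hy) ha
    · exact absurd (g0.symm.trans (hxy.symm.trans g1)) hab
    · rfl
    · exact absurd (by rw [← g1]; exact hxy ▸ hA _ hy) hb
    · exact absurd (by rw [← g0]; exact hxy ▸ hA _ hx) ha
    · exact absurd (by rw [← g1]; exact hxy ▸ hA _ hx) hb
    · rw [gi _ hx, gi _ hy] at hxy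
      have := h.injective (Subtype.ext hxy)
      exact Subtype.ext (Subtype.mk.inj this)
  · ext x; constructor
    · rintro ⟨t, ht, rfl⟩; exact hA _ ⟨Subtype.coe_lt_coe.2 ht.1, Subtype.coe_lt_coe.2 ht.2⟩
    · intro hx
      obtain ⟨t, ht⟩ := h.surjective ⟨x, hx⟩
      refine ⟨⟨t.1, t.2.1.le, t.2.2.le⟩, ⟨Subtype.coe_lt_coe.1 t.2.1, Subtype.coe_lt_coe.1 t.2.2⟩, ?_⟩
      show g t.1 = x
      rw [gi t.1 t.2]; rw [show (⟨t.1, t.2⟩ : Ioo (0:ℝ) 1) = t from rfl, ht]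

theorem arc_path {A : Set X} (hA : IsArc A) {a b : X} (hab : a ≠ b) (ha : a ∉ A) (hb : b ∉ A)
    (hc : closure A = A ∪ {a, b}) :
    ∃ g : C(I, X), Function.Injective g ∧ g 0 = a ∧ g 1 = b ∧ g '' Ioo 0 1 = A := by
  obtain ⟨h⟩ := hA
  have hc' : closure A = A ∪ {b, a} := by rw [hc, pair_comm]
  have aa : a ∈ closure A := by rw [hc]; simp
  have bb : b ∈ closure A := by rw [hc]; simp
  have hrr : rv.trans (rv.trans h) = h := by
    ext t
    show ((h (rv (rv t))).1) = _
    rw [show rv (rv t) = t from rv.left_inv t]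
  rcases clu_or h aa ha with h1 | h1
  · have k1 := clu_lm hab hc h1
    rcases clu_or h bb hb with h2 | h2
    · exact absurd (lm_uniq k1 (clu_lm hab.symm hc' h2)) hab
    · exact mk_path h hab ha hb k1 (clu_lm hab.symm hc' h2)
  · have k1 := clu_lm hab hc h1
    rcases clu_or h bb hb with h2 | h2
    · exact mk_path (rv.trans h) hab ha hb k1 (by rw [hrr]; exact clu_lm hab.symm hc' h2)
    · exact absurd (lm_uniq k1 (clu_lm hab.symm hc' h2)) hab
end ext
end CF

end

open Set Topology

noncomputable section
namespace CF
set_option linter.all false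
open scoped Classical symmDiff unitInterval

def toC : Plane ≃L[ℝ] ℂ := Complex.equivRealProdCLM.symm

theorem toC_bdd {f : Set ℂ} : Bornology.IsBounded (toC ⁻¹' f) ↔ Bornology.IsBounded f := by
  constructor
  · intro h
    have := toC.lipschitz.isBounded_image h
    rwa [image_preimage_eq f toC.surjective] at this
  · intro h
    have := toC.symm.lipschitz.isBounded_image h
    rwa [ContinuousLinearEquiv.image_symm_eq_preimage] at this

theorem transport {V : Type} [Fintype V] {G : SimpleGraph V} [Fintype G.edgeSet] (d : Drawing G Plane) :
    ∃ D : Dr V G.edgeSet, (∀ e, e.1 = s(D.s e, D.t e)) ∧ ∃ F : D.FF → Set Plane,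
      Function.Injective F ∧ (∀ f, d.IsFace f ↔ ∃ g, F g = f) ∧
      (∀ g e, d.emap e ⊆ frontier (F g) ↔ Dr.adj g e) ∧
      (∀ g g', ¬ Bornology.IsBounded (F g) → ¬ Bornology.IsBounded (F g') → g = g') := by
  have key : ∀ e : G.edgeSet, ∃ u w : V, e.1 = s(u, w) ∧ ∃ g : C(I, ℂ), Function.Injective g ∧
      g 0 = toC (d.vmap u) ∧ g 1 = toC (d.vmap w) ∧ g '' Ioo 0 1 = toC '' d.emap e := by
    rintro ⟨e, he⟩
    induction e using Sym2.ind with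
    | _ u w =>
      have hne : u ≠ w := G.ne_of_adj he
      obtain ⟨g, h1, h2, h3, h4⟩ := arc_path (d.arc ⟨s(u, w), he⟩) (d.vinj.ne hne) (d.vertex_notin _ u)
        (d.vertex_notin _ w) (d.closure_emap _ u w rfl)
      refine ⟨u, w, rfl, ⟨fun t => toC (g t), toC.continuous.comp g.continuous⟩, ?_, ?_, ?_, ?_⟩
      · exact toC.injective.comp h1
      · exact congrArg toC h2
      · exact congrArg toC h3
      · rw [← h4, ← image_comp]; rfl
  choose s t hst g gi g0 g1 gA using key
  have mA : ∀ e τ, τ ∈ Ioo (0:I) 1 → ∃ p ∈ d.emap e, toC p = g e τ := by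
    intro e τ hτ
    have : g e τ ∈ g e '' Ioo 0 1 := mem_image_of_mem _ hτ
    rw [gA] at this; exact this
  let D : Dr V G.edgeSet :=
    { s := s, t := t, pos := fun v => toC (d.vmap v), γ := g
      pinj := toC.injective.comp d.vinj
      ginj := gi, g0 := g0, g1 := g1
      gv := by
        intro e τ v hτ h
        obtain ⟨p, hp, hp'⟩ := mA e τ hτ
        rw [← hp'] at h
        exact d.vertex_notin e v (toC.injective h ▸ hp)
      gd := by
        intro e e' τ τ' hne hτ hτ' h
        obtain ⟨p, hp, hp'⟩ := mA e τ hτ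
        obtain ⟨q, hq, hq'⟩ := mA e' τ' hτ'
        rw [← hp', ← hq'] at h
        have : p ∈ d.emap e ∩ d.emap e' := ⟨hp, toC.injective h ▸ hq⟩
        rw [d.edges_disj e e' hne] at this; exact this }
  have hK : toC ⁻¹' D.K = d.image := by
    ext p
    rw [mem_preimage, Dr.K, Dr.mem_KZ, MDrawing.image, mem_union, mem_iUnion]
    constructor
    · rintro (⟨v, hv⟩ | ⟨e, -, τ, hτ⟩)
      · exact Or.inl ⟨v, toC.injective hv⟩
      · rcases Dr.io τ with rfl | rfl | h
        · exact Or.inl ⟨s e, toC.injective ((g0 e).symm.trans hτ)⟩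
        · exact Or.inl ⟨t e, toC.injective ((g1 e).symm.trans hτ)⟩
        · obtain ⟨q, hq, hq'⟩ := mA e τ h
          exact Or.inr ⟨e, toC.injective (hq'.trans hτ) ▸ hq⟩
    · rintro (⟨v, hv⟩ | ⟨e, he⟩)
      · exact Or.inl ⟨v, congrArg toC hv⟩
      · have : toC p ∈ toC '' d.emap e := mem_image_of_mem _ he
        rw [← gA] at this
        obtain ⟨τ, -, hτ⟩ := this
        exact Or.inr ⟨e, Finset.mem_univ _, τ, hτ⟩
  have hK' : toC '' (d.image)ᶜ = D.Kᶜ := by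
    rw [← hK, ← preimage_compl, image_preimage_eq _ toC.surjective]
  have hcc : ∀ x, x ∉ d.image → toC ⁻¹' (cc D.K (toC x)) = connectedComponentIn (d.image)ᶜ x := by
    intro x hx
    have := toC.toHomeomorph.image_connectedComponentIn (s := (d.image)ᶜ) hx
    rw [cc, ← hK']
    have h2 : toC '' (connectedComponentIn (d.image)ᶜ x) = connectedComponentIn (toC '' (d.image)ᶜ) (toC x) := this
    rw [← h2, preimage_image_eq _ toC.injective]
  refine ⟨D, hst, fun f => toC ⁻¹' f.1, ?_, ?_, ?_, ?_⟩
  · intro f f' h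
    exact Subtype.ext (toC.surjective.preimage_injective h)
  · intro f
    constructor
    · rintro ⟨x, hx, rfl⟩
      have hx' : toC x ∉ D.K := by
        intro h; apply hx; rw [← hK]; exact h
      exact ⟨⟨cc D.K (toC x), toC x, hx', rfl⟩, hcc x hx⟩
    · rintro ⟨⟨f', y, hy, rfl⟩, rfl⟩
      obtain ⟨x, rfl⟩ := toC.surjective y
      have hx : x ∉ d.image := by rw [← hK]; exact hy
      exact ⟨x, hx, hcc x hx⟩
  · intro f e
    have hfr : frontier (toC ⁻¹' f.1) = toC ⁻¹' (closure f.1 \ f.1) := by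
      rw [← (Dr.ff_open f).frontier_eq]
      exact (toC.toHomeomorph.preimage_frontier f.1).symm
    show d.emap e ⊆ frontier (toC ⁻¹' f.1) ↔ _
    rw [hfr, ← image_subset_iff, ← gA, image_subset_iff]
    constructor
    · intro h τ hτ
      exact (h hτ).1
    · intro h τ hτ
      refine ⟨h τ hτ, fun h' => Dr.ff_sub f _ h' ?_⟩
      rw [Dr.K, Dr.mem_KZ]
      exact Or.inr ⟨e, Finset.mem_univ _, τ, rfl⟩
  · rintro ⟨f, x, hx, rfl⟩ ⟨f', x', hx', rfl⟩ h h'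
    apply Subtype.ext
    rw [toC_bdd] at h h'
    exact cc_unb (Dr.KZ_bdd _) h h'
end CF

end

open Set Topology

noncomputable section
namespace CF
set_option linter.all false
open scoped Classical symmDiff

section graph
variable {V : Type} [Fintype V] {G : SimpleGraph V} [Fintype G.edgeSet] {g : Gr V G.edgeSet}

theorem g_inc (hg : ∀ e, e.1 = s(g.s e, g.t e)) {e : G.edgeSet} {v : V} : g.inc e v ↔ v ∈ e.1 := by
  rw [hg e, Sym2.mem_iff, Gr.inc]
  constructor <;> rintro (h | h) <;> simp [h]

theorem g_nl (hg : ∀ e, e.1 = s(g.s e, g.t e)) (B) : g.NL B := by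
  intro e _ h
  have h2 := e.2
  rw [hg e, h] at h2
  exact G.ne_of_adj h2 rfl

theorem g_two (hg : ∀ e, e.1 = s(g.s e, g.t e)) {Z : Finset G.edgeSet} (hZ : g.Ev Z) {e : G.edgeSet}
    (he : e ∈ Z) {v : V} (hv : v ∈ e.1) : ∃ e' ∈ Z, e' ≠ e ∧ v ∈ e'.1 := by
  have h1 := Gr.ev_star (g_nl hg Z) hZ v
  have h2 : e ∈ g.star Z v := Gr.mem_star.2 ⟨he, (g_inc hg).2 hv⟩
  have h3 : 1 < (g.star Z v).card := by
    have := Finset.card_pos.2 ⟨e, h2⟩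
    obtain ⟨m, hm⟩ := h1; omega
  obtain ⟨e', h4, h5⟩ := Finset.exists_mem_ne h3 e
  exact ⟨e', (Gr.mem_star.1 h4).1, h5, (g_inc hg).1 (Gr.mem_star.1 h4).2⟩

theorem g_tf (hg : ∀ e, e.1 = s(g.s e, g.t e)) (hT : TriangleFree G) (A) : g.TF A := by
  intro Z _ hev hne
  by_contra hcard
  obtain ⟨e, he⟩ := Finset.nonempty_iff_ne_empty.2 hne
  obtain ⟨u, w, hw⟩ : ∃ u w, e.1 = s(u, w) := ⟨_, _, hg e⟩
  obtain ⟨e1, m1, n1, i1⟩ := g_two hg hev he (v := u) (by simp [hw])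
  obtain ⟨x, hx⟩ := Sym2.mem_iff_exists.1 i1
  obtain ⟨e2, m2, n2, i2⟩ := g_two hg hev he (v := w) (by simp [hw])
  obtain ⟨y, hy⟩ := Sym2.mem_iff_exists.1 i2
  obtain ⟨e3, m3, n3, i3⟩ := g_two hg hev m1 (v := x) (by simp [hx])
  have a0 : G.Adj u w := by have := e.2; rw [hw] at this; exact this
  have a1 : G.Adj u x := by have := e1.2; rw [hx] at this; exact this
  have a2 : G.Adj w y := by have := e2.2; rw [hy] at this; exact this
  have xw : x ≠ w := by
    rintro rfl; exact n1 (Subtype.ext (hx.trans hw.symm))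
  have e12 : e1 ≠ e2 := by
    rintro rfl
    rw [hx, Sym2.mem_iff] at i2
    rcases i2 with h | h
    · exact a0.ne h.symm
    · exact xw h.symm
  have e3e : e3 ≠ e := by
    rintro rfl
    rw [hw, Sym2.mem_iff] at i3
    rcases i3 with h | h
    · exact a1.ne h.symm
    · exact xw h
  have e32 : e3 = e2 := by
    by_contra h
    apply hcard
    have : ({e, e1, e2, e3} : Finset G.edgeSet) ⊆ Z := by
      intro z hz
      simp only [Finset.mem_insert, Finset.mem_singleton] at hz
      rcases hz with rfl | rfl | rfl | rfl <;> assumption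
    refine le_trans ?_ (Finset.card_le_card this)
    rw [Finset.card_insert_of_notMem, Finset.card_insert_of_notMem, Finset.card_pair (Ne.symm h)]
    · simp [e12, Ne.symm n3]
    · simp [Ne.symm n1, Ne.symm n2, Ne.symm e3e]
  subst e32
  rw [hy, Sym2.mem_iff] at i3
  have hxy : x = y := i3.resolve_left xw
  subst hxy
  obtain ⟨a, p, hp, hl⟩ := SimpleGraph.is3Clique_iff_exists_cycle_length_three.1
    ⟨{u, w, x}, SimpleGraph.is3Clique_triple_iff.2 ⟨a0, a1, a2⟩⟩
  exact hT a p hp hl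

def cyc {a : V} (w : G.Walk a a) : Finset G.edgeSet := Finset.univ.filter (fun e => e.1 ∈ w.edges)

theorem cyc_card {a : V} {w : G.Walk a a} (hw : w.IsCycle) : (cyc w).card = w.length := by
  rw [← SimpleGraph.Walk.length_edges, ← List.toFinset_card_of_nodup hw.isTrail.edges_nodup]
  rw [← Finset.card_map (Function.Embedding.subtype _)]
  congr 1
  ext e
  simp only [cyc, Finset.mem_map, Finset.mem_filter, Finset.mem_univ, true_and, List.mem_toFinset,
    Function.Embedding.subtype_apply]
  constructor
  · rintro ⟨e, h, rfl⟩; exact h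
  · intro h; exact ⟨⟨e, w.edges_subset_edgeSet h⟩, h, rfl⟩

theorem mem_cyc {a : V} {w : G.Walk a a} {e : G.edgeSet} : e ∈ cyc w ↔ e.1 ∈ w.edges := by simp [cyc]

theorem cyc_star (hg : ∀ e, e.1 = s(g.s e, g.t e)) {a : V} {w : G.Walk a a} (hw : w.IsCycle) (v : V) :
    (g.star (cyc w) v).card = if v ∈ w.support then 2 else 0 := by
  split_ifs with h
  · rw [← hw.ncard_neighborSet_toSubgraph_eq_two h, ← Set.ncard_coe_finset,
      ← Set.ncard_image_of_injective _ (Subtype.val_injective (p := (· ∈ G.edgeSet))),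
      ← Set.ncard_image_of_injective (w.toSubgraph.neighborSet v) (f := fun x => s(v, x))
        (fun x y h => Sym2.congr_right.1 h)]
    congr 1
    ext e
    constructor
    · rintro ⟨e, he, rfl⟩
      have he := Gr.mem_star.1 (Finset.mem_coe.1 he)
      obtain ⟨x, hx⟩ := Sym2.mem_iff_exists.1 ((g_inc hg).1 he.2)
      refine ⟨x, ?_, hx.symm⟩
      have := mem_cyc.1 he.1
      rw [hx] at this
      exact SimpleGraph.Walk.adj_toSubgraph_iff_mem_edges.2 this
    · rintro ⟨x, hx, rfl⟩
      have h1 := SimpleGraph.Walk.adj_toSubgraph_iff_mem_edges.1 hx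
      refine ⟨⟨s(v, x), w.edges_subset_edgeSet h1⟩, ?_, rfl⟩
      exact Gr.mem_star.2 ⟨mem_cyc.2 h1, (g_inc hg).2 (by simp)⟩
  · rw [Finset.card_eq_zero, Finset.eq_empty_iff_forall_notMem]
    intro e he
    have he := Gr.mem_star.1 he
    exact h (w.mem_support_of_mem_edges (mem_cyc.1 he.1) ((g_inc hg).1 he.2))

theorem cyc_circuit (hg : ∀ e, e.1 = s(g.s e, g.t e)) {a : V} {w : G.Walk a a} (hw : w.IsCycle) :
    g.Circuit (cyc w) := by
  refine ⟨Gr.ev_of_star (g_nl hg _) (fun v => ?_), ?_, ?_⟩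
  · rw [cyc_star hg hw]; split_ifs <;> simp
  · rw [← Finset.card_pos.trans Finset.nonempty_iff_ne_empty, cyc_card hw]
    have := hw.three_le_length; omega
  · intro W hW hev hne
    have full : ∀ v e, e ∈ W → v ∈ e.1 → ∀ e', e' ∈ cyc w → v ∈ e'.1 → e' ∈ W := by
      intro v e he hv e' he' hv'
      have h1 : g.star W v ⊆ g.star (cyc w) v := fun x hx =>
        Gr.mem_star.2 ⟨hW (Gr.mem_star.1 hx).1, (Gr.mem_star.1 hx).2⟩
      have h2 := cyc_star hg hw v
      have h3 := Gr.ev_star (g_nl hg W) hev v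
      have h4 := Finset.card_pos.2 ⟨e, Gr.mem_star.2 ⟨he, (g_inc hg).2 hv⟩⟩
      have h5 : (g.star (cyc w) v).card ≤ (g.star W v).card := by
        have : (g.star (cyc w) v).card ≤ 2 := by rw [h2]; split_ifs <;> simp
        obtain ⟨m, hm⟩ := h3; omega
      have h6 := Finset.eq_of_subset_of_card_le h1 h5
      have : e' ∈ g.star W v := by rw [h6]; exact Gr.mem_star.2 ⟨he', (g_inc hg).2 hv'⟩
      exact (Gr.mem_star.1 this).1
    have walk : ∀ {x y : V} (p : G.Walk x y), (∀ e ∈ p.edges, e ∈ w.edges) →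
        (∃ e ∈ W, x ∈ e.1) → ∀ e : G.edgeSet, e.1 ∈ p.edges → e ∈ W := by
      intro x y p
      induction p with
      | nil => intro _ _ e he; simp at he
      | @cons x z y h p ih =>
        intro hsub ⟨e0, h0, h0'⟩ e he
        have hf : (⟨s(x, z), h⟩ : G.edgeSet) ∈ W :=
          full x e0 h0 h0' _ (mem_cyc.2 (hsub _ (by simp))) (by simp)
        rw [SimpleGraph.Walk.edges_cons, List.mem_cons] at he
        rcases he with he | he
        · rw [show e = ⟨s(x, z), h⟩ from Subtype.ext he]; exact hf
        · exact ih (fun e he => hsub e (by simp [he])) ⟨_, hf, by simp⟩ e he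
    obtain ⟨e0, h0⟩ := Finset.nonempty_iff_ne_empty.2 hne
    obtain ⟨x, y, hxy⟩ : ∃ x y, e0.1 = s(x, y) := ⟨_, _, hg e0⟩
    have hx : x ∈ w.support := w.mem_support_of_mem_edges (mem_cyc.1 (hW h0)) (by simp [hxy])
    refine hW.antisymm fun e he => ?_
    refine walk (w.rotate x hx) (fun e he => ((w.rotate_edges x hx).mem_iff).1 he) ⟨e0, h0, by simp [hxy]⟩ e ?_
    exact ((w.rotate_edges x hx).mem_iff).2 (mem_cyc.1 he)

end graph
end CF

end

open Set Topology

noncomputable section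
namespace CF
set_option linter.all false
open scoped Classical symmDiff

theorem er_ne {E : Type} {S : Finset E} {e e' : E} (h : e' ∈ S.erase e) : e' ≠ e := Finset.ne_of_mem_erase h

theorem assemble {V : Type} [Fintype V] {G : SimpleGraph V} {d : Drawing G Plane} {k : ℕ}
    (hk : k ≤ 9) (h : InGClass G d k) :
    ∃ (F : Type) (_ : Fintype F) (o : F) (Φ : F → Set Plane) (c : F → ℕ),
      Function.Injective Φ ∧ (∀ f, d.IsFace f ↔ ∃ g, Φ g = f) ∧
      (∀ g, Bornology.IsBounded (Φ g) ↔ g ≠ o) ∧ (∀ g, d.faceLen (Φ g) = c g) ∧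
      (∀ g, g ≠ o → 4 ≤ c g) ∧
      (∑ g with g ≠ o, ((c g : ℤ) - 4)) ≤ (k : ℤ) - 6 ∧
      Even ((∑ g with g ≠ o, ((c g : ℤ) - 4)) - k) := by
  obtain ⟨hT, a, w, hw, hlen, ⟨fo, hfo, hunb, hfr⟩, hcr⟩ := h
  haveI : Fintype G.edgeSet := Fintype.ofFinite _
  obtain ⟨D, hg, Φ, Φi, hface, hadj, hone⟩ := transport d
  obtain ⟨o, ho⟩ := (hface fo).1 hfo
  set P := D.pm with hP
  have hgP : ∀ e, e.1 = s(P.s e, P.t e) := hg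
  have hA : ∀ e, e ∈ P.A := fun e => Finset.mem_univ e
  let o' : P.F := o
  have adjP : ∀ (f : P.F) e, d.emap e ⊆ frontier (Φ f) ↔ (f = P.l e ∨ f = P.r e) := by
    intro f e
    rw [hadj f e]; exact Dr.adj_iff
  have hC : ∀ e, (o' = P.l e ∨ o' = P.r e) ↔ e ∈ cyc w := by
    intro e
    rw [← adjP o' e, mem_cyc]
    change d.emap e ⊆ frontier (Φ o) ↔ _
    rw [ho, hfr]
    constructor
    · intro hs
      obtain ⟨ψ⟩ := d.arc e
      have hp := (ψ ⟨1/2, by norm_num, by norm_num⟩).2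
      generalize ((ψ ⟨1/2, by norm_num, by norm_num⟩ : d.emap e) : Plane) = p at hp
      rcases hs hp with h | h
      · simp only [mem_iUnion, mem_singleton_iff] at h
        obtain ⟨v, -, hv⟩ := h
        exact absurd (hv ▸ hp) (d.vertex_notin e v)
      · simp only [mem_iUnion] at h
        obtain ⟨e', he', hpe⟩ := h
        by_cases hee : e = e'
        · rw [hee]; exact he'
        · have : p ∈ d.emap e ∩ d.emap e' := ⟨hp, hpe⟩
          rw [d.edges_disj e e' hee] at this
          exact this.elim
    · intro he p hp
      right
      simp only [mem_iUnion]
      exact ⟨e, he, hp⟩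
  have hcirc := cyc_circuit hgP hw
  have hlrC : ∀ e ∈ cyc w, P.l e ≠ P.r e := by
    obtain ⟨R, hR⟩ := PM.ex_bd (P := P) (fun e _ => hA e) hcirc.1
    intro e he hlr
    rw [← hR, PM.mem_bd, hlr] at he
    exact he.2 Iff.rfl
  have hbd : P.bd {o'} = cyc w := by
    ext e
    rw [PM.mem_bd1, ← hC e]
    constructor
    · rintro ⟨-, h⟩
      by_contra hn
      push Not at hn
      exact h ⟨fun h => absurd h.symm hn.1, fun h => absurd h.symm hn.2⟩
    · intro h
      have hne := hlrC e ((hC e).1 h)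
      refine ⟨hA e, fun hiff => ?_⟩
      rcases h with h | h
      · exact hne (h.symm.trans (hiff.1 h.symm).symm)
      · exact hne ((hiff.2 h.symm).trans h)
  have hVs : ∀ v, v ∈ w.toSubgraph.verts → v ∈ P.Vs (cyc w) := by
    intro v hv
    rw [SimpleGraph.Walk.mem_verts_toSubgraph,
      SimpleGraph.Walk.mem_support_iff_exists_mem_edges_of_not_nil hw.not_nil] at hv
    obtain ⟨e, he, hve⟩ := hv
    exact ⟨⟨e, w.edges_subset_edgeSet he⟩, mem_cyc.2 he, (g_inc hgP).2 hve⟩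
  have adjE : ∀ e : G.edgeSet, G.Adj (P.s e) (P.t e) := by
    intro e; have := e.2; rw [hgP e] at this; exact this
  have hcrit : P.Crit o' := by
    refine ⟨?_, ?_, ?_, ?_⟩
    · rintro e - ⟨h1, h2⟩
      exact hlrC e ((hC e).1 (Or.inl h1.symm)) (h1.trans h2.symm)
    · rw [hbd]; exact hcirc
    · rw [hbd]
      intro hall
      obtain ⟨φ, h1, h2, h3⟩ := hcr.2 w.toSubgraph le_rfl hcr.1
      apply h3
      refine ⟨φ, fun u v huv => h1 u v ?_, fun _ _ => rfl⟩
      have hG : G.Adj u v := huv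
      have : (⟨s(u, v), hG⟩ : G.edgeSet) ∈ cyc w := by rw [hall]; exact hA _
      exact SimpleGraph.Walk.adj_toSubgraph_iff_mem_edges.2 (mem_cyc.1 this)
    · intro e _ he
      rw [hbd] at he ⊢
      have hle : w.toSubgraph ≤ (⊤ : G.Subgraph).deleteEdges {e.1} := by
        refine ⟨fun v _ => mem_univ v, fun u v huv => ?_⟩
        rw [SimpleGraph.Subgraph.deleteEdges_adj]
        refine ⟨huv.adj_sub, fun h => he ?_⟩
        rw [mem_cyc, ← mem_singleton_iff.1 h]
        exact SimpleGraph.Walk.adj_toSubgraph_iff_mem_edges.1 huv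
      have hlt : (⊤ : G.Subgraph).deleteEdges {e.1} < ⊤ := by
        refine lt_of_le_of_ne le_top fun h => ?_
        have h1 : (⊤ : G.Subgraph).Adj (P.s e) (P.t e) := adjE e
        rw [← h, SimpleGraph.Subgraph.deleteEdges_adj] at h1
        exact h1.2 (by rw [← hgP e]; rfl)
      obtain ⟨φ, h1, ⟨ψ, h2, h2'⟩, h3⟩ := hcr.2 _ hle hlt
      refine ⟨ψ, ?_, ?_⟩
      · intro e' he'
        apply h2
        rw [SimpleGraph.Subgraph.deleteEdges_adj]
        refine ⟨adjE e', fun h => er_ne he' ?_⟩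
        rw [← hgP e'] at h
        exact Subtype.ext h
      · rintro ⟨χ, hχ, hχ'⟩
        apply h3
        refine ⟨χ, fun u v huv => ?_, fun v hv => (hχ' v (hVs v hv)).trans (h2' v hv)⟩
        have hG : G.Adj u v := huv
        have h4 := hχ ⟨s(u, v), hG⟩ (hA _)
        have h5 := hgP ⟨s(u, v), hG⟩
        rcases Sym2.eq_iff.1 h5 with ⟨r1, r2⟩ | ⟨r1, r2⟩
        · rw [← r1, ← r2] at h4; exact h4
        · rw [← r1, ← r2] at h4; exact h4.symm
  have htf : P.TF P.A := g_tf hgP hT _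
  have hkc : (P.bd {o'}).card = k := by rw [hbd, cyc_card hw, hlen]
  have hk9 : (P.bd {o'}).card ≤ 9 := by omega
  have hmain := PM.main P o' htf hcrit hk9
  have hbr : ∀ e, P.l e ≠ P.r e := fun e =>
    PM.bridgeless (⟨PM.main_IHyp _, htf, hcrit, rfl, hk9⟩ : PM.Std P.A.card P o') (hA e)
  have hbd1 : ∀ (f : P.F) e, e ∈ P.bd {f} ↔ (f = P.l e ∨ f = P.r e) := by
    intro f e
    have := hbr e
    rw [PM.mem_bd1]
    constructor
    · rintro ⟨-, h⟩
      by_contra hn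
      push Not at hn
      exact h ⟨fun h => absurd h.symm hn.1, fun h => absurd h.symm hn.2⟩
    · rintro (rfl | rfl)
      · exact ⟨hA e, fun h => this (h.1 rfl).symm⟩
      · exact ⟨hA e, fun h => this (h.2 rfl)⟩
  have hwt : P.wt {o'}ᶜ = ∑ g with g ≠ o', (((P.bd {g}).card : ℤ) - 4) := by
    unfold PM.wt
    apply Finset.sum_congr _ (fun _ _ => rfl)
    ext; simp
  refine ⟨P.F, P.fF, o', Φ, fun f => (P.bd {f}).card, Φi, hface, ?_, ?_, ?_, ?_, ?_⟩
  · intro f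
    constructor
    · rintro h rfl
      apply hunb; rw [← ho]; exact h
    · intro h
      by_contra hn
      exact h (hone f o hn (by rw [ho]; exact hunb))
  · intro f
    have hnu : ∀ e, d.emap e ⊆ frontier (Φ f) →
        ¬ (∀ g', d.IsFace g' → d.emap e ⊆ frontier g' → g' = Φ f) := by
      intro e he hall
      have h1 := Φi (hall (Φ (P.l e)) ((hface _).2 ⟨_, rfl⟩) ((adjP _ e).2 (Or.inl rfl)))
      have h2 := Φi (hall (Φ (P.r e)) ((hface _).2 ⟨_, rfl⟩) ((adjP _ e).2 (Or.inr rfl)))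
      exact hbr e (h1.trans h2.symm)
    unfold MDrawing.faceLen
    have e1 : {e : G.edgeSet | d.emap e ⊆ frontier (Φ f) ∧
        (∀ g', d.IsFace g' → d.emap e ⊆ frontier g' → g' = Φ f)} = ∅ := by
      ext e; simp only [mem_setOf_eq, mem_empty_iff_false, iff_false, not_and]
      exact hnu e
    have e2 : {e : G.edgeSet | d.emap e ⊆ frontier (Φ f) ∧
        ¬ (∀ g', d.IsFace g' → d.emap e ⊆ frontier g' → g' = Φ f)} = ↑(P.bd {f}) := by
      ext e
      rw [Finset.mem_coe, hbd1 f e, ← adjP f e]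
      exact ⟨fun h => h.1, fun h => ⟨h, hnu e h⟩⟩
    rw [e1, e2, Set.ncard_empty, Set.ncard_coe_finset]; simp
  · intro f hf
    exact htf _ (PM.bd_sub _) (PM.ev_bd _) (PM.bd1_ne hf)
  · rw [← hwt, ← hkc]; exact hmain
  · have h1 := PM.wt_int (P := P) (o := o')
    have h2 := PM.bd_sum (P := P) (fun e _ => hbr e)
    have h2' : (∑ f, ((P.bd {f}).card : ℤ)) = 2 * P.A.card := by exact_mod_cast h2
    rw [hwt, h2', hkc] at h1
    rw [show (∑ g with g ≠ o', (((P.bd {g}).card : ℤ) - 4)) - k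
      = 2 * ((P.A.card : ℤ) - k - 2 * ((Finset.univ.filter (fun f => f ≠ o')).card : ℤ)) by linarith]
    exact even_two_mul _

theorem sm_of {V : Type} [Finite V] {G : SimpleGraph V} {d : Drawing G Plane} {k : ℕ}
    (hk : k ≤ 9) (h : InGClass G d k) :
    (6 ≤ k) ∧ ∀ Sm, PlaneS d Sm → (∀ x ∈ Sm, 5 ≤ x) ∧ (Sm.map (fun x : ℕ => (x : ℤ) - 4)).sum ≤ (k : ℤ) - 6 ∧
      Even ((Sm.map (fun x : ℕ => (x : ℤ) - 4)).sum - k) := by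
  haveI : Fintype V := Fintype.ofFinite V
  obtain ⟨F, fF, o, Φ, c, Φi, hface, hb, hlen, h4, hle, hev⟩ := assemble hk h
  constructor
  · have : 0 ≤ ∑ g with g ≠ o, ((c g : ℤ) - 4) := by
      apply Finset.sum_nonneg
      intro g hg
      have := h4 g (Finset.mem_filter.1 hg).2
      omega
    omega
  · rintro Sm ⟨l, hnd, hl, rfl⟩
    set T : Finset F := Finset.univ.filter (fun g => g ≠ o ∧ 5 ≤ c g) with hT
    have hperm : (l : Multiset (Set Plane)) = T.val.map Φ := by
      refine (Multiset.Nodup.ext (Multiset.coe_nodup.2 hnd) (T.nodup.map Φi)).2 fun f => ?_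
      rw [Multiset.mem_coe, hl f, Multiset.mem_map]
      constructor
      · rintro ⟨h1, h2, h3⟩
        obtain ⟨g, rfl⟩ := (hface f).1 h1
        rw [hlen g] at h3
        exact ⟨g, Finset.mem_filter.2 ⟨Finset.mem_univ _, (hb g).1 h2, h3⟩, rfl⟩
      · rintro ⟨g, hg, rfl⟩
        have := (Finset.mem_filter.1 hg).2
        exact ⟨(hface _).2 ⟨g, rfl⟩, (hb g).2 this.1, by rw [hlen g]; exact this.2⟩
    have hSm : ((l.map d.faceLen : List ℕ) : Multiset ℕ) = T.val.map c := by
      rw [← Multiset.map_coe, hperm, Multiset.map_map]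
      exact Multiset.map_congr rfl (fun g _ => hlen g)
    rw [hSm]
    have hsum : ((T.val.map c).map (fun x : ℕ => (x : ℤ) - 4)).sum = ∑ g with g ≠ o, ((c g : ℤ) - 4) := by
      rw [Multiset.map_map]
      change ∑ g ∈ T, ((c g : ℤ) - 4) = _
      apply Finset.sum_subset
      · intro g hg
        exact Finset.mem_filter.2 ⟨Finset.mem_univ _, (Finset.mem_filter.1 hg).2.1⟩
      · intro g hg hg'
        have h1 := (Finset.mem_filter.1 hg).2
        have h2 := h4 g h1
        have h3 : ¬ 5 ≤ c g := fun h => hg' (Finset.mem_filter.2 ⟨Finset.mem_univ _, h1, h⟩)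
        omega
    rw [hsum]
    refine ⟨?_, hle, hev⟩
    intro x hx
    obtain ⟨g, hg, rfl⟩ := Multiset.mem_map.1 hx
    exact (Finset.mem_filter.1 hg).2.2

theorem sm_list {k : ℕ} {Sm : Multiset ℕ} (h5 : ∀ x ∈ Sm, 5 ≤ x)
    (hle : (Sm.map (fun x : ℕ => (x : ℤ) - 4)).sum ≤ (k : ℤ) - 6) (hk : k ≤ 9) :
    Sm = 0 ∨ (∃ x, Sm = {x} ∧ 5 ≤ x) ∨ (∃ x y, Sm = {x, y} ∧ 5 ≤ y ∧ y ≤ x) ∨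
      (∃ x y z, Sm = {x, y, z} ∧ 5 ≤ x ∧ 5 ≤ y ∧ 5 ≤ z) := by
  have hc : (Multiset.card Sm : ℤ) ≤ (Sm.map (fun x : ℕ => (x : ℤ) - 4)).sum := by
    clear hle
    induction Sm using Multiset.induction_on with
    | empty => simp
    | cons a s ih =>
      have h1 := ih (fun x hx => h5 x (Multiset.mem_cons_of_mem hx))
      have h2 := h5 a (Multiset.mem_cons_self a s)
      rw [Multiset.card_cons, Multiset.map_cons, Multiset.sum_cons]
      push_cast; omega
  have hc3 : Multiset.card Sm ≤ 3 := by omega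
  rcases Nat.lt_or_ge (Multiset.card Sm) 1 with h | h
  · left; exact Multiset.card_eq_zero.1 (by omega)
  rcases Nat.lt_or_ge (Multiset.card Sm) 2 with h' | h'
  · obtain ⟨x, rfl⟩ := Multiset.card_eq_one.1 (show Multiset.card Sm = 1 by omega)
    exact Or.inr (Or.inl ⟨x, rfl, h5 x (by simp)⟩)
  rcases Nat.lt_or_ge (Multiset.card Sm) 3 with h'' | h''
  · obtain ⟨x, y, rfl⟩ := Multiset.card_eq_two.1 (show Multiset.card Sm = 2 by omega)
    refine Or.inr (Or.inr (Or.inl ?_))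
    rcases le_total x y with hxy | hxy
    · exact ⟨y, x, Multiset.pair_comm x y, h5 x (by simp), hxy⟩
    · exact ⟨x, y, rfl, h5 y (by simp), hxy⟩
  · obtain ⟨x, y, z, rfl⟩ := Multiset.card_eq_three.1 (show Multiset.card Sm = 3 by omega)
    exact Or.inr (Or.inr (Or.inr ⟨x, y, z, rfl, h5 x (by simp), h5 y (by simp), h5 z (by simp)⟩))

end CF

end

/-- `𝒢_{4,4}` and `𝒢_{4,5}` are empty (so `𝒮_{4,4} = 𝒮_{4,5} = ∅`);
`𝒮_{4,6} ⊆ {∅}`; `𝒮_{4,7} ⊆ {{5}}`; `𝒮_{4,8} ⊆ {{6}, {5,5}, ∅}`; and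
`𝒮_{4,9} ⊆ {{7}, {6,5}, {5,5,5}, {5}}`. -/
theorem critical_face_multisets :
    (¬ ∃ (V : Type) (_ : Finite V) (G : SimpleGraph V) (d : Drawing G Plane),
        InGClass G d 4) ∧
    (¬ ∃ (V : Type) (_ : Finite V) (G : SimpleGraph V) (d : Drawing G Plane),
        InGClass G d 5) ∧
    Scal 6 ⊆ {(0 : Multiset ℕ)} ∧
    Scal 7 ⊆ {({5} : Multiset ℕ)} ∧
    Scal 8 ⊆ {({6} : Multiset ℕ), ({5, 5} : Multiset ℕ), (0 : Multiset ℕ)} ∧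
    Scal 9 ⊆ {({7} : Multiset ℕ), ({6, 5} : Multiset ℕ), ({5, 5, 5} : Multiset ℕ),
      ({5} : Multiset ℕ)} := by
  refine ⟨?_, ?_, ?_, ?_, ?_, ?_⟩
  · rintro ⟨V, _, G, d, h⟩
    have := (CF.sm_of (by norm_num) h).1
    omega
  · rintro ⟨V, _, G, d, h⟩
    have := (CF.sm_of (by norm_num) h).1
    omega
  all_goals
    rintro Sm ⟨V, _, G, d, h, hS⟩
    obtain ⟨h5, hle, hev⟩ := (CF.sm_of (by norm_num) h).2 Sm hS
    simp only [Set.mem_insert_iff, Set.mem_singleton_iff]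
    rcases CF.sm_list h5 hle (by norm_num) with rfl | ⟨x, rfl, hx⟩ | ⟨x, y, rfl, hy, hxy⟩ | ⟨x, y, z, rfl, hx, hy, hz⟩
    all_goals
      replace hev := Int.even_iff.1 hev
      simp only [Multiset.insert_eq_cons, Multiset.map_cons, Multiset.sum_cons, Multiset.map_singleton,
        Multiset.sum_singleton, Multiset.map_zero, Multiset.sum_zero] at hev hle
  all_goals try omega
  · rfl
  · obtain rfl : x = 5 := by omega
    rfl
  · exact Or.inr (Or.inr rfl)
  · obtain rfl : x = 6 := by omega
    exact Or.inl rfl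
  · obtain rfl : x = 5 := by omega
    obtain rfl : y = 5 := by omega
    exact Or.inr (Or.inl rfl)
  · rcases (show x = 5 ∨ x = 7 by omega) with rfl | rfl
    · exact Or.inr (Or.inr (Or.inr rfl))
    · exact Or.inl rfl
  · obtain rfl : y = 5 := by omega
    obtain rfl : x = 6 := by omega
    exact Or.inr (Or.inl rfl)
  · obtain rfl : x = 5 := by omega
    obtain rfl : y = 5 := by omega
    obtain rfl : z = 5 := by omega
    exact Or.inr (Or.inr (Or.inl rfl))
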